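/- Asymptotic formula in Waring's problem (logarithmic improvement): for every integer k ≥ 3 and every integer s ≥ k² + 2 − ⌊log k / log 2⌋, one has R_{s,k}(n) = (Γ(1 + 1/k)^s / Γ(s/k)) · 𝔖_{s,k}(n) · n^{s/k − 1} + o(n^{s/k − 1}) as n → ∞. -/

import Mathlib

/-- `e t = e^{2πit}`. -/
noncomputable def e (t : ℝ) : ℂ := Complex.exp (2 * Real.pi * Complex.I * t)

/-- `R_{s,k}(n)`: the number of representations of `n` as a sum of `s` `k`-th
powers of positive integers. -/
noncomputable def R (s k n : ℕ) : ℕ :=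
  Nat.card {m : Fin s → ℕ // (∀ i, 0 < m i) ∧ ∑ i, m i ^ k = n}

/-- The singular series
`𝔖_{s,k}(n) = ∑_{q≥1} ∑_{1≤a≤q, (a,q)=1} (q⁻¹ ∑_{r=1}^q e(a r^k / q))^s e(-n a / q)`. -/
noncomputable def singularSeries (s k n : ℕ) : ℂ :=
  ∑' q : ℕ, ∑ a ∈ (Finset.Icc 1 q).filter (fun a => Nat.gcd a q = 1),
    ((q : ℂ)⁻¹ * ∑ r ∈ Finset.Icc 1 q, e ((a * r ^ k : ℕ) / (q : ℝ))) ^ s *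
      e (-((n * a : ℕ) : ℝ) / q)

open Polynomial in
/-- Nonvanishing modulo `p` of the Taylor determinant of the monomial curve
`(X^(m+1), …, X^(m+l))` at a nonzero point. -/
theorem det_choose_ne_zero {K : Type*} [Field K] {m l p : ℕ} [CharP K p]
    (hml : m + l < p) {u : K} (hu : u ≠ 0) :
    (Matrix.of fun j i : Fin l => (taylor u (X ^ (m + j + 1) : K[X])).coeff (i + 1)).det ≠ 0 := by
  intro h0
  obtain ⟨v, hv, hv0⟩ := Matrix.exists_vecMul_eq_zero_iff.2 h0
  apply hv
  set Q : K[X] := ∑ j : Fin l, C (v j) * X ^ (m + j + 1) with hQ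
  have hcoef : ∀ d < l, (taylor u Q).coeff (d + 1) = 0 := by
    intro d hd
    have := congrFun hv0 ⟨d, hd⟩
    simp only [Matrix.vecMul, dotProduct, Matrix.of_apply, Pi.zero_apply] at this
    rw [hQ, map_sum, finsetSum_coeff, ← this]
    refine Finset.sum_congr rfl fun j _ => ?_
    rw [taylor_mul, taylor_C, coeff_C_mul]
  have hdvd : (X - C u) ^ l ∣ derivative Q := by
    rw [X_sub_C_pow_dvd_iff, X_pow_dvd_iff]
    intro d hd
    have h1 : (derivative Q).comp (X + C u) = derivative (Q.comp (X + C u)) := by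
      simp [derivative_comp]
    rw [h1, coeff_derivative]
    have := hcoef d hd
    rw [taylor_apply] at this
    rw [this, zero_mul]
  set G : K[X] := ∑ j : Fin l, C (((m + j + 1 : ℕ) : K) * v j) * X ^ (j : ℕ) with hG
  have hQG : derivative Q = X ^ m * G := by
    rw [hQ, hG, derivative_sum, Finset.mul_sum]
    refine Finset.sum_congr rfl fun j _ => ?_
    rw [derivative_C_mul_X_pow]
    have : m + (j : ℕ) + 1 - 1 = m + j := by omega
    rw [this, pow_add]
    simp only [map_mul, Nat.cast_add, Nat.cast_one]
    ring_nf
  have hcop : IsCoprime ((X - C u) ^ l : K[X]) (X ^ m) := by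
    apply IsCoprime.pow
    have h2 : IsCoprime (X - C u : K[X]) (X - C 0) :=
      isCoprime_X_sub_C_of_isUnit_sub (by simpa using hu)
    simpa using h2
  rw [hQG] at hdvd
  have hG0 : G = 0 := by
    have hd := hcop.dvd_of_dvd_mul_left hdvd
    by_contra hne
    have hdeg := degree_le_of_dvd hd hne
    have : G.degree < l := by
      rw [hG]
      refine (degree_sum_le _ _).trans_lt ?_
      rw [Finset.sup_lt_iff (WithBot.bot_lt_coe _)]
      intro j _
      exact (degree_C_mul_X_pow_le _ _).trans_lt (by exact_mod_cast j.2)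
    rw [degree_pow, degree_X_sub_C] at hdeg
    simp at hdeg
    exact absurd (hdeg.trans_lt this) (lt_irrefl _)
  funext j
  have hj : G.coeff j = ((m + j + 1 : ℕ) : K) * v j := by
    rw [hG, finsetSum_coeff, Finset.sum_eq_single j]
    · rw [coeff_C_mul_X_pow, if_pos rfl]
    · intro b _ hb
      rw [coeff_C_mul_X_pow, if_neg]
      intro h; exact hb (Fin.ext h.symm)
    · simp
  rw [hG0, coeff_zero] at hj
  rcases mul_eq_zero.1 hj.symm with h | h
  · exfalso
    rw [CharP.cast_eq_zero_iff K p] at h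
    exact absurd (Nat.le_of_dvd (by omega) h) (by have := j.2; omega)
  · exact h

section Curves

variable {p : ℕ} [Fact p.Prime]

/-- Curves `(φ₁, …, φ_k)` over `ℤ_p` with `φ_j = X^j + (terms of degree > k divisible by p)`. -/
def MomentLike (k : ℕ) (φ : Fin k → Polynomial ℤ_[p]) : Prop :=
  ∀ j, (∀ i ≤ k, (φ j).coeff i = if i = j + 1 then 1 else 0) ∧
    ∀ i, k < i → (p : ℤ_[p]) ∣ (φ j).coeff i

open Polynomial in
/-- Rescaling a nondegenerate curve to a ball gives a moment-like curve. -/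
theorem exists_momentLike_rescale {l : ℕ} (ψ : Fin l → ℤ_[p][X]) (y : ℤ_[p]) {a : ℕ} (ha : 1 ≤ a)
    (T : Matrix (Fin l) (Fin l) ℤ_[p])
    (hT : T = Matrix.of fun j i : Fin l => (taylor y (ψ j)).coeff (i + 1))
    (hdet : IsUnit T.det) :
    ∃ φ, MomentLike l φ ∧ ∀ m : ℤ_[p], (fun j => (ψ j).eval (y + p ^ a * m)) =
      (fun j => (ψ j).eval y) +
        T.mulVec (fun i => (p : ℤ_[p]) ^ (a * (i + 1)) * (φ i).eval m) := by
  set θ : Fin l → ℤ_[p][X] := fun i => ∑ j, C (T⁻¹ i j) * taylor y (ψ j) with hθ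
  have hTi : T⁻¹ * T = 1 := Matrix.nonsing_inv_mul _ hdet
  have hTi' : T * T⁻¹ = 1 := Matrix.mul_nonsing_inv _ hdet
  have hθc : ∀ i r : Fin l, (θ i).coeff (r + 1) = if (r : ℕ) = i then 1 else 0 := by
    intro i r
    have h := congrFun (congrFun hTi i) r
    rw [Matrix.mul_apply, Matrix.one_apply] at h
    rw [hθ, finsetSum_coeff]
    simp only [coeff_C_mul]
    have e1 : (∑ j, T⁻¹ i j * (taylor y (ψ j)).coeff (r + 1)) = ∑ j, T⁻¹ i j * T j r := by
      refine Finset.sum_congr rfl fun j _ => ?_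
      rw [hT]; rfl
    rw [e1, h]
    by_cases hir : i = r
    · simp [hir]
    · have : (r : ℕ) ≠ i := fun h => hir (Fin.ext h.symm)
      simp [hir, this]
  set D : Fin l → ℕ := fun i => (θ i).natDegree + 1
  set c : Fin l → ℕ → ℤ_[p] := fun i r => if r ≤ l then (if r = (i : ℕ) + 1 then 1 else 0) else
    (θ i).coeff r * (p : ℤ_[p]) ^ (a * (r - (i + 1))) with hc
  set φ : Fin l → ℤ_[p][X] := fun i => ∑ r ∈ Finset.range (D i + l + 1), C (c i r) * X ^ r with hφ
  have hφc : ∀ i r, (φ i).coeff r = c i r := by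
    intro i r
    simp only [hφ, finsetSum_coeff, coeff_C_mul_X_pow]
    rw [Finset.sum_ite_eq]
    split_ifs with h
    · rfl
    · rw [Finset.mem_range, not_lt] at h
      simp only [hc]
      rw [if_neg (by omega), coeff_eq_zero_of_natDegree_lt (by simp only [D] at h; omega), zero_mul]
  have key : ∀ (i : Fin l) (m : ℤ_[p]), (p : ℤ_[p]) ^ (a * ((i : ℕ) + 1)) * (φ i).eval m =
      (θ i).eval (p ^ a * m) - (θ i).coeff 0 := by
    intro i m
    rw [hφ]
    simp only [eval_finsetSum, eval_mul, eval_C, eval_pow, eval_X]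
    rw [eval_eq_sum_range' (n := D i + l + 1) (by simp only [D]; omega), Finset.mul_sum,
      Finset.sum_range_succ', Finset.sum_range_succ']
    simp only [hc, pow_zero, mul_one]
    rw [if_pos (Nat.zero_le _), if_neg (by omega), mul_zero, add_zero, add_sub_cancel_right]
    refine Finset.sum_congr rfl fun r _ => ?_
    by_cases hr : r + 1 ≤ l
    · rw [if_pos hr]
      have h := hθc i ⟨r, by omega⟩
      simp only at h
      rw [h]
      by_cases hri : r = i
      · subst hri; simp [mul_pow, pow_mul]
      · simp [hri]
    · rw [if_neg hr]
      have h1 : a * (r + 1) = a * ((i : ℕ) + 1) + a * (r + 1 - (i + 1)) := by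
        rw [← mul_add]; congr 1; have := i.2; omega
      rw [mul_pow, ← pow_mul, h1, pow_add]; ring
  refine ⟨φ, fun j => ⟨fun i hi => ?_, fun i hi => ?_⟩, fun m => ?_⟩
  · rw [hφc]; simp only [hc]; rw [if_pos hi]
  · rw [hφc]; simp only [hc]; rw [if_neg (by omega)]
    apply Dvd.dvd.mul_left
    apply dvd_pow_self
    have : 1 ≤ i - (j + 1) := by have := j.2; omega
    exact (Nat.mul_pos ha this).ne'
  · simp only [key]
    have h3 : (fun i => (θ i).eval (p ^ a * m) - (θ i).coeff 0) =
        T⁻¹.mulVec (fun j => (ψ j).eval (y + p ^ a * m) - (ψ j).eval y) := by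
      funext i
      simp only [hθ, eval_finsetSum, finsetSum_coeff, eval_mul, eval_C, coeff_C_mul,
        Matrix.mulVec, dotProduct, taylor_coeff_zero, taylor_eval, mul_sub, Finset.sum_sub_distrib,
        add_comm]
    rw [h3, Matrix.mulVec_mulVec, hTi', Matrix.one_mulVec]
    funext j; simp

theorem isUnit_iff_toZMod_ne_zero (x : ℤ_[p]) : IsUnit x ↔ PadicInt.toZMod x ≠ 0 := by
  rw [Ne, ← RingHom.mem_ker, PadicInt.ker_toZMod, IsLocalRing.mem_maximalIdeal, mem_nonunits_iff,
    not_not]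

open Polynomial in
theorem MomentLike.map_toZMod {k : ℕ} {φ : Fin k → ℤ_[p][X]} (h : MomentLike k φ) (j : Fin k) :
    (φ j).map PadicInt.toZMod = X ^ ((j : ℕ) + 1) := by
  ext i
  rw [coeff_map, coeff_X_pow]
  by_cases hi : i ≤ k
  · rw [(h j).1 i hi]; split_ifs <;> simp
  · obtain ⟨c, hc⟩ := (h j).2 i (by omega)
    rw [hc, if_neg (by have := j.2; omega)]; simp

open Polynomial in
theorem MomentLike.isUnit_det {k : ℕ} {φ : Fin k → ℤ_[p][X]} (h : MomentLike k φ) (y : ℤ_[p]) :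
    IsUnit (Matrix.of fun j i : Fin k => (taylor y (φ j)).coeff (i + 1)).det := by
  rw [isUnit_iff_toZMod_ne_zero, RingHom.map_det]
  have h1 : (PadicInt.toZMod (p := p)).mapMatrix
      (Matrix.of fun j i : Fin k => (taylor y (φ j)).coeff (i + 1)) =
      Matrix.of fun j i : Fin k =>
        (taylor (PadicInt.toZMod y) (X ^ ((j : ℕ) + 1))).coeff ((i : ℕ) + 1) := by
    ext j i
    simp only [RingHom.mapMatrix_apply, Matrix.map_apply, Matrix.of_apply]
    rw [← coeff_map, map_taylor, h.map_toZMod]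
  rw [h1, Matrix.det_of_isLowerTriangular]
  · rw [Finset.prod_eq_one]
    · exact one_ne_zero
    · intro i _
      simp [taylor_apply, coeff_X_add_C_pow]
  · intro j i hij
    have hij' : (j : ℕ) < i := hij
    simp [taylor_apply, coeff_X_add_C_pow, Nat.choose_eq_zero_of_lt (Nat.succ_lt_succ hij')]

end Curves

section Admissible

variable {p : ℕ} [Fact p.Prime]

/-- A frequency map `ω : ℤ_p → F` which is an affine image of a moment-like curve of degree `k`
that does not collapse anything beyond scale `p ^ (k * N)`. -/
def Admissible (p : ℕ) [Fact p.Prime] {F : Type} [AddCommGroup F] (k N : ℕ) (ω : ℤ_[p] → F) :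
    Prop :=
  ∃ φ : Fin k → Polynomial ℤ_[p], MomentLike k φ ∧ ∃ B : (Fin k → ℤ_[p]) →+ F, ∃ c : F,
    (∀ n, ω n = c + B (fun j => (φ j).eval n)) ∧
      ∀ v, B v = 0 → ∀ i, (p : ℤ_[p]) ^ (k * N) ∣ v i

variable {F : Type} [AddCommGroup F]

theorem dvd_mulVec {k : ℕ} (T : Matrix (Fin k) (Fin k) ℤ_[p]) {d : ℤ_[p]} {v : Fin k → ℤ_[p]}
    (h : ∀ i, d ∣ v i) (i : Fin k) : d ∣ T.mulVec v i := by
  change d ∣ ∑ j, T i j * v j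
  exact Finset.dvd_sum fun j _ => (h j).mul_left _

theorem dvd_of_dvd_mulVec {k : ℕ} {T : Matrix (Fin k) (Fin k) ℤ_[p]} (hT : IsUnit T.det)
    {d : ℤ_[p]} {v : Fin k → ℤ_[p]} (h : ∀ i, d ∣ T.mulVec v i) (i : Fin k) : d ∣ v i := by
  have := dvd_mulVec T⁻¹ h i
  rwa [Matrix.mulVec_mulVec, Matrix.nonsing_inv_mul _ hT, Matrix.one_mulVec] at this

theorem p_ne_zero : (p : ℤ_[p]) ≠ 0 := by
  exact_mod_cast (Fact.out : p.Prime).ne_zero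

theorem pow_dvd_of_pow_dvd_mul {M s N : ℕ} {x : ℤ_[p]} (hM : N + s ≤ M)
    (h : (p : ℤ_[p]) ^ M ∣ p ^ s * x) : (p : ℤ_[p]) ^ N ∣ x := by
  have h1 : (p : ℤ_[p]) ^ (s + N) ∣ p ^ s * x := (pow_dvd_pow _ (by omega)).trans h
  rw [pow_add] at h1
  exact (mul_dvd_mul_iff_left (pow_ne_zero _ p_ne_zero)).1 h1

open Polynomial in
/-- An affine image of a nondegenerate curve is admissible on each ball of radius `p ^ (-a)`. -/
theorem admissible_rescale {l : ℕ} (ψ : Fin l → ℤ_[p][X]) (y : ℤ_[p]) {a : ℕ} (ha : 1 ≤ a)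
    (hdet : IsUnit (Matrix.of fun j i : Fin l => (taylor y (ψ j)).coeff (i + 1)).det)
    (B : (Fin l → ℤ_[p]) →+ F) (c : F) {M N : ℕ} (hM : l * N + a * l ≤ M)
    (hB : ∀ v, B v = 0 → ∀ i, (p : ℤ_[p]) ^ M ∣ v i) :
    Admissible p l N fun m => c + B fun j => (ψ j).eval (y + p ^ a * m) := by
  obtain ⟨φ, hφ, h⟩ := exists_momentLike_rescale ψ y ha _ rfl hdet
  set T := Matrix.of fun j i : Fin l => (taylor y (ψ j)).coeff (i + 1)
  let E : (Fin l → ℤ_[p]) →+ (Fin l → ℤ_[p]) :=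
    { toFun := fun v => T.mulVec fun i => (p : ℤ_[p]) ^ (a * (i + 1)) * v i
      map_zero' := by
        have : (fun i : Fin l => (p : ℤ_[p]) ^ (a * ((i : ℕ) + 1)) * (0 : Fin l → ℤ_[p]) i) = 0 := by
          funext i; simp
        rw [this, Matrix.mulVec_zero]
      map_add' := fun v w => by
        rw [← Matrix.mulVec_add]; congr 1; funext i; simp [mul_add] }
  refine ⟨φ, hφ, B.comp E, c + B fun j => (ψ j).eval y, fun m => ?_, fun v hv i => ?_⟩
  · beta_reduce
    rw [h m, map_add, add_assoc]; rfl
  · have h1 := hB _ hv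
    have h2 := dvd_of_dvd_mulVec hdet h1 i
    refine pow_dvd_of_pow_dvd_mul ?_ h2
    have : a * ((i : ℕ) + 1) ≤ a * l := Nat.mul_le_mul_left _ i.2
    omega

theorem Admissible.rescale {k N : ℕ} {ω : ℤ_[p] → F} (h : Admissible p k N ω) (y : ℤ_[p]) {a : ℕ}
    (ha : 1 ≤ a) (haN : a ≤ N) : Admissible p k (N - a) fun m => ω (y + p ^ a * m) := by
  obtain ⟨φ, hφ, B, c, hω, hB⟩ := h
  simp only [hω]
  refine admissible_rescale φ y ha (hφ.isUnit_det y) B c (M := k * N) ?_ hB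
  rw [mul_comm a k, ← mul_add, Nat.sub_add_cancel haN]

theorem Admissible.dvd_sub_of_eq {N : ℕ} {ω : ℤ_[p] → F} (h : Admissible p 1 N ω) {n m : ℤ_[p]}
    (hnm : ω n = ω m) : (p : ℤ_[p]) ^ N ∣ n - m := by
  obtain ⟨φ, hφ, B, c, hω, hB⟩ := h
  rw [hω, hω, add_right_inj, ← sub_eq_zero, ← map_sub] at hnm
  have h0 := hB _ hnm 0
  rw [one_mul] at h0
  simp only [Pi.sub_apply] at h0
  have hp1 : ∃ Q : Polynomial ℤ_[p], φ 0 = Polynomial.X + Polynomial.C (p : ℤ_[p]) * Q := by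
    have : Polynomial.C (p : ℤ_[p]) ∣ φ 0 - Polynomial.X := by
      rw [Polynomial.C_dvd_iff_dvd_coeff]
      intro i
      rw [Polynomial.coeff_sub, Polynomial.coeff_X]
      by_cases hi : i ≤ 1
      · rw [(hφ 0).1 i hi]
        simp [eq_comm]
      · rw [if_neg (by omega), sub_zero]
        exact (hφ 0).2 i (by omega)
    obtain ⟨Q, hQ⟩ := this
    exact ⟨Q, by rw [← hQ]; ring⟩
  obtain ⟨Q, hQ⟩ := hp1
  obtain ⟨q, hq⟩ := Polynomial.sub_dvd_eval_sub n m Q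
  have e1 : (φ 0).eval n - (φ 0).eval m = (1 + p * q) * (n - m) := by
    simp only [hQ, Polynomial.eval_add, Polynomial.eval_X, Polynomial.eval_mul, Polynomial.eval_C]
    linear_combination (p : ℤ_[p]) * hq
  rw [e1] at h0
  have hu : IsUnit (1 + (p : ℤ_[p]) * q) := by
    rw [isUnit_iff_toZMod_ne_zero]; simp
  exact (hu.dvd_mul_left).1 h0

open Polynomial in
/-- The projection of the curve near `y` seen from the tangent box at `x` of size `p ^ (-b)`,
for `y` far away from `x`, is admissible of lower degree. -/
theorem Admissible.exists_project {m l N N' b a : ℕ} {ω : ℤ_[p] → F}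
    (h : Admissible p (m + l) N ω) {x y : ℤ_[p]} (hxy : ¬ (p : ℤ_[p]) ∣ y - x) (hp : m + l < p)
    (hl : 1 ≤ l) (hb : 1 ≤ b) (hbN : b ≤ N) (ha : 1 ≤ a) (hN' : l * N' + a * l ≤ (m + 1) * b) :
    ∃ H : AddSubgroup F, (∀ z, ω (x + p ^ b * z) - ω x ∈ H) ∧
      Admissible p l N' fun z => (QuotientAddGroup.mk (ω (y + p ^ a * z)) : F ⧸ H) := by
  obtain ⟨φ, hφ, B, c, hω, hB⟩ := h
  have hdet := hφ.isUnit_det x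
  obtain ⟨φ', -, hφ'⟩ := exists_momentLike_rescale φ x hb _ rfl hdet
  set T := Matrix.of fun j i : Fin (m + l) => (taylor x (φ j)).coeff (i + 1) with hT
  let V : AddSubgroup (Fin (m + l) → ℤ_[p]) :=
    { carrier := {v | ∀ i : Fin l, (p : ℤ_[p]) ^ ((m + 1) * b) ∣ v (Fin.natAdd m i)}
      add_mem' := fun hv hw i => dvd_add (hv i) (hw i)
      zero_mem' := fun i => dvd_zero _
      neg_mem' := fun hv i => (dvd_neg).2 (hv i) }
  let BT : (Fin (m + l) → ℤ_[p]) →+ F := B.comp T.mulVecLin.toAddMonoidHom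
  have hBT : ∀ v, BT v = B (T.mulVec v) := fun _ => rfl
  let ι : (Fin l → ℤ_[p]) →+ (Fin (m + l) → ℤ_[p]) :=
    { toFun := fun v => Fin.append 0 v
      map_zero' := by
        funext i; refine Fin.addCases (fun i => ?_) (fun i => ?_) i <;> simp
      map_add' := fun v w => by
        funext i; refine Fin.addCases (fun i => ?_) (fun i => ?_) i <;> simp }
  have hι : ∀ v, ι v = Fin.append 0 v := fun _ => rfl
  have hTi' : T * T⁻¹ = 1 := Matrix.mul_nonsing_inv _ hdet
  have hTi : T⁻¹ * T = 1 := Matrix.nonsing_inv_mul _ hdet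
  let C' : Fin (m + l) → ℤ_[p][X] := fun i => ∑ j, C (T⁻¹ i j) * (φ j - C ((φ j).eval x))
  let ψ : Fin l → ℤ_[p][X] := fun i => C' (Fin.natAdd m i)
  have hC' : ∀ n, T.mulVec (fun i => (C' i).eval n) = fun j => (φ j).eval n - (φ j).eval x := by
    intro n
    have : (fun i => (C' i).eval n) = T⁻¹.mulVec (fun j => (φ j).eval n - (φ j).eval x) := by
      funext i; simp [C', eval_finsetSum, Matrix.mulVec, dotProduct]
    rw [this, Matrix.mulVec_mulVec, hTi', Matrix.one_mulVec]
  refine ⟨V.map BT, fun z => ⟨fun i => (p : ℤ_[p]) ^ (b * (i + 1)) * (φ' i).eval z,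
    fun i => ?_, ?_⟩, ?_⟩
  · refine Dvd.dvd.mul_right (pow_dvd_pow _ ?_) _
    rw [mul_comm]
    exact Nat.mul_le_mul_left _ (by simp)
  · rw [hBT, hω, hω, add_sub_add_left_eq_sub, hφ' z, map_add, add_sub_cancel_left]
  · have hmk : ∀ z, (QuotientAddGroup.mk (ω (y + p ^ a * z)) : F ⧸ V.map BT) =
        QuotientAddGroup.mk (ω x) + ((QuotientAddGroup.mk' (V.map BT)).comp (BT.comp ι))
          (fun j => (ψ j).eval (y + p ^ a * z)) := by
      intro z
      change _ = QuotientAddGroup.mk (ω x) + QuotientAddGroup.mk _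
      rw [← QuotientAddGroup.mk_add, QuotientAddGroup.eq]
      set n := y + p ^ a * z
      refine ⟨ι (fun j => (ψ j).eval n) - fun i => (C' i).eval n, fun i => ?_, ?_⟩
      · simp [hι, ψ]
      · rw [map_sub, hBT (fun i => (C' i).eval n), hC' n, hω n, hω x]
        have : B (fun j => (φ j).eval n - (φ j).eval x) =
          B (fun j => (φ j).eval n) - B (fun j => (φ j).eval x) := by rw [← map_sub]; rfl
        rw [this]
        have h9 : (BT.comp ι) (fun j => (ψ j).eval n) = BT (ι fun j => (ψ j).eval n) := rfl
        rw [h9]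
        abel
    simp only [hmk]
    refine admissible_rescale ψ y ha ?_ _ _ hN' ?_
    · rw [isUnit_iff_toZMod_ne_zero, RingHom.map_det]
      have hC'm : ∀ i, (C' i).map PadicInt.toZMod =
          (X - C (PadicInt.toZMod x)) ^ ((i : ℕ) + 1) := by
        intro i
        have e1 : ∀ j, (φ j - C ((φ j).eval x)).map (PadicInt.toZMod (p := p)) =
            ∑ r : Fin (m + l), C (PadicInt.toZMod (T j r)) *
              (X - C (PadicInt.toZMod x)) ^ ((r : ℕ) + 1) := by
          intro j
          have hd : ((φ j).map (PadicInt.toZMod (p := p))).natDegree < m + l + 1 := by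
            rw [hφ.map_toZMod, natDegree_X_pow]; omega
          have e2 := sum_taylor_eq ((φ j).map (PadicInt.toZMod (p := p))) (PadicInt.toZMod x)
          rw [sum_over_range' _ _ (m + l + 1) (by rwa [natDegree_taylor])] at e2
          · rw [Finset.sum_range_succ'] at e2
            rw [Polynomial.map_sub, ← e2, map_C, taylor_coeff_zero, pow_zero, mul_one, eval_map,
              eval₂_at_apply, add_sub_cancel_right, Finset.sum_range]
            refine Finset.sum_congr rfl fun r _ => ?_
            rw [← map_taylor, coeff_map]; rfl
          · simp
        have e3 : ∀ r, ∑ j, T⁻¹ i j * T j r = if i = r then 1 else 0 := by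
          intro r
          have := congrFun (congrFun hTi i) r
          rwa [Matrix.mul_apply, Matrix.one_apply] at this
        simp only [C', Polynomial.map_sum, Polynomial.map_mul, map_C, e1, Finset.mul_sum]
        rw [Finset.sum_comm, Finset.sum_eq_single i]
        · simp only [← mul_assoc, ← map_mul]
          rw [← Finset.sum_mul, ← map_sum, ← map_sum, e3]; simp
        · intro r _ hr
          simp only [← mul_assoc, ← map_mul]
          rw [← Finset.sum_mul, ← map_sum, ← map_sum, e3, if_neg (Ne.symm hr)]; simp
        · simp
      have hu : PadicInt.toZMod y - PadicInt.toZMod x ≠ 0 := by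
        rw [← map_sub, Ne, ← RingHom.mem_ker, PadicInt.ker_toZMod,
          PadicInt.maximalIdeal_eq_span_p, Ideal.mem_span_singleton]
        exact hxy
      have hd := det_choose_ne_zero (K := ZMod p) hp hu
      have hM : (PadicInt.toZMod (p := p)).mapMatrix
          (Matrix.of fun j i : Fin l => (taylor y (ψ j)).coeff (i + 1)) =
          Matrix.of fun j i : Fin l => (taylor (PadicInt.toZMod y - PadicInt.toZMod x)
            (X ^ (m + (j : ℕ) + 1) : (ZMod p)[X])).coeff ((i : ℕ) + 1) := by
        ext j i
        simp only [RingHom.mapMatrix_apply, Matrix.map_apply, Matrix.of_apply]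
        rw [← coeff_map, map_taylor, hC'm, taylor_apply, taylor_apply]
        congr 1
        simp [sub_eq_add_neg, add_assoc]
      rw [hM]
      exact hd
    · intro v hv i
      have hv' : (QuotientAddGroup.mk (BT (ι v)) : F ⧸ V.map BT) = 0 := hv
      rw [QuotientAddGroup.eq_zero_iff] at hv'
      obtain ⟨w, hw, hwv⟩ := hv'
      have h0 : B (T.mulVec (ι v - w)) = 0 := by
        rw [← hBT, map_sub, hwv, sub_self]
      have h1 := dvd_of_dvd_mulVec hdet (hB _ h0) (Fin.natAdd m i)
      have h2 : (p : ℤ_[p]) ^ ((m + 1) * b) ∣ ι v (Fin.natAdd m i) - w (Fin.natAdd m i) :=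
        (pow_dvd_pow _ (Nat.mul_le_mul (by omega) hbN)).trans h1
      have h3 := dvd_add h2 (hw i)
      simpa [hι] using h3

end Admissible

theorem Finset.sum_range_mul_eq {M : Type*} [AddCommMonoid M] (m n : ℕ) (f : ℕ → M) :
    ∑ j ∈ Finset.range (m * n), f j =
      ∑ i ∈ Finset.range m, ∑ j ∈ Finset.range n, f (i + m * j) := by
  rcases Nat.eq_zero_or_pos m with rfl | hm
  · simp
  rw [← Finset.sum_product']
  refine Finset.sum_nbij' (fun j => (j % m, j / m)) (fun x => x.1 + m * x.2) ?_ ?_ ?_ ?_ ?_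
  · intro j hj
    simp only [Finset.mem_range, Finset.mem_product] at *
    exact ⟨Nat.mod_lt _ hm, Nat.div_lt_of_lt_mul hj⟩
  · rintro ⟨i, j⟩ h
    simp only [Finset.mem_range, Finset.mem_product] at *
    calc i + m * j < m + m * j := by omega
      _ = m * (j + 1) := by ring
      _ ≤ m * n := Nat.mul_le_mul_left _ h.2
  · intro j _; exact Nat.mod_add_div j m
  · rintro ⟨i, j⟩ h
    simp only [Finset.mem_range, Finset.mem_product] at h
    simp [Nat.add_mul_mod_self_left, Nat.mod_eq_of_lt h.1, Nat.add_mul_div_left _ _ hm,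
      Nat.div_eq_of_lt h.1]
  · intro j _; simp [Nat.mod_add_div]

/-- Hölder's inequality in a form free of roots. -/
theorem sum_pow_succ_le {X : Type*} (S : Finset X) (q : ℕ) {h f g : X → ℝ}
    (hh : ∀ x ∈ S, 0 ≤ h x) (hf : ∀ x ∈ S, 0 ≤ f x) (hg : ∀ x ∈ S, 0 ≤ g x)
    (H : ∀ x ∈ S, h x ^ (q + 1) ≤ f x * g x ^ q) :
    (∑ x ∈ S, h x) ^ (q + 1) ≤ (∑ x ∈ S, f x) * (∑ x ∈ S, g x) ^ q := by
  classical
  rcases Nat.eq_zero_or_pos q with rfl | hq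
  · simpa using Finset.sum_le_sum fun x hx => by simpa using H x hx
  have hz : ∀ x ∈ S, g x = 0 → h x = 0 := fun x hx h0 => by
    have := H x hx
    rw [h0, zero_pow hq.ne', mul_zero] at this
    exact (pow_eq_zero_iff (by omega)).1 (le_antisymm this (pow_nonneg (hh x hx) _))
  set S' := S.filter fun x => g x ≠ 0 with hS'
  have e1 : ∑ x ∈ S, h x = ∑ x ∈ S', h x := by
    rw [hS', Finset.sum_filter]
    refine Finset.sum_congr rfl fun x hx => ?_
    split_ifs with h0
    · rfl
    · exact hz x hx (not_not.1 h0)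
  have e2 : ∑ x ∈ S, g x = ∑ x ∈ S', g x := by
    rw [hS', Finset.sum_filter]
    exact Finset.sum_congr rfl fun j _ => by split_ifs with h; rfl; simpa using h
  have e3 : ∑ x ∈ S', f x ≤ ∑ x ∈ S, f x :=
    Finset.sum_le_sum_of_subset_of_nonneg (Finset.filter_subset _ _) fun x hx _ => hf x hx
  rw [e1, e2]
  have hgp : ∀ x ∈ S', 0 < g x := fun x hx => lt_of_le_of_ne (hg x (Finset.mem_filter.1 hx).1)
    (Ne.symm (Finset.mem_filter.1 hx).2)
  rcases S'.eq_empty_or_nonempty with hT0 | hTn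
  · simp [hT0, zero_pow hq.ne']
  set V := ∑ x ∈ S', g x with hV
  have hVp : 0 < V := Finset.sum_pos hgp hTn
  refine le_trans ?_ (mul_le_mul_of_nonneg_right e3 (pow_nonneg hVp.le q))
  have J := Real.pow_arith_mean_le_arith_mean_pow S' (fun x => g x / V) (fun x => h x / g x)
    (fun x hx => by have := hgp x hx; positivity)
    (by rw [← Finset.sum_div]; exact div_self hVp.ne')
    (fun x hx => div_nonneg (hh x (Finset.mem_filter.1 hx).1) (hgp x hx).le) (q + 1)
  have e4 : ∑ x ∈ S', g x / V * (h x / g x) = (∑ x ∈ S', h x) / V := by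
    rw [Finset.sum_div]
    refine Finset.sum_congr rfl fun x hx => ?_
    have := (hgp x hx).ne'
    field_simp
  rw [e4, div_pow, div_le_iff₀ (pow_pos hVp _)] at J
  refine J.trans ?_
  rw [Finset.sum_mul, Finset.sum_mul]
  refine Finset.sum_le_sum fun x hx => ?_
  have hx0 := hgp x hx
  have : g x / V * (h x / g x) ^ (q + 1) * V ^ (q + 1) = h x ^ (q + 1) / g x ^ q * V ^ q := by
    rw [div_pow, pow_succ (g x), pow_succ V]
    field_simp
  rw [this]
  refine mul_le_mul_of_nonneg_right ?_ (pow_nonneg hVp.le q)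
  rw [div_le_iff₀ (pow_pos hx0 q)]
  exact H x (Finset.mem_filter.1 hx).1

/-- Minkowski's inequality in a form free of roots. -/
theorem sum_mul_sum_pow_le {X J : Type*} (S : Finset X) (T : Finset J) {r : ℕ} (hr : 1 ≤ r)
    {w : X → ℝ} {g : J → X → ℝ} {v : J → ℝ} {c : ℝ} (hw : ∀ x, 0 ≤ w x) (hg : ∀ j x, 0 ≤ g j x)
    (hv : ∀ j, 0 ≤ v j)
    (h : ∀ j ∈ T, ∑ x ∈ S, w x * g j x ^ r ≤ c * v j ^ r) :
    ∑ x ∈ S, w x * (∑ j ∈ T, g j x) ^ r ≤ c * (∑ j ∈ T, v j) ^ r := by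
  classical
  set T' := T.filter fun j => v j ≠ 0 with hT'
  have hv' : ∑ j ∈ T, v j = ∑ j ∈ T', v j := by
    rw [hT', Finset.sum_filter]
    exact Finset.sum_congr rfl fun j _ => by split_ifs with h; rfl; simpa using h
  have hg' : ∀ x ∈ S, w x * (∑ j ∈ T, g j x) ^ r = w x * (∑ j ∈ T', g j x) ^ r := by
    intro x hx
    by_cases hwx : w x = 0
    · simp [hwx]
    congr 2
    rw [hT', Finset.sum_filter]
    refine Finset.sum_congr rfl fun j hj => ?_
    split_ifs with hvj
    · rfl
    · rw [not_not] at hvj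
      have h0 := h j hj
      rw [hvj, zero_pow (by omega), mul_zero] at h0
      have h1 : w x * g j x ^ r ≤ 0 := (Finset.single_le_sum
        (fun y _ => mul_nonneg (hw y) (pow_nonneg (hg j y) r)) hx).trans h0
      have h2 : w x * g j x ^ r = 0 := le_antisymm h1 (mul_nonneg (hw x) (pow_nonneg (hg j x) r))
      rcases mul_eq_zero.1 h2 with h3 | h3
      · exact absurd h3 hwx
      · exact pow_eq_zero_iff (by omega) |>.1 h3
  rw [Finset.sum_congr rfl hg', hv']
  set V := ∑ j ∈ T', v j with hV
  have hvpos : ∀ j ∈ T', 0 < v j := fun j hj =>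
    lt_of_le_of_ne (hv j) (Ne.symm (Finset.mem_filter.1 hj).2)
  rcases T'.eq_empty_or_nonempty with hT0 | hTn
  · simp [hV, hT0, zero_pow (by omega : r ≠ 0)]
  have hVpos : 0 < V := Finset.sum_pos hvpos hTn
  obtain ⟨q, rfl⟩ : ∃ q, r = q + 1 := ⟨r - 1, by omega⟩
  calc ∑ x ∈ S, w x * (∑ j ∈ T', g j x) ^ (q + 1)
      ≤ ∑ x ∈ S, w x * ((∑ j ∈ T', g j x ^ (q + 1) / v j ^ q) * V ^ q) := by
        refine Finset.sum_le_sum fun x _ => mul_le_mul_of_nonneg_left ?_ (hw x)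
        refine sum_pow_succ_le T' q (fun j _ => hg j x) (fun j hj => ?_)
          (fun j hj => (hvpos j hj).le) (fun j hj => ?_)
        · exact div_nonneg (pow_nonneg (hg j x) _) (pow_nonneg (hv j) _)
        · rw [div_mul_cancel₀ _ (pow_pos (hvpos j hj) q).ne']
    _ = (∑ j ∈ T', (∑ x ∈ S, w x * g j x ^ (q + 1)) / v j ^ q) * V ^ q := by
        rw [Finset.sum_mul]
        simp only [Finset.sum_div, Finset.sum_mul, Finset.mul_sum]
        rw [Finset.sum_comm]
        refine Finset.sum_congr rfl fun j _ => Finset.sum_congr rfl fun x _ => ?_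
        ring
    _ ≤ (∑ j ∈ T', c * v j) * V ^ q := by
        refine mul_le_mul_of_nonneg_right (Finset.sum_le_sum fun j hj => ?_)
          (pow_nonneg hVpos.le _)
        rw [div_le_iff₀ (pow_pos (hvpos j hj) q)]
        refine (h j (Finset.mem_filter.1 hj).1).trans_eq ?_
        ring
    _ = c * V ^ (q + 1) := by
        rw [← Finset.mul_sum]; ring

/-- Sum of `v` over the pieces of level `N` in the ball of level `d` about `c`. -/
def ballSum (p : ℕ) (v : ℕ → ℝ) (N c d : ℕ) : ℝ :=
  ∑ j ∈ Finset.range (p ^ (N - d)), v (c + p ^ d * j)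

theorem ballSum_nonneg {p : ℕ} {v : ℕ → ℝ} (hv : ∀ n, 0 ≤ v n) (N c d : ℕ) : 0 ≤ ballSum p v N c d :=
  Finset.sum_nonneg fun _ _ => hv _

theorem sum_ballSum {p : ℕ} (v : ℕ → ℝ) {N d d' : ℕ} (c : ℕ) (h : d ≤ d') (h' : d' ≤ N) :
    ∑ i ∈ Finset.range (p ^ (d' - d)), ballSum p v N (c + p ^ d * i) d' = ballSum p v N c d := by
  have e : p ^ (N - d) = p ^ (d' - d) * p ^ (N - d') := by
    rw [← pow_add]; congr 1; omega
  rw [ballSum, e, Finset.sum_range_mul_eq]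
  refine Finset.sum_congr rfl fun i _ => Finset.sum_congr rfl fun j _ => ?_
  congr 1
  have : p ^ d' = p ^ d * p ^ (d' - d) := by rw [← pow_add]; congr 1; omega
  rw [this]; ring

section Decoupling

variable {p : ℕ} [Fact p.Prime] {F : Type} [AddCommGroup F]

open Classical in
/-- The part of the exponential sum with coefficients `a` and frequencies `ω n`, `n ∈ s`, coming
from the ball of radius `p ^ (-d)` about `c`. -/
noncomputable def expSum (ω : ℤ_[p] → F) (s : Finset ℤ_[p]) (a : ℤ_[p] → ℂ) (c d : ℕ)
    (χ : AddChar F ℂ) : ℂ :=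
  ∑ n ∈ s with (p : ℤ_[p]) ^ d ∣ n - c, a n * χ (ω n)

/-- Half of the critical exponent `k (k + 1)`. -/
def crit (k : ℕ) : ℕ := k * (k + 1) / 2

theorem two_mul_crit (k : ℕ) : 2 * crit k = k * (k + 1) :=
  Nat.mul_div_cancel' (Nat.even_mul_succ_self k).two_dvd

theorem crit_pos {k : ℕ} (hk : 1 ≤ k) : 1 ≤ crit k := by
  have := two_mul_crit k
  have : 1 * 2 ≤ k * (k + 1) := Nat.mul_le_mul hk (by omega)
  omega

theorem crit_mono {l k : ℕ} (h : l ≤ k) : crit l ≤ crit k :=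
  Nat.div_le_div_right (Nat.mul_le_mul h (by omega))

/-- The decoupling inequality at level `N`, with `v` bounding the `L ^ (k (k + 1))`-norms squared of
the pieces at the finest scale. -/
def Dec (p : ℕ) [Fact p.Prime] (k N : ℕ) (D : ℝ) : Prop :=
  ∀ (F : Type) [AddCommGroup F] [Finite F] (ω : ℤ_[p] → F), Admissible p k N ω →
    ∀ (s : Finset ℤ_[p]) (a : ℤ_[p] → ℂ) (v : ℕ → ℝ), (∀ n, 0 ≤ v n) →
    (∀ n, ∑ χ, ‖expSum ω s a n N χ‖ ^ (2 * crit k) ≤ v n ^ crit k) →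
    ∑ χ, ‖expSum ω s a 0 0 χ‖ ^ (2 * crit k) ≤ D * (∑ j ∈ Finset.range (p ^ N), v j) ^ crit k

theorem exists_unique_residue (x : ℤ_[p]) (M : ℕ) :
    ∃ i ∈ Finset.range (p ^ M), ∀ j ∈ Finset.range (p ^ M), (p : ℤ_[p]) ^ M ∣ x - j ↔ j = i := by
  have : NeZero (p ^ M) := ⟨pow_ne_zero _ (Fact.out : p.Prime).ne_zero⟩
  refine ⟨(PadicInt.toZModPow M x).val, Finset.mem_range.2 (ZMod.val_lt _), fun j hj => ?_⟩
  rw [← Ideal.mem_span_singleton, ← PadicInt.ker_toZModPow, RingHom.mem_ker, map_sub, map_natCast,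
    sub_eq_zero]
  constructor
  · intro h
    rw [h, ZMod.val_natCast, Nat.mod_eq_of_lt (Finset.mem_range.1 hj)]
  · rintro rfl
    rw [ZMod.natCast_zmod_val]

theorem expSum_eq_sum (ω : ℤ_[p] → F) (s : Finset ℤ_[p]) (a : ℤ_[p] → ℂ) (c : ℕ) {d d' : ℕ}
    (h : d ≤ d') (χ : AddChar F ℂ) :
    expSum ω s a c d χ =
      ∑ i ∈ Finset.range (p ^ (d' - d)), expSum ω s a (c + p ^ d * i) d' χ := by
  classical
  simp only [expSum, Finset.sum_filter]
  rw [Finset.sum_comm]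
  refine Finset.sum_congr rfl fun n _ => ?_
  have hp' : (p : ℤ_[p]) ^ d' = p ^ d * p ^ (d' - d) := by rw [← pow_add]; congr 1; omega
  by_cases hn : (p : ℤ_[p]) ^ d ∣ n - c
  · rw [if_pos hn]
    obtain ⟨x, hx⟩ := hn
    obtain ⟨i, hi, H⟩ := exists_unique_residue x (d' - d)
    have H' : ∀ j ∈ Finset.range (p ^ (d' - d)),
        (p : ℤ_[p]) ^ d' ∣ n - (c + p ^ d * j : ℕ) ↔ j = i := by
      intro j hj
      rw [← H j hj]
      have : n - (c + p ^ d * j : ℕ) = (p : ℤ_[p]) ^ d * (x - j) := by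
        push_cast; linear_combination hx
      rw [this, hp', mul_dvd_mul_iff_left (pow_ne_zero _ p_ne_zero)]
    rw [Finset.sum_congr rfl fun j hj => if_congr (H' j hj) rfl rfl, Finset.sum_ite_eq', if_pos hi]
  · rw [if_neg hn]
    symm
    refine Finset.sum_eq_zero fun i _ => if_neg fun hd => hn ?_
    have h1 : (p : ℤ_[p]) ^ d ∣ n - (c + p ^ d * i : ℕ) := (Dvd.intro _ hp'.symm).trans hd
    have h2 := dvd_add h1 (Dvd.intro (i : ℤ_[p]) rfl : (p : ℤ_[p]) ^ d ∣ p ^ d * i)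
    convert h2 using 1
    push_cast; ring

theorem affine_injective (c d : ℕ) :
    Function.Injective fun m : ℤ_[p] => (c : ℤ_[p]) + p ^ d * m := fun _ _ h =>
  mul_left_cancel₀ (pow_ne_zero _ p_ne_zero) (add_left_cancel h)

/-- The elements of `s` in a ball, in rescaled coordinates. -/
noncomputable def rescaleSet (s : Finset ℤ_[p]) (c d : ℕ) : Finset ℤ_[p] :=
  s.preimage (fun m => (c : ℤ_[p]) + p ^ d * m) (affine_injective c d).injOn

open Classical in
theorem sum_rescaleSet (s : Finset ℤ_[p]) (g : ℤ_[p] → ℂ) (c d c' d' : ℕ) :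
    ∑ m ∈ rescaleSet s c d with (p : ℤ_[p]) ^ d' ∣ m - c', g (c + p ^ d * m) =
      ∑ n ∈ s with (p : ℤ_[p]) ^ (d + d') ∣ n - (c + p ^ d * c' : ℕ), g n := by
  have key : ∀ m : ℤ_[p], (p : ℤ_[p]) ^ (d + d') ∣ c + p ^ d * m - (c + p ^ d * c' : ℕ) ↔
      (p : ℤ_[p]) ^ d' ∣ m - c' := by
    intro m
    have : (c : ℤ_[p]) + p ^ d * m - (c + p ^ d * c' : ℕ) = p ^ d * (m - c') := by push_cast; ring
    rw [this, pow_add, mul_dvd_mul_iff_left (pow_ne_zero _ p_ne_zero)]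
  rw [Finset.sum_filter, Finset.sum_filter, rescaleSet,
    ← Finset.sum_preimage (fun m : ℤ_[p] => (c : ℤ_[p]) + p ^ d * m) s (affine_injective c d).injOn]
  · exact Finset.sum_congr rfl fun m _ => (if_congr (key m) rfl rfl).symm
  · intro x _ hx
    refine if_neg fun h => hx ?_
    rw [pow_add] at h
    obtain ⟨y, hy⟩ := h
    exact ⟨c' + p ^ d' * y, by push_cast at hy; linear_combination -hy⟩

theorem Dec.mono {k N : ℕ} {D D' : ℝ} (h : Dec p k N D) (hD : D ≤ D') : Dec p k N D' := by
  intro F _ _ ω hω s a v hv H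
  exact (h F ω hω s a v hv H).trans
    (mul_le_mul_of_nonneg_right hD (pow_nonneg (Finset.sum_nonneg fun _ _ => hv _) _))

theorem Dec.ball {k N d : ℕ} {D : ℝ} (h : Dec p k (N - d) D) (hd1 : 1 ≤ d) (hd : d ≤ N) [Finite F]
    {ω : ℤ_[p] → F} (hω : Admissible p k N ω) (s : Finset ℤ_[p]) (a : ℤ_[p] → ℂ) {v : ℕ → ℝ}
    (hv : ∀ n, 0 ≤ v n) (H : ∀ n, ∑ χ, ‖expSum ω s a n N χ‖ ^ (2 * crit k) ≤ v n ^ crit k)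
    (c : ℕ) :
    ∑ χ, ‖expSum ω s a c d χ‖ ^ (2 * crit k) ≤ D * ballSum p v N c d ^ crit k := by
  have hadm : Admissible p k (N - d) fun m => ω (c + p ^ d * m) := hω.rescale c hd1 hd
  have e : ∀ (c' d' : ℕ) (χ : AddChar F ℂ), expSum (fun m : ℤ_[p] => ω (c + p ^ d * m)) (rescaleSet s c d)
      (fun m : ℤ_[p] => a (c + p ^ d * m)) c' d' χ = expSum ω s a (c + p ^ d * c') (d + d') χ := by
    intro c' d' χ
    exact sum_rescaleSet s (fun n => a n * χ (ω n)) c d c' d'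
  have := h F _ hadm (rescaleSet s c d) (fun m : ℤ_[p] => a (c + p ^ d * m)) (fun j => v (c + p ^ d * j))
    (fun _ => hv _) (fun n => by simpa only [e, Nat.add_sub_cancel' hd] using H (c + p ^ d * n))
  simpa only [e, mul_zero, add_zero, ballSum] using this

end Decoupling

section Decoupling

variable {p : ℕ} [Fact p.Prime] {F : Type} [AddCommGroup F]

/-- The bilinear decoupling inequality at level `N` for two separated pieces of levels `a`, `b`. -/
def Bil (p : ℕ) [Fact p.Prime] (k N l a b : ℕ) (K : ℝ) : Prop :=
  ∀ (F : Type) [AddCommGroup F] [Finite F] (ω : ℤ_[p] → F), Admissible p k N ω →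
    ∀ (s : Finset ℤ_[p]) (α : ℤ_[p] → ℂ) (v : ℕ → ℝ), (∀ n, 0 ≤ v n) →
    (∀ n, ∑ χ, ‖expSum ω s α n N χ‖ ^ (2 * crit k) ≤ v n ^ crit k) →
    ∀ c c' : ℕ, ¬ (p : ℤ_[p]) ∣ (c : ℤ_[p]) - c' →
    ∑ χ, ‖expSum ω s α c a χ‖ ^ (2 * crit l) * ‖expSum ω s α c' b χ‖ ^ (2 * (crit k - crit l)) ≤
      K * (ballSum p v N c a ^ crit l * ballSum p v N c' b ^ (crit k - crit l))

theorem Bil.mono {k N l a b : ℕ} {K K' : ℝ} (h : Bil p k N l a b K) (hK : K ≤ K') :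
    Bil p k N l a b K' := by
  intro F _ _ ω hω s α v hv H c c' hc
  exact (h F ω hω s α v hv H c c' hc).trans (mul_le_mul_of_nonneg_right hK
    (mul_nonneg (pow_nonneg (ballSum_nonneg hv _ _ _) _) (pow_nonneg (ballSum_nonneg hv _ _ _) _)))

theorem expSum_mul_of_mem {ω : ℤ_[p] → F} {s : Finset ℤ_[p]} {α : ℤ_[p] → ℂ} {c b : ℕ}
    {H : AddSubgroup F} (hH : ∀ z, ω (c + p ^ b * z) - ω c ∈ H) (χ : AddChar F ℂ)
    (w : AddChar (F ⧸ H) ℂ) :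
    expSum ω s α c b (χ * w.compAddMonoidHom (QuotientAddGroup.mk' H)) =
      w (ω c : F ⧸ H) * expSum ω s α c b χ := by
  classical
  rw [expSum, expSum, Finset.mul_sum]
  refine Finset.sum_congr rfl fun n hn => ?_
  obtain ⟨z, hz⟩ := (Finset.mem_filter.1 hn).2
  have h1 : ((ω n : F) : F ⧸ H) = ω c := by
    have hn : n = c + p ^ b * z := by linear_combination hz
    rw [QuotientAddGroup.eq_iff_sub_mem, hn]
    exact hH z
  rw [AddChar.mul_apply, AddChar.compAddMonoidHom_apply, QuotientAddGroup.mk'_apply, h1]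
  ring

theorem sum_norm_expSum_twist [Finite F] {ω : ℤ_[p] → F} {s : Finset ℤ_[p]} {α : ℤ_[p] → ℂ}
    {c' b : ℕ} {H : AddSubgroup F} (hH : ∀ z, ω (c' + p ^ b * z) - ω c' ∈ H) (c d m m' : ℕ) :
    ∑ χ, ‖expSum ω s α c' b χ‖ ^ m' * ∑ w : AddChar (F ⧸ H) ℂ,
        ‖expSum ω s α c d (χ * w.compAddMonoidHom (QuotientAddGroup.mk' H))‖ ^ m =
      Fintype.card (AddChar (F ⧸ H) ℂ) *
        ∑ χ, ‖expSum ω s α c d χ‖ ^ m * ‖expSum ω s α c' b χ‖ ^ m' := by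
  have key : ∀ w : AddChar (F ⧸ H) ℂ, ∑ χ, ‖expSum ω s α c' b χ‖ ^ m' *
      ‖expSum ω s α c d (χ * w.compAddMonoidHom (QuotientAddGroup.mk' H))‖ ^ m =
      ∑ χ, ‖expSum ω s α c d χ‖ ^ m * ‖expSum ω s α c' b χ‖ ^ m' := by
    intro w
    rw [← Equiv.sum_comp (Equiv.mulRight (w.compAddMonoidHom (QuotientAddGroup.mk' H)))
      fun χ => ‖expSum ω s α c d χ‖ ^ m * ‖expSum ω s α c' b χ‖ ^ m']
    refine Finset.sum_congr rfl fun χ _ => ?_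
    rw [Equiv.coe_mulRight, expSum_mul_of_mem hH, norm_mul, AddChar.norm_apply, one_mul, mul_comm]
  rw [Finset.sum_congr rfl fun χ _ => Finset.mul_sum _ _ _, Finset.sum_comm,
    Finset.sum_congr rfl fun w _ => key w, Finset.sum_const, nsmul_eq_mul, Finset.card_univ]

/-- Lower degree decoupling refines the first piece of a bilinear expression. -/
theorem Bil.refine {k N l N' a b : ℕ} {D K : ℝ} (hB : Bil p k N l (a + N') b K)
    (hD : Dec p l N' D) (hD0 : 0 ≤ D) (hl : 1 ≤ l) (hlk : l ≤ k) (hkp : k < p) (ha : 1 ≤ a)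
    (hb : 1 ≤ b) (hbN : b ≤ N) (haN : a + N' ≤ N) (hN' : l * (a + N') ≤ (k - l + 1) * b) :
    Bil p k N l a b (D * K) := by
  intro F _ _ ω hω s α v hv hH c c' hc
  obtain ⟨m, rfl⟩ : ∃ m, k = m + l := ⟨k - l, by omega⟩
  rw [Nat.add_sub_cancel] at hN'
  obtain ⟨H, hHω, hadm⟩ := hω.exists_project (x := c') (y := c) (b := b) (a := a) (N' := N')
    hc hkp hl hb hbN ha (by rw [← mul_comm l a]; linarith)
  set r := crit l with hr
  have hr1 : 1 ≤ r := crit_pos hl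
  set W := Fintype.card (AddChar (F ⧸ H) ℂ) with hW
  have hWpos : (0 : ℝ) < W := by exact_mod_cast Fintype.card_pos
  set M := 2 * (crit (m + l) - r)
  set tw : AddChar (F ⧸ H) ℂ → AddChar F ℂ :=
    fun w => w.compAddMonoidHom (QuotientAddGroup.mk' H) with htw
  set g : ℕ → AddChar F ℂ → ℝ := fun j χ =>
    (∑ w, ‖expSum ω s α (c + p ^ a * j) (a + N') (χ * tw w)‖ ^ (2 * r)) ^ ((r : ℝ)⁻¹) with hg
  have hg0 : ∀ j χ, 0 ≤ g j χ := fun j χ => by positivity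
  have hgr : ∀ j χ, g j χ ^ r =
      ∑ w, ‖expSum ω s α (c + p ^ a * j) (a + N') (χ * tw w)‖ ^ (2 * r) := by
    intro j χ
    rw [hg]
    exact Real.rpow_inv_natCast_pow (by positivity) (by omega)
  have step : ∀ χ, ∑ w, ‖expSum ω s α c a (χ * tw w)‖ ^ (2 * r) ≤
      D * (∑ j ∈ Finset.range (p ^ N'), g j χ) ^ r := by
    intro χ
    have e : ∀ (c₁ d₁ : ℕ) (w : AddChar (F ⧸ H) ℂ),
        expSum (fun z : ℤ_[p] => (QuotientAddGroup.mk (ω (c + p ^ a * z)) : F ⧸ H))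
          (rescaleSet s c a) (fun z : ℤ_[p] => α (c + p ^ a * z) * χ (ω (c + p ^ a * z))) c₁ d₁ w =
        expSum ω s α (c + p ^ a * c₁) (a + d₁) (χ * tw w) := by
      intro c₁ d₁ w
      have := sum_rescaleSet s (fun n => α n * (χ * tw w) (ω n)) c a c₁ d₁
      rw [expSum, expSum, ← this]
      refine Finset.sum_congr rfl fun n _ => ?_
      rw [AddChar.mul_apply, htw, AddChar.compAddMonoidHom_apply, QuotientAddGroup.mk'_apply,
        mul_assoc]
    have := hD (F ⧸ H) _ hadm (rescaleSet s c a)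
      (fun z : ℤ_[p] => α (c + p ^ a * z) * χ (ω (c + p ^ a * z))) (fun j => g j χ)
      (fun j => hg0 j χ) (fun j => by rw [hgr]; simp only [e]; exact le_rfl)
    simpa only [e, mul_zero, add_zero] using this
  set U' := ballSum p v N c' b ^ (crit (m + l) - r)
  have hU' : 0 ≤ U' := pow_nonneg (ballSum_nonneg hv _ _ _) _
  have hmink := sum_mul_sum_pow_le Finset.univ (Finset.range (p ^ N')) hr1
    (w := fun χ => ‖expSum ω s α c' b χ‖ ^ M) (g := g)
    (v := fun j => ballSum p v N (c + p ^ a * j) (a + N')) (c := W * (K * U'))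
    (fun _ => by positivity) hg0 (fun _ => ballSum_nonneg hv _ _ _) (fun j _ => by
      simp only [hgr]
      rw [htw, sum_norm_expSum_twist hHω, mul_assoc]
      refine mul_le_mul_of_nonneg_left ?_ hWpos.le
      refine (hB F ω hω s α v hv hH (c + p ^ a * j) c' ?_).trans_eq ?_
      · intro h
        apply hc
        have h2 : (p : ℤ_[p]) ∣ p ^ a * j := Dvd.dvd.mul_right (dvd_pow_self _ (by omega)) _
        have := dvd_sub h h2
        push_cast at this
        convert this using 1; ring
      · ring)
  have hsum := sum_ballSum (p := p) v (N := N) c (Nat.le_add_right a N') haN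
  rw [Nat.add_sub_cancel_left] at hsum
  rw [hsum] at hmink
  refine le_of_mul_le_mul_left ?_ hWpos
  rw [← sum_norm_expSum_twist hHω]
  calc _ ≤ ∑ χ, ‖expSum ω s α c' b χ‖ ^ M * (D * (∑ j ∈ Finset.range (p ^ N'), g j χ) ^ r) :=
        Finset.sum_le_sum fun χ _ => mul_le_mul_of_nonneg_left (step χ) (by positivity)
    _ = D * ∑ χ, ‖expSum ω s α c' b χ‖ ^ M * (∑ j ∈ Finset.range (p ^ N'), g j χ) ^ r := by
        rw [Finset.mul_sum]; exact Finset.sum_congr rfl fun _ _ => by ring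
    _ ≤ D * (W * (K * U') * ballSum p v N c a ^ r) := mul_le_mul_of_nonneg_left hmink hD0
    _ = _ := by ring

end Decoupling

theorem sum_pow_le_pow_sum_of_nonneg {J : Type*} (T : Finset J) {v : J → ℝ}
    (hv : ∀ j ∈ T, 0 ≤ v j) {r : ℕ} (hr : 1 ≤ r) : ∑ j ∈ T, v j ^ r ≤ (∑ j ∈ T, v j) ^ r := by
  obtain ⟨q, rfl⟩ : ∃ q, r = q + 1 := ⟨r - 1, by omega⟩
  rw [pow_succ', Finset.sum_mul]
  refine Finset.sum_le_sum fun j hj => ?_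
  rw [pow_succ']
  exact mul_le_mul_of_nonneg_left
    (pow_le_pow_left₀ (hv j hj) (Finset.single_le_sum hv hj) q) (hv j hj)

theorem norm_sum_pow_le_card {J : Type*} (T : Finset J) (z : J → ℂ) (q : ℕ) :
    ‖∑ j ∈ T, z j‖ ^ (q + 1) ≤ (T.card : ℝ) ^ q * ∑ j ∈ T, ‖z j‖ ^ (q + 1) := by
  have h := sum_pow_succ_le T q (h := fun j => ‖z j‖) (f := fun j => ‖z j‖ ^ (q + 1))
    (g := fun _ => 1) (fun _ _ => norm_nonneg _) (fun _ _ => by positivity)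
    (fun _ _ => zero_le_one) (fun _ _ => by simp)
  refine (pow_le_pow_left₀ (norm_nonneg _) (norm_sum_le _ _) _).trans (h.trans_eq ?_)
  simp [mul_comm]

theorem pow_mul_pow_le_add {x y : ℝ} (hx : 0 ≤ x) (hy : 0 ≤ y) {A A' : ℕ} :
    x ^ A * y ^ A' ≤ x ^ (A + A') + y ^ (A + A') := by
  rw [pow_add, pow_add]
  rcases le_total x y with h | h
  · exact (mul_le_mul_of_nonneg_right (pow_le_pow_left₀ hx h A) (by positivity)).trans
      (le_add_of_nonneg_left (by positivity))
  · exact (mul_le_mul_of_nonneg_left (pow_le_pow_left₀ hy h A') (by positivity)).trans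
      (le_add_of_nonneg_right (by positivity))

theorem pow_mul_pow_self_le {x y : ℝ} (hx : 0 ≤ x) (hy : 0 ≤ y) {A r : ℕ} (hA : A ≤ r) :
    x ^ r * y ^ r ≤ x ^ (2 * A) * y ^ (2 * (r - A)) + y ^ (2 * A) * x ^ (2 * (r - A)) := by
  obtain ⟨B, rfl⟩ : ∃ B, r = A + B := ⟨r - A, by omega⟩
  rw [Nat.add_sub_cancel_left]
  rcases le_total A B with h | h
  · obtain ⟨t, rfl⟩ : ∃ t, B = A + t := ⟨B - A, by omega⟩
    have := pow_mul_pow_le_add (A := t) (A' := t) hx hy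
    calc x ^ (A + (A + t)) * y ^ (A + (A + t)) = (x * y) ^ (2 * A) * (x ^ t * y ^ t) := by ring
      _ ≤ (x * y) ^ (2 * A) * (x ^ (t + t) + y ^ (t + t)) := by gcongr
      _ = _ := by ring
  · obtain ⟨t, rfl⟩ : ∃ t, A = B + t := ⟨A - B, by omega⟩
    have := pow_mul_pow_le_add (A := t) (A' := t) hx hy
    calc x ^ (B + t + B) * y ^ (B + t + B) = (x * y) ^ (2 * B) * (x ^ t * y ^ t) := by ring
      _ ≤ (x * y) ^ (2 * B) * (x ^ (t + t) + y ^ (t + t)) := by gcongr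
      _ = _ := by ring

theorem pow_mul_pow_eq_of_exponents {x y : ℝ} {q r A B C : ℕ} (h : (q + 1) * A + B = r + q * C)
    (hA : A ≤ r) (hB : B ≤ r) (hC : C ≤ r) :
    (x ^ A * y ^ (r - A)) ^ (q + 1) = (y ^ B * x ^ (r - B)) * (x ^ C * y ^ (r - C)) ^ q := by
  obtain ⟨A', rfl⟩ := Nat.exists_eq_add_of_le hA
  obtain ⟨B', hB'⟩ := Nat.exists_eq_add_of_le hB
  obtain ⟨C', hC'⟩ := Nat.exists_eq_add_of_le hC
  rw [Nat.add_sub_cancel_left, show A + A' - B = B' by omega, show A + A' - C = C' by omega]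
  have e1 : A * (q + 1) = B' + C * q := by nlinarith
  have e2 : A' * (q + 1) = B + C' * q := by nlinarith
  rw [mul_pow, mul_pow, ← pow_mul, ← pow_mul, ← pow_mul, ← pow_mul, e1, e2, pow_add, pow_add]
  ring

theorem crit_interpolation (q l : ℕ) :
    (q + 1) * crit (l + 1) + crit q = crit (q + l + 1) + q * crit l := by
  have h1 := two_mul_crit (l + 1)
  have h2 := two_mul_crit q
  have h3 := two_mul_crit (q + l + 1)
  have h4 := two_mul_crit l
  have : 2 * ((q + 1) * crit (l + 1) + crit q) = 2 * (crit (q + l + 1) + q * crit l) := by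
    calc _ = (q + 1) * (2 * crit (l + 1)) + 2 * crit q := by ring
      _ = 2 * crit (q + l + 1) + q * (2 * crit l) := by rw [h1, h2, h3, h4]; ring
      _ = _ := by ring
  omega

section Decoupling

variable {p : ℕ} [Fact p.Prime]

theorem Bil.holder {q l N a b : ℕ} {K₁ K₂ K : ℝ} (h₁ : Bil p (q + l + 1) N q b a K₁)
    (h₂ : Bil p (q + l + 1) N l a b K₂) (hK : 0 ≤ K) (hK' : K₁ * K₂ ^ q ≤ K ^ (q + 1))
    (hK₁ : 0 ≤ K₁) :
    Bil p (q + l + 1) N (l + 1) a b K := by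
  intro F _ _ ω hω s α v hv hH c c' hc
  have h1 := h₁ F ω hω s α v hv hH c' c (by rwa [← neg_sub, dvd_neg])
  have h2 := h₂ F ω hω s α v hv hH c c' hc
  have ex := crit_interpolation q l
  have i1 : crit (l + 1) ≤ crit (q + l + 1) := crit_mono (by omega)
  have i2 : crit q ≤ crit (q + l + 1) := crit_mono (by omega)
  have i3 : crit l ≤ crit (q + l + 1) := crit_mono (by omega)
  set r := crit (q + l + 1)
  set U := ballSum p v N c a
  set V := ballSum p v N c' b
  have hU : 0 ≤ U := ballSum_nonneg hv _ _ _
  have hV : 0 ≤ V := ballSum_nonneg hv _ _ _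
  have main := sum_pow_succ_le Finset.univ q
    (h := fun χ => ‖expSum ω s α c a χ‖ ^ (2 * crit (l + 1)) *
      ‖expSum ω s α c' b χ‖ ^ (2 * (r - crit (l + 1))))
    (f := fun χ => ‖expSum ω s α c' b χ‖ ^ (2 * crit q) * ‖expSum ω s α c a χ‖ ^ (2 * (r - crit q)))
    (g := fun χ => ‖expSum ω s α c a χ‖ ^ (2 * crit l) * ‖expSum ω s α c' b χ‖ ^ (2 * (r - crit l)))
    (fun _ _ => by positivity) (fun _ _ => by positivity) (fun _ _ => by positivity)
    (fun χ _ => by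
      simp only [pow_mul _ 2]
      exact (pow_mul_pow_eq_of_exponents ex i1 i2 i3).le)
  rw [← pow_le_pow_iff_left₀ (Finset.sum_nonneg fun _ _ => by positivity) (by positivity)
    (Nat.succ_ne_zero q)]
  refine main.trans ?_
  calc _ ≤ (K₁ * (V ^ crit q * U ^ (r - crit q))) * (K₂ * (U ^ crit l * V ^ (r - crit l))) ^ q := by
        refine mul_le_mul h1 (pow_le_pow_left₀ (Finset.sum_nonneg fun _ _ => by positivity) h2 q)
          (pow_nonneg (Finset.sum_nonneg fun _ _ => by positivity) _) (by positivity)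
    _ = K₁ * K₂ ^ q * (U ^ crit (l + 1) * V ^ (r - crit (l + 1))) ^ (q + 1) := by
        rw [pow_mul_pow_eq_of_exponents ex i1 i2 i3]; ring
    _ ≤ K ^ (q + 1) * (U ^ crit (l + 1) * V ^ (r - crit (l + 1))) ^ (q + 1) := by gcongr
    _ = _ := by rw [Nat.succ_eq_add_one, ← mul_pow]

theorem Dec.bil_zero {k N a b : ℕ} {D : ℝ} (h : Dec p k (N - b) D) (hb : 1 ≤ b) (hbN : b ≤ N) :
    Bil p k N 0 a b D := by
  intro F _ _ ω hω s α v hv hH c c' hc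
  simpa [crit] using h.ball hb hbN hω s α hv hH c'

theorem Dec.bil {k N l a b : ℕ} {D D' : ℝ} (h : Dec p k (N - a) D) (h' : Dec p k (N - b) D')
    (hD : 0 ≤ D) (hD' : 0 ≤ D')
    (ha : 1 ≤ a) (haN : a ≤ N) (hb : 1 ≤ b) (hbN : b ≤ N) (hl : 1 ≤ l) (hlk : l < k) :
    Bil p k N l a b (D + D') := by
  intro F _ _ ω hω s α v hv hH c c' hc
  have h1 := h.ball ha haN hω s α hv hH c
  have h2 := h'.ball hb hbN hω s α hv hH c'
  have hr1 : 1 ≤ crit l := crit_pos hl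
  have hr2 : 1 ≤ crit k - crit l := by
    have := two_mul_crit l; have := two_mul_crit k
    have : (l + 1) * (l + 2) ≤ k * (k + 1) := Nat.mul_le_mul hlk (by omega)
    have : (l + 1) * (l + 2) = l * (l + 1) + 2 * (l + 1) := by ring
    omega
  obtain ⟨B, hB⟩ : ∃ B, crit k = crit l + B := ⟨crit k - crit l, by omega⟩
  rw [hB] at h1 h2 ⊢
  rw [Nat.add_sub_cancel_left]
  set A := crit l
  have hB1 : 1 ≤ B := by omega
  set U := ballSum p v N c a
  set V := ballSum p v N c' b
  have hU : 0 ≤ U := ballSum_nonneg hv _ _ _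
  have hV : 0 ≤ V := ballSum_nonneg hv _ _ _
  have zero : ∀ {g : AddChar F ℂ → ℝ} {X E : ℝ}, (∀ χ, 0 ≤ g χ) → X = 0 →
      ∑ χ, g χ ^ (2 * (A + B)) ≤ E * X ^ (A + B) → ∀ χ, g χ = 0 := by
    intro g X E hg hX hs χ
    rw [hX, zero_pow (by omega), mul_zero] at hs
    have := (Finset.single_le_sum (fun χ _ => pow_nonneg (hg χ) (2 * (A + B)))
      (Finset.mem_univ χ)).trans hs
    exact (pow_eq_zero_iff (by omega)).1 (le_antisymm this (pow_nonneg (hg χ) _))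
  rcases hU.eq_or_lt with hU0 | hUp
  · have := zero (fun χ => norm_nonneg (expSum ω s α c a χ)) hU0.symm h1
    simp only [this, zero_pow (show 2 * A ≠ 0 by omega), zero_mul, Finset.sum_const_zero]
    positivity
  rcases hV.eq_or_lt with hV0 | hVp
  · have := zero (fun χ => norm_nonneg (expSum ω s α c' b χ)) hV0.symm h2
    simp only [this, zero_pow (show 2 * B ≠ 0 by omega), mul_zero, Finset.sum_const_zero]
    positivity
  have key : ∀ χ, ‖expSum ω s α c a χ‖ ^ (2 * A) * ‖expSum ω s α c' b χ‖ ^ (2 * B) ≤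
      (U ^ A * V ^ B) * (‖expSum ω s α c a χ‖ ^ (2 * (A + B)) / U ^ (A + B) +
        ‖expSum ω s α c' b χ‖ ^ (2 * (A + B)) / V ^ (A + B)) := by
    intro χ
    have := pow_mul_pow_le_add (x := ‖expSum ω s α c a χ‖ ^ 2 / U)
      (y := ‖expSum ω s α c' b χ‖ ^ 2 / V) (by positivity) (by positivity) (A := A) (A' := B)
    calc _ = (U ^ A * V ^ B) * ((‖expSum ω s α c a χ‖ ^ 2 / U) ^ A *
          (‖expSum ω s α c' b χ‖ ^ 2 / V) ^ B) := by
          rw [div_pow, div_pow, pow_mul, pow_mul]; field_simp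
      _ ≤ _ := by
          refine mul_le_mul_of_nonneg_left (this.trans_eq ?_) (by positivity)
          rw [div_pow, div_pow, pow_mul, pow_mul]
  refine (Finset.sum_le_sum fun χ _ => key χ).trans ?_
  rw [← Finset.mul_sum, Finset.sum_add_distrib, ← Finset.sum_div, ← Finset.sum_div, mul_comm]
  refine mul_le_mul_of_nonneg_right (add_le_add ?_ ?_) (by positivity)
  · rwa [div_le_iff₀ (by positivity)]
  · rwa [div_le_iff₀ (by positivity)]

theorem expSum_zero_zero {F : Type} [AddCommGroup F] (ω : ℤ_[p] → F) (s : Finset ℤ_[p])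
    (α : ℤ_[p] → ℂ) (d : ℕ) (χ : AddChar F ℂ) :
    expSum ω s α 0 0 χ = ∑ i ∈ Finset.range (p ^ d), expSum ω s α i d χ := by
  rw [expSum_eq_sum ω s α 0 (Nat.zero_le d)]; simp

theorem dec_trivial (p : ℕ) [Fact p.Prime] {k : ℕ} (hk : 1 ≤ k) (N : ℕ) :
    Dec p k N ((p : ℝ) ^ (N * (2 * crit k))) := by
  intro F _ _ ω hω s α v hv hH
  have hr := crit_pos hk
  obtain ⟨q, hq⟩ : ∃ q, 2 * crit k = q + 1 := ⟨2 * crit k - 1, by omega⟩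
  have hp1 : (1 : ℝ) ≤ p := by exact_mod_cast (Fact.out : p.Prime).one_lt.le
  calc ∑ χ, ‖expSum ω s α 0 0 χ‖ ^ (2 * crit k)
      ≤ ∑ χ, ((p : ℝ) ^ N) ^ q * ∑ j ∈ Finset.range (p ^ N), ‖expSum ω s α j N χ‖ ^ (2 * crit k) := by
        refine Finset.sum_le_sum fun χ _ => ?_
        rw [expSum_zero_zero ω s α N, hq]
        refine (norm_sum_pow_le_card _ _ _).trans_eq ?_
        simp
    _ = ((p : ℝ) ^ N) ^ q * ∑ j ∈ Finset.range (p ^ N), ∑ χ, ‖expSum ω s α j N χ‖ ^ (2 * crit k) := by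
        rw [← Finset.mul_sum, Finset.sum_comm]
    _ ≤ ((p : ℝ) ^ N) ^ q * (∑ j ∈ Finset.range (p ^ N), v j) ^ crit k := by
        refine mul_le_mul_of_nonneg_left ?_ (by positivity)
        exact (Finset.sum_le_sum fun j _ => hH j).trans
          (sum_pow_le_pow_sum_of_nonneg _ (fun j _ => hv j) hr)
    _ ≤ _ := by
        refine mul_le_mul_of_nonneg_right ?_
          (pow_nonneg (Finset.sum_nonneg fun _ _ => hv _) _)
        rw [← pow_mul, hq]
        exact pow_le_pow_right₀ hp1 (Nat.mul_le_mul_left _ (by omega))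

theorem norm_sum_pow_le_broad_narrow {P : ℕ} (hP : 1 ≤ P) (z : ℕ → ℂ) {κ : ℝ} (hκ : 0 < κ)
    (r : ℕ) :
    ‖∑ i ∈ Finset.range P, z i‖ ^ (2 * r) ≤
      (1 + κ) ^ (2 * r) * ∑ i ∈ Finset.range P, ‖z i‖ ^ (2 * r) +
      (P : ℝ) ^ (2 * r) * (P / κ) ^ r * ∑ i ∈ Finset.range P, ∑ i' ∈ (Finset.range P).erase i,
        ‖z i‖ ^ r * ‖z i'‖ ^ r := by
  have hP0 : (0 : ℝ) < P := by exact_mod_cast hP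
  obtain ⟨m, hm, hmax⟩ := Finset.exists_max_image (Finset.range P) (fun i => ‖z i‖)
    ⟨0, Finset.mem_range.2 hP⟩
  by_cases hA : ∀ i ∈ (Finset.range P).erase m, ‖z i‖ ≤ κ / P * ‖z m‖
  · refine le_add_of_le_of_nonneg ?_ (by positivity)
    have h1 : ‖∑ i ∈ Finset.range P, z i‖ ≤ (1 + κ) * ‖z m‖ := by
      rw [← Finset.add_sum_erase _ _ hm]
      calc _ ≤ ‖z m‖ + ∑ i ∈ (Finset.range P).erase m, ‖z i‖ :=
            (norm_add_le _ _).trans (by gcongr; exact norm_sum_le _ _)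
        _ ≤ ‖z m‖ + ∑ i ∈ (Finset.range P).erase m, κ / P * ‖z m‖ := by
            gcongr with i hi; exact hA i hi
        _ ≤ ‖z m‖ + P * (κ / P * ‖z m‖) := by
            rw [Finset.sum_const, nsmul_eq_mul]
            gcongr
            exact (Finset.card_erase_le).trans (by simp)
        _ = _ := by field_simp
    calc _ ≤ ((1 + κ) * ‖z m‖) ^ (2 * r) := by gcongr
      _ = (1 + κ) ^ (2 * r) * ‖z m‖ ^ (2 * r) := mul_pow _ _ _
      _ ≤ _ := by
        gcongr
        exact Finset.single_le_sum (f := fun i => ‖z i‖ ^ (2 * r)) (fun _ _ => by positivity) hm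
  · push Not at hA
    obtain ⟨i', hi', hlt⟩ := hA
    refine le_add_of_nonneg_of_le (by positivity) ?_
    have h1 : ‖∑ i ∈ Finset.range P, z i‖ ≤ P * ‖z m‖ := by
      calc _ ≤ ∑ i ∈ Finset.range P, ‖z i‖ := norm_sum_le _ _
        _ ≤ ∑ i ∈ Finset.range P, ‖z m‖ := Finset.sum_le_sum hmax
        _ = _ := by simp
    have h2 : ‖z m‖ ≤ P / κ * ‖z i'‖ := by
      calc ‖z m‖ = P / κ * (κ / P * ‖z m‖) := by field_simp
        _ ≤ _ := by gcongr
    calc _ ≤ (P * ‖z m‖) ^ (2 * r) := by gcongr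
      _ = (P : ℝ) ^ (2 * r) * (‖z m‖ ^ r * ‖z m‖ ^ r) := by rw [mul_pow]; ring
      _ ≤ (P : ℝ) ^ (2 * r) * (‖z m‖ ^ r * (P / κ * ‖z i'‖) ^ r) := by gcongr
      _ = (P : ℝ) ^ (2 * r) * (P / κ) ^ r * (‖z m‖ ^ r * ‖z i'‖ ^ r) := by rw [mul_pow]; ring
      _ ≤ _ := by
        gcongr
        refine le_trans ?_ (Finset.single_le_sum (f := fun i => ∑ i' ∈ (Finset.range P).erase i,
          ‖z i‖ ^ r * ‖z i'‖ ^ r) (fun _ _ => by positivity) hm)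
        exact Finset.single_le_sum (f := fun i' => ‖z m‖ ^ r * ‖z i'‖ ^ r)
          (fun _ _ => by positivity) hi'

end Decoupling

theorem sum_norm_sq_sum_of_orthogonal {ι X : Type*} [Fintype X] [DecidableEq ι] (s : Finset ι)
    (z : ι → X → ℂ)
    (h : ∀ i ∈ s, ∀ j ∈ s, i ≠ j → ∑ χ, z i χ * (starRingEnd ℂ) (z j χ) = 0) :
    ∑ χ, ‖∑ i ∈ s, z i χ‖ ^ 2 = ∑ i ∈ s, ∑ χ, ‖z i χ‖ ^ 2 := by
  have key : ∀ w : ℂ, ((‖w‖ ^ 2 : ℝ) : ℂ) = w * (starRingEnd ℂ) w := fun w => by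
    rw [Complex.mul_conj, Complex.normSq_eq_norm_sq]
  rw [← Complex.ofReal_inj, Complex.ofReal_sum, Complex.ofReal_sum]
  simp only [Complex.ofReal_sum, key, map_sum, Finset.sum_mul_sum]
  rw [Finset.sum_comm]
  refine Finset.sum_congr rfl fun i hi => ?_
  rw [Finset.sum_comm, Finset.sum_eq_single_of_mem i hi]
  intro j hj hji
  exact h i hi j hj hji.symm

section Decoupling

variable {p : ℕ} [Fact p.Prime]

theorem dec_one (N : ℕ) : Dec p 1 N 1 := by
  intro F _ _ ω hω s a v hv hH
  classical
  have := Fintype.ofFinite F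
  have hc : crit 1 = 1 := by rfl
  simp only [hc, mul_one, pow_one, one_mul] at hH ⊢
  simp only [expSum_zero_zero ω s a N]
  rw [sum_norm_sq_sum_of_orthogonal]
  · exact Finset.sum_le_sum fun j _ => hH j
  intro i hi j hj hij
  simp only [expSum, map_sum, Finset.sum_mul_sum]
  rw [Finset.sum_comm]
  refine Finset.sum_eq_zero fun n hn => ?_
  rw [Finset.sum_comm]
  refine Finset.sum_eq_zero fun m hm => ?_
  have h1 := (Finset.mem_filter.1 hn).2
  have h2 := (Finset.mem_filter.1 hm).2
  have h3 : ω n - ω m ≠ 0 := by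
    intro h0
    have h4 := hω.dvd_sub_of_eq (sub_eq_zero.1 h0)
    obtain ⟨i₀, _, h5⟩ := exists_unique_residue n N
    exact hij (((h5 i hi).1 h1).trans ((h5 j hj).1 (by
      have := dvd_add h4 h2; rwa [sub_add_sub_cancel] at this)).symm)
  have h4 := AddChar.sum_apply_eq_zero_iff_ne_zero.2 h3
  calc _ = ∑ χ : AddChar F ℂ, a n * (starRingEnd ℂ) (a m) * χ (ω n - ω m) := by
        refine Finset.sum_congr rfl fun χ _ => ?_
        rw [sub_eq_add_neg, AddChar.map_add_eq_mul, AddChar.map_neg_eq_conj, map_mul]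
        ring
    _ = 0 := by rw [← Finset.mul_sum, h4, mul_zero]

theorem Bil.sum_le {k N l b : ℕ} {K : ℝ} (hB : Bil p k N l 1 b K) (hK : 0 ≤ K) (hl : l < k)
    (hb : 1 ≤ b) (hbN : b ≤ N) {F : Type} [AddCommGroup F] [Finite F] {ω : ℤ_[p] → F}
    (hω : Admissible p k N ω) (s : Finset ℤ_[p]) (α : ℤ_[p] → ℂ) {v : ℕ → ℝ} (hv : ∀ n, 0 ≤ v n)
    (hH : ∀ n, ∑ χ, ‖expSum ω s α n N χ‖ ^ (2 * crit k) ≤ v n ^ crit k) {i j : ℕ}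
    (hi : i < p) (hj : j < p) (hij : i ≠ j) :
    ∑ χ, ‖expSum ω s α i 1 χ‖ ^ (2 * crit l) * ‖expSum ω s α j 1 χ‖ ^ (2 * (crit k - crit l)) ≤
      (p : ℝ) ^ (2 * crit k * b) * K * ballSum p v N 0 0 ^ crit k := by
  have hp := (Fact.out : p.Prime)
  have hp1 : (1 : ℝ) ≤ p := by exact_mod_cast hp.one_lt.le
  have hlt : crit l < crit k := by
    have := two_mul_crit l; have := two_mul_crit k
    have : (l + 1) * (l + 2) ≤ k * (k + 1) := Nat.mul_le_mul hl (by omega)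
    have : (l + 1) * (l + 2) = l * (l + 1) + 2 * (l + 1) := by ring
    omega
  set U := ballSum p v N 0 0
  have hU : 0 ≤ U := ballSum_nonneg hv _ _ _
  have hcop : ∀ m : ℕ, ¬ (p : ℤ_[p]) ∣ (i : ℤ_[p]) - (j + p ^ 1 * m : ℕ) := by
    intro m h
    have h1 : (p : ℤ_[p]) ∣ (i : ℤ_[p]) - j := by
      have := dvd_add h (Dvd.intro (m : ℤ_[p]) rfl)
      refine (this.trans (dvd_of_eq ?_))
      push_cast; ring
    obtain ⟨i₀, _, h5⟩ := exists_unique_residue (p := p) (i : ℤ_[p]) 1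
    simp only [pow_one] at h5
    exact hij (((h5 i (Finset.mem_range.2 hi)).1 (by simp)).trans
      ((h5 j (Finset.mem_range.2 hj)).1 h1).symm)
  have hball1 : ∀ i < p, ballSum p v N i 1 ≤ U := by
    intro i hi
    have h := sum_ballSum (p := p) v 0 (Nat.zero_le 1) (hb.trans hbN)
    change _ = U at h
    rw [← h]
    have h2 := Finset.single_le_sum (f := fun i => ballSum p v N (0 + p ^ 0 * i) 1)
      (fun i _ => ballSum_nonneg hv _ _ _)
      (Finset.mem_range.2 (by simpa using hi) : i ∈ Finset.range (p ^ (1 - 0)))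
    simpa using h2
  have hball2 : ∀ m ∈ Finset.range (p ^ (b - 1)), ballSum p v N (j + p ^ 1 * m) b ≤ U := by
    intro m hm
    refine le_trans ?_ (hball1 j hj)
    rw [← sum_ballSum v j hb hbN]
    exact Finset.single_le_sum (f := fun m => ballSum p v N (j + p ^ 1 * m) b)
      (fun i _ => ballSum_nonneg hv _ _ _) hm
  obtain ⟨B, hB'⟩ : ∃ B, 2 * (crit k - crit l) = B + 1 := ⟨2 * (crit k - crit l) - 1, by omega⟩
  calc _ ≤ ∑ χ, ‖expSum ω s α i 1 χ‖ ^ (2 * crit l) * (((p : ℝ) ^ (b - 1)) ^ B *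
        ∑ m ∈ Finset.range (p ^ (b - 1)),
          ‖expSum ω s α (j + p ^ 1 * m) b χ‖ ^ (2 * (crit k - crit l))) := by
        refine Finset.sum_le_sum fun χ _ => mul_le_mul_of_nonneg_left ?_ (by positivity)
        rw [expSum_eq_sum ω s α j hb, hB']
        refine (norm_sum_pow_le_card _ _ _).trans_eq ?_
        simp
    _ = ((p : ℝ) ^ (b - 1)) ^ B * ∑ m ∈ Finset.range (p ^ (b - 1)), ∑ χ,
          ‖expSum ω s α i 1 χ‖ ^ (2 * crit l) *
            ‖expSum ω s α (j + p ^ 1 * m) b χ‖ ^ (2 * (crit k - crit l)) := by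
        rw [Finset.sum_comm, Finset.mul_sum]
        refine Finset.sum_congr rfl fun χ _ => ?_
        rw [Finset.mul_sum, Finset.mul_sum, Finset.mul_sum]
        refine Finset.sum_congr rfl fun m _ => ?_
        ring
    _ ≤ ((p : ℝ) ^ (b - 1)) ^ B * ∑ m ∈ Finset.range (p ^ (b - 1)), K * U ^ crit k := by
        gcongr with m hm
        refine (hB F ω hω s α v hv hH i (j + p ^ 1 * m) (hcop m)).trans ?_
        refine mul_le_mul_of_nonneg_left ?_ hK
        calc _ ≤ U ^ crit l * U ^ (crit k - crit l) :=
              mul_le_mul (pow_le_pow_left₀ (ballSum_nonneg hv _ _ _) (hball1 i hi) _)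
                (pow_le_pow_left₀ (ballSum_nonneg hv _ _ _) (hball2 m hm) _)
                (pow_nonneg (ballSum_nonneg hv _ _ _) _) (by positivity)
          _ = U ^ crit k := by rw [← pow_add]; congr 1; omega
    _ = (p : ℝ) ^ ((b - 1) * (B + 1)) * K * U ^ crit k := by
        rw [Finset.sum_const, Finset.card_range, nsmul_eq_mul]; push_cast; ring
    _ ≤ _ := by
        refine mul_le_mul_of_nonneg_right (mul_le_mul_of_nonneg_right
          (pow_le_pow_right₀ hp1 ?_) hK) (by positivity)
        rw [← hB', mul_comm]
        exact Nat.mul_le_mul (by omega) (by omega)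

theorem Dec.succ {k N l b : ℕ} {D K κ : ℝ} (hD : Dec p k (N - 1) D) (hD0 : 0 ≤ D)
    (hB : Bil p k N l 1 b K) (hK : 0 ≤ K) (hl : l < k) (hb : 1 ≤ b) (hbN : b ≤ N) (hκ : 0 < κ) :
    Dec p k N ((1 + κ) ^ (2 * crit k) * D +
      (p : ℝ) ^ (2 * crit k) * (p / κ) ^ crit k * (2 * p ^ 2) *
        ((p : ℝ) ^ (2 * crit k * b) * K)) := by
  intro F _ _ ω hω s α v hv hH
  have hp := (Fact.out : p.Prime)
  have hr : 1 ≤ crit k := crit_pos (by omega)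
  have hU0 : ∑ j ∈ Finset.range (p ^ N), v j = ballSum p v N 0 0 := by simp [ballSum]
  rw [hU0]
  set U := ballSum p v N 0 0 with hUdef
  have hU : 0 ≤ U := ballSum_nonneg hv _ _ _
  set E := (p : ℝ) ^ (2 * crit k * b) * K
  have hE : 0 ≤ E := by positivity
  have hle : crit l ≤ crit k := crit_mono hl.le
  have h1 : ∑ i ∈ Finset.range p, ∑ χ, ‖expSum ω s α i 1 χ‖ ^ (2 * crit k) ≤ D * U ^ crit k := by
    calc _ ≤ ∑ i ∈ Finset.range p, D * ballSum p v N i 1 ^ crit k :=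
          Finset.sum_le_sum fun i _ => hD.ball le_rfl (hb.trans hbN) hω s α hv hH i
      _ ≤ D * (∑ i ∈ Finset.range p, ballSum p v N i 1) ^ crit k := by
          rw [← Finset.mul_sum]
          exact mul_le_mul_of_nonneg_left (sum_pow_le_pow_sum_of_nonneg _
            (fun j _ => ballSum_nonneg hv _ _ _) hr) hD0
      _ = _ := by
          rw [hUdef, ← sum_ballSum v 0 (Nat.zero_le 1) (hb.trans hbN)]; simp
  have h2 : ∀ i < p, ∀ j < p, i ≠ j → ∑ χ, ‖expSum ω s α i 1 χ‖ ^ crit k *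
      ‖expSum ω s α j 1 χ‖ ^ crit k ≤ 2 * E * U ^ crit k := by
    intro i hi j hj hij
    calc _ ≤ ∑ χ, (‖expSum ω s α i 1 χ‖ ^ (2 * crit l) *
            ‖expSum ω s α j 1 χ‖ ^ (2 * (crit k - crit l)) +
          ‖expSum ω s α j 1 χ‖ ^ (2 * crit l) *
            ‖expSum ω s α i 1 χ‖ ^ (2 * (crit k - crit l))) := by
          refine Finset.sum_le_sum fun χ _ => ?_
          exact pow_mul_pow_self_le (norm_nonneg _) (norm_nonneg _) hle
      _ ≤ E * U ^ crit k + E * U ^ crit k := by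
          rw [Finset.sum_add_distrib]
          exact add_le_add (hB.sum_le hK hl hb hbN hω s α hv hH hi hj hij)
            (hB.sum_le hK hl hb hbN hω s α hv hH hj hi hij.symm)
      _ = _ := by ring
  calc ∑ χ, ‖expSum ω s α 0 0 χ‖ ^ (2 * crit k)
      ≤ ∑ χ, ((1 + κ) ^ (2 * crit k) * ∑ i ∈ Finset.range p, ‖expSum ω s α i 1 χ‖ ^ (2 * crit k) +
        (p : ℝ) ^ (2 * crit k) * (p / κ) ^ crit k * ∑ i ∈ Finset.range p,
          ∑ j ∈ (Finset.range p).erase i,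
            ‖expSum ω s α i 1 χ‖ ^ crit k * ‖expSum ω s α j 1 χ‖ ^ crit k) := by
        refine Finset.sum_le_sum fun χ _ => ?_
        rw [expSum_zero_zero ω s α 1, pow_one]
        exact norm_sum_pow_le_broad_narrow hp.one_lt.le _ hκ _
    _ = (1 + κ) ^ (2 * crit k) * ∑ i ∈ Finset.range p, ∑ χ, ‖expSum ω s α i 1 χ‖ ^ (2 * crit k) +
        (p : ℝ) ^ (2 * crit k) * (p / κ) ^ crit k * ∑ i ∈ Finset.range p,
          ∑ j ∈ (Finset.range p).erase i,
            ∑ χ, ‖expSum ω s α i 1 χ‖ ^ crit k * ‖expSum ω s α j 1 χ‖ ^ crit k := by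
        rw [Finset.sum_add_distrib, ← Finset.mul_sum, ← Finset.mul_sum, Finset.sum_comm]
        congr 2
        rw [Finset.sum_comm]
        refine Finset.sum_congr rfl fun i _ => ?_
        rw [Finset.sum_comm]
    _ ≤ (1 + κ) ^ (2 * crit k) * (D * U ^ crit k) +
        (p : ℝ) ^ (2 * crit k) * (p / κ) ^ crit k * (p * (p * (2 * E * U ^ crit k))) := by
        refine add_le_add (mul_le_mul_of_nonneg_left h1 (by positivity))
          (mul_le_mul_of_nonneg_left ?_ (by positivity))
        calc _ ≤ ∑ i ∈ Finset.range p, ∑ j ∈ (Finset.range p).erase i, 2 * E * U ^ crit k := by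
              refine Finset.sum_le_sum fun i hi => Finset.sum_le_sum fun j hj => ?_
              exact h2 i (Finset.mem_range.1 hi) j
                (Finset.mem_range.1 (Finset.mem_of_mem_erase hj)) (Finset.ne_of_mem_erase hj).symm
          _ ≤ ∑ i ∈ Finset.range p, p * (2 * E * U ^ crit k) := by
              refine Finset.sum_le_sum fun i _ => ?_
              rw [Finset.sum_const, nsmul_eq_mul]
              refine mul_le_mul_of_nonneg_right ?_ (by positivity)
              exact_mod_cast (Finset.card_erase_le).trans (by simp)
          _ = _ := by simp
    _ = _ := by ring

end Decoupling

/-- The gain, relative to the trivial bound, in the `l`-th bilinear estimate after `n` steps of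
the bootstrap. -/
noncomputable def gain (k : ℕ) : ℕ → ℕ → ℝ
  | 0, l => if l = 0 then 1 else 0
  | n + 1, l => if l = 0 then 1 else
      gain k n (k - l) / l + (k - l : ℕ) / ((k - l : ℕ) + 1) * gain k n (l - 1)

theorem gain_zero_right (k n : ℕ) : gain k n 0 = 1 := by
  cases n <;> simp [gain]

theorem sum_gain (m n : ℕ) :
    ∑ l ∈ Finset.range m, gain (m + 1) n (l + 1) = n * (m / (m + 1)) := by
  induction n with
  | zero => simp [gain]
  | succ n ih =>
    have h1 : ∑ l ∈ Finset.range m, gain (m + 1) n (m + 1 - (l + 1)) / ((l + 1 : ℕ) : ℝ) =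
        ∑ l ∈ Finset.range m, gain (m + 1) n (l + 1) / ((m - l : ℕ) : ℝ) := by
      rw [← Finset.sum_range_reflect]
      refine Finset.sum_congr rfl fun l hl => ?_
      have := Finset.mem_range.1 hl
      congr 2
      · omega
      · omega
    have h2 : ∑ l ∈ Finset.range m, ((m - l : ℕ) : ℝ) / ((m - l : ℕ) + 1) * gain (m + 1) n l =
        m / (m + 1) + ∑ l ∈ Finset.range m,
          (1 - 1 / ((m - l : ℕ) : ℝ)) * gain (m + 1) n (l + 1) := by
      have h3 : ∑ l ∈ Finset.range (m + 1), ((m - l : ℕ) : ℝ) / ((m - l : ℕ) + 1) * gain (m + 1) n l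
          = ∑ l ∈ Finset.range m, ((m - l : ℕ) : ℝ) / ((m - l : ℕ) + 1) * gain (m + 1) n l := by
        rw [Finset.sum_range_succ]; simp
      rw [← h3, Finset.sum_range_succ', gain_zero_right, add_comm]
      congr 1
      · simp
      refine Finset.sum_congr rfl fun l hl => ?_
      congr 1
      have := Finset.mem_range.1 hl
      have h4 : ((m - (l + 1) : ℕ) : ℝ) = ((m - l : ℕ) : ℝ) - 1 := by
        rw [show m - l = m - (l + 1) + 1 by omega]; push_cast; ring
      have h5 : ((m - l : ℕ) : ℝ) ≠ 0 := by
        have : m - l ≠ 0 := by omega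
        exact_mod_cast this
      rw [h4, sub_add_cancel, sub_div, div_self h5]
    calc ∑ l ∈ Finset.range m, gain (m + 1) (n + 1) (l + 1)
        = ∑ l ∈ Finset.range m, (gain (m + 1) n (m + 1 - (l + 1)) / ((l + 1 : ℕ) : ℝ) +
          ((m - l : ℕ) : ℝ) / ((m - l : ℕ) + 1) * gain (m + 1) n l) := by
          refine Finset.sum_congr rfl fun l _ => ?_
          rw [gain, if_neg (Nat.succ_ne_zero l), Nat.add_sub_add_right, Nat.add_sub_cancel]
      _ = _ := by
          rw [Finset.sum_add_distrib, h1, h2, add_left_comm, ← Finset.sum_add_distrib]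
          have : ∑ l ∈ Finset.range m, (gain (m + 1) n (l + 1) / ((m - l : ℕ) : ℝ) +
              (1 - 1 / ((m - l : ℕ) : ℝ)) * gain (m + 1) n (l + 1)) =
              ∑ l ∈ Finset.range m, gain (m + 1) n (l + 1) :=
            Finset.sum_congr rfl fun l _ => by ring
          rw [this, ih]; push_cast; ring

theorem exists_le_gain {k : ℕ} (hk : 2 ≤ k) (L : ℝ) : ∃ n l, 1 ≤ l ∧ l < k ∧ L ≤ gain k n l := by
  obtain ⟨m, rfl⟩ : ∃ m, k = m + 1 := ⟨k - 1, by omega⟩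
  obtain ⟨n, hn⟩ := exists_nat_ge (L * (m + 1))
  by_contra! h
  have h1 : ∑ l ∈ Finset.range m, gain (m + 1) n (l + 1) < ∑ l ∈ Finset.range m, L :=
    Finset.sum_lt_sum_of_nonempty ⟨0, Finset.mem_range.2 (by omega)⟩ fun l hl =>
      h n (l + 1) (by omega) (by have := Finset.mem_range.1 hl; omega)
  rw [sum_gain, Finset.sum_const, Finset.card_range, nsmul_eq_mul] at h1
  have hm : (0 : ℝ) < m := by exact_mod_cast (by omega : 0 < m)
  have h2 : (n : ℝ) * (m / (m + 1)) = m * (n / (m + 1)) := by ring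
  rw [h2] at h1
  have h3 := lt_of_mul_lt_mul_left h1 hm.le
  rw [div_lt_iff₀ (by positivity)] at h3
  linarith

section Decoupling

variable {p : ℕ} [Fact p.Prime]

/-- The decoupling constant of degree `k` is `O(p ^ (η N))`. -/
def Feasible (p : ℕ) [Fact p.Prime] (k : ℕ) (η : ℝ) : Prop :=
  ∃ C : ℝ, 0 ≤ C ∧ ∀ N : ℕ, Dec p k N (C * (p : ℝ) ^ (η * N))

theorem one_le_cast_prime (p : ℕ) [Fact p.Prime] : (1 : ℝ) ≤ p := by
  exact_mod_cast (Fact.out : p.Prime).one_lt.le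

theorem Feasible.mono {k : ℕ} {η η' : ℝ} (h : Feasible p k η) (hη : η ≤ η') : Feasible p k η' := by
  obtain ⟨C, hC, H⟩ := h
  refine ⟨C, hC, fun N => (H N).mono ?_⟩
  gcongr
  exact one_le_cast_prime p

/-- The bilinear estimates of degree `l` save `p ^ (η x b)` after `n` steps. -/
def BilGain (p : ℕ) [Fact p.Prime] (k n l : ℕ) (η x : ℝ) : Prop :=
  ∀ δ > 0, ∃ C : ℝ, 0 ≤ C ∧ ∀ N a b : ℕ, 1 ≤ a → 1 ≤ b → k.factorial ^ n ∣ b →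
    k ^ (n + 1) * b ≤ N → l * a ≤ (k - l + 1) * b →
    Bil p k N l a b (C * (p : ℝ) ^ ((η + δ) * N - η * x * b))

theorem Feasible.bilGain_zero {k n : ℕ} {η : ℝ} (hk : 1 ≤ k) (h : Feasible p k η) :
    BilGain p k n 0 η 1 := by
  intro δ hδ
  obtain ⟨C, hC, H⟩ := h
  refine ⟨C, hC, fun N a b ha hb _ hN _ => ?_⟩
  have hbN : b ≤ N := le_trans (Nat.le_mul_of_pos_left _ (by positivity)) hN
  refine ((H (N - b)).mono ?_).bil_zero hb hbN
  have hp1 := one_le_cast_prime p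
  rw [Nat.cast_sub hbN]
  have : 0 ≤ δ * N := by positivity
  refine mul_le_mul_of_nonneg_left (Real.rpow_le_rpow_of_exponent_le hp1 ?_) hC
  linarith

theorem Feasible.bilGain_base {k l : ℕ} {η : ℝ} (hη : 0 ≤ η) (hl : 1 ≤ l) (hlk : l < k)
    (h : Feasible p k η) : BilGain p k 0 l η 0 := by
  intro δ hδ
  obtain ⟨C, hC, H⟩ := h
  have hp1 := one_le_cast_prime p
  refine ⟨C + C, by positivity, fun N a b ha hb _ hN hab => ?_⟩
  rw [zero_add, pow_one] at hN
  have hbN : b ≤ N := le_trans (Nat.le_mul_of_pos_left _ (by omega)) hN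
  have haN : a ≤ N := by
    refine le_trans (Nat.le_mul_of_pos_left _ hl) (hab.trans (le_trans ?_ hN))
    exact Nat.mul_le_mul_right _ (by omega)
  refine (Dec.bil (H _) (H _) (by positivity) (by positivity) ha haN hb hbN hl hlk).mono ?_
  rw [add_mul]
  have hδN : 0 ≤ δ * N := by positivity
  refine add_le_add (mul_le_mul_of_nonneg_left (Real.rpow_le_rpow_of_exponent_le hp1 ?_) hC)
    (mul_le_mul_of_nonneg_left (Real.rpow_le_rpow_of_exponent_le hp1 ?_) hC)
  · have : η * ((N - a : ℕ) : ℝ) ≤ η * N := by gcongr; exact Nat.sub_le _ _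
    linarith
  · have : η * ((N - b : ℕ) : ℝ) ≤ η * N := by gcongr; exact Nat.sub_le _ _
    linarith

theorem BilGain.step {k n l : ℕ} {η x y : ℝ} (hkp : k < p) (hl : 1 ≤ l) (hlk : l < k)
    (IH : ∀ ε > 0, Feasible p l ε) (h₁ : BilGain p k n (k - l) η x)
    (h₂ : BilGain p k n (l - 1) η y) :
    BilGain p k (n + 1) l η (x / l + (k - l : ℕ) / ((k - l : ℕ) + 1) * y) := by
  obtain ⟨q, hq⟩ : ∃ q, k = q + (l - 1) + 1 := ⟨k - l, by omega⟩
  have hql : k - l = q := by omega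
  have hq1 : 1 ≤ q := by omega
  rw [hql] at h₁ ⊢
  intro δ hδ
  obtain ⟨C₁, hC₁, H₁⟩ := h₁ (δ / 2) (by positivity)
  obtain ⟨C₂, hC₂, H₂⟩ := h₂ (δ / 2) (by positivity)
  obtain ⟨C₃, hC₃, H₃⟩ := IH (δ / 2) (by positivity)
  have hp1 := one_le_cast_prime p
  have hp0 : (0 : ℝ) < p := by linarith
  set C := max C₁ C₂ with hC
  have hC0 : 0 ≤ C := le_max_of_le_left hC₁
  refine ⟨C₃ * C, by positivity, fun N a b ha hb hdvd hN hab => ?_⟩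
  rw [hql] at hab
  obtain ⟨a₀, ha₀⟩ : ∃ a₀, l * a₀ = (q + 1) * b := by
    have : l ∣ b := (Nat.dvd_factorial hl hlk.le).trans
      ((dvd_pow_self _ (Nat.succ_ne_zero n)).trans hdvd)
    obtain ⟨g, hg⟩ := this
    exact ⟨(q + 1) * g, by rw [hg]; ring⟩
  have hdvd₀ : k.factorial ^ n ∣ a₀ := by
    obtain ⟨b', hb'⟩ := hdvd
    obtain ⟨g, hg⟩ := Nat.dvd_factorial hl hlk.le
    have : l * a₀ = l * (k.factorial ^ n * ((q + 1) * g * b')) := by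
      rw [ha₀, hb', pow_succ]
      conv_lhs => rw [hg]
      conv_rhs => rw [hg]
      ring
    exact ⟨_, Nat.eq_of_mul_eq_mul_left hl this⟩
  have ha₀1 : 1 ≤ a₀ := by
    rcases Nat.eq_zero_or_pos a₀ with h | h
    · rw [h] at ha₀; have : 0 < (q + 1) * b := by positivity
      omega
    · exact h
  have haa₀ : a ≤ a₀ := by
    refine Nat.le_of_mul_le_mul_left (c := l) ?_ hl
    rw [ha₀]; exact hab
  have ha₀k : a₀ ≤ k * b := by
    calc a₀ ≤ l * a₀ := Nat.le_mul_of_pos_left _ hl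
      _ = (q + 1) * b := ha₀
      _ ≤ k * b := Nat.mul_le_mul_right _ (by omega)
  have hN₀ : k ^ (n + 1) * a₀ ≤ N := by
    calc _ ≤ k ^ (n + 1) * (k * b) := Nat.mul_le_mul_left _ ha₀k
      _ = k ^ (n + 1 + 1) * b := by ring
      _ ≤ N := hN
  have hNb : k ^ (n + 1) * b ≤ N :=
    le_trans (Nat.mul_le_mul_right _ (Nat.pow_le_pow_right (by omega) (by omega))) hN
  have hkpos : 0 < k ^ (n + 1) := Nat.pow_pos (by omega)
  have ha₀N : a₀ ≤ N := le_trans (Nat.le_mul_of_pos_left _ hkpos) hN₀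
  have hbN : b ≤ N := le_trans (Nat.le_mul_of_pos_left _ hkpos) hNb
  have e₁ := H₁ N b a₀ hb ha₀1 hdvd₀ hN₀ (by
    refine Nat.le_of_mul_le_mul_left (c := l) ?_ hl
    have h1 : k - q + 1 = l + 1 := by omega
    rw [h1, show l * ((l + 1) * a₀) = (l + 1) * (l * a₀) by ring, ha₀]
    nlinarith)
  have e₂ := H₂ N a₀ b ha₀1 hb ((pow_dvd_pow _ (Nat.le_succ n)).trans hdvd) hNb (by
    calc (l - 1) * a₀ ≤ l * a₀ := Nat.mul_le_mul_right _ (by omega)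
      _ = (q + 1) * b := ha₀
      _ ≤ _ := Nat.mul_le_mul_right _ (by omega))
  set z := x / l + q / (q + 1) * y with hz
  set K := C * (p : ℝ) ^ ((η + δ / 2) * N - η * z * b) with hK
  have hKey : (C₁ * (p : ℝ) ^ ((η + δ / 2) * N - η * x * a₀)) *
      (C₂ * (p : ℝ) ^ ((η + δ / 2) * N - η * y * b)) ^ q ≤ K ^ (q + 1) := by
    have hexp : ((η + δ / 2) * N - η * z * b) * (q + 1 : ℕ) =
        ((η + δ / 2) * N - η * x * a₀) + ((η + δ / 2) * N - η * y * b) * q := by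
      have hl0 : (l : ℝ) ≠ 0 := by positivity
      have ha₀' : (a₀ : ℝ) = (q + 1) * b / l := by
        rw [eq_div_iff hl0, mul_comm]; exact_mod_cast ha₀
      rw [hz, ha₀']; push_cast; field_simp; ring
    rw [hK, mul_pow, mul_pow, ← Real.rpow_natCast _ (q + 1), ← Real.rpow_natCast (_ ^ _) (q + 1),
      ← Real.rpow_mul hp0.le, hexp, Real.rpow_add hp0, ← Real.rpow_natCast (_ ^ _) q,
      ← Real.rpow_mul hp0.le, Real.rpow_natCast]
    calc _ = (C₁ * C₂ ^ q) * ((p : ℝ) ^ ((η + δ / 2) * N - η * x * a₀) *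
          (p : ℝ) ^ (((η + δ / 2) * N - η * y * b) * q)) := by ring
      _ ≤ _ := by
        refine mul_le_mul_of_nonneg_right ?_ (by positivity)
        rw [pow_succ']
        exact mul_le_mul (le_max_left _ _) (pow_le_pow_left₀ hC₂ (le_max_right _ _) _)
          (by positivity) hC0
  have e₃ : Bil p k N l a₀ b K := by
    have hl' : l = l - 1 + 1 := by omega
    rw [hl']
    subst hq
    exact Bil.holder e₁ e₂ (by positivity) hKey (by positivity)
  obtain ⟨N', rfl⟩ : ∃ N', a₀ = a + N' := ⟨a₀ - a, by omega⟩
  refine (e₃.refine (H₃ N') (by positivity) hl hlk.le hkp ha hb hbN ha₀N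
    (by rw [hql, ha₀])).mono ?_
  calc C₃ * (p : ℝ) ^ (δ / 2 * N') * K
      ≤ C₃ * (p : ℝ) ^ (δ / 2 * N) * K := by
        have : N' ≤ N := by omega
        gcongr
    _ = _ := by
        rw [hK, show (η + δ) * N - η * z * b = δ / 2 * N + ((η + δ / 2) * N - η * z * b) by ring,
          Real.rpow_add hp0]
        ring

theorem Feasible.bilGain {k n l : ℕ} {η : ℝ} (hη : 0 ≤ η) (hkp : k < p) (hlk : l < k)
    (IH : ∀ l, 1 ≤ l → l < k → ∀ ε > 0, Feasible p l ε) (h : Feasible p k η) :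
    BilGain p k n l η (gain k n l) := by
  induction n generalizing l with
  | zero =>
    rcases Nat.eq_zero_or_pos l with rfl | hl
    · rw [gain_zero_right]; exact h.bilGain_zero (by omega)
    · rw [gain, if_neg hl.ne']; exact h.bilGain_base hη hl hlk
  | succ n ih =>
    rcases Nat.eq_zero_or_pos l with rfl | hl
    · rw [gain_zero_right]; exact h.bilGain_zero (by omega)
    · rw [gain, if_neg hl.ne']
      exact BilGain.step hkp hl hlk (IH l hl hlk) (ih (by omega)) (ih (by omega))

theorem Feasible.improve {k : ℕ} (hk : 2 ≤ k) (hkp : k < p)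
    (IH : ∀ l, 1 ≤ l → l < k → ∀ ε > 0, Feasible p l ε) {η₀ : ℝ} (hη₀ : 0 < η₀) :
    ∃ c > 0, ∀ η, η₀ ≤ η → Feasible p k η → Feasible p k (η - c) := by
  have hp1 : (1 : ℝ) < p := by exact_mod_cast (Fact.out : p.Prime).one_lt
  have hp0 : (0 : ℝ) < p := by linarith
  set r := crit k with hr
  have hr1 : 1 ≤ r := crit_pos (by omega)
  obtain ⟨n, l, hl, hlk, hx⟩ := exists_le_gain hk ((2 * r + 1) / η₀)
  set x := gain k n l
  have hkn : (0 : ℝ) < (k : ℝ) ^ (n + 1) := by positivity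
  set ρ : ℝ := 1 / (k : ℝ) ^ (n + 1) with hρ
  have hρ0 : 0 < ρ := by positivity
  refine ⟨min (ρ / 2) (η₀ / 2), by positivity, fun η hη h => ?_⟩
  set c := min (ρ / 2) (η₀ / 2)
  have hcρ : c ≤ ρ / 2 := min_le_left _ _
  have hcη : c ≤ η₀ / 2 := min_le_right _ _
  have hηx : 2 * r + 1 ≤ η * x := by
    rw [div_le_iff₀ hη₀] at hx
    have : 0 ≤ x := by
      by_contra hneg
      push Not at hneg
      have : x * η₀ < 0 := mul_neg_of_neg_of_pos hneg hη₀
      have : (0 : ℝ) ≤ 2 * r + 1 := by positivity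
      linarith
    nlinarith
  obtain ⟨C, hC, H⟩ := h.bilGain (by linarith) hkp hlk IH (n := n) (ρ / 2) (by positivity)
  set M := k.factorial ^ n * k with hM
  have hM0 : 0 < M := by positivity
  have hbil : ∀ N : ℕ, k ^ (n + 1) * M ≤ N → ∃ b, 1 ≤ b ∧ b ≤ N ∧
      ∃ K, 0 ≤ K ∧ Bil p k N l 1 b K ∧
        (p : ℝ) ^ (2 * r * b) * K ≤ C * (p : ℝ) ^ (M : ℝ) * (p : ℝ) ^ ((η - c) * N) := by
    intro N hN
    set t := N / (k ^ (n + 1) * M)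
    have ht : 1 ≤ t := (Nat.one_le_div_iff (by positivity)).2 hN
    have ht2 : k ^ (n + 1) * (M * t) ≤ N := by
      rw [← mul_assoc]; exact Nat.mul_div_le N _
    have ht3 : (N : ℝ) * ρ - M ≤ (M * t : ℕ) := by
      have h1 : N < k ^ (n + 1) * M * (t + 1) := Nat.lt_mul_div_succ N (by positivity)
      have h2 : (N : ℝ) < k ^ (n + 1) * M * (t + 1) := by exact_mod_cast h1
      have h3 : (N : ℝ) * ρ < M * (t + 1) := by
        rw [hρ, mul_one_div, div_lt_iff₀ hkn]
        linarith
      push_cast; linarith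
    have hMt : 1 ≤ M * t := Nat.mul_pos hM0 ht
    refine ⟨M * t, hMt, le_trans (Nat.le_mul_of_pos_left _ (by positivity)) ht2, _, ?_,
      H N 1 (M * t) le_rfl hMt ((Dvd.intro _ rfl : _ ∣ M).mul_right t) ht2 ?_, ?_⟩
    · positivity
    · calc l * 1 ≤ k := by omega
        _ ≤ M := Nat.le_mul_of_pos_left _ (by positivity)
        _ ≤ M * t := Nat.le_mul_of_pos_right _ ht
        _ ≤ _ := Nat.le_mul_of_pos_left _ (by omega)
    · generalize hb : M * t = b at *
      rw [← Real.rpow_natCast _ (2 * r * b), mul_left_comm, ← Real.rpow_add hp0, mul_assoc C,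
        ← Real.rpow_add hp0]
      refine mul_le_mul_of_nonneg_left (Real.rpow_le_rpow_of_exponent_le hp1.le ?_) hC
      push_cast
      have h1 : (2 * r + 1) * (b : ℝ) ≤ η * x * b := by gcongr
      have h2 : c * N ≤ ρ / 2 * N := by gcongr
      linarith
  set κ := (p : ℝ) ^ (η₀ / 4 / (2 * r : ℕ)) - 1 with hκdef
  have h2r : (0 : ℝ) < (2 * r : ℕ) := by exact_mod_cast (by omega : 0 < 2 * r)
  have hκ : 0 < κ := by
    have := Real.one_lt_rpow hp1 (show 0 < η₀ / 4 / (2 * r : ℕ) by positivity)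
    linarith
  have hκ2 : (1 + κ) ^ (2 * r) = (p : ℝ) ^ (η₀ / 4) := by
    rw [hκdef, add_sub_cancel, ← Real.rpow_natCast (_ ^ _), ← Real.rpow_mul hp0.le,
      div_mul_cancel₀ _ h2r.ne']
  set C' := (p : ℝ) ^ (2 * r) * (p / κ) ^ r * (2 * p ^ 2) * (C * (p : ℝ) ^ (M : ℝ)) with hC'
  have hC'0 : 0 ≤ C' := by positivity
  set θ := (p : ℝ) ^ (-(η₀ / 4)) with hθ
  have hθ1 : θ < 1 := Real.rpow_lt_one_of_one_lt_of_neg hp1 (by linarith)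
  have hθ1' : 0 < 1 - θ := by linarith
  have hηc : 0 ≤ η - c := by linarith
  set C₀ := max ((p : ℝ) ^ (k ^ (n + 1) * M * (2 * r))) (C' / (1 - θ)) with hC₀
  have hC₀0 : 0 ≤ C₀ := le_max_of_le_left (by positivity)
  have hC₀' : θ * C₀ + C' ≤ C₀ := by
    have h1 : C' / (1 - θ) ≤ C₀ := le_max_right _ _
    rw [div_le_iff₀ hθ1'] at h1
    linarith
  refine ⟨C₀, hC₀0, fun N => ?_⟩
  induction N with
  | zero =>
    refine (dec_trivial p (by omega) 0).mono ?_
    simp only [Nat.zero_mul, pow_zero, Nat.cast_zero, mul_zero, Real.rpow_zero, mul_one]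
    exact le_max_of_le_left (one_le_pow₀ hp1.le)
  | succ N ih =>
    rcases lt_or_ge (N + 1) (k ^ (n + 1) * M) with hN | hN
    · refine (dec_trivial p (by omega) (N + 1)).mono ?_
      calc (p : ℝ) ^ ((N + 1) * (2 * r)) ≤ (p : ℝ) ^ (k ^ (n + 1) * M * (2 * r)) :=
            pow_le_pow_right₀ hp1.le (Nat.mul_le_mul_right _ hN.le)
        _ ≤ C₀ := le_max_left _ _
        _ ≤ _ := le_mul_of_one_le_right hC₀0
            (Real.one_le_rpow hp1.le (by positivity))
    · obtain ⟨b, hb, hbN, K, hK, hB, hle⟩ := hbil (N + 1) hN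
      refine (Dec.succ (D := C₀ * (p : ℝ) ^ ((η - c) * N)) ih (by positivity) hB hK hlk hb hbN
        hκ).mono ?_
      set E := (p : ℝ) ^ ((η - c) * (N + 1 : ℕ))
      have h1 : (1 + κ) ^ (2 * r) * (C₀ * (p : ℝ) ^ ((η - c) * N)) ≤ θ * C₀ * E := by
        rw [hκ2]
        have : (p : ℝ) ^ (η₀ / 4) * (p : ℝ) ^ ((η - c) * N) ≤ θ * E := by
          rw [← Real.rpow_add hp0, ← Real.rpow_add hp0]
          refine Real.rpow_le_rpow_of_exponent_le hp1.le ?_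
          push_cast
          linarith
        calc _ = C₀ * ((p : ℝ) ^ (η₀ / 4) * (p : ℝ) ^ ((η - c) * N)) := by ring
          _ ≤ C₀ * (θ * E) := mul_le_mul_of_nonneg_left this hC₀0
          _ = _ := by ring
      have h2 : (p : ℝ) ^ (2 * r) * (p / κ) ^ r * (2 * p ^ 2) * ((p : ℝ) ^ (2 * r * b) * K) ≤
          C' * E := by
        calc _ ≤ (p : ℝ) ^ (2 * r) * (p / κ) ^ r * (2 * p ^ 2) *
              (C * (p : ℝ) ^ (M : ℝ) * E) := mul_le_mul_of_nonneg_left hle (by positivity)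
          _ = _ := by rw [hC']; ring
      calc _ ≤ θ * C₀ * E + C' * E := add_le_add h1 h2
        _ = (θ * C₀ + C') * E := by ring
        _ ≤ C₀ * E := mul_le_mul_of_nonneg_right hC₀' (by positivity)

theorem feasible_of_pos {k : ℕ} (hk : 1 ≤ k) (hkp : k < p) {ε : ℝ} (hε : 0 < ε) :
    Feasible p k ε := by
  induction k using Nat.strong_induction_on generalizing ε with
  | _ k IH =>
    have hp1 := one_le_cast_prime p
    rcases eq_or_lt_of_le hk with rfl | hk2
    · refine ⟨1, zero_le_one, fun N => (dec_one N).mono ?_⟩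
      rw [one_mul]
      exact Real.one_le_rpow hp1 (by positivity)
    obtain ⟨c, hc, H⟩ := Feasible.improve hk2 hkp
      (fun l hl hlk ε hε => IH l hlk hl (hlk.trans hkp) hε) hε
    have key : ∀ m : ℕ, Feasible p k (max ε (2 * crit k - m * c)) := by
      intro m
      induction m with
      | zero =>
        refine Feasible.mono (η := (2 * crit k : ℕ)) ⟨1, zero_le_one, fun N =>
          (dec_trivial p hk N).mono ?_⟩ (by simp)
        rw [one_mul, ← Nat.cast_mul, Real.rpow_natCast, mul_comm]
      | succ m ih =>
        refine (H _ (le_max_left _ _) ih).mono ?_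
        rw [sub_le_iff_le_add]
        refine max_le (by linarith [le_max_left ε (2 * crit k - (m + 1 : ℕ) * c)]) ?_
        have := le_max_right ε (2 * crit k - (m + 1 : ℕ) * c)
        push_cast at this ⊢
        linarith
    obtain ⟨m, hm⟩ := exists_nat_ge ((2 * crit k : ℝ) / c)
    rw [div_le_iff₀ hc] at hm
    have := key m
    rwa [max_eq_left (by linarith)] at this

end Decoupling

section Vinogradov

variable {p : ℕ} [Fact p.Prime]

/-- The character of `(ℤ/P)^k` with frequency `b`. -/
noncomputable def freqChar {P : ℕ} [NeZero P] {k : ℕ} (b : Fin k → ZMod P) :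
    AddChar (Fin k → ZMod P) ℂ where
  toFun x := ZMod.stdAddChar (∑ j, b j * x j)
  map_zero_eq_one' := by simp
  map_add_eq_mul' x y := by
    rw [← AddChar.map_add_eq_mul, ← Finset.sum_add_distrib]
    simp only [Pi.add_apply, mul_add]

theorem freqChar_apply {P : ℕ} [NeZero P] {k : ℕ} (b x : Fin k → ZMod P) :
    freqChar b x = ZMod.stdAddChar (∑ j, b j * x j) := rfl

theorem freqChar_injective {P : ℕ} [NeZero P] {k : ℕ} :
    Function.Injective (freqChar : (Fin k → ZMod P) → AddChar (Fin k → ZMod P) ℂ) := by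
  intro b c h
  funext j
  have := DFunLike.congr_fun h (Pi.single j 1)
  simpa [freqChar_apply, Pi.single_apply] using ZMod.injective_stdAddChar this

theorem admissible_powers {k N M : ℕ} (hM : k * N ≤ M) :
    Admissible p k N fun n => fun j : Fin k => PadicInt.toZModPow M (n ^ (j.1 + 1)) := by
  refine ⟨fun j => Polynomial.X ^ (j.1 + 1), fun j => ⟨fun i _ => ?_, fun i hi => ?_⟩,
    (PadicInt.toZModPow M).toAddMonoidHom.compLeft (Fin k), 0, fun n => ?_, fun v hv i => ?_⟩
  · rw [Polynomial.coeff_X_pow]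
  · rw [Polynomial.coeff_X_pow, if_neg (by omega)]; exact dvd_zero _
  · funext j; simp
  · have h := congr_fun hv i
    simp only [AddMonoidHom.compLeft_apply, Function.comp, Pi.zero_apply] at h
    change PadicInt.toZModPow M (v i) = 0 at h
    rw [← RingHom.mem_ker, PadicInt.ker_toZModPow, Ideal.mem_span_singleton] at h
    exact (pow_dvd_pow _ hM).trans h

/-- Vinogradov's mean value theorem at the critical exponent. -/
theorem vinogradov_mean_value {k : ℕ} (hk : 1 ≤ k) (hkp : k < p) {ε : ℝ} (hε : 0 < ε) :
    ∃ C : ℝ, 0 ≤ C ∧ ∀ X P M : ℕ, [NeZero P] → P = p ^ M → 1 ≤ X → (p * X) ^ k ≤ P →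
      ∑ b : Fin k → ZMod P, ‖∑ n ∈ Finset.Icc 1 X,
        (ZMod.stdAddChar (∑ j, b j * (n : ZMod P) ^ (j.1 + 1)) : ℂ)‖ ^ (2 * crit k) ≤
      C * (X : ℝ) ^ (crit k + ε) * (P : ℝ) ^ k := by
  obtain ⟨C, hC, H⟩ := feasible_of_pos hk hkp hε
  have hp := (Fact.out : p.Prime)
  have hp0 : (0 : ℝ) < p := by exact_mod_cast hp.pos
  refine ⟨C * (p : ℝ) ^ (crit k + ε), by positivity, fun X P M _ hPM hX hP => ?_⟩
  subst hPM
  have hr := crit_pos hk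
  set N := Nat.clog p X with hN
  have hN1 : X ≤ p ^ N := Nat.le_pow_clog hp.one_lt X
  have hN2 : p ^ N ≤ p * X := by
    rcases Nat.eq_zero_or_pos N with h | h
    · rw [h, pow_zero]; exact Nat.mul_pos hp.pos hX
    · obtain ⟨N', hN'⟩ : ∃ N', N = N' + 1 := ⟨N - 1, by omega⟩
      have : p ^ N' < X := by
        by_contra! hlt
        have := (Nat.clog_le_iff_le_pow hp.one_lt).2 hlt
        omega
      rw [hN', pow_succ, mul_comm]
      exact Nat.mul_le_mul_left _ this.le
  have hM : k * N ≤ M := by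
    have : p ^ (k * N) ≤ p ^ M := by
      rw [mul_comm, pow_mul]
      exact (Nat.pow_le_pow_left hN2 k).trans hP
    exact (Nat.pow_le_pow_iff_right hp.one_lt).1 this
  have hadm := admissible_powers (p := p) hM
  set F := Fin k → ZMod (p ^ M)
  set ω : ℤ_[p] → F := fun n => fun j => PadicInt.toZModPow M (n ^ (j.1 + 1)) with hω
  have hinj : Function.Injective (fun n : ℕ => (n : ℤ_[p])) := Nat.cast_injective
  classical
  set s : Finset ℤ_[p] := (Finset.Icc 1 X).map ⟨_, hinj⟩ with hs
  set A : ℝ := (Fintype.card (AddChar F ℂ) : ℝ) with hA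
  have hA0 : 0 ≤ A := by positivity
  have hv : ∀ n : ℕ, ∑ χ : AddChar F ℂ, ‖expSum ω s (fun _ => 1) n N χ‖ ^ (2 * crit k) ≤
      (A ^ ((crit k : ℝ)⁻¹)) ^ crit k := by
    intro c
    rw [Real.rpow_inv_natCast_pow hA0 (by omega)]
    have : ∀ χ : AddChar F ℂ, ‖expSum ω s (fun _ => 1) c N χ‖ ^ (2 * crit k) ≤ 1 := by
      intro χ
      refine pow_le_one₀ (norm_nonneg _) ?_
      have hcard : (s.filter fun n => (p : ℤ_[p]) ^ N ∣ n - c).card ≤ 1 := by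
        refine Finset.card_le_one.2 fun x hx y hy => ?_
        rw [Finset.mem_filter, hs, Finset.mem_map] at hx hy
        obtain ⟨⟨m, hm, rfl⟩, hmc⟩ := hx
        obtain ⟨⟨n, hn, rfl⟩, hnc⟩ := hy
        simp only [Function.Embedding.coeFn_mk] at hmc hnc ⊢
        have h1 : (p : ℤ_[p]) ^ N ∣ ((m - n : ℤ) : ℤ_[p]) := by
          have := dvd_sub hmc hnc
          rw [sub_sub_sub_cancel_right] at this
          exact_mod_cast this
        have h2 : ((p ^ N : ℕ) : ℤ) ∣ (m : ℤ) - n := by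
          rw [← Ideal.mem_span_singleton, ← PadicInt.ker_toZModPow, RingHom.mem_ker,
            map_intCast] at h1
          exact (ZMod.intCast_zmod_eq_zero_iff_dvd _ _).1 h1
        have hm' := Finset.mem_Icc.1 hm
        have hn' := Finset.mem_Icc.1 hn
        have h3 : (m : ℤ) - n = 0 := by
          refine Int.eq_zero_of_abs_lt_dvd h2 ?_
          rw [abs_lt]; constructor <;> push_cast <;> have : (X : ℤ) ≤ (p : ℤ) ^ N := (by exact_mod_cast hN1) <;> omega
        have : m = n := by omega
        rw [this]
      rw [expSum]
      refine (norm_sum_le _ _).trans ?_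
      calc _ ≤ ∑ n ∈ s.filter (fun n => (p : ℤ_[p]) ^ N ∣ n - c), (1 : ℝ) := by
            refine Finset.sum_le_sum fun n _ => ?_
            rw [one_mul, AddChar.norm_apply]
        _ ≤ 1 := by simpa using hcard
    calc _ ≤ ∑ χ : AddChar F ℂ, (1 : ℝ) := Finset.sum_le_sum fun χ _ => this χ
      _ = A := by simp [hA]
  have main := H N F ω hadm s (fun _ => 1) (fun _ => A ^ ((crit k : ℝ)⁻¹))
    (fun _ => by positivity) hv
  have hAP : A = ((p ^ M : ℕ) : ℝ) ^ k := by
    rw [hA, AddChar.card_eq]; simp [F, ZMod.card]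
  have hb : ∀ b : F, ∑ n ∈ Finset.Icc 1 X,
      (ZMod.stdAddChar (∑ j, b j * (n : ZMod (p ^ M)) ^ (j.1 + 1)) : ℂ) =
      expSum ω s (fun _ => 1) 0 0 (freqChar b) := by
    intro b
    simp [expSum, hs, hω]
    rfl
  calc _ = ∑ b : F, ‖expSum ω s (fun _ => 1) 0 0 (freqChar b)‖ ^ (2 * crit k) := by
        simp only [hb]
        congr!
    _ = ∑ χ ∈ Finset.univ.image (freqChar : F → AddChar F ℂ),
          ‖expSum ω s (fun _ => 1) 0 0 χ‖ ^ (2 * crit k) := by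
        rw [Finset.sum_image fun _ _ _ _ h => freqChar_injective h]
    _ ≤ _ := Finset.sum_le_univ_sum_of_nonneg fun _ => by positivity
    _ ≤ _ := main
    _ = C * ((p : ℝ) ^ N) ^ (crit k + ε) * A := by
        rw [Finset.sum_const, Finset.card_range, nsmul_eq_mul, mul_pow,
          Real.rpow_inv_natCast_pow hA0 (by omega), Nat.cast_pow, Real.rpow_add (by positivity),
          Real.rpow_natCast, mul_comm ε, Real.rpow_mul hp0.le, Real.rpow_natCast]
        ring
    _ ≤ C * ((p : ℝ) * X) ^ (crit k + ε) * A := by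
        gcongr
        exact_mod_cast hN2
    _ = _ := by rw [hAP, Real.mul_rpow (by positivity) (by positivity)]; ring

end Vinogradov

section

open Finset

theorem e_add (s t : ℝ) : e (s + t) = e s * e t := by
  rw [e, e, e, ← Complex.exp_add]; push_cast; ring_nf

theorem e_zero : e 0 = 1 := by simp [e]

theorem norm_e (t : ℝ) : ‖e t‖ = 1 := by
  rw [e, show (2 * Real.pi * Complex.I * t : ℂ) = ((2 * Real.pi * t : ℝ) : ℂ) * Complex.I by
    push_cast; ring]
  exact Complex.norm_exp_ofReal_mul_I _

theorem e_intCast (m : ℤ) : e m = 1 := by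
  rw [e, show (2 * Real.pi * Complex.I * (m : ℝ) : ℂ) = m * (2 * Real.pi * Complex.I) by
    push_cast; ring]
  exact Complex.exp_int_mul_two_pi_mul_I m

theorem e_add_intCast (t : ℝ) (m : ℤ) : e (t + m) = e t := by rw [e_add, e_intCast, mul_one]

theorem e_nat_mul (m : ℕ) (t : ℝ) : e (m * t) = e t ^ m := by
  rw [e, e, ← Complex.exp_nat_mul]; push_cast; ring_nf

theorem stdAddChar_intCast_eq_e {P : ℕ} [NeZero P] (j : ℤ) :
    (ZMod.stdAddChar (j : ZMod P) : ℂ) = e (j / P) := by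
  rw [ZMod.stdAddChar_coe, e]; push_cast; ring_nf

/-- The distance to the nearest integer. -/
noncomputable def distInt (t : ℝ) : ℝ := |t - round t|

theorem distInt_nonneg (t : ℝ) : 0 ≤ distInt t := abs_nonneg _

theorem distInt_le_half (t : ℝ) : distInt t ≤ 1 / 2 := abs_sub_round t

theorem distInt_le (t : ℝ) (m : ℤ) : distInt t ≤ |t - m| := round_le t m

theorem distInt_add_intCast (t : ℝ) (m : ℤ) : distInt (t + m) = distInt t := by
  simp [distInt]

theorem four_mul_distInt_le (t : ℝ) : 4 * distInt t ≤ ‖1 - e t‖ := by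
  set d := t - round t with hd
  have h1 : e t = e d := by
    rw [show t = d + (round t : ℤ) by rw [hd]; ring, e_add_intCast]
  have h2 : ‖1 - e d‖ = 2 * |Real.sin (Real.pi * d)| := by
    have : 1 - e d = -(2 * Complex.I * Complex.sin (Real.pi * d)) * e (d / 2) := by
      have h3 : e d = e (d / 2) * e (d / 2) := by rw [← e_add]; ring_nf
      have h4 : Complex.sin (Real.pi * d) = (e (-(d / 2)) - e (d / 2)) * Complex.I / 2 := by
        rw [Complex.sin, e, e]; push_cast; ring_nf
      rw [h4, h3]
      have h5 : e (-(d / 2)) * e (d / 2) = 1 := by rw [← e_add, neg_add_cancel, e_zero]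
      linear_combination (-1) * h5 +
        (e (-(d / 2)) * e (d / 2) - e (d / 2) * e (d / 2)) * Complex.I_sq
    rw [this, norm_mul, norm_e, mul_one, norm_neg, norm_mul, norm_mul, Complex.norm_I,
      ← Complex.ofReal_mul, ← Complex.ofReal_sin, Complex.norm_real]
    simp
  have h3 : |d| ≤ 1 / 2 := abs_sub_round t
  have h4 : 2 / Real.pi * |Real.pi * d| ≤ |Real.sin (Real.pi * d)| := by
    apply Real.mul_abs_le_abs_sin
    rw [abs_mul, abs_of_pos Real.pi_pos]
    nlinarith [Real.pi_pos]
  rw [h1, h2, distInt, ← hd]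
  rw [abs_mul, abs_of_pos Real.pi_pos] at h4
  have h5 : 2 / Real.pi * (Real.pi * |d|) = 2 * |d| := by field_simp
  linarith

/-- A smooth version of `min H (1 / distInt t)`, which bounds a linear exponential sum with `H`
terms. -/
noncomputable def linBound (H t : ℝ) : ℝ := 2 * H / (1 + H * distInt t)

theorem linBound_nonneg {H : ℝ} (hH : 0 ≤ H) (t : ℝ) : 0 ≤ linBound H t := by
  have := distInt_nonneg t
  unfold linBound; positivity

theorem linBound_le {H : ℝ} (hH : 0 ≤ H) (t : ℝ) : linBound H t ≤ 2 * H := by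
  have := distInt_nonneg t
  exact div_le_self (by positivity) (by nlinarith [mul_nonneg hH this])

theorem linBound_le_div {H t D : ℝ} (hH : 0 ≤ H) (hD : 0 < D) (h : D ≤ distInt t) :
    linBound H t ≤ 2 / D := by
  have h1 : 0 ≤ H * distInt t := mul_nonneg hH (distInt_nonneg t)
  rw [linBound, div_le_div_iff₀ (by linarith) hD]
  nlinarith [mul_le_mul_of_nonneg_left h hH]

theorem linBound_add_intCast (H t : ℝ) (m : ℤ) : linBound H (t + m) = linBound H t := by
  rw [linBound, distInt_add_intCast, linBound]

theorem norm_sum_e_le (H : ℕ) (t : ℝ) : ‖∑ i ∈ Finset.range H, e (i * t)‖ ≤ linBound H t := by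
  set S := ∑ i ∈ Finset.range H, e (i * t) with hS
  have h1 : ‖S‖ ≤ H := by
    refine (norm_sum_le _ _).trans (by simp [norm_e])
  have h2 : (1 - e t) * S = 1 - e t ^ H := by
    rw [hS]; simp only [e_nat_mul]; exact mul_neg_geom_sum (e t) H
  have h3 : ‖1 - e t‖ * ‖S‖ ≤ 2 := by
    rw [← norm_mul, h2]
    refine (norm_sub_le _ _).trans ?_
    rw [norm_pow, norm_e]; norm_num
  have h4 := mul_le_mul_of_nonneg_right (four_mul_distInt_le t) (norm_nonneg S)
  have h0 := distInt_nonneg t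
  have hH : (0 : ℝ) ≤ H := H.cast_nonneg
  rw [linBound, le_div_iff₀ (by positivity)]
  nlinarith [mul_le_mul_of_nonneg_left (h4.trans h3) hH]

theorem norm_sum_Icc_e_le (a b : ℤ) (t : ℝ) (H : ℝ) (hH : (b - a + 1 : ℤ) ≤ H) (h0 : 0 ≤ H) :
    ‖∑ i ∈ Finset.Icc a b, e (i * t)‖ ≤ linBound H t := by
  have h1 : ∑ i ∈ Finset.Icc a b, e (i * t)
      = e (a * t) * ∑ i ∈ Finset.range (b - a + 1).toNat, e (i * t) := by
    rw [Finset.mul_sum]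
    symm
    refine Finset.sum_bij (fun i _ => a + i) ?_ ?_ ?_ ?_
    · intro i hi; simp at hi ⊢; omega
    · intro i _ j _ h; simpa using h
    · intro i hi
      simp at hi
      exact ⟨(i - a).toNat, by simp; omega, by omega⟩
    · intro i _
      rw [← e_add]; push_cast; ring_nf
  rw [h1, norm_mul, norm_e, one_mul]
  refine (norm_sum_e_le _ t).trans ?_
  have h2 : (((b - a + 1).toNat : ℕ) : ℝ) ≤ H := by
    rcases le_total 0 (b - a + 1) with h | h
    · have : (((b - a + 1).toNat : ℕ) : ℤ) = b - a + 1 := Int.toNat_of_nonneg h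
      calc (((b - a + 1).toNat : ℕ) : ℝ) = ((((b - a + 1).toNat : ℕ) : ℤ) : ℝ) := by push_cast; rfl
        _ ≤ H := by rw [this]; exact hH
    · rw [Int.toNat_of_nonpos h]; simpa using h0
  have hd := distInt_nonneg t
  have hn : (0 : ℝ) ≤ (((b - a + 1).toNat : ℕ) : ℝ) := Nat.cast_nonneg _
  rw [linBound, linBound, div_le_div_iff₀ (by positivity) (by positivity)]
  nlinarith

/-- The contribution of the points at index distance `i` in a block of `q` points. -/
noncomputable def blockWeight (H : ℝ) (q i : ℕ) : ℝ := if i ≤ 2 then 2 * H else 2 * q / (i - 2)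

theorem blockWeight_nonneg {H : ℝ} (hH : 0 ≤ H) (q i : ℕ) : 0 ≤ blockWeight H q i := by
  unfold blockWeight
  split_ifs with h
  · linarith
  · have : (2 : ℝ) ≤ i := by exact_mod_cast (by omega : 2 ≤ i)
    exact div_nonneg (by positivity) (by linarith)

theorem sum_blockWeight_le {H : ℝ} (hH : 0 ≤ H) (q : ℕ) (hq : 1 ≤ q) :
    ∑ i ∈ Finset.range (q + 1), blockWeight H q i ≤ 6 * H + 2 * q * (1 + Real.log q) := by
  have h1 : ∑ i ∈ Finset.range (q + 1), blockWeight H q i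
      ≤ ∑ i ∈ Finset.range (3 + q), blockWeight H q i :=
    Finset.sum_le_sum_of_subset_of_nonneg (by intro i; simp; omega)
      fun i _ _ => blockWeight_nonneg hH q i
  refine h1.trans ?_
  rw [Finset.sum_range_add]
  have h2 : ∑ i ∈ Finset.range 3, blockWeight H q i = 6 * H := by
    simp [Finset.sum_range_succ, blockWeight]; ring
  have h3 : ∑ i ∈ Finset.range q, blockWeight H q (3 + i) = 2 * q * (harmonic q : ℝ) := by
    rw [harmonic]; push_cast; rw [Finset.mul_sum]
    refine Finset.sum_congr rfl fun i _ => ?_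
    rw [blockWeight, if_neg (by omega)]; push_cast
    rw [show (3 + (i : ℝ) - 2) = i + 1 by ring]; rfl
  rw [h2, h3]
  gcongr
  exact harmonic_le_one_add_log q

theorem sum_linBound_block_le {H : ℝ} (hH : 0 ≤ H) (q : ℕ) (hq : 1 ≤ q) (a : ℤ)
    (ha : IsCoprime a (q : ℤ)) (α θ : ℝ) (h : |α - a / q| ≤ 1 / (q : ℝ) ^ 2) :
    ∑ z ∈ Finset.range q, linBound H (θ + z * α) ≤ 12 * H + 4 * q * (1 + Real.log q) := by
  have hq0 : (0 : ℝ) < q := by exact_mod_cast hq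
  set m := ⌊q * θ⌋ with hm
  let u : ℕ → ℕ := fun z => ((z * a + m) % q).toNat
  have hu : ∀ z, ((u z : ℕ) : ℤ) = (z * a + m) % q := fun z =>
    Int.toNat_of_nonneg (Int.emod_nonneg _ (by omega))
  have hlt : ∀ z, u z < q := fun z => by
    have := Int.emod_lt_of_pos (z * a + m) (show (0 : ℤ) < q by omega)
    rw [← hu] at this; omega
  have hmain : ∀ z ∈ Finset.range q, linBound H (θ + z * α)
      ≤ blockWeight H q (u z) + blockWeight H q (q - u z) := by
    intro z hz
    have hzq : (z : ℝ) + 1 ≤ q := by exact_mod_cast Finset.mem_range.mp hz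
    set η := q * θ - m + q * (z * (α - a / q)) with hη
    have hη1 : |q * (z * (α - a / q))| ≤ 1 := by
      rw [abs_mul, abs_mul, abs_of_pos hq0, abs_of_nonneg (Nat.cast_nonneg z)]
      have hzq' : (z : ℝ) ≤ q := by linarith
      calc q * (z * |α - a / q|) ≤ q * (q * (1 / (q : ℝ) ^ 2)) := by gcongr
        _ = 1 := by field_simp
    have hη2 := abs_le.mp hη1
    have hf1 : (m : ℝ) ≤ q * θ := Int.floor_le _
    have hf2 : q * θ < m + 1 := Int.lt_floor_add_one _
    obtain ⟨w, hw⟩ : ∃ w : ℤ, (z * a + m : ℤ) = u z + q * w :=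
      ⟨(z * a + m) / q, by rw [hu]; exact (Int.emod_add_mul_ediv _ _).symm⟩
    have hw' : (z * a + m : ℝ) = u z + q * w := by exact_mod_cast hw
    have ht : θ + z * α = (u z + η) / q + w := by
      rw [eq_comm, div_add' _ _ _ hq0.ne', div_eq_iff hq0.ne', hη]
      have : (q : ℝ) * (z * (α - a / q)) = q * z * α - z * a := by field_simp
      rw [this]; linear_combination -hw'
    rw [ht, linBound_add_intCast]
    have hule : (u z : ℝ) ≤ q := by exact_mod_cast (hlt z).le
    have hb1 := blockWeight_nonneg hH q (u z)
    have hb2 := blockWeight_nonneg hH q (q - u z)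
    rcases le_or_gt (round ((u z + η) / q)) 0 with hr | hr
    · refine le_trans ?_ (le_add_of_nonneg_right hb2)
      unfold blockWeight
      split_ifs with h2
      · exact linBound_le hH _
      have h3 : (3 : ℝ) ≤ u z := by exact_mod_cast (by omega : 3 ≤ u z)
      have h4 : ((u z : ℝ) - 2) / q ≤ distInt ((u z + η) / q) := by
        refine le_trans ?_ (le_abs_self _)
        have : ((round ((u z + η) / q) : ℤ) : ℝ) ≤ 0 := by exact_mod_cast hr
        have h5 : ((u z : ℝ) - 2) / q ≤ (u z + η) / q := by gcongr; linarith
        linarith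
      refine (linBound_le_div hH (by apply div_pos <;> linarith) h4).trans (le_of_eq ?_)
      field_simp
    · refine le_trans ?_ (le_add_of_nonneg_left hb1)
      unfold blockWeight
      split_ifs with h2
      · exact linBound_le hH _
      rw [Nat.cast_sub (hlt z).le]
      have h3 : (3 : ℝ) ≤ q - u z := by
        rw [← Nat.cast_sub (hlt z).le]; exact_mod_cast (by omega : 3 ≤ q - u z)
      have h4 : ((q - u z : ℝ) - 2) / q ≤ distInt ((u z + η) / q) := by
        refine le_trans ?_ (neg_le_abs _)
        have : (1 : ℝ) ≤ ((round ((u z + η) / q) : ℤ) : ℝ) := by exact_mod_cast hr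
        have h5 : ((q - u z : ℝ) - 2) / q ≤ (q - (u z + η)) / q :=
          div_le_div_of_nonneg_right (by linarith) hq0.le
        rw [sub_div (q : ℝ) (u z + η), div_self hq0.ne'] at h5
        linarith
      refine (linBound_le_div hH (by apply div_pos <;> linarith) h4).trans (le_of_eq ?_)
      field_simp
  have hinj : Set.InjOn u (Finset.range q) := by
    intro z hz z' hz' hzz
    have h1 : ((z * a + m) % q : ℤ) = (z' * a + m) % q := by rw [← hu, ← hu, hzz]
    have h2 : (q : ℤ) ∣ (z - z') * a := by
      have h4 := Int.emod_eq_emod_iff_emod_sub_eq_zero.mp h1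
      have h5 := Int.dvd_of_emod_eq_zero h4
      rwa [show (z * a + m - (z' * a + m) : ℤ) = (z - z') * a by ring] at h5
    have h3 : (q : ℤ) ∣ z - z' := ha.symm.dvd_of_dvd_mul_right h2
    simp at hz hz'
    obtain ⟨c, hc⟩ := h3
    have h4 : c = 0 := by nlinarith
    subst h4; omega
  have himg : (Finset.range q).image u = Finset.range q := by
    apply Finset.eq_of_subset_of_card_le
    · intro i hi
      obtain ⟨z, -, rfl⟩ := Finset.mem_image.mp hi
      exact Finset.mem_range.mpr (hlt z)
    · rw [Finset.card_image_of_injOn hinj]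
  have hs1 : ∑ z ∈ Finset.range q, blockWeight H q (u z)
      ≤ ∑ i ∈ Finset.range (q + 1), blockWeight H q i := by
    rw [← Finset.sum_image (f := blockWeight H q) hinj, himg]
    exact Finset.sum_le_sum_of_subset_of_nonneg (by intro i; simp; omega)
      fun i _ _ => blockWeight_nonneg hH q i
  have hs2 : ∑ z ∈ Finset.range q, blockWeight H q (q - u z)
      ≤ ∑ i ∈ Finset.range (q + 1), blockWeight H q i := by
    rw [← Finset.sum_image (f := fun i => blockWeight H q (q - i)) hinj, himg,
      ← Finset.sum_range_reflect _ (q + 1)]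
    simp only [Nat.add_sub_cancel]
    exact Finset.sum_le_sum_of_subset_of_nonneg (by intro i; simp; omega)
      fun i _ _ => blockWeight_nonneg hH q _
  have hs3 := sum_blockWeight_le hH q hq
  calc _ ≤ ∑ z ∈ Finset.range q, (blockWeight H q (u z) + blockWeight H q (q - u z)) :=
        Finset.sum_le_sum hmain
    _ ≤ _ := by rw [Finset.sum_add_distrib]; linarith

theorem sum_linBound_le {H : ℝ} (hH : 0 ≤ H) (q : ℕ) (hq : 1 ≤ q) (a : ℤ)
    (ha : IsCoprime a (q : ℤ)) (α θ : ℝ) (h : |α - a / q| ≤ 1 / (q : ℝ) ^ 2) (Z : ℕ) :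
    ∑ z ∈ Finset.range Z, linBound H (θ + z * α)
      ≤ (Z / q + 1) * (12 * H + 4 * q * (1 + Real.log q)) := by
  have hq0 : (0 : ℝ) < q := by exact_mod_cast hq
  have hlog : 0 ≤ Real.log q := Real.log_nonneg (by exact_mod_cast hq)
  have hblocks : ∀ t : ℕ, ∑ z ∈ Finset.range (t * q), linBound H (θ + z * α)
      ≤ t * (12 * H + 4 * q * (1 + Real.log q)) := by
    intro t
    induction t with
    | zero => simp
    | succ t ih =>
      rw [add_mul, one_mul, Finset.sum_range_add]
      have := sum_linBound_block_le hH q hq a ha α (θ + (t * q : ℕ) * α) h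
      have h2 : ∑ z ∈ Finset.range q, linBound H (θ + ((t * q + z : ℕ) : ℝ) * α)
          = ∑ z ∈ Finset.range q, linBound H (θ + (t * q : ℕ) * α + z * α) := by
        refine Finset.sum_congr rfl fun z _ => ?_
        push_cast; ring_nf
      rw [h2]; push_cast at *; linarith
  calc _ ≤ ∑ z ∈ Finset.range ((Z / q + 1) * q), linBound H (θ + z * α) :=
        Finset.sum_le_sum_of_subset_of_nonneg
          (Finset.range_subset_range.mpr (by
            have := Nat.lt_div_mul_add (a := Z) (b := q) hq; nlinarith))
          fun i _ _ => linBound_nonneg hH _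
    _ ≤ _ := hblocks _
    _ ≤ _ := by
      have : ((Z / q : ℕ) : ℝ) ≤ Z / q := Nat.cast_div_le
      push_cast; gcongr

section

variable {P : ℕ}

/-- The action on coefficient vectors of the substitution `n ↦ n - z`. -/
def shiftMatrix (k : ℕ) (z : ZMod P) : Matrix (Fin k) (Fin k) (ZMod P) := fun j i =>
  (-z) ^ (i.1 - j.1) * ((i.1 + 1).choose (j.1 + 1) : ZMod P)

theorem shiftMatrix_mulVec_bijective [NeZero P] (k : ℕ) (z : ZMod P) :
    Function.Bijective (shiftMatrix k z).mulVec := by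
  have hdet : (shiftMatrix k z).det = 1 := by
    rw [Matrix.det_of_isUpperTriangular]
    · simp [shiftMatrix]
    · intro i j hij
      simp only [id] at hij
      rw [shiftMatrix, Nat.choose_eq_zero_of_lt (by omega)]; simp
  have hu : IsUnit (shiftMatrix k z) := (Matrix.isUnit_iff_isUnit_det _).mpr (by rw [hdet]; simp)
  exact (Finite.injective_iff_bijective).mp (Matrix.mulVec_injective_of_isUnit hu)

theorem sum_shiftMatrix_mulVec {k : ℕ} (z : ZMod P) (c : Fin k → ZMod P) (n : ZMod P) :
    ∑ j, (shiftMatrix k z).mulVec c j * n ^ (j.1 + 1)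
      = ∑ i, c i * (n - z) ^ (i.1 + 1) - ∑ i, c i * (-z) ^ (i.1 + 1) := by
  have h : ∀ i : Fin k, ∑ j : Fin k, shiftMatrix k z j i * n ^ (j.1 + 1)
      = (n - z) ^ (i.1 + 1) - (-z) ^ (i.1 + 1) := by
    intro i
    rw [sub_eq_add_neg n z, add_pow, sum_range_succ']
    simp only [pow_zero, one_mul, Nat.sub_zero, Nat.choose_zero_right, Nat.cast_one, mul_one,
      add_sub_cancel_right]
    simp only [shiftMatrix]
    rw [Fin.sum_univ_eq_sum_range (fun j => (-z) ^ (i.1 - j) *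
      ((i.1 + 1).choose (j + 1) : ZMod P) * n ^ (j + 1)) k]
    symm
    rw [← sum_subset (range_subset_range.mpr (show i.1 + 1 ≤ k by omega))]
    · refine sum_congr rfl fun j _ => ?_
      rw [Nat.add_sub_add_right]; ring
    · intro j _ hj
      rw [Nat.choose_eq_zero_of_lt (by simp at hj; omega)]; simp
  simp only [Matrix.mulVec, dotProduct, sum_mul]
  rw [sum_comm, ← sum_sub_distrib]
  refine sum_congr rfl fun i _ => ?_
  rw [← mul_sub, ← h i, mul_sum]
  exact sum_congr rfl fun j _ => by ring

theorem shiftMatrix_mulVec_last {m : ℕ} (z : ZMod P) (c : Fin (m + 2) → ZMod P) :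
    (shiftMatrix (m + 2) z).mulVec c (Fin.last (m + 1)) = c (Fin.last (m + 1)) := by
  simp only [Matrix.mulVec, dotProduct, shiftMatrix]
  rw [Fin.sum_univ_castSucc]
  simp only [Fin.val_last, Fin.val_castSucc]
  rw [sum_eq_zero fun i _ => by rw [Nat.choose_eq_zero_of_lt (by omega)]; simp]
  simp

theorem shiftMatrix_mulVec_penultimate {m : ℕ} (z : ZMod P) (c : Fin (m + 2) → ZMod P) :
    (shiftMatrix (m + 2) z).mulVec c (Fin.last m).castSucc
      = c (Fin.last m).castSucc - (m + 2) * z * c (Fin.last (m + 1)) := by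
  simp only [Matrix.mulVec, dotProduct, shiftMatrix]
  rw [Fin.sum_univ_castSucc, Fin.sum_univ_castSucc]
  simp only [Fin.val_last, Fin.val_castSucc]
  rw [sum_eq_zero fun i _ => by rw [Nat.choose_eq_zero_of_lt (by omega)]; simp]
  rw [Nat.choose_self, Nat.choose_succ_self_right]
  simp
  ring

variable [NeZero P]

local notation "ψ" => (ZMod.stdAddChar : AddChar (ZMod _) ℂ)

theorem conj_stdAddChar (a : ZMod P) : (starRingEnd ℂ) (ψ a) = ψ (-a) := by
  rw [AddChar.map_neg_eq_conj]

theorem norm_stdAddChar (a : ZMod P) : ‖(ψ a : ℂ)‖ = 1 := AddChar.norm_apply _ _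

theorem sum_stdAddChar_mul (b : ZMod P) :
    ∑ a : ZMod P, (ψ (a * b) : ℂ) = if b = 0 then (P : ℂ) else 0 := by
  have := AddChar.sum_mulShift b (ZMod.isPrimitive_stdAddChar P)
  simpa [ZMod.card] using this

theorem stdAddChar_sum {ι : Type*} (s : Finset ι) (g : ι → ZMod P) :
    (ψ (∑ i ∈ s, g i) : ℂ) = ∏ i ∈ s, ψ (g i) := by
  classical
  induction s using Finset.induction_on with
  | empty => simp
  | insert i s hi ih => rw [sum_insert hi, prod_insert hi, AddChar.map_add_eq_mul, ih]

theorem sum_pow_stdAddChar {r : ℕ} (s : Finset ℕ) (g : ℕ → ZMod P) :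
    (∑ n ∈ s, (ψ (g n) : ℂ)) ^ r
      = ∑ x ∈ Fintype.piFinset (fun _ : Fin r => s), ψ (∑ i, g (x i)) := by
  rw [Finset.sum_pow']
  exact sum_congr rfl fun x _ => (stdAddChar_sum _ _).symm

/-- Expansion of an even moment. -/
theorem norm_pow_two_mul_eq {r : ℕ} (s : Finset ℕ) (g : ℕ → ZMod P) :
    ((‖∑ n ∈ s, (ψ (g n) : ℂ)‖ ^ (2 * r) : ℝ) : ℂ)
      = ∑ x ∈ Fintype.piFinset (fun _ : Fin r => s), ∑ y ∈ Fintype.piFinset (fun _ : Fin r => s),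
          ψ (∑ i, g (x i) - ∑ i, g (y i)) := by
  push_cast
  rw [pow_mul, ← Complex.mul_conj', mul_pow, map_sum]
  simp only [conj_stdAddChar]
  rw [sum_pow_stdAddChar, sum_pow_stdAddChar s (fun n => -g n), sum_mul_sum]
  refine sum_congr rfl fun x _ => sum_congr rfl fun y _ => ?_
  rw [← AddChar.map_add_eq_mul, sum_neg_distrib, sub_eq_add_neg]

/-- The Dirichlet kernel mod `P`. -/
noncomputable def dirKer (H : ℕ) (θ : ZMod P) : ℂ :=
  ∑ h ∈ Icc (-(H : ℤ)) H, ψ (θ * (h : ZMod P))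

theorem sum_stdAddChar_mul_dirKer {H : ℕ} (hH : 2 * H < P) (s : ℤ) (hs : |s| ≤ H) :
    ∑ θ : ZMod P, (ψ (θ * (s : ZMod P)) : ℂ) * dirKer H θ = P := by
  simp only [dirKer, mul_sum, ← AddChar.map_add_eq_mul, ← mul_add]
  rw [sum_comm]
  simp only [sum_stdAddChar_mul]
  rw [sum_eq_single (-s)]
  · simp
  · intro h hh hne
    rw [if_neg]
    intro h0
    have h1 : ((s + h : ℤ) : ZMod P) = 0 := by exact_mod_cast h0
    rw [ZMod.intCast_zmod_eq_zero_iff_dvd] at h1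
    have h2 : s + h = 0 := by
      apply Int.eq_zero_of_abs_lt_dvd h1
      rw [mem_Icc] at hh
      rw [abs_le] at hs
      rw [abs_lt]; constructor <;> omega
    omega
  · intro h
    rw [abs_le] at hs
    exact absurd (mem_Icc.mpr ⟨by omega, by omega⟩) h

theorem linBound_val (H : ℝ) (N : ℤ) :
    linBound H (((N : ZMod P).val : ℝ) / P) = linBound H (N / P) := by
  have hP : (P : ℝ) ≠ 0 := by exact_mod_cast NeZero.ne P
  have h1 : (((N : ZMod P).val : ℕ) : ℤ) = N % P := ZMod.val_intCast N
  have h2 : (((N : ZMod P).val : ℕ) : ℝ) = N - P * (N / P : ℤ) := by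
    have : (((N : ZMod P).val : ℕ) : ℤ) = N - P * (N / P) := by rw [h1, Int.emod_def]
    exact_mod_cast this
  have h3 : (N : ℝ) / P = ((N : ZMod P).val : ℝ) / P + (N / P : ℤ) := by
    rw [h2]; field_simp; ring
  rw [h3, linBound_add_intCast]

theorem norm_sum_stdAddChar_Icc_le (a b : ℤ) (θ : ZMod P) (H : ℝ) (hH : (b - a + 1 : ℤ) ≤ H)
    (h0 : 0 ≤ H) : ‖∑ h ∈ Icc a b, (ψ (θ * (h : ZMod P)) : ℂ)‖ ≤ linBound H (θ.val / P) := by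
  refine le_of_eq_of_le ?_ (norm_sum_Icc_e_le a b (θ.val / P) H hH h0)
  congr 1
  refine sum_congr rfl fun h _ => ?_
  have := stdAddChar_intCast_eq_e (P := P) (θ.val * h)
  push_cast at this
  rw [ZMod.natCast_zmod_val] at this
  rw [this]; ring_nf

theorem norm_dirKer_le (H : ℕ) (θ : ZMod P) :
    ‖dirKer H θ‖ ≤ linBound (2 * H + 1) (θ.val / P) :=
  norm_sum_stdAddChar_Icc_le _ _ θ _ (by push_cast; linarith) (by positivity)

theorem norm_dirKer_le_card (H : ℕ) (θ : ZMod P) : ‖dirKer H θ‖ ≤ 2 * H + 1 := by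
  refine (norm_sum_le _ _).trans ?_
  simp only [norm_stdAddChar, sum_const, Int.card_Icc, nsmul_eq_mul, mul_one]
  have : (((H : ℤ) + 1 - -(H : ℤ)).toNat : ℕ) = 2 * H + 1 := by omega
  rw [this]; push_cast; rfl

/-- The Vinogradov polynomial sum over `I`. -/
noncomputable def vinoSum {k : ℕ} (I : Finset ℕ) (c : Fin k → ZMod P) : ℂ :=
  ∑ n ∈ I, ψ (∑ j, c j * (n : ZMod P) ^ (j.1 + 1))

/-- The Waring sum, `∑_{x ≤ X} ψ(a x^k)`. -/
noncomputable def waringSum (k X : ℕ) (a : ZMod P) : ℂ := ∑ n ∈ Icc 1 X, ψ (a * (n : ZMod P) ^ k)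

theorem prod_dirKer_moment {m r X : ℕ} (hP : 2 * (r * X ^ (m + 1)) < P) (hX : 1 ≤ X)
    (a : ZMod P) :
    ∑ c : Fin (m + 1) → ZMod P,
        ((‖vinoSum (Icc 1 X) (Fin.snoc c a : Fin (m + 2) → ZMod P)‖ ^ (2 * r) : ℝ) : ℂ) *
          ∏ j, dirKer (r * X ^ (j.1 + 1)) (c j)
      = (P : ℂ) ^ (m + 1) * ((‖waringSum (m + 2) X a‖ ^ (2 * r) : ℝ) : ℂ) := by
  simp only [vinoSum, waringSum, norm_pow_two_mul_eq, sum_mul]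
  rw [sum_comm, mul_sum]
  refine sum_congr rfl fun x hx => ?_
  rw [sum_comm, mul_sum]
  refine sum_congr rfl fun y hy => ?_
  rw [Fintype.mem_piFinset] at hx hy
  set s : ℕ → ℤ := fun j => ∑ i, (x i : ℤ) ^ (j + 1) - ∑ i, (y i : ℤ) ^ (j + 1) with hs
  have hs1 : ∀ j : Fin (m + 1), |s j| ≤ (r * X ^ (j.1 + 1) : ℕ) := by
    intro j
    have hb : ∀ x : Fin r → ℕ, (∀ i, x i ∈ Icc 1 X) →
        ∑ i, (x i : ℤ) ^ (j.1 + 1) ≤ (r * X ^ (j.1 + 1) : ℕ) ∧ 0 ≤ ∑ i, (x i : ℤ) ^ (j.1 + 1) := by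
      intro x hx
      constructor
      · calc ∑ i, (x i : ℤ) ^ (j.1 + 1) ≤ ∑ _i : Fin r, (X : ℤ) ^ (j.1 + 1) := by
              refine sum_le_sum fun i _ => ?_
              have := (mem_Icc.mp (hx i)).2
              gcongr
          _ = _ := by simp
      · positivity
    have h1 := hb x hx
    have h2 := hb y hy
    rw [abs_le]; simp only [hs]
    constructor <;> linarith [h1.1, h1.2, h2.1, h2.2]
  have hexp : ∀ c : Fin (m + 1) → ZMod P,
      (ψ (∑ i, ∑ j, (Fin.snoc c a : Fin (m + 2) → ZMod P) j * (x i : ZMod P) ^ (j.1 + 1)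
        - ∑ i, ∑ j, (Fin.snoc c a : Fin (m + 2) → ZMod P) j * (y i : ZMod P) ^ (j.1 + 1)) : ℂ)
      = (∏ j : Fin (m + 1), ψ (c j * (s j : ZMod P))) *
        ψ (∑ i, a * (x i : ZMod P) ^ (m + 2) - ∑ i, a * (y i : ZMod P) ^ (m + 2)) := by
    intro c
    rw [← stdAddChar_sum, ← AddChar.map_add_eq_mul]
    congr 1
    simp only [Fin.sum_univ_castSucc (n := m + 1), Fin.snoc_castSucc, Fin.snoc_last,
      Fin.val_castSucc, Fin.val_last, sum_add_distrib, hs]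
    push_cast
    simp only [mul_sub, mul_sum, sum_sub_distrib]
    rw [sum_comm (t := (univ : Finset (Fin (m + 1)))),
      sum_comm (t := (univ : Finset (Fin (m + 1))))]
    ring
  simp only [hexp]
  have hprod : ∑ c : Fin (m + 1) → ZMod P,
      (∏ j : Fin (m + 1), (ψ (c j * (s j : ZMod P)) : ℂ) * dirKer (r * X ^ (j.1 + 1)) (c j))
      = (P : ℂ) ^ (m + 1) := by
    rw [← Fintype.prod_sum (fun (j : Fin (m + 1)) (θ : ZMod P) =>
      (ψ (θ * (s j : ZMod P)) : ℂ) * dirKer (r * X ^ (j.1 + 1)) θ)]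
    have : ∀ j : Fin (m + 1), ∑ θ : ZMod P, (ψ (θ * (s j : ZMod P)) : ℂ) *
        dirKer (r * X ^ (j.1 + 1)) θ = P := by
      intro j
      refine sum_stdAddChar_mul_dirKer (lt_of_le_of_lt ?_ hP) (s j) (hs1 j)
      have : X ^ (j.1 + 1) ≤ X ^ (m + 1) := Nat.pow_le_pow_right hX (by omega)
      gcongr
    simp [this]
  rw [← hprod, sum_mul]
  refine sum_congr rfl fun c _ => ?_
  rw [prod_mul_distrib]; ring

theorem norm_vinoSum_shift {k X : ℕ} (z : ℕ) (c : Fin k → ZMod P) :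
    ‖vinoSum (Icc (z + 1) (z + X)) ((shiftMatrix k (z : ZMod P)).mulVec c)‖
      = ‖vinoSum (Icc 1 X) c‖ := by
  have h : vinoSum (Icc (z + 1) (z + X)) ((shiftMatrix k (z : ZMod P)).mulVec c)
      = ψ (-∑ i, c i * (-(z : ZMod P)) ^ (i.1 + 1)) * vinoSum (Icc 1 X) c := by
    simp only [vinoSum, sum_shiftMatrix_mulVec, mul_sum]
    rw [show Icc (z + 1) (z + X) = (Icc 1 X).image (z + ·) by rw [image_add_left_Icc],
      sum_image fun x _ y _ h => by simpa using h]
    refine sum_congr rfl fun n _ => ?_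
    rw [← AddChar.map_add_eq_mul]
    push_cast
    rw [add_sub_cancel_left, sub_eq_neg_add]
  rw [h, norm_mul, norm_stdAddChar, one_mul]

/-- Fourier coefficients of the indicator of `I` mod `P`. -/
noncomputable def windowCoeff (I : Finset ℕ) (u : ZMod P) : ℂ :=
  (P : ℂ)⁻¹ * ∑ l ∈ I, ψ (u * (-(l : ZMod P)))

theorem vinoSum_window {k : ℕ} {I J : Finset ℕ} (hIJ : I ⊆ J) (hJ : ∀ n ∈ J, n < P)
    (c : Fin (k + 1) → ZMod P) :
    vinoSum I c = ∑ u : ZMod P, windowCoeff I u * vinoSum J (c + Pi.single 0 u) := by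
  have hP : (P : ℂ) ≠ 0 := by exact_mod_cast NeZero.ne P
  have h1 : ∀ u : ZMod P, vinoSum J (c + Pi.single 0 u)
      = ∑ n ∈ J, ψ (u * (n : ZMod P)) * ψ (∑ j, c j * (n : ZMod P) ^ (j.1 + 1)) := by
    intro u
    refine sum_congr rfl fun n _ => ?_
    rw [← AddChar.map_add_eq_mul]
    congr 1
    simp only [Pi.add_apply, add_mul, sum_add_distrib]
    rw [add_comm]
    congr 1
    rw [sum_eq_single 0 (fun j _ hj => by simp [Pi.single_eq_of_ne hj]) (by simp)]
    simp
  have h2 : ∀ n ∈ J, ∑ u : ZMod P, windowCoeff I u * (ψ (u * (n : ZMod P)) : ℂ) = if n ∈ I then 1 else 0 := by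
    intro n hn
    simp only [windowCoeff, mul_assoc, sum_mul, ← mul_sum]
    rw [sum_comm]
    simp only [← AddChar.map_add_eq_mul, ← mul_add, sum_stdAddChar_mul]
    have h3 : ∀ l ∈ I, (if -(l : ZMod P) + n = 0 then (P : ℂ) else 0)
        = if l = n then (P : ℂ) else 0 := by
      intro l hl
      congr 1
      rw [neg_add_eq_zero, ZMod.natCast_eq_natCast_iff']
      rw [Nat.mod_eq_of_lt (hJ l (hIJ hl)), Nat.mod_eq_of_lt (hJ n hn)]
    rw [sum_congr rfl h3, sum_ite_eq' I n]
    split_ifs <;> simp [hP]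
  simp only [h1, mul_sum, ← mul_assoc]
  rw [sum_comm]
  simp only [← sum_mul]
  rw [sum_congr rfl fun n hn => by rw [h2 n hn]]
  simp only [ite_mul, one_mul, zero_mul]
  rw [← sum_filter, filter_mem_eq_inter, inter_eq_right.mpr hIJ]
  rfl

theorem norm_windowCoeff_le (z X : ℕ) (u : ZMod P) :
    ‖windowCoeff (Icc (z + 1) (z + X)) u‖ ≤ (P : ℝ)⁻¹ * linBound X (u.val / P) := by
  rw [windowCoeff, norm_mul, norm_inv, Complex.norm_natCast]
  gcongr
  rw [← norm_star]
  simp only [Complex.star_def, map_sum, conj_stdAddChar, mul_neg, neg_neg]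
  refine le_of_eq_of_le ?_
    (norm_sum_stdAddChar_Icc_le (z + 1 : ℤ) (z + X) u X (by push_cast; linarith) (by positivity))
  congr 1
  refine sum_bij (fun l _ => (l : ℤ)) ?_ ?_ ?_ ?_
  · intro l hl; simp at hl ⊢; omega
  · intro i _ j _ h; simpa using h
  · intro l hl
    simp at hl
    exact ⟨l.toNat, by simp; omega, by omega⟩
  · intro l _; simp

theorem sum_val_eq_sum_range {M : Type*} [AddCommMonoid M] (g : ℕ → M) :
    ∑ u : ZMod P, g u.val = ∑ i ∈ range P, g i := by
  refine sum_bij (fun u _ => u.val) ?_ ?_ ?_ ?_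
  · intro u _; exact mem_range.mpr (ZMod.val_lt u)
  · intro u _ v _ h; exact ZMod.val_injective P h
  · intro i hi
    exact ⟨i, mem_univ _, ZMod.val_natCast_of_lt (mem_range.mp hi)⟩
  · intro u _; rfl

theorem sum_windowWeight_le (X : ℕ) (hX : X ≤ P) :
    ∑ u : ZMod P, (P : ℝ)⁻¹ * linBound X (u.val / P) ≤ 32 * (1 + Real.log P) := by
  have hP : 1 ≤ P := Nat.one_le_iff_ne_zero.mpr (NeZero.ne P)
  have hP0 : (0 : ℝ) < P := by exact_mod_cast hP
  have hlog : 0 ≤ Real.log P := Real.log_nonneg (by exact_mod_cast hP)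
  have h := sum_linBound_le (H := X) (by positivity) P hP 1 (isCoprime_one_left) (1 / P) 0
    (by simp) P
  rw [div_self hP0.ne'] at h
  rw [← mul_sum, sum_val_eq_sum_range (fun i => linBound X ((i : ℝ) / P)),
    inv_mul_le_iff₀ hP0]
  simp only [zero_add, mul_one_div] at h
  have hX' : (X : ℝ) ≤ P := by exact_mod_cast hX
  nlinarith [mul_nonneg hP0.le hlog]

/-- Moving the window of summation: the shift `n ↦ n - z` combined with completion. -/
theorem sum_vinoSum_mul_le {m q X : ℕ} (hm : 1 ≤ m) (hq : 1 ≤ q) (hP : 2 * X < P) (z : ℕ)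
    (hz : z < X) {W : ℝ}
    (hW : ∑ u : ZMod P, (P : ℝ)⁻¹ * linBound X (u.val / P) ≤ W)
    (A : Finset (ZMod P)) (L : ZMod P → ℝ) (hL : ∀ θ, 0 ≤ L θ) :
    ∑ c : Fin (m + 2) → ZMod P, ‖vinoSum (Icc 1 X) c‖ ^ q *
        (if c (Fin.last (m + 1)) ∈ A then L (c (Fin.last m).castSucc) else 0)
      ≤ W ^ q * ∑ c : Fin (m + 2) → ZMod P, ‖vinoSum (Icc 1 (2 * X)) c‖ ^ q *
        (if c (Fin.last (m + 1)) ∈ A then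
          L (c (Fin.last m).castSucc + z * ((m + 2) * c (Fin.last (m + 1)))) else 0) := by
  set w : ZMod P → ℝ := fun u => (P : ℝ)⁻¹ * linBound X (u.val / P) with hw
  have hw0 : ∀ u, 0 ≤ w u := fun u =>
    mul_nonneg (by positivity) (linBound_nonneg (Nat.cast_nonneg X) _)
  set Λ : (Fin (m + 2) → ZMod P) → ℝ := fun c => if c (Fin.last (m + 1)) ∈ A then
          L (c (Fin.last m).castSucc + z * ((m + 2) * c (Fin.last (m + 1)))) else 0 with hΛ
  have hΛ0 : ∀ c, 0 ≤ Λ c := fun c => by simp only [hΛ]; split_ifs; exacts [hL _, le_rfl]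
  have hW0 : 0 ≤ W := (sum_nonneg fun u _ => hw0 u).trans hW
  set G : (Fin (m + 2) → ZMod P) → ℝ := fun c => ‖vinoSum (Icc 1 (2 * X)) c‖ with hG
  have hG0 : ∀ c, 0 ≤ G c := fun c => norm_nonneg _
  obtain ⟨q, rfl⟩ : ∃ q', q = q' + 1 := ⟨q - 1, by omega⟩
  have h1 : ∑ c : Fin (m + 2) → ZMod P, ‖vinoSum (Icc 1 X) c‖ ^ (q + 1) *
        (if c (Fin.last (m + 1)) ∈ A then L (c (Fin.last m).castSucc) else 0)
      = ∑ c : Fin (m + 2) → ZMod P, ‖vinoSum (Icc (z + 1) (z + X)) c‖ ^ (q + 1) * Λ c := by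
    rw [← (shiftMatrix_mulVec_bijective (m + 2) (z : ZMod P)).sum_comp
      (fun c => ‖vinoSum (Icc (z + 1) (z + X)) c‖ ^ (q + 1) * Λ c)]
    refine sum_congr rfl fun c _ => ?_
    rw [norm_vinoSum_shift]
    simp only [hΛ]
    rw [shiftMatrix_mulVec_last, shiftMatrix_mulVec_penultimate,
      show ∀ x y : ZMod P, x - (m + 2) * z * y + z * ((m + 2) * y) = x by intros; ring]
  have h2 : ∀ c : Fin (m + 2) → ZMod P, ‖vinoSum (Icc (z + 1) (z + X)) c‖ ^ (q + 1)
      ≤ W ^ q * ∑ u, w u * G (c + Pi.single 0 u) ^ (q + 1) := by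
    intro c
    have h3 : ‖vinoSum (Icc (z + 1) (z + X)) c‖ ≤ ∑ u, w u * G (c + Pi.single 0 u) := by
      rw [vinoSum_window (J := Icc 1 (2 * X)) (Icc_subset_Icc (by omega) (by omega))
        (fun n hn => by rw [mem_Icc] at hn; omega)]
      refine (norm_sum_le _ _).trans (sum_le_sum fun u _ => ?_)
      rw [norm_mul]
      gcongr
      exact norm_windowCoeff_le z X u
    calc _ ≤ (∑ u, w u * G (c + Pi.single 0 u)) ^ (q + 1) := by gcongr
      _ ≤ (∑ u, w u * G (c + Pi.single 0 u) ^ (q + 1)) * (∑ u, w u) ^ q := by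
        apply sum_pow_succ_le
        · intro u _; exact mul_nonneg (hw0 u) (norm_nonneg _)
        · intro u _; exact mul_nonneg (hw0 u) (pow_nonneg (norm_nonneg _) _)
        · intro u _; exact hw0 u
        · intro u _; rw [mul_pow]; exact le_of_eq (by ring)
      _ ≤ _ := by
        rw [mul_comm]
        have : 0 ≤ ∑ u, w u * G (c + Pi.single 0 u) ^ (q + 1) :=
          sum_nonneg fun u _ => mul_nonneg (hw0 u) (pow_nonneg (norm_nonneg _) _)
        have : 0 ≤ ∑ u, w u := sum_nonneg fun u _ => hw0 u
        gcongr
  have h4 : ∀ u : ZMod P, ∑ c : Fin (m + 2) → ZMod P, G (c + Pi.single 0 u) ^ (q + 1) * Λ c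
      = ∑ c : Fin (m + 2) → ZMod P, G c ^ (q + 1) * Λ c := by
    intro u
    rw [← Equiv.sum_comp (Equiv.addRight (Pi.single 0 u : Fin (m + 2) → ZMod P))
      (fun c => G c ^ (q + 1) * Λ c)]
    refine sum_congr rfl fun c _ => ?_
    simp only [Equiv.coe_addRight, hΛ, Pi.add_apply]
    rw [Pi.single_eq_of_ne (by simp [Fin.ext_iff]), Pi.single_eq_of_ne (by
      simp [Fin.ext_iff]; omega), add_zero, add_zero]
  rw [h1]
  calc _ ≤ ∑ c : Fin (m + 2) → ZMod P, (W ^ q * ∑ u, w u * G (c + Pi.single 0 u) ^ (q + 1)) * Λ c :=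
by
        refine sum_le_sum fun c _ => ?_
        exact mul_le_mul_of_nonneg_right (h2 c) (hΛ0 c)
    _ = W ^ q * ∑ u, w u * ∑ c : Fin (m + 2) → ZMod P, G (c + Pi.single 0 u) ^ (q + 1) * Λ c := by
      simp only [mul_assoc, sum_mul, ← mul_sum]
      rw [sum_comm]
      simp only [mul_sum]
    _ = W ^ q * (∑ u, w u) * ∑ c : Fin (m + 2) → ZMod P, G c ^ (q + 1) * Λ c := by
      simp only [h4, ← sum_mul]; ring
    _ ≤ W ^ (q + 1) * ∑ c : Fin (m + 2) → ZMod P, G c ^ (q + 1) * Λ c := by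
      rw [pow_succ]
      have : 0 ≤ ∑ c : Fin (m + 2) → ZMod P, G c ^ (q + 1) * Λ c :=
        sum_nonneg fun c _ => mul_nonneg (pow_nonneg (hG0 c) _) (hΛ0 c)
      gcongr

theorem linBound_val_add (H : ℝ) (θ x : ZMod P) (z m : ℕ) :
    linBound H ((θ + z * ((m + 2) * x) : ZMod P).val / P)
      = linBound H (θ.val / P + z * ((m + 2) * (x.val / P))) := by
  have h := linBound_val (P := P) H (θ.val + z * ((m + 2) * x.val) : ℤ)
  push_cast at h
  simp only [ZMod.natCast_zmod_val] at h
  rw [h]; congr 1; ring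

theorem sum_snoc_eq {m : ℕ} (A : Finset (ZMod P)) (g : (Fin (m + 2) → ZMod P) → ℝ) :
    ∑ a ∈ A, ∑ c : Fin (m + 1) → ZMod P, g (Fin.snoc c a : Fin (m + 2) → ZMod P)
      = ∑ c : Fin (m + 2) → ZMod P, if c (Fin.last (m + 1)) ∈ A then g c else 0 := by
  rw [← (Fin.snocEquiv fun _ : Fin (m + 2) => ZMod P).sum_comp, Fintype.sum_prod_type]
  simp only [Fin.snocEquiv_apply, Fin.snoc_last]
  rw [← sum_filter_add_sum_filter_not univ (· ∈ A)]
  rw [sum_eq_zero (s := univ.filter (· ∉ A)) (fun a ha => by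
    simp [(mem_filter.mp ha).2]), add_zero]
  have : univ.filter (· ∈ A) = A := by ext; simp
  rw [this]
  exact sum_congr rfl fun a ha => by simp [ha]; rfl

/-- The mean value over a set of frequencies `a` for which the multiples of `k a / P` are well
distributed (`k = m + 2`), in terms of the Vinogradov mean value. -/
theorem moment_waringSum_le_vinoSum {m r X : ℕ} (hm : 1 ≤ m) (hr : 1 ≤ r) (hX : 1 ≤ X)
    (hP : 2 * (r * X ^ (m + 1)) < P) {W S : ℝ} (hS0 : 0 ≤ S)
    (hW : ∑ u : ZMod P, (P : ℝ)⁻¹ * linBound X (u.val / P) ≤ W) (A : Finset (ZMod P))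
    (hS : ∀ a ∈ A, ∀ θ : ℝ, ∑ z ∈ range X,
      linBound (2 * (r * X ^ (m + 1) : ℕ) + 1) (θ + z * ((m + 2) * (a.val / P))) ≤ S) :
    X * ((P : ℝ) ^ (m + 1) * ∑ a ∈ A, ‖waringSum (m + 2) X a‖ ^ (2 * r))
      ≤ (∏ j : Fin m, (2 * (r * X ^ (j.1 + 1) : ℕ) + 1 : ℝ)) * (W ^ (2 * r) *
        (S * ∑ c : Fin (m + 2) → ZMod P, ‖vinoSum (Icc 1 (2 * X)) c‖ ^ (2 * r))) := by
  set B : ℝ := ∏ j : Fin m, (2 * (r * X ^ (j.1 + 1) : ℕ) + 1 : ℝ) with hB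
  have hB0 : 0 ≤ B := by positivity
  have hW0 : 0 ≤ W := (sum_nonneg fun u _ =>
    mul_nonneg (by positivity) (linBound_nonneg (Nat.cast_nonneg X) _)).trans hW
  set H : ℝ := 2 * (r * X ^ (m + 1) : ℕ) + 1 with hH
  have hH0 : 0 ≤ H := by positivity
  set L : ZMod P → ℝ := fun θ => linBound H (θ.val / P) with hL
  have hL0 : ∀ θ, 0 ≤ L θ := fun θ => linBound_nonneg hH0 _
  have hPX : 2 * X < P := by
    refine lt_of_le_of_lt ?_ hP
    have : X ≤ X ^ (m + 1) := Nat.le_self_pow (by omega) X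
    nlinarith
  have h1 : ∀ a : ZMod P, (P : ℝ) ^ (m + 1) * ‖waringSum (m + 2) X a‖ ^ (2 * r)
      ≤ B * ∑ c : Fin (m + 1) → ZMod P,
        ‖vinoSum (Icc 1 X) (Fin.snoc c a : Fin (m + 2) → ZMod P)‖ ^ (2 * r) *
          L (c (Fin.last m)) := by
    intro a
    have h := congrArg norm (prod_dirKer_moment (m := m) (r := r) (X := X) hP hX a)
    rw [norm_mul, norm_pow, Complex.norm_natCast, Complex.norm_real, Real.norm_of_nonneg
      (by positivity)] at h
    rw [← h, mul_sum]
    refine (norm_sum_le _ _).trans (sum_le_sum fun c _ => ?_)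
    rw [norm_mul, Complex.norm_real, Real.norm_of_nonneg (by positivity), Fin.prod_univ_castSucc,
      norm_mul, norm_prod, mul_left_comm]
    gcongr
    · exact prod_le_prod (fun _ _ => norm_nonneg _) fun j _ => norm_dirKer_le_card _ _
    · exact norm_dirKer_le _ _
  have h2 : (P : ℝ) ^ (m + 1) * ∑ a ∈ A, ‖waringSum (m + 2) X a‖ ^ (2 * r)
      ≤ B * ∑ c : Fin (m + 2) → ZMod P, ‖vinoSum (Icc 1 X) c‖ ^ (2 * r) *
        (if c (Fin.last (m + 1)) ∈ A then L (c (Fin.last m).castSucc) else 0) := by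
    rw [mul_sum]
    refine (sum_le_sum fun a _ => h1 a).trans (le_of_eq ?_)
    rw [← mul_sum]
    congr 1
    have := sum_snoc_eq A (fun c : Fin (m + 2) → ZMod P =>
      ‖vinoSum (Icc 1 X) c‖ ^ (2 * r) * L (c (Fin.last m).castSucc))
    simp only [Fin.snoc_castSucc] at this
    rw [this]
    exact sum_congr rfl fun c _ => by split_ifs <;> simp
  have h3 : ∀ z ∈ range X, (P : ℝ) ^ (m + 1) * ∑ a ∈ A, ‖waringSum (m + 2) X a‖ ^ (2 * r)
      ≤ B * (W ^ (2 * r) * ∑ c : Fin (m + 2) → ZMod P, ‖vinoSum (Icc 1 (2 * X)) c‖ ^ (2 * r) *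
        (if c (Fin.last (m + 1)) ∈ A then
          L (c (Fin.last m).castSucc + z * ((m + 2) * c (Fin.last (m + 1)))) else 0)) := by
    intro z hz
    refine h2.trans ?_
    gcongr
    exact sum_vinoSum_mul_le hm (by omega) hPX z (mem_range.mp hz) hW A L hL0
  have h4 := sum_le_sum h3
  rw [sum_const, card_range, nsmul_eq_mul, ← mul_sum, ← mul_sum, sum_comm] at h4
  refine h4.trans ?_
  gcongr
  rw [mul_sum]
  refine sum_le_sum fun c _ => ?_
  rw [← mul_sum, mul_comm]
  gcongr
  split_ifs with hc
  · refine le_of_eq_of_le ?_ (hS _ hc ((c (Fin.last m).castSucc).val / P))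
    exact sum_congr rfl fun z _ => linBound_val_add H _ _ z m
  · simpa using hS0

end

section

/-- Logarithms are absorbed by small powers. -/
theorem exists_one_add_log_le (C₁ : ℝ) (d : ℕ) {ε : ℝ} (hε : 0 < ε) :
    ∃ C, 0 ≤ C ∧ ∀ X y : ℝ, 1 ≤ X → 1 ≤ y → y ≤ C₁ * X ^ d → 1 + Real.log y ≤ C * X ^ ε := by
  set δ : ℝ := ε / (d + 1) with hδ
  have hδ0 : 0 < δ := by positivity
  refine ⟨1 + |C₁| ^ δ / δ, by positivity, fun X y hX hy h => ?_⟩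
  have hX0 : (0 : ℝ) < X := by linarith
  have h1 : (1 : ℝ) ≤ X ^ ε := Real.one_le_rpow hX hε.le
  have h2 : y ^ δ ≤ |C₁| ^ δ * X ^ ε := by
    calc y ^ δ ≤ (|C₁| * X ^ d) ^ δ := by
          gcongr
          refine h.trans ?_
          gcongr
          exact le_abs_self _
      _ = |C₁| ^ δ * X ^ (d * δ) := by
          rw [Real.mul_rpow (abs_nonneg _) (by positivity), ← Real.rpow_natCast_mul hX0.le]
      _ ≤ _ := by
          gcongr
          rw [hδ, mul_div_assoc', div_le_iff₀ (by positivity)]; nlinarith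
  calc 1 + Real.log y ≤ X ^ ε + y ^ δ / δ := by
        have := Real.log_le_rpow_div (by linarith : 0 ≤ y) hδ0
        linarith
    _ ≤ X ^ ε + |C₁| ^ δ * X ^ ε / δ := by gcongr
    _ = _ := by ring

/-- The frequencies not close to a rational with small denominator. -/
def IsMinor {P : ℕ} (k X : ℕ) (τ : ℝ) (a : ZMod P) : Prop :=
  ∀ q : ℕ, 1 ≤ q → (q : ℝ) ≤ (X : ℝ) ^ τ → ∀ b : ℤ,
    (X : ℝ) ^ (τ - k) < |q * ((a.val : ℝ) / P) - b|

theorem sum_linBound_minor_le {k r : ℕ} (hk : 3 ≤ k) {τ ε : ℝ} (hτ0 : 0 ≤ τ) (hτ1 : τ ≤ 1)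
    (hε : 0 < ε) : ∃ C, 0 ≤ C ∧ ∀ (X P : ℕ) (a : ZMod P), 1 ≤ X → IsMinor k X τ a → ∀ θ : ℝ,
      ∑ z ∈ range X, linBound (2 * (r * X ^ (k - 1) : ℕ) + 1) (θ + z * (k * (a.val / P)))
        ≤ C * (X : ℝ) ^ (k - τ + ε) := by
  obtain ⟨C₂, hC₂, hlog⟩ := exists_one_add_log_le 1 k hε
  refine ⟨(k + 1) * (12 * (2 * r + 1)) + 8 * C₂, by positivity, fun X P a hX ha θ => ?_⟩
  have hX1 : (1 : ℝ) ≤ X := by exact_mod_cast hX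
  have hX0 : (0 : ℝ) < X := by linarith
  have hk3 : (3 : ℝ) ≤ k := by exact_mod_cast hk
  have hXk1 : (1 : ℝ) ≤ (X : ℝ) ^ (k - τ) := Real.one_le_rpow hX1 (by linarith)
  set ξ : ℝ := k * ((a.val : ℝ) / P) with hξ
  obtain ⟨f, hf1, hf2⟩ := Real.exists_rat_abs_sub_le_and_den_le ξ
    (n := ⌊(X : ℝ) ^ (k - τ)⌋₊) (Nat.floor_pos.mpr hXk1)
  set q := f.den with hq
  have hq1 : 1 ≤ q := f.den_pos
  have hq0 : (0 : ℝ) < q := by exact_mod_cast hq1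
  have hqle : (q : ℝ) ≤ (X : ℝ) ^ (k - τ) := (Nat.le_floor_iff (by positivity)).mp hf2
  have hfl : (X : ℝ) ^ (k - τ) < (⌊(X : ℝ) ^ (k - τ)⌋₊ : ℝ) + 1 := Nat.lt_floor_add_one _
  have hcast : (f : ℝ) = (f.num : ℝ) / q := by rw [hq]; exact Rat.cast_def f
  rw [hcast] at hf1
  have happrox : |ξ - f.num / q| ≤ 1 / (q : ℝ) ^ 2 := by
    refine hf1.trans ?_
    rw [sq]
    apply one_div_le_one_div_of_le (by positivity)
    have : (q : ℝ) ≤ (⌊(X : ℝ) ^ (k - τ)⌋₊ : ℝ) + 1 := by linarith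
    gcongr
  have hbig : (X : ℝ) ^ τ < k * q := by
    by_contra hcon
    push Not at hcon
    have h1 := ha (k * q) (by nlinarith) (by push_cast; exact hcon) f.num
    have h2 : (((k * q : ℕ) : ℝ) * ((a.val : ℝ) / P) - (f.num : ℤ)) = q * (ξ - f.num / q) := by
      rw [hξ]; push_cast; field_simp
    rw [h2, abs_mul, abs_of_pos hq0] at h1
    have h3 : (q : ℝ) * |ξ - f.num / q| ≤ (X : ℝ) ^ (τ - k) := by
      calc (q : ℝ) * |ξ - f.num / q| ≤ q * (1 / ((⌊(X : ℝ) ^ (k - τ)⌋₊ + 1) * q)) := by gcongr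
        _ = 1 / (⌊(X : ℝ) ^ (k - τ)⌋₊ + 1 : ℝ) := by field_simp
        _ ≤ 1 / (X : ℝ) ^ (k - τ) := one_div_le_one_div_of_le (by positivity) hfl.le
        _ = _ := by rw [one_div, ← Real.rpow_neg hX0.le, neg_sub]
    linarith
  have hcop : IsCoprime f.num (q : ℤ) := by
    rw [Int.isCoprime_iff_nat_coprime]; simpa using f.reduced
  set H : ℝ := 2 * (r * X ^ (k - 1) : ℕ) + 1 with hH
  refine (sum_linBound_le (H := H) (by positivity) q hq1 f.num hcop ξ θ happrox X).trans ?_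
  have hXq : (X : ℝ) / q ≤ k * (X : ℝ) ^ (1 - τ) := by
    rw [div_le_iff₀ hq0, Real.rpow_sub hX0, Real.rpow_one, mul_div_assoc', div_mul_eq_mul_div,
      le_div_iff₀ (by positivity)]
    nlinarith
  have hX1τ : (1 : ℝ) ≤ (X : ℝ) ^ (1 - τ) := Real.one_le_rpow hX1 (by linarith)
  have hH2 : H ≤ (2 * r + 1) * (X : ℝ) ^ (k - 1 : ℝ) := by
    have h1 : (X : ℝ) ^ (k - 1 : ℝ) = (X : ℝ) ^ (k - 1) := by
      rw [← Real.rpow_natCast, Nat.cast_sub (by omega)]; simp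
    have h2 : (1 : ℝ) ≤ (X : ℝ) ^ (k - 1) := one_le_pow₀ hX1
    rw [h1, hH]; push_cast; nlinarith
  have hlogq : 1 + Real.log q ≤ C₂ * (X : ℝ) ^ ε := by
    refine hlog X q hX1 (by exact_mod_cast hq1) ?_
    rw [one_mul, ← Real.rpow_natCast]
    refine hqle.trans ?_
    gcongr
    linarith
  have hlog0 : 0 ≤ 1 + Real.log q := by
    have := Real.log_nonneg (show (1 : ℝ) ≤ q by exact_mod_cast hq1)
    linarith
  have hε1 : (1 : ℝ) ≤ (X : ℝ) ^ ε := Real.one_le_rpow hX1 hε.le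
  have hXle : (X : ℝ) ≤ (X : ℝ) ^ (k - τ) := by
    nth_rewrite 1 [← Real.rpow_one (X : ℝ)]
    gcongr
    linarith
  have e1 : (X / q + 1 : ℝ) * (12 * H) ≤ (k + 1) * (12 * (2 * r + 1)) * (X : ℝ) ^ (k - τ) := by
    calc (X / q + 1 : ℝ) * (12 * H)
        ≤ ((k + 1) * (X : ℝ) ^ (1 - τ)) * (12 * ((2 * r + 1) * (X : ℝ) ^ (k - 1 : ℝ))) := by
          gcongr; linarith
      _ = (k + 1) * (12 * (2 * r + 1)) * ((X : ℝ) ^ (1 - τ) * (X : ℝ) ^ (k - 1 : ℝ)) := by ring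
      _ = _ := by rw [← Real.rpow_add hX0]; ring_nf
  have e2 : (X / q + 1 : ℝ) * (4 * q * (1 + Real.log q))
      ≤ 8 * (X : ℝ) ^ (k - τ) * (C₂ * (X : ℝ) ^ ε) := by
    calc (X / q + 1 : ℝ) * (4 * q * (1 + Real.log q)) = 4 * (X + q) * (1 + Real.log q) := by
          field_simp
      _ ≤ 8 * (X : ℝ) ^ (k - τ) * (C₂ * (X : ℝ) ^ ε) := by
          have : 4 * ((X : ℝ) + q) ≤ 8 * (X : ℝ) ^ (k - τ) := by linarith
          exact mul_le_mul this hlogq hlog0 (by positivity)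
  rw [Real.rpow_add hX0, mul_add]
  have : (k + 1) * (12 * (2 * r + 1)) * (X : ℝ) ^ (k - τ)
      ≤ (k + 1) * (12 * (2 * r + 1)) * ((X : ℝ) ^ (k - τ) * (X : ℝ) ^ ε) := by
    gcongr
    exact le_mul_of_one_le_right (by positivity) hε1
  linarith

variable {p : ℕ} [Fact p.Prime]

/-- The critical moment over the minor arcs saves a factor `X ^ τ`. -/
theorem minor_arc_moment {m : ℕ} (hm : 1 ≤ m) (hkp : m + 2 < p) {τ ε : ℝ} (C₁ : ℝ) (hτ0 : 0 ≤ τ)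
    (hτ1 : τ ≤ 1) (hε : 0 < ε) :
    ∃ C, 0 ≤ C ∧ ∀ X P M : ℕ, [NeZero P] → P = p ^ M → 1 ≤ X → (p * (2 * X)) ^ (m + 2) ≤ P →
      2 * (crit (m + 2) * X ^ (m + 1)) < P → (P : ℝ) ≤ C₁ * (X : ℝ) ^ (m + 2) →
      ∀ A : Finset (ZMod P), (∀ a ∈ A, IsMinor (m + 2) X τ a) →
        ∑ a ∈ A, ‖waringSum (m + 2) X a‖ ^ (2 * crit (m + 2))
          ≤ C * (X : ℝ) ^ (((m + 2 : ℕ) : ℝ) ^ 2 - τ + ε) * P := by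
  set r := crit (m + 2) with hr
  have hr1 : 1 ≤ r := crit_pos (by omega)
  set ε' : ℝ := ε / (2 * r + 2) with hε'
  have hε'0 : 0 < ε' := by positivity
  obtain ⟨C₂, hC₂, hlog⟩ := exists_one_add_log_le C₁ (m + 2) hε'0
  obtain ⟨C₃, hC₃, hsum⟩ := sum_linBound_minor_le (k := m + 2) (r := r) (by omega) hτ0 hτ1 hε'0
  obtain ⟨C₄, hC₄, hvmvt⟩ := vinogradov_mean_value (k := m + 2) (p := p) (by omega) hkp hε'0
  refine ⟨(2 * r + 1) ^ m * ((32 * C₂) ^ (2 * r) * (C₃ * (C₄ * 2 ^ (r + ε')))), by positivity,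
    fun X P M _ hPM hX hP1 hP2 hP3 A hA => ?_⟩
  have hX1 : (1 : ℝ) ≤ X := by exact_mod_cast hX
  have hX0 : (0 : ℝ) < X := by linarith
  have hP : 1 ≤ P := Nat.one_le_iff_ne_zero.mpr (NeZero.ne P)
  have hP0 : (0 : ℝ) < P := by exact_mod_cast hP
  have hW : ∑ u : ZMod P, (P : ℝ)⁻¹ * linBound X (u.val / P) ≤ 32 * C₂ * (X : ℝ) ^ ε' := by
    refine (sum_windowWeight_le X ?_).trans ?_
    · have : X ≤ X ^ (m + 1) := Nat.le_self_pow (by omega) X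
      nlinarith
    · have := hlog X P hX1 (by exact_mod_cast hP) hP3
      linarith
  have hmain := moment_waringSum_le_vinoSum hm hr1 hX hP2 (W := 32 * C₂ * (X : ℝ) ^ ε')
    (S := C₃ * (X : ℝ) ^ (((m + 2 : ℕ) : ℝ) - τ + ε')) (by positivity) hW A (fun a ha θ => by
      simpa using hsum X P a hX (hA a ha) θ)
  have hv := hvmvt (2 * X) P M hPM (by omega) hP1
  have hbox : ∏ j : Fin m, (2 * (r * X ^ (j.1 + 1) : ℕ) + 1 : ℝ)
      ≤ (2 * r + 1) ^ m * (X : ℝ) ^ (crit m : ℝ) := by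
    calc ∏ j : Fin m, (2 * (r * X ^ (j.1 + 1) : ℕ) + 1 : ℝ)
        ≤ ∏ j : Fin m, ((2 * r + 1) * (X : ℝ) ^ (j.1 + 1)) := by
          refine prod_le_prod (fun _ _ => by positivity) fun j _ => ?_
          have : (1 : ℝ) ≤ (X : ℝ) ^ (j.1 + 1) := one_le_pow₀ hX1
          push_cast; nlinarith
      _ = _ := by
          rw [prod_mul_distrib, prod_const, card_univ, Fintype.card_fin, prod_pow_eq_pow_sum,
            Real.rpow_natCast, Fin.sum_univ_eq_sum_range (fun j => j + 1) m]
          congr 2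
          have h1 := two_mul_crit m
          have h2 := Finset.sum_range_id_mul_two (m + 1)
          rw [sum_range_succ'] at h2
          simp only [Nat.add_sub_cancel, add_zero] at h2
          nlinarith
  have hchain : (X : ℝ) * ((P : ℝ) ^ (m + 1) * ∑ a ∈ A, ‖waringSum (m + 2) X a‖ ^ (2 * r))
      ≤ ((2 * r + 1) ^ m * (X : ℝ) ^ (crit m : ℝ)) * ((32 * C₂ * (X : ℝ) ^ ε') ^ (2 * r) *
        (C₃ * (X : ℝ) ^ (((m + 2 : ℕ) : ℝ) - τ + ε') *
          (C₄ * ((2 * X : ℕ) : ℝ) ^ (r + ε') * (P : ℝ) ^ (m + 2)))) := by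
    refine hmain.trans ?_
    gcongr
    exact hv
  have hexp : ((2 * r + 1) ^ m * (X : ℝ) ^ (crit m : ℝ)) * ((32 * C₂ * (X : ℝ) ^ ε') ^ (2 * r) *
        (C₃ * (X : ℝ) ^ (((m + 2 : ℕ) : ℝ) - τ + ε') *
          (C₄ * ((2 * X : ℕ) : ℝ) ^ (r + ε') * (P : ℝ) ^ (m + 2))))
      = X * ((P : ℝ) ^ (m + 1) * ((2 * r + 1) ^ m * ((32 * C₂) ^ (2 * r) *
        (C₃ * (C₄ * 2 ^ (r + ε')))) * (X : ℝ) ^ (((m + 2 : ℕ) : ℝ) ^ 2 - τ + ε) * P)) := by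
    have h1 : ((32 * C₂ * (X : ℝ) ^ ε') ^ (2 * r)) = (32 * C₂) ^ (2 * r) * (X : ℝ) ^ (2 * r * ε') := by
      rw [mul_pow, ← Real.rpow_mul_natCast hX0.le]; push_cast; ring_nf
    have h2 : ((2 * X : ℕ) : ℝ) ^ (r + ε') = 2 ^ (r + ε') * (X : ℝ) ^ (r + ε') := by
      push_cast; rw [Real.mul_rpow (by norm_num) hX0.le]
    have hc1 : (2 * crit m : ℝ) = m * (m + 1) := by exact_mod_cast two_mul_crit m
    have hc2 : (2 * r : ℝ) = (m + 2) * (m + 2 + 1) := by exact_mod_cast two_mul_crit (m + 2)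
    have hεε : 2 * r * ε' + 2 * ε' = ε := by rw [hε']; field_simp
    have h3 : (X : ℝ) ^ (crit m : ℝ) * (X : ℝ) ^ (2 * r * ε') *
        (X : ℝ) ^ (((m + 2 : ℕ) : ℝ) - τ + ε') * (X : ℝ) ^ (r + ε')
        = X * (X : ℝ) ^ (((m + 2 : ℕ) : ℝ) ^ 2 - τ + ε) := by
      rw [← Real.rpow_add hX0, ← Real.rpow_add hX0, ← Real.rpow_add hX0]
      nth_rewrite 2 [← Real.rpow_one (X : ℝ)]
      rw [← Real.rpow_add hX0]
      congr 1
      push_cast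
      linear_combination hc1 / 2 + hc2 / 2 + hεε
    rw [h1, h2]
    calc _ = ((2 * r + 1) ^ m * ((32 * C₂) ^ (2 * r) * (C₃ * (C₄ * 2 ^ (r + ε'))))) *
          ((X : ℝ) ^ (crit m : ℝ) * (X : ℝ) ^ (2 * r * ε') *
        (X : ℝ) ^ (((m + 2 : ℕ) : ℝ) - τ + ε') * (X : ℝ) ^ (r + ε')) * (P : ℝ) ^ (m + 2) := by ring
      _ = _ := by rw [h3]; ring
  rw [hexp] at hchain
  exact le_of_mul_le_mul_left (le_of_mul_le_mul_left hchain hX0) (by positivity)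

end

/-- A bound that is multiplicative over coprime factors, uniform at prime powers, and trivial at
powers of large primes, holds uniformly. -/
theorem exists_bound_of_coprime_mul {Q : ℕ → ℝ → Prop} {K : ℝ} (hK1 : 1 ≤ K) (B : ℕ) (h1 : Q 1 1)
    (hmul : ∀ m n, 1 < m → 1 < n → m.Coprime n → ∀ c d, 0 ≤ c → 0 ≤ d → Q m c → Q n d →
      Q (m * n) (c * d))
    (hK : ∀ p m, p.Prime → 0 < m → Q (p ^ m) K)
    (hB : ∀ p m, p.Prime → 0 < m → B ≤ p → Q (p ^ m) 1) {n : ℕ} (hn : n ≠ 0) :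
    ∃ i ≤ B, Q n (K ^ i) := by
  have key : ∀ n : ℕ, n ≠ 0 → Q n (K ^ #(n.primeFactors.filter (· < B))) := by
    intro n
    induction n using Nat.recOnPosPrimePosCoprime with
    | zero => intro h; exact absurd rfl h
    | one => intro _; simpa using h1
    | prime_pow p m hp hm =>
      intro _
      rw [Nat.primeFactors_prime_pow hm.ne' hp]
      by_cases h : p < B
      · rw [filter_singleton, if_pos h]; simpa using hK p m hp hm
      · rw [filter_singleton, if_neg h]; simpa using hB p m hp hm (not_lt.mp h)
    | coprime a b ha hb hab iha ihb =>
      intro _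
      rw [hab.primeFactors_mul, filter_union, card_union_of_disjoint
        (disjoint_filter_filter hab.disjoint_primeFactors), pow_add]
      exact hmul a b ha hb hab _ _ (by positivity) (by positivity) (iha (by omega)) (ihb (by omega))
  refine ⟨_, ?_, key n hn⟩
  calc #(n.primeFactors.filter (· < B)) ≤ #(range B) :=
        card_le_card fun p hp => mem_range.mpr (mem_filter.mp hp).2
    _ = B := card_range B

/-- The divisor bound. -/
theorem card_divisors_le_rpow {ε : ℝ} (hε : 0 < ε) :
    ∃ C : ℝ, 0 ≤ C ∧ ∀ n : ℕ, n ≠ 0 → (#n.divisors : ℝ) ≤ C * (n : ℝ) ^ ε := by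
  set g : ℕ → ℝ := fun n => #n.divisors / (n : ℝ) ^ ε with hg
  have h2 : 1 < (2 : ℝ) ^ ε := Real.one_lt_rpow (by norm_num) hε
  set K : ℝ := 1 + ((2 : ℝ) ^ ε - 1)⁻¹ with hK
  have hK0 : 0 < ((2 : ℝ) ^ ε - 1)⁻¹ := inv_pos.mpr (by linarith)
  have hpp : ∀ p m : ℕ, p.Prime → g (p ^ m) = (m + 1) / ((p : ℝ) ^ ε) ^ m := by
    intro p m hp
    simp only [hg]
    rw [Nat.divisors_prime_pow hp, card_map, card_range]
    push_cast
    rw [← Real.rpow_natCast, ← Real.rpow_mul (by positivity), ← Real.rpow_natCast,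
      ← Real.rpow_mul (by positivity), mul_comm]
  obtain ⟨B, hB⟩ := exists_nat_ge ((2 : ℝ) ^ (1 / ε))
  refine ⟨K ^ B, by positivity, fun n hn => ?_⟩
  have hn0 : (0 : ℝ) < n := by positivity
  rw [← div_le_iff₀ (by positivity)]
  have hK1 : 1 ≤ K := by linarith
  have hmul : ∀ m n : ℕ, 1 < m → 1 < n → m.Coprime n → ∀ c d : ℝ, 0 ≤ c → 0 ≤ d → g m ≤ c →
      g n ≤ d → g (m * n) ≤ c * d := by
    intro m n _ _ h c d hc hd hm hn
    refine le_trans (le_of_eq ?_) (mul_le_mul hm hn (by simp only [hg]; positivity) hc)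
    simp only [hg]
    rw [h.card_divisors_mul]
    push_cast
    rw [Real.mul_rpow (by positivity) (by positivity), div_mul_div_comm]
  have hKp : ∀ p m : ℕ, p.Prime → 0 < m → g (p ^ m) ≤ K := by
    intro p m hp hm
    rw [hpp p m hp]
    have hp2 : (2 : ℝ) ^ ε ≤ (p : ℝ) ^ ε :=
      Real.rpow_le_rpow (by norm_num) (by exact_mod_cast hp.two_le) hε.le
    have hbern := one_add_mul_le_pow (a := (2 : ℝ) ^ ε - 1) (by linarith) m
    rw [add_sub_cancel] at hbern
    have hp0 : (0 : ℝ) < p := by exact_mod_cast hp.pos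
    rw [div_le_iff₀ (by positivity)]
    have h3 : ((2 : ℝ) ^ ε) ^ m ≤ ((p : ℝ) ^ ε) ^ m := by gcongr
    calc (m + 1 : ℝ) ≤ K * (1 + m * ((2 : ℝ) ^ ε - 1)) := by
          have h4 : ((2 : ℝ) ^ ε - 1)⁻¹ * ((2 : ℝ) ^ ε - 1) = 1 :=
            inv_mul_cancel₀ (by linarith)
          rw [hK]
          nlinarith [mul_nonneg (Nat.cast_nonneg (α := ℝ) m) (by linarith : 0 ≤ (2 : ℝ) ^ ε - 1)]
      _ ≤ _ := by gcongr; linarith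
  have hBp : ∀ p m : ℕ, p.Prime → 0 < m → B ≤ p → g (p ^ m) ≤ 1 := by
    intro p m hp hm hpB
    rw [hpp p m hp, div_le_one (by have := hp.pos; positivity)]
    have h3 : (2 : ℝ) ≤ (p : ℝ) ^ ε := by
      calc (2 : ℝ) = ((2 : ℝ) ^ (1 / ε)) ^ ε := by
            rw [← Real.rpow_mul (by norm_num), one_div_mul_cancel hε.ne', Real.rpow_one]
        _ ≤ _ := Real.rpow_le_rpow (by positivity) (hB.trans (by exact_mod_cast hpB)) hε.le
    calc (m + 1 : ℝ) ≤ 2 ^ m := by exact_mod_cast Nat.lt_two_pow_self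
      _ ≤ _ := by gcongr
  obtain ⟨i, hi, hQ⟩ := exists_bound_of_coprime_mul (Q := fun n c => g n ≤ c) hK1 B (by simp [hg])
    hmul hKp hBp hn
  exact hQ.trans (pow_le_pow_right₀ hK1 hi)

open Polynomial in
/-- Iterated differencing: the sum of `F` over the values of all `j`-th differences of `g`, with
increments less than `X`, on the integer interval `[u, v]`. -/
noncomputable def diffSum {M : Type*} [AddCommMonoid M] (X : ℕ) :
    ℕ → ℤ[X] → ℤ → ℤ → (ℤ → M) → M
  | 0, g, u, v, F => ∑ x ∈ Icc u v, F (g.eval x)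
  | j + 1, g, u, v, F => ∑ h ∈ Ioo (-(X : ℤ)) X,
      diffSum X j (g.comp (Polynomial.X + C h) - g) (max u (u - h)) (min v (v - h)) F

section
open Polynomial

theorem map_diffSum {M N : Type*} [AddCommMonoid M] [AddCommMonoid N] (φ : M →+ N) (X j : ℕ)
    (g : ℤ[X]) (u v : ℤ) (F : ℤ → M) :
    φ (diffSum X j g u v F) = diffSum X j g u v (fun n => φ (F n)) := by
  induction j generalizing g u v with
  | zero => simp [diffSum]
  | succ j ih => simp [diffSum, ih]

theorem diffSum_sum {ι M : Type*} [AddCommMonoid M] (s : Finset ι) (X j : ℕ)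
    (g : ℤ[X]) (u v : ℤ) (F : ι → ℤ → M) :
    ∑ i ∈ s, diffSum X j g u v (F i) = diffSum X j g u v (fun n => ∑ i ∈ s, F i n) := by
  induction j generalizing g u v with
  | zero => simp only [diffSum]; exact sum_comm
  | succ j ih => simp only [diffSum]; rw [sum_comm]; exact sum_congr rfl fun h _ => ih _ _ _

/-- The number of times a value is attained by the `j`-th differences. -/
noncomputable def diffCount (X j : ℕ) (g : ℤ[X]) (u v N : ℤ) : ℕ :=
  diffSum X j g u v (fun n => if n = N then 1 else 0)

theorem diffSum_eq_sum (X j : ℕ) (g : ℤ[X]) (u v : ℤ) (F : ℤ → ℕ) (B : ℤ)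
    (hB : ∀ x ∈ Icc u v, |g.eval x| ≤ B) :
    diffSum X j g u v F
      = ∑ N ∈ Icc (-(2 ^ j * B)) (2 ^ j * B), F N * diffCount X j g u v N := by
  induction j generalizing g u v B with
  | zero =>
    simp only [diffCount, diffSum, mul_sum]
    rw [sum_comm]
    refine sum_congr rfl fun x hx => ?_
    have h1 := abs_le.mp (hB x hx)
    simp only [mul_ite, mul_one, mul_zero]
    rw [sum_ite_eq, if_pos (mem_Icc.mpr (by constructor <;> simp <;> linarith))]
  | succ j ih =>
    simp only [diffCount, diffSum, mul_sum]
    rw [sum_comm]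
    refine sum_congr rfl fun h hh => ?_
    rw [ih _ _ _ (2 * B) ?_, pow_succ, mul_assoc]
    · simp only [diffCount]
    · intro x hx
      rw [mem_Icc] at hx
      have h1 := abs_le.mp (hB x (mem_Icc.mpr (by omega)))
      have h2 := abs_le.mp (hB (x + h) (mem_Icc.mpr (by omega)))
      simp only [eval_sub, eval_comp, eval_add, eval_X, eval_C]
      rw [abs_le]; constructor <;> linarith

theorem card_Ioo_neg_le (X : ℕ) : #(Ioo (-(X : ℤ)) X) ≤ 2 * X := by
  rw [Int.card_Ioo]; omega

theorem diffCount_succ (X j : ℕ) (g : ℤ[X]) (u v N : ℤ) :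
    diffCount X (j + 1) g u v N = ∑ h ∈ Ioo (-(X : ℤ)) X,
      diffCount X j (g.comp (Polynomial.X + C h) - g) (max u (u - h)) (min v (v - h)) N := rfl

theorem diffCount_zero (X : ℕ) (g : ℤ[X]) (u v N : ℤ) :
    diffCount X 0 g u v N = #{x ∈ Icc u v | g.eval x = N} := by
  simp only [diffCount, diffSum, card_filter]

theorem diffCount_le_card (X j : ℕ) (g : ℤ[X]) (u v N : ℤ) (huv : v - u < X) :
    diffCount X j g u v N ≤ X * (2 * X) ^ j := by
  induction j generalizing g u v with
  | zero =>
    rw [diffCount_zero]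
    refine (card_filter_le _ _).trans ?_
    simp; omega
  | succ j ih =>
    rw [diffCount_succ]
    calc _ ≤ ∑ h ∈ Ioo (-(X : ℤ)) X, X * (2 * X) ^ j :=
          sum_le_sum fun h _ => ih _ _ _ (by omega)
      _ ≤ _ := by
          rw [sum_const, smul_eq_mul, pow_succ]
          nlinarith [Nat.mul_le_mul_right (X * (2 * X) ^ j) (card_Ioo_neg_le X)]

theorem dvd_of_diffCount_ne_zero (X j : ℕ) (g : ℤ[X]) (u v N d : ℤ) (hd : ∀ x, d ∣ g.eval x)
    (h : diffCount X j g u v N ≠ 0) : d ∣ N := by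
  induction j generalizing g u v with
  | zero =>
    rw [diffCount_zero, card_ne_zero] at h
    obtain ⟨x, hx⟩ := h
    rw [← (mem_filter.mp hx).2]; exact hd x
  | succ j ih =>
    rw [diffCount_succ] at h
    obtain ⟨y, _, hy⟩ := exists_ne_zero_of_sum_ne_zero h
    refine ih _ _ _ (fun x => ?_) hy
    simp only [eval_sub, eval_comp, eval_add, eval_X, eval_C]
    exact dvd_sub (hd _) (hd _)

theorem dvd_diff_eval (g : ℤ[X]) (h x : ℤ) : h ∣ (g.comp (Polynomial.X + C h) - g).eval x := by
  simp only [eval_sub, eval_comp, eval_add, eval_X, eval_C]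
  simpa using g.sub_dvd_eval_sub (x + h) x

theorem natDegree_diff (g : ℤ[X]) {h : ℤ} (hh : h ≠ 0) :
    (g.comp (Polynomial.X + C h) - g).natDegree = g.natDegree - 1 := by
  rw [← taylor_apply]
  set d := g.natDegree with hd
  rcases Nat.eq_zero_or_pos d with h0 | h0
  · obtain ⟨c, hc⟩ := natDegree_eq_zero.mp (hd.symm.trans h0)
    rw [← hc, taylor_C, sub_self, natDegree_zero, h0]
  have hg0 : g ≠ 0 := by rintro rfl; simp at hd; omega
  have hcoeff : (taylor h g - g).coeff (d - 1) = d * g.coeff d * h := by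
    have hdeg : (hasseDeriv (d - 1) g).natDegree < 2 := by
      have := natDegree_hasseDeriv_le g (d - 1); omega
    rw [coeff_sub, taylor_coeff, eval_eq_sum_range' hdeg]
    simp only [hasseDeriv_coeff, sum_range_succ, sum_range_zero]
    rw [show 1 + (d - 1) = d - 1 + 1 by omega, Nat.choose_succ_self_right, show d - 1 + 1 = d by omega]
    simp
  refine le_antisymm ?_ (le_natDegree_of_ne_zero ?_)
  · have := degree_sub_lt_left (p := taylor h g) (q := g) (by simp)
      (by simpa using hg0) (by simp)
    rw [degree_taylor, degree_eq_natDegree hg0] at this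
    by_cases hz : taylor h g - g = 0
    · simp [hz]
    · rw [degree_eq_natDegree hz] at this
      have := WithBot.coe_lt_coe.mp this
      change _ < (d : ℕ) at this
      simp at this
      omega
  · rw [hcoeff]
    have : g.coeff d ≠ 0 := by simpa [hd] using hg0
    have : d ≠ 0 := by omega
    positivity

theorem card_eval_eq_le (g : ℤ[X]) (hg : 1 ≤ g.natDegree) (s : Finset ℤ) (N : ℤ) :
    #{x ∈ s | g.eval x = N} ≤ g.natDegree := by
  have hd : (g - C N).natDegree = g.natDegree := natDegree_sub_C
  have h0 : g - C N ≠ 0 := fun h => by rw [h] at hd; simp at hd; omega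
  rw [← hd]
  refine le_trans (card_le_card ?_) (((g - C N).roots.toFinset_card_le).trans (card_roots' _))
  intro x hx
  rw [Multiset.mem_toFinset, mem_roots h0]
  simp [(mem_filter.mp hx).2]

theorem diffCount_le_of_ne_zero (X j : ℕ) (g : ℤ[X]) (u v N : ℤ) (hg : j + 1 ≤ g.natDegree)
    (hN : N ≠ 0) : diffCount X j g u v N ≤ g.natDegree * (2 * #N.natAbs.divisors) ^ j := by
  induction j generalizing g u v with
  | zero => rw [diffCount_zero]; simpa using card_eval_eq_le g (by omega) _ N
  | succ j ih =>
    rw [diffCount_succ]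
    set S := N.natAbs.divisors.image (fun d : ℕ => (d : ℤ)) ∪
      N.natAbs.divisors.image (fun d : ℕ => -(d : ℤ)) with hS
    have hScard : #S ≤ 2 * #N.natAbs.divisors := by
      refine (card_union_le _ _).trans ?_
      have h1 := card_image_le (s := N.natAbs.divisors) (f := fun d : ℕ => (d : ℤ))
      have h2 := card_image_le (s := N.natAbs.divisors) (f := fun d : ℕ => -(d : ℤ))
      omega
    calc _ ≤ ∑ h ∈ Ioo (-(X : ℤ)) X,
          if h ∈ S then g.natDegree * (2 * #N.natAbs.divisors) ^ j else 0 := by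
          refine sum_le_sum fun h _ => ?_
          split_ifs with hh
          · have hh0 : h ≠ 0 := by
              rintro rfl
              simp [hS, hN] at hh
            refine (ih _ _ _ (by rw [natDegree_diff g hh0]; omega)).trans ?_
            rw [natDegree_diff g hh0]
            gcongr; omega
          · by_contra hcon
            have hdvd := dvd_of_diffCount_ne_zero X j _ _ _ N h (dvd_diff_eval g h)
              (fun h0 => hcon (by rw [h0]))
            apply hh
            simp only [hS, mem_union, mem_image, Nat.mem_divisors]
            have h1 : h.natAbs ∣ N.natAbs ∧ N.natAbs ≠ 0 :=
              ⟨Int.natAbs_dvd_natAbs.mpr hdvd, by simpa using hN⟩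
            rcases Int.natAbs_eq h with h2 | h2
            · exact Or.inl ⟨_, h1, h2.symm⟩
            · exact Or.inr ⟨_, h1, h2.symm⟩
      _ ≤ #S * (g.natDegree * (2 * #N.natAbs.divisors) ^ j) := by
          rw [← sum_filter, sum_const, smul_eq_mul]
          gcongr
          exact fun x hx => (mem_filter.mp hx).2
      _ ≤ _ := by
          rw [pow_succ]
          nlinarith [Nat.mul_le_mul_right (g.natDegree * (2 * #N.natAbs.divisors) ^ j) hScard]

theorem diffCount_zero_le (X j : ℕ) (g : ℤ[X]) (u v : ℤ) (hg : j + 1 ≤ g.natDegree)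
    (huv : v - u < X) : diffCount X j g u v 0 ≤ (g.natDegree + j) * (2 * X) ^ j := by
  induction j generalizing g u v with
  | zero => rw [diffCount_zero]; simpa using card_eval_eq_le g (by omega) _ 0
  | succ j ih =>
    rw [diffCount_succ]
    calc _ ≤ ∑ h ∈ Ioo (-(X : ℤ)) X,
          ((if h = 0 then X * (2 * X) ^ j else 0) + (g.natDegree + j) * (2 * X) ^ j) := by
          refine sum_le_sum fun h _ => ?_
          split_ifs with hh
          · exact (diffCount_le_card X j _ _ _ _ (by omega)).trans (Nat.le_add_right _ _)
          · refine (ih _ _ _ (by rw [natDegree_diff g hh]; omega) (by omega)).trans ?_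
            rw [natDegree_diff g hh, zero_add]
            gcongr; omega
      _ ≤ X * (2 * X) ^ j + 2 * X * ((g.natDegree + j) * (2 * X) ^ j) := by
          rw [sum_add_distrib, sum_ite_eq', sum_const, smul_eq_mul]
          gcongr
          · split_ifs <;> simp
          · exact card_Ioo_neg_le X
      _ ≤ _ := by
          rw [pow_succ]
          nlinarith [Nat.zero_le (X * (2 * X) ^ j)]

end

section
open Polynomial

variable {P : ℕ} [NeZero P]

local notation "ψ" => (ZMod.stdAddChar : AddChar (ZMod _) ℂ)

/-- The exponential sum of `a g(x)` over an integer interval. -/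
noncomputable def polySum (a : ZMod P) (g : ℤ[X]) (u v : ℤ) : ℂ :=
  ∑ x ∈ Icc u v, ψ (a * ((g.eval x : ℤ) : ZMod P))

theorem norm_sq_polySum (X : ℕ) (a : ZMod P) (g : ℤ[X]) (u v : ℤ) (huv : v - u < X) :
    ((‖polySum a g u v‖ ^ 2 : ℝ) : ℂ) = ∑ h ∈ Ioo (-(X : ℤ)) X,
      polySum a (g.comp (Polynomial.X + C h) - g) (max u (u - h)) (min v (v - h)) := by
  push_cast
  rw [← Complex.mul_conj', polySum, map_sum, sum_mul_sum, sum_comm]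
  have h1 : ∀ x ∈ Icc u v, ∑ y ∈ Icc u v,
      ψ (a * ((g.eval y : ℤ) : ZMod P)) * (starRingEnd ℂ) (ψ (a * ((g.eval x : ℤ) : ZMod P)))
      = ∑ h ∈ Ioo (-(X : ℤ)) X, if x + h ∈ Icc u v then
        ψ (a * ((g.eval (x + h) - g.eval x : ℤ) : ZMod P)) else 0 := by
    intro x hx
    rw [← sum_filter]
    rw [mem_Icc] at hx
    refine sum_nbij' (fun y => y - x) (fun h => x + h) ?_ ?_ ?_ ?_ ?_
    · intro y hy
      rw [mem_Icc] at hy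
      rw [mem_filter, mem_Ioo, mem_Icc]; omega
    · intro h hh
      exact (mem_filter.mp hh).2
    · intro y _; ring
    · intro h _; ring
    · intro y _
      rw [conj_stdAddChar, ← AddChar.map_add_eq_mul]
      congr 1
      rw [add_sub_cancel]
      push_cast; ring
  rw [sum_congr rfl h1, sum_comm]
  refine sum_congr rfl fun h _ => ?_
  rw [polySum, ← sum_filter]
  refine sum_congr ?_ fun x _ => ?_
  · ext x
    simp only [mem_filter, mem_Icc]
    omega
  · simp [eval_comp]

/-- Weyl differencing. -/
theorem norm_polySum_pow_le (X j : ℕ) (a : ZMod P) (g : ℤ[X]) (u v : ℤ) (huv : v - u < X) :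
    ‖polySum a g u v‖ ^ 2 ^ (j + 1) ≤ (2 * X : ℝ) ^ (2 ^ (j + 1) - j - 2) *
      (diffSum X (j + 1) g u v (fun n => (ψ (a * (n : ZMod P)) : ℂ))).re := by
  induction j generalizing g u v with
  | zero =>
    have h := congrArg Complex.re (norm_sq_polySum X a g u v huv)
    rw [Complex.ofReal_re] at h
    simp only [zero_add, pow_one, Nat.sub_zero, Nat.sub_self, pow_zero, one_mul]
    rw [h]; rfl
  | succ j ih =>
    set S : ℤ → ℂ := fun h =>
      polySum a (g.comp (Polynomial.X + C h) - g) (max u (u - h)) (min v (v - h)) with hS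
    set T : ℤ → ℝ := fun h => (diffSum X (j + 1) (g.comp (Polynomial.X + C h) - g)
      (max u (u - h)) (min v (v - h)) (fun n => (ψ (a * (n : ZMod P)) : ℂ))).re with hT
    have hlt : j + 2 ≤ 2 ^ (j + 1) := Nat.lt_two_pow_self
    have h1 : ‖polySum a g u v‖ ^ 2 ≤ ∑ h ∈ Ioo (-(X : ℤ)) X, ‖S h‖ := by
      have h := congrArg norm (norm_sq_polySum X a g u v huv)
      rw [Complex.norm_real, Real.norm_of_nonneg (by positivity)] at h
      rw [h]
      exact norm_sum_le _ _
    have h3 : (∑ h ∈ Ioo (-(X : ℤ)) X, ‖S h‖) ^ (2 ^ (j + 1) - 1 + 1)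
        ≤ (#(Ioo (-(X : ℤ)) X) : ℝ) ^ (2 ^ (j + 1) - 1) *
          ∑ h ∈ Ioo (-(X : ℤ)) X, ‖S h‖ ^ (2 ^ (j + 1) - 1 + 1) :=
      pow_sum_le_card_mul_sum_pow (fun _ _ => norm_nonneg _) _
    rw [Nat.sub_add_cancel (by omega)] at h3
    have hcard : (#(Ioo (-(X : ℤ)) X) : ℝ) ≤ 2 * X := by exact_mod_cast card_Ioo_neg_le X
    calc ‖polySum a g u v‖ ^ 2 ^ (j + 1 + 1) = (‖polySum a g u v‖ ^ 2) ^ 2 ^ (j + 1) := by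
          rw [← pow_mul]; congr 1; ring
      _ ≤ (∑ h ∈ Ioo (-(X : ℤ)) X, ‖S h‖) ^ 2 ^ (j + 1) := by gcongr
      _ ≤ _ := h3
      _ ≤ (2 * X : ℝ) ^ (2 ^ (j + 1) - 1) * ∑ h ∈ Ioo (-(X : ℤ)) X,
            ((2 * X : ℝ) ^ (2 ^ (j + 1) - j - 2) * T h) := by
          gcongr with h hh
          exact ih _ _ _ (by omega)
      _ = (2 * X : ℝ) ^ (2 ^ (j + 1) - 1 + (2 ^ (j + 1) - j - 2)) *
            ∑ h ∈ Ioo (-(X : ℤ)) X, T h := by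
          rw [← mul_sum, pow_add _ (2 ^ (j + 1) - 1), mul_assoc]
      _ = _ := by
          rw [show 2 ^ (j + 1) - 1 + (2 ^ (j + 1) - j - 2) = 2 ^ (j + 1 + 1) - (j + 1) - 2 by
            rw [pow_succ 2 (j + 1)]; omega]
          congr 1
          exact (Complex.re_sum _ _).symm

theorem waringSum_eq_polySum (k X : ℕ) (a : ZMod P) :
    waringSum k X a = polySum a (Polynomial.X ^ k) 1 X := by
  rw [waringSum, polySum]
  refine sum_nbij' (fun n => (n : ℤ)) Int.toNat ?_ ?_ ?_ ?_ ?_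
  · intro n hn; rw [mem_Icc] at hn ⊢; omega
  · intro n hn; rw [mem_Icc] at hn ⊢; omega
  · intro n _; simp
  · intro n hn; rw [mem_Icc] at hn; simp; omega
  · intro n _; simp

theorem exists_count_norm_pow (k X r : ℕ) : ∃ cnt : ZMod P → ℕ, ∀ u : ZMod P,
    ∑ a : ZMod P, ((‖waringSum k X a‖ ^ (2 * r) : ℝ) : ℂ) * ψ (a * u) = (P : ℂ) * cnt u := by
  refine ⟨fun u => ∑ x ∈ Fintype.piFinset (fun _ : Fin r => Icc 1 X),
    ∑ y ∈ Fintype.piFinset (fun _ : Fin r => Icc 1 X),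
      if (∑ i, (x i : ZMod P) ^ k - ∑ i, (y i : ZMod P) ^ k + u) = 0 then 1 else 0, fun u => ?_⟩
  simp only [waringSum, norm_pow_two_mul_eq, sum_mul]
  push_cast
  rw [sum_comm, mul_sum]
  refine sum_congr rfl fun x _ => ?_
  rw [sum_comm, mul_sum]
  refine sum_congr rfl fun y _ => ?_
  rw [mul_ite, mul_one, mul_zero, ← sum_stdAddChar_mul]
  refine sum_congr rfl fun a _ => ?_
  rw [← AddChar.map_add_eq_mul, ← mul_sum, ← mul_sum]
  ring_nf

theorem sum_mul_diffSum_le {k j X : ℕ} (hkj : j + 1 ≤ k) (hP : 2 * (2 ^ j * X ^ k) < P)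
    (W : ZMod P → ℝ) (cnt : ZMod P → ℕ)
    (hW : ∀ u, ∑ a : ZMod P, (W a : ℂ) * ψ (a * u) = (P : ℂ) * cnt u) (D : ℕ)
    (hD : ∀ n : ℕ, n ≠ 0 → n ≤ 2 ^ j * X ^ k → k * (2 * #n.divisors) ^ j ≤ D) :
    ∑ a : ZMod P, W a *
        (diffSum X j (Polynomial.X ^ k : ℤ[X]) 1 X (fun n => (ψ (a * (n : ZMod P)) : ℂ))).re
      ≤ (k + j) * (2 * X) ^ j * (∑ a, W a) + D * (P * W 0) := by
  set g : ℤ[X] := Polynomial.X ^ k with hg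
  have hdeg : g.natDegree = k := by simp [hg]
  have hsum0 : ∑ a, W a = P * cnt 0 := by
    have := hW 0
    simp only [mul_zero, AddChar.map_zero_eq_one, mul_one] at this
    exact_mod_cast this
  have htot : (∑ u, cnt u : ℕ) = W 0 := by
    have hP0 : (P : ℂ) ≠ 0 := NeZero.ne _
    have h1 : (P : ℂ) * ∑ u, (cnt u : ℂ) = P * W 0 := by
      rw [mul_sum, ← sum_congr rfl fun u _ => hW u, sum_comm]
      simp only [← mul_sum]
      rw [Fintype.sum_eq_single 0]
      · simp [ZMod.card]; ring
      · intro a ha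
        have := sum_stdAddChar_mul a
        rw [if_neg ha] at this
        simp only [mul_comm _ a] at this
        rw [this, mul_zero]
    have h2 := mul_left_cancel₀ hP0 h1
    exact_mod_cast h2
  have hval : ∑ a : ZMod P, W a * (diffSum X j g 1 X (fun n => (ψ (a * (n : ZMod P)) : ℂ))).re
      = P * (diffSum X j g 1 X (fun n => cnt (n : ZMod P)) : ℕ) := by
    have h1 : ∑ a : ZMod P, (W a : ℂ) * (diffSum X j g 1 X (fun n => (ψ (a * (n : ZMod P)) : ℂ)))
        = P * (diffSum X j g 1 X (fun n => cnt (n : ZMod P)) : ℕ) := by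
      have h2 : ∀ a : ZMod P, (W a : ℂ) * (diffSum X j g 1 X (fun n => (ψ (a * (n : ZMod P)) : ℂ)))
          = diffSum X j g 1 X (fun n => (W a : ℂ) * (ψ (a * (n : ZMod P)) : ℂ)) := fun a =>
        map_diffSum (AddMonoidHom.mulLeft (W a : ℂ)) X j g 1 X _
      rw [sum_congr rfl fun a _ => h2 a, diffSum_sum]
      simp only [hW]
      have h3 := map_diffSum ((AddMonoidHom.mulLeft (P : ℂ)).comp (Nat.castAddMonoidHom ℂ))
        X j g 1 X (fun n => cnt (n : ZMod P))
      simpa using h3.symm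
    have h2 := congrArg Complex.re h1
    rw [Complex.re_sum] at h2
    simp only [Complex.re_ofReal_mul] at h2
    rw [h2]
    norm_cast
  have hbound : diffSum X j g 1 X (fun n => cnt (n : ZMod P))
      ≤ cnt 0 * ((k + j) * (2 * X) ^ j) + D * ∑ u, cnt u := by
    rw [diffSum_eq_sum X j g 1 X _ ((X : ℤ) ^ k)]
    · have hsub : ∀ N ∈ Icc (-(2 ^ j * (X : ℤ) ^ k)) (2 ^ j * (X : ℤ) ^ k),
          cnt (N : ZMod P) * diffCount X j g 1 X N
            ≤ (if N = 0 then cnt 0 * ((k + j) * (2 * X) ^ j) else 0) + D * cnt (N : ZMod P) := by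
        intro N hN
        split_ifs with h0
        · subst h0
          refine le_trans ?_ (Nat.le_add_right _ _)
          simp only [Int.cast_zero]
          gcongr
          exact (diffCount_zero_le X j g 1 X (by omega) (by omega)).trans (by rw [hdeg])
        · rw [zero_add, mul_comm]
          gcongr
          refine (diffCount_le_of_ne_zero X j g 1 X N (by omega) h0).trans ?_
          rw [hdeg]
          refine hD _ (by omega) ?_
          have : |N| ≤ 2 ^ j * (X : ℤ) ^ k := abs_le.mpr (mem_Icc.mp hN)
          zify; exact this
      refine (sum_le_sum hsub).trans ?_
      rw [sum_add_distrib, sum_ite_eq', ← mul_sum]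
      gcongr
      · split_ifs <;> simp
      · rw [← sum_image (f := fun u : ZMod P => cnt u) (g := fun N : ℤ => (N : ZMod P))]
        · exact sum_le_sum_of_subset (subset_univ _)
        · intro N hN M hM hNM
          rw [coe_Icc, Set.mem_Icc] at hN hM
          have h1 : ((N - M : ℤ) : ZMod P) = 0 := by push_cast; rw [sub_eq_zero]; exact hNM
          rw [ZMod.intCast_zmod_eq_zero_iff_dvd] at h1
          have h2 : |N - M| < P := by
            have : (2 * (2 ^ j * (X : ℤ) ^ k)) < P := by exact_mod_cast hP
            rw [abs_lt]; constructor <;> linarith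
          have := Int.eq_zero_of_abs_lt_dvd h1 h2
          omega
    · intro x hx
      rw [mem_Icc] at hx
      simp only [hg, eval_pow, eval_X]
      rw [abs_of_nonneg (by have := hx.1; positivity)]
      have := hx.1
      gcongr
      exact hx.2
  rw [hval, hsum0, ← htot]
  have : ((diffSum X j g 1 X (fun n => cnt (n : ZMod P)) : ℕ) : ℝ)
      ≤ cnt 0 * ((k + j) * (2 * X) ^ j) + D * (∑ u, cnt u : ℕ) := by exact_mod_cast hbound
  have hP0 : (0 : ℝ) ≤ P := by positivity
  nlinarith [mul_le_mul_of_nonneg_left this hP0]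

/-- **Hua's lemma**, discrete form. -/
theorem hua_moment {k : ℕ} (hk : 2 ≤ k) {ε : ℝ} (hε : 0 < ε) (j : ℕ) (hj : 1 ≤ j) (hjk : j ≤ k - 1) :
    ∃ C, 0 ≤ C ∧ ∀ X P : ℕ, [NeZero P] → 1 ≤ X → 2 * (2 ^ k * X ^ k) < P →
      ∑ a : ZMod P, ‖waringSum k X a‖ ^ 2 ^ j ≤ C * (X : ℝ) ^ ((2 : ℝ) ^ j - j + ε) * P := by
  have hDex : ∀ j ≤ k, ∃ C, 0 ≤ C ∧ ∀ X : ℕ, 1 ≤ X → ∀ n : ℕ, n ≠ 0 → n ≤ 2 ^ j * X ^ k →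
      ((k * (2 * #n.divisors) ^ j : ℕ) : ℝ) ≤ C * (X : ℝ) ^ ε := by
    intro j hjk
    set δ : ℝ := ε / (k * k) with hδ
    have hδ0 : 0 < δ := by positivity
    obtain ⟨C, hC, hdiv⟩ := card_divisors_le_rpow hδ0
    refine ⟨k * (2 * (C * ((2 : ℝ) ^ j) ^ δ)) ^ j, by positivity, fun X hX n hn hnX => ?_⟩
    have hX1 : (1 : ℝ) ≤ X := by exact_mod_cast hX
    have h1 : (#n.divisors : ℝ) ≤ C * (((2 : ℝ) ^ j) ^ δ * (X : ℝ) ^ (k * δ)) := by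
      refine (hdiv n hn).trans ?_
      rw [Real.rpow_natCast_mul (by positivity), ← Real.mul_rpow (by positivity) (by positivity)]
      gcongr
      exact_mod_cast hnX
    have h2 : ((X : ℝ) ^ (k * δ)) ^ j ≤ (X : ℝ) ^ ε := by
      rw [← Real.rpow_mul_natCast (by positivity)]
      gcongr
      rw [hδ]
      have hj : (j : ℝ) ≤ k := by exact_mod_cast hjk
      have hk0 : (0 : ℝ) < k := by positivity
      calc (k : ℝ) * (ε / (k * k)) * j ≤ k * (ε / (k * k)) * k := by gcongr
        _ = ε := by field_simp
    push_cast
    calc (k : ℝ) * (2 * #n.divisors) ^ j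
        ≤ k * (2 * (C * (((2 : ℝ) ^ j) ^ δ * (X : ℝ) ^ (k * δ)))) ^ j := by gcongr
      _ = k * (2 * (C * ((2 : ℝ) ^ j) ^ δ)) ^ j * ((X : ℝ) ^ (k * δ)) ^ j := by
          rw [mul_assoc (k : ℝ), ← mul_pow]; ring
      _ ≤ _ := by gcongr
  have hfl : ∀ C : ℝ, 0 ≤ C → ∀ X : ℕ, ∀ N : ℕ, (N : ℝ) ≤ C * (X : ℝ) ^ ε →
      N ≤ ⌊C * (X : ℝ) ^ ε⌋₊ := fun C hC X N h => Nat.le_floor h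
  induction j, hj using Nat.le_induction with
  | base =>
    obtain ⟨C, hC, hD⟩ := hDex 1 (by omega)
    refine ⟨(k + 1) * 2 + C, by positivity, fun X P _ hX hP => ?_⟩
    have hX1 : (1 : ℝ) ≤ X := by exact_mod_cast hX
    have hX0 : (0 : ℝ) < X := by linarith
    have hP' : 2 * (2 ^ 1 * X ^ k) < P := by
      refine lt_of_le_of_lt ?_ hP
      gcongr <;> omega
    have h := sum_mul_diffSum_le (k := k) (j := 1) (X := X) (P := P) (by omega) hP' (fun _ => 1)
      (fun u => if u = 0 then 1 else 0) (fun u => by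
        simp only [Complex.ofReal_one, one_mul]
        rw [sum_stdAddChar_mul]; split_ifs <;> simp)
      ⌊C * (X : ℝ) ^ ε⌋₊ (fun n hn hnX => hfl C hC X _ (hD X hX n hn hnX))
    have hw : ∀ a : ZMod P, ‖waringSum k X a‖ ^ 2 ^ 1 ≤ 1 *
        (diffSum X 1 (Polynomial.X ^ k : ℤ[X]) 1 X (fun n => (ψ (a * (n : ZMod P)) : ℂ))).re := by
      intro a
      rw [waringSum_eq_polySum]
      simpa using norm_polySum_pow_le X 0 a (Polynomial.X ^ k) 1 X (by omega)
    refine ((sum_le_sum fun a _ => hw a).trans h).trans ?_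
    have hf : (⌊C * (X : ℝ) ^ ε⌋₊ : ℝ) ≤ C * (X : ℝ) ^ ε := Nat.floor_le (by positivity)
    have e1 : (X : ℝ) ^ ε ≤ (X : ℝ) ^ ((2 : ℝ) ^ 1 - (1 : ℕ) + ε) := by gcongr; norm_num
    have e2 : (X : ℝ) ≤ (X : ℝ) ^ ((2 : ℝ) ^ 1 - (1 : ℕ) + ε) := by
      nth_rewrite 1 [← Real.rpow_one (X : ℝ)]
      gcongr; norm_num; linarith
    have hsum1 : ∑ _a : ZMod P, (1 : ℝ) = P := by simp [ZMod.card]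
    rw [hsum1, pow_one]
    calc ((k + (1 : ℕ)) * (2 * X) * P + ⌊C * (X : ℝ) ^ ε⌋₊ * (P * 1) : ℝ)
        ≤ (k + 1) * (2 * (X : ℝ) ^ ((2 : ℝ) ^ 1 - (1 : ℕ) + ε)) * P
          + C * (X : ℝ) ^ ((2 : ℝ) ^ 1 - (1 : ℕ) + ε) * (P * 1) := by
          push_cast at e1 e2 ⊢
          gcongr
          exact hf.trans (by gcongr)
      _ = _ := by ring
  | succ j hj ih =>
    obtain ⟨C, hC, hD⟩ := hDex j (by omega)
    obtain ⟨C', hC', hM⟩ := ih (by omega)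
    refine ⟨2 ^ (2 ^ j - j - 1) * ((k + j) * 2 ^ j * C' + C), by positivity, fun X P _ hX hP => ?_⟩
    have hX1 : (1 : ℝ) ≤ X := by exact_mod_cast hX
    have hX0 : (0 : ℝ) < X := by linarith
    obtain ⟨i, rfl⟩ : ∃ i, j = i + 1 := ⟨j - 1, by omega⟩
    have hP' : 2 * (2 ^ (i + 1) * X ^ k) < P := by
      refine lt_of_le_of_lt ?_ hP
      gcongr <;> omega
    obtain ⟨cnt, hcnt⟩ := exists_count_norm_pow (P := P) k X (2 ^ i)
    rw [← pow_succ'] at hcnt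
    have h := sum_mul_diffSum_le (k := k) (j := i + 1) (X := X) (P := P) (by omega) hP' _ cnt hcnt
      ⌊C * (X : ℝ) ^ ε⌋₊ (fun n hn hnX => hfl C hC X _ (hD X hX n hn hnX))
    have hMX := hM X P hX hP
    have hf : (⌊C * (X : ℝ) ^ ε⌋₊ : ℝ) ≤ C * (X : ℝ) ^ ε := Nat.floor_le (by positivity)
    have hlt : i + 2 ≤ 2 ^ (i + 1) := Nat.lt_two_pow_self
    have hf0 : ‖waringSum k X (0 : ZMod P)‖ = X := by simp [waringSum]
    have e1 : (X : ℝ) ^ (2 ^ (i + 1) - (i + 1) - 1) = (X : ℝ) ^ ((2 : ℝ) ^ (i + 1) - (i + 1) - 1) := by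
      rw [← Real.rpow_natCast, Nat.cast_sub (by omega), Nat.cast_sub (by omega)]
      push_cast; rfl
    calc ∑ a : ZMod P, ‖waringSum k X a‖ ^ 2 ^ (i + 1 + 1)
        ≤ ∑ a : ZMod P, ‖waringSum k X a‖ ^ 2 ^ (i + 1) * ((2 * X : ℝ) ^ (2 ^ (i + 1) - i - 2) *
          (diffSum X (i + 1) (Polynomial.X ^ k : ℤ[X]) 1 X
            (fun n => (ψ (a * (n : ZMod P)) : ℂ))).re) := by
          refine sum_le_sum fun a _ => ?_
          rw [pow_succ 2 (i + 1), pow_mul, sq, ← mul_pow, mul_pow]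
          gcongr
          have := norm_polySum_pow_le X i a (Polynomial.X ^ k) 1 X (by omega)
          rwa [← waringSum_eq_polySum] at this
      _ = (2 * X : ℝ) ^ (2 ^ (i + 1) - i - 2) * ∑ a : ZMod P, ‖waringSum k X a‖ ^ 2 ^ (i + 1) *
          (diffSum X (i + 1) (Polynomial.X ^ k : ℤ[X]) 1 X
            (fun n => (ψ (a * (n : ZMod P)) : ℂ))).re := by
          rw [mul_sum]; exact sum_congr rfl fun a _ => by ring
      _ ≤ (2 * X : ℝ) ^ (2 ^ (i + 1) - i - 2) *
          ((k + (i + 1 : ℕ)) * (2 * X) ^ (i + 1) * (C' * (X : ℝ) ^ ((2 : ℝ) ^ (i + 1) - (i + 1 : ℕ) + ε) * P)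
            + C * (X : ℝ) ^ ε * (P * (X : ℝ) ^ 2 ^ (i + 1))) := by
          gcongr
          refine h.trans ?_
          rw [hf0]
          gcongr
      _ = _ := by
          have e2 : (X : ℝ) ^ (i + 1) * (X : ℝ) ^ ((2 : ℝ) ^ (i + 1) - (i + 1 : ℕ) + ε)
              = (X : ℝ) ^ ((2 : ℝ) ^ (i + 1) + ε) := by
            rw [← Real.rpow_natCast, ← Real.rpow_add hX0]; congr 1; ring
          have e3 : (X : ℝ) ^ ε * (X : ℝ) ^ 2 ^ (i + 1) = (X : ℝ) ^ ((2 : ℝ) ^ (i + 1) + ε) := by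
            rw [← Real.rpow_natCast, ← Real.rpow_add hX0]; push_cast; congr 1; ring
          have e4 : (X : ℝ) ^ (2 ^ (i + 1) - (i + 1) - 1) * (X : ℝ) ^ ((2 : ℝ) ^ (i + 1) + ε)
              = (X : ℝ) ^ ((2 : ℝ) ^ (i + 1 + 1) - (i + 1 + 1 : ℕ) + ε) := by
            rw [e1, ← Real.rpow_add hX0]; push_cast; congr 1; ring
          rw [show 2 ^ (i + 1) - i - 2 = 2 ^ (i + 1) - (i + 1) - 1 by omega, ← e4]
          rw [mul_pow, mul_pow]
          linear_combination (2 ^ (2 ^ (i + 1) - (i + 1) - 1) * (X : ℝ) ^ (2 ^ (i + 1) - (i + 1) - 1)) *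
            ((k + (i + 1 : ℕ)) * 2 ^ (i + 1) * C' * P * e2 + C * P * e3)

end

section

variable {p : ℕ} [Fact p.Prime]

theorem norm_waringSum_le {P : ℕ} [NeZero P] (k X : ℕ) (a : ZMod P) : ‖waringSum k X a‖ ≤ X := by
  refine (norm_sum_le _ _).trans ?_
  simp

/-- The two moments beating the trivial bound interpolate to the exponent `k² + 2 - j`. -/
theorem interpolation_exponent {k j : ℝ} (hk : 3 ≤ k) (hj : 1 ≤ j) (hj' : j = 1 ∨ 2 ≤ j) {t : ℝ}
    (ht : t ≤ k) :
    (k - j) * (k - 2 + j) < (1 - 1 / k) * (k ^ 2 + 2 - j - t) := by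
  have hk0 : 0 < k := by linarith
  have h1 : (1 - 1 / k) * (k ^ 2 + 2 - j - k) ≤ (1 - 1 / k) * (k ^ 2 + 2 - j - t) := by
    have : 1 / k ≤ 1 := by rw [div_le_one hk0]; linarith
    exact mul_le_mul_of_nonneg_left (by linarith) (by linarith)
  refine lt_of_lt_of_le ?_ h1
  rw [show (1 - 1 / k) * (k ^ 2 + 2 - j - k)
    = (k - j) * (k - 2 + j) + (j ^ 2 - 3 * j + 3 + (j - 2) / k) by field_simp; ring]
  have h2 : -(1 / 3) ≤ (j - 2) / k := by
    rw [le_div_iff₀ hk0]; nlinarith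
  rcases hj' with rfl | h
  · linarith
  · nlinarith

/-- The minor arcs contribution is negligible. -/
theorem minor_arc_bound {k : ℕ} (hk : 3 ≤ k) (hkp : k < p) {s : ℕ}
    (hs : k ^ 2 + 2 ≤ s + Nat.log 2 k) (C₁ : ℝ) :
    ∃ C η : ℝ, 0 ≤ C ∧ 0 < η ∧ ∀ X P M : ℕ, [NeZero P] → P = p ^ M → 1 ≤ X →
      (p * (2 * X)) ^ k ≤ P → 2 * (k ^ 2 * X ^ (k - 1)) < P → 2 * (2 ^ k * X ^ k) < P →
      (P : ℝ) ≤ C₁ * (X : ℝ) ^ k →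
      ∀ A : Finset (ZMod P), (∀ a ∈ A, IsMinor k X (1 - 1 / k) a) →
        ∑ a ∈ A, ‖waringSum k X a‖ ^ s ≤ C * (X : ℝ) ^ ((s : ℝ) - k - η) * P := by
  obtain ⟨j, hj⟩ : ∃ j, j = Nat.log 2 k := ⟨_, rfl⟩
  rw [← hj] at hs
  have hj1 : 1 ≤ j := hj ▸ Nat.log_pos (by norm_num) (by omega)
  have h2j : 2 ^ j ≤ k := hj ▸ Nat.pow_log_le_self 2 (by omega)
  have hjk : j < 2 ^ j := Nat.lt_two_pow_self
  obtain ⟨s₁, hs₁⟩ : ∃ s₁, s₁ = k ^ 2 + 2 - j := ⟨_, rfl⟩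
  have hkk : 2 * k ≤ k ^ 2 := by nlinarith
  have hss : s₁ ≤ s := by omega
  have hcrit : 2 * crit k = k ^ 2 + k := by rw [two_mul_crit]; ring
  set τ : ℝ := 1 - 1 / (k : ℝ) with hτ
  have hk3 : (3 : ℝ) ≤ k := by exact_mod_cast hk
  have hk0 : (0 : ℝ) < k := by linarith
  have hk1 : 1 / (k : ℝ) ≤ 1 := by rw [div_le_one hk0]; linarith
  have hk2 : 0 < 1 / (k : ℝ) := by positivity
  have hj1R : (1 : ℝ) ≤ j := by exact_mod_cast hj1
  have h2jR : (2 : ℝ) ^ j ≤ k := by exact_mod_cast h2j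
  have hexp := interpolation_exponent hk3 hj1R
    (by rcases hj1.eq_or_lt with h | h
        · left; exact_mod_cast h.symm
        · right; exact_mod_cast h) h2jR
  have hjkR : (j : ℝ) ≤ k - 1 := by
    have : j + 1 ≤ k := by omega
    have : (j : ℝ) + 1 ≤ k := by exact_mod_cast this
    linarith
  have hsu : (0 : ℝ) < (k : ℝ) ^ 2 + 2 - j - 2 ^ j := by nlinarith
  have hvs : (0 : ℝ) < (k : ℝ) - 2 + j := by linarith
  obtain ⟨ν, hν1, hν2⟩ : ∃ ν : ℝ, ((k : ℝ) - j) / ((k : ℝ) ^ 2 + 2 - j - 2 ^ j) < ν ∧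
      ν < τ / ((k : ℝ) - 2 + j) := by
    apply _root_.exists_between
    rw [div_lt_div_iff₀ hsu hvs]; exact hexp
  rw [div_lt_iff₀ hsu] at hν1
  rw [lt_div_iff₀ hvs] at hν2
  set η : ℝ := min (ν * ((k : ℝ) ^ 2 + 2 - j - 2 ^ j) - (k - j)) (τ - ν * ((k : ℝ) - 2 + j)) / 2 with hη
  have hη0 : 0 < η := by
    rw [hη]; apply half_pos; apply lt_min <;> linarith
  have hη1 : 2 * η ≤ ν * ((k : ℝ) ^ 2 + 2 - j - 2 ^ j) - (k - j) := by
    rw [hη, mul_div_cancel₀ _ (by norm_num)]; exact min_le_left _ _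
  have hη2 : 2 * η ≤ τ - ν * ((k : ℝ) - 2 + j) := by
    rw [hη, mul_div_cancel₀ _ (by norm_num)]; exact min_le_right _ _
  obtain ⟨Ca, hCa, hminor⟩ := minor_arc_moment (p := p) (m := k - 2) (by omega) (by omega) (τ := τ) C₁
    (by linarith) (by linarith) hη0
  simp only [show k - 2 + 2 = k by omega, show k - 2 + 1 = k - 1 by omega] at hminor
  obtain ⟨Cb, hCb, hhua⟩ := hua_moment (k := k) (by omega) hη0 j hj1 (by omega)
  refine ⟨Ca + Cb, η, by positivity, hη0, fun X P M _ hPM hX hP1 hP2 hP3 hP4 A hA => ?_⟩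
  have hX1 : (1 : ℝ) ≤ X := by exact_mod_cast hX
  have hX0 : (0 : ℝ) < X := by linarith
  have hP0 : (0 : ℝ) ≤ P := by positivity
  have hM1 := hminor X P M hPM hX hP1 (by
    refine lt_of_le_of_lt ?_ hP2
    have : crit k ≤ k ^ 2 := by omega
    gcongr) hP4 A hA
  have hM2 := hhua X P hX hP3
  rw [hcrit] at hM1
  obtain ⟨l, hl⟩ : ∃ l : ℝ, l = (X : ℝ) ^ (1 - ν) := ⟨_, rfl⟩
  have hl0 : 0 < l := hl ▸ by positivity
  have hpt : ∀ a : ZMod P, ‖waringSum k X a‖ ^ s ≤ (X : ℝ) ^ (s - s₁) *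
      ((l ^ (k - 2 + j))⁻¹ * ‖waringSum k X a‖ ^ (k ^ 2 + k)
        + l ^ (s₁ - 2 ^ j) * ‖waringSum k X a‖ ^ 2 ^ j) := by
    intro a
    set w := ‖waringSum k X a‖ with hw
    have hw0 : 0 ≤ w := norm_nonneg _
    have hwX : w ≤ X := norm_waringSum_le k X a
    have h1 : w ^ s₁ ≤ (l ^ (k - 2 + j))⁻¹ * w ^ (k ^ 2 + k) + l ^ (s₁ - 2 ^ j) * w ^ 2 ^ j := by
      rcases le_total l w with h | h
      · have h2 : w ^ s₁ ≤ (l ^ (k - 2 + j))⁻¹ * w ^ (k ^ 2 + k) := by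
          rw [le_inv_mul_iff₀ (by positivity),
            show k ^ 2 + k = (k - 2 + j) + s₁ by omega, pow_add w]
          exact mul_le_mul_of_nonneg_right (pow_le_pow_left₀ hl0.le h _) (pow_nonneg hw0 _)
        have : 0 ≤ l ^ (s₁ - 2 ^ j) * w ^ 2 ^ j := by positivity
        linarith
      · have h2 : w ^ s₁ ≤ l ^ (s₁ - 2 ^ j) * w ^ 2 ^ j := by
          nth_rewrite 1 [show s₁ = (s₁ - 2 ^ j) + 2 ^ j by omega]
          rw [pow_add]
          exact mul_le_mul_of_nonneg_right (pow_le_pow_left₀ hw0 h _) (pow_nonneg hw0 _)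
        have : 0 ≤ (l ^ (k - 2 + j))⁻¹ * w ^ (k ^ 2 + k) := by positivity
        linarith
    calc w ^ s = w ^ (s - s₁) * w ^ s₁ := by rw [← pow_add, Nat.sub_add_cancel hss]
      _ ≤ _ := by gcongr
  have hs1R : (s₁ : ℝ) = (k : ℝ) ^ 2 + 2 - j := by
    rw [hs₁, Nat.cast_sub (by omega)]; push_cast; ring
  have e0 : (X : ℝ) ^ (s - s₁) = (X : ℝ) ^ ((s : ℝ) - s₁) := by
    rw [← Real.rpow_natCast, Nat.cast_sub hss]
  have e1 : (l ^ (k - 2 + j))⁻¹ = (X : ℝ) ^ (-((1 - ν) * ((k : ℝ) - 2 + j))) := by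
    rw [hl, ← Real.rpow_mul_natCast hX0.le, ← Real.rpow_neg hX0.le]
    rw [Nat.cast_add, Nat.cast_sub (by omega)]; norm_num
  have e2 : l ^ (s₁ - 2 ^ j) = (X : ℝ) ^ ((1 - ν) * ((k : ℝ) ^ 2 + 2 - j - 2 ^ j)) := by
    rw [hl, ← Real.rpow_mul_natCast hX0.le, Nat.cast_sub (by omega), hs1R]; norm_num
  calc ∑ a ∈ A, ‖waringSum k X a‖ ^ s
      ≤ ∑ a ∈ A, (X : ℝ) ^ (s - s₁) *
      ((l ^ (k - 2 + j))⁻¹ * ‖waringSum k X a‖ ^ (k ^ 2 + k)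
        + l ^ (s₁ - 2 ^ j) * ‖waringSum k X a‖ ^ 2 ^ j) := sum_le_sum fun a _ => hpt a
    _ = (X : ℝ) ^ (s - s₁) * ((l ^ (k - 2 + j))⁻¹ * ∑ a ∈ A, ‖waringSum k X a‖ ^ (k ^ 2 + k)
        + l ^ (s₁ - 2 ^ j) * ∑ a ∈ A, ‖waringSum k X a‖ ^ 2 ^ j) := by
        rw [← mul_sum, sum_add_distrib, mul_sum, mul_sum]
    _ ≤ (X : ℝ) ^ (s - s₁) * ((l ^ (k - 2 + j))⁻¹ *
          (Ca * (X : ℝ) ^ ((k : ℝ) ^ 2 - τ + η) * P)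
        + l ^ (s₁ - 2 ^ j) * (Cb * (X : ℝ) ^ ((2 : ℝ) ^ j - j + η) * P)) := by
        gcongr
        exact (sum_le_sum_of_subset_of_nonneg (subset_univ A)
          fun _ _ _ => by positivity).trans hM2
    _ = Ca * ((X : ℝ) ^ ((s : ℝ) - s₁) * (X : ℝ) ^ (-((1 - ν) * ((k : ℝ) - 2 + j))) *
          (X : ℝ) ^ ((k : ℝ) ^ 2 - τ + η)) * P
        + Cb * ((X : ℝ) ^ ((s : ℝ) - s₁) * (X : ℝ) ^ ((1 - ν) * ((k : ℝ) ^ 2 + 2 - j - 2 ^ j)) *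
          (X : ℝ) ^ ((2 : ℝ) ^ j - j + η)) * P := by
        rw [e0, e1, e2]; ring
    _ ≤ Ca * (X : ℝ) ^ ((s : ℝ) - k - η) * P + Cb * (X : ℝ) ^ ((s : ℝ) - k - η) * P := by
        rw [← Real.rpow_add hX0, ← Real.rpow_add hX0, ← Real.rpow_add hX0, ← Real.rpow_add hX0]
        gcongr
        · rw [hs1R]; linarith
        · rw [hs1R]; linarith
    _ = _ := by ring

end

section

local notation "ψ" => (ZMod.stdAddChar : AddChar (ZMod _) ℂ)

/-- The complete exponential sum of `a x ^ k` modulo `q`. -/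
noncomputable def powerGauss (k q : ℕ) (a : ℤ) : ℂ :=
  ∑ x ∈ range q, e ((a * x ^ k : ℤ) / q)

theorem powerGauss_eq_sum (k q : ℕ) [NeZero q] (a : ℤ) :
    powerGauss k q a = ∑ x : ZMod q, ψ ((a : ZMod q) * x ^ k) := by
  rw [powerGauss, ← sum_val_eq_sum_range (fun x => e ((a * x ^ k : ℤ) / q))]
  refine sum_congr rfl fun x _ => ?_
  rw [← stdAddChar_intCast_eq_e]
  simp

theorem norm_powerGauss_le (k q : ℕ) (a : ℤ) : ‖powerGauss k q a‖ ≤ q := by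
  refine (norm_sum_le _ _).trans ?_
  simp [norm_e]

theorem add_pow_of_mul_eq_zero {A : Type*} [CommRing A] {u v : A} (h : u * v = 0) {k : ℕ}
    (hk : 1 ≤ k) : (u + v) ^ k = u ^ k + v ^ k := by
  induction k, hk using Nat.le_induction with
  | base => simp
  | succ n hn ih =>
    obtain ⟨i, rfl⟩ : ∃ i, n = i + 1 := ⟨n - 1, by omega⟩
    rw [pow_succ, ih]
    linear_combination (u ^ i + v ^ i) * h

theorem add_pow_of_sq_eq_zero {A : Type*} [CommRing A] (x : A) {y : A} (h : y ^ 2 = 0) (k : ℕ) :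
    (x + y) ^ k = x ^ k + k * x ^ (k - 1) * y := by
  obtain ⟨c, hc⟩ := (Polynomial.powAddExpansion x y k)
  rw [hc, h]; ring

/-- Multiplicativity of the complete sums. -/
theorem powerGauss_mul {k : ℕ} (hk : 1 ≤ k) {q₁ q₂ : ℕ} (h1 : q₁ ≠ 0) (h2 : q₂ ≠ 0)
    (h : q₁.Coprime q₂) (a : ℤ) :
    powerGauss k (q₁ * q₂) a
      = powerGauss k q₁ (a * q₂ ^ (k - 1)) * powerGauss k q₂ (a * q₁ ^ (k - 1)) := by
  have : NeZero q₁ := ⟨h1⟩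
  have : NeZero q₂ := ⟨h2⟩
  have : NeZero (q₁ * q₂) := ⟨mul_ne_zero h1 h2⟩
  obtain ⟨i, rfl⟩ : ∃ i, k = i + 1 := ⟨k - 1, by omega⟩
  set φ : ZMod q₁ × ZMod q₂ → ZMod (q₁ * q₂) :=
    fun x => (x.1.val * q₂ : ℕ) + (x.2.val * q₁ : ℕ) with hφ
  have hinj : Function.Injective φ := by
    rintro ⟨x, y⟩ ⟨x', y'⟩ hxy
    simp only [hφ] at hxy
    rw [← Nat.cast_add, ← Nat.cast_add, ZMod.natCast_eq_natCast_iff] at hxy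
    ext
    · have h3 := hxy.of_mul_right q₂
      have h4 : x.val * q₂ ≡ x'.val * q₂ [MOD q₁] := by
        have e1 : x.val * q₂ + y.val * q₁ ≡ x.val * q₂ [MOD q₁] := by
          simp [Nat.ModEq]
        have e2 : x'.val * q₂ + y'.val * q₁ ≡ x'.val * q₂ [MOD q₁] := by
          simp [Nat.ModEq]
        exact e1.symm.trans (h3.trans e2)
      have h5 := Nat.ModEq.cancel_right_of_coprime h h4
      rw [← ZMod.natCast_eq_natCast_iff] at h5
      simpa using h5
    · have h3 := hxy.of_mul_left q₁
      have h4 : y.val * q₁ ≡ y'.val * q₁ [MOD q₂] := by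
        have e1 : x.val * q₂ + y.val * q₁ ≡ y.val * q₁ [MOD q₂] := by
          simp [Nat.ModEq]
        have e2 : x'.val * q₂ + y'.val * q₁ ≡ y'.val * q₁ [MOD q₂] := by
          simp [Nat.ModEq]
        exact e1.symm.trans (h3.trans e2)
      have h5 := Nat.ModEq.cancel_right_of_coprime h.symm h4
      rw [← ZMod.natCast_eq_natCast_iff] at h5
      simpa using h5
  have hbij : Function.Bijective φ := by
    rw [Fintype.bijective_iff_injective_and_card]
    exact ⟨hinj, by simp [ZMod.card]⟩
  rw [powerGauss_eq_sum, ← (Equiv.ofBijective φ hbij).sum_comp, Fintype.sum_prod_type,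
    powerGauss_eq_sum, powerGauss_eq_sum, sum_mul_sum]
  refine sum_congr rfl fun x _ => sum_congr rfl fun y _ => ?_
  simp only [Equiv.ofBijective_apply, hφ]
  rw [add_pow_of_mul_eq_zero _ (by omega), mul_add, AddChar.map_add_eq_mul]
  · congr 1
    · have e1 := stdAddChar_intCast_eq_e (P := q₁ * q₂) (a * (x.val * q₂) ^ (i + 1))
      have e2 := stdAddChar_intCast_eq_e (P := q₁) (a * q₂ ^ i * x.val ^ (i + 1))
      push_cast at e1 e2
      rw [ZMod.natCast_zmod_val] at e2
      simp only [Nat.add_sub_cancel]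
      push_cast
      rw [e1, e2]
      congr 1
      have : (q₂ : ℝ) ≠ 0 := by exact_mod_cast h2
      field_simp
      ring
    · have e1 := stdAddChar_intCast_eq_e (P := q₁ * q₂) (a * (y.val * q₁) ^ (i + 1))
      have e2 := stdAddChar_intCast_eq_e (P := q₂) (a * q₁ ^ i * y.val ^ (i + 1))
      push_cast at e1 e2
      rw [ZMod.natCast_zmod_val] at e2
      simp only [Nat.add_sub_cancel]
      push_cast
      rw [e1, e2]
      congr 1
      have : (q₁ : ℝ) ≠ 0 := by exact_mod_cast h1
      field_simp
      ring
  · rw [← Nat.cast_mul, ZMod.natCast_eq_zero_iff]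
    exact ⟨x.val * y.val, by ring⟩

theorem card_pow_eq_le (p : ℕ) [Fact p.Prime] {k : ℕ} (hk : 1 ≤ k) (b : ZMod p) :
    #{x : ZMod p | x ^ k = b} ≤ k := by
  refine le_trans (card_le_card ?_) ((Polynomial.nthRoots k b).toFinset_card_le.trans
    (Polynomial.card_nthRoots k b))
  intro x hx
  rw [Multiset.mem_toFinset, Polynomial.mem_nthRoots (by omega)]
  simpa using hx

/-- Square-root type bound for prime moduli. -/
theorem norm_powerGauss_prime_sq_le {p : ℕ} [hp : Fact p.Prime] {k : ℕ} (hk : 1 ≤ k) {a : ℤ}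
    (ha : ¬ (p : ℤ) ∣ a) : ‖powerGauss k p a‖ ^ 2 ≤ 2 * k ^ 2 * p := by
  have hp2 := hp.out.two_le
  have ha0 : (a : ZMod p) ≠ 0 := by rwa [Ne, ZMod.intCast_zmod_eq_zero_iff_dvd]
  set S : ZMod p → ℂ := fun b => ∑ x : ZMod p, ψ (b * x ^ k) with hS
  have hSa : powerGauss k p a = S a := powerGauss_eq_sum k p a
  have hmean : ∑ b, ‖S b‖ ^ 2 ≤ p * (k * p) := by
    have h1 : ((∑ b, ‖S b‖ ^ 2 : ℝ) : ℂ) = ((p * ∑ x : ZMod p, #{y : ZMod p | y ^ k = x ^ k} : ℕ) : ℂ) := by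
      push_cast
      simp only [← Complex.mul_conj', hS, map_sum, sum_mul_sum, conj_stdAddChar,
        ← AddChar.map_add_eq_mul]
      calc ∑ b : ZMod p, ∑ x : ZMod p, ∑ y : ZMod p, (ψ (b * x ^ k + -(b * y ^ k)) : ℂ)
          = ∑ x : ZMod p, ∑ y : ZMod p, ∑ b : ZMod p, (ψ (b * (x ^ k - y ^ k)) : ℂ) := by
            rw [sum_comm]
            refine sum_congr rfl fun x _ => ?_
            rw [sum_comm]
            refine sum_congr rfl fun y _ => sum_congr rfl fun b _ => ?_
            congr 1; ring
        _ = _ := by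
            simp only [sum_stdAddChar_mul]
            rw [mul_sum]
            refine sum_congr rfl fun x _ => ?_
            rw [← sum_filter, sum_const, nsmul_eq_mul, mul_comm]
            congr 3
            ext y
            simp only [mem_filter, mem_univ, true_and, sub_eq_zero, eq_comm]
    have h2 : (∑ b, ‖S b‖ ^ 2 : ℝ) = ((p * ∑ x : ZMod p, #{y : ZMod p | y ^ k = x ^ k} : ℕ) : ℝ) := by
      exact_mod_cast h1
    rw [h2]
    have h3 : ∑ x : ZMod p, #{y : ZMod p | y ^ k = x ^ k} ≤ p * k := by
      calc _ ≤ ∑ x : ZMod p, k := sum_le_sum fun x _ => card_pow_eq_le p hk _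
        _ = _ := by simp [ZMod.card]
    have h4 : ((p * ∑ x : ZMod p, #{y : ZMod p | y ^ k = x ^ k} : ℕ) : ℝ) ≤ ((p * (p * k) : ℕ) : ℝ) := by
      exact_mod_cast Nat.mul_le_mul_left p h3
    refine h4.trans (le_of_eq ?_)
    push_cast; ring
  have hinv : ∀ c : ZMod p, c ≠ 0 → S (a * c ^ k) = S a := by
    intro c hc
    simp only [hS]
    have h := Equiv.sum_comp (Equiv.mulLeft₀ c hc)
      (fun x : ZMod p => (ψ ((a : ZMod p) * x ^ k) : ℂ))
    rw [← h]
    refine sum_congr rfl fun x _ => ?_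
    congr 1
    change (a : ZMod p) * c ^ k * x ^ k = a * (c * x) ^ k
    ring
  have hcount : ((p : ℝ) - 1) * ‖S a‖ ^ 2 ≤ k * ∑ b, ‖S b‖ ^ 2 := by
    calc ((p : ℝ) - 1) * ‖S a‖ ^ 2 = ∑ c ∈ univ.erase (0 : ZMod p), ‖S (a * c ^ k)‖ ^ 2 := by
          rw [sum_congr rfl fun c hc => by rw [hinv c (ne_of_mem_erase hc)], sum_const,
            card_erase_of_mem (mem_univ _), card_univ, ZMod.card, nsmul_eq_mul,
            Nat.cast_sub (by omega)]
          simp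
      _ ≤ ∑ c : ZMod p, ‖S (a * c ^ k)‖ ^ 2 :=
          sum_le_sum_of_subset_of_nonneg (erase_subset _ _) fun _ _ _ => by positivity
      _ = ∑ b : ZMod p, ∑ c ∈ univ.filter (fun c : ZMod p => a * c ^ k = b), ‖S (a * c ^ k)‖ ^ 2 :=
          (sum_fiberwise _ _ _).symm
      _ ≤ ∑ b : ZMod p, k * ‖S b‖ ^ 2 := by
          refine sum_le_sum fun b _ => ?_
          rw [sum_congr rfl fun c hc => by rw [(mem_filter.mp hc).2], sum_const, nsmul_eq_mul]
          gcongr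
          refine le_trans (card_le_card ?_) (card_pow_eq_le p hk ((a : ZMod p)⁻¹ * b))
          intro c hc
          have := (mem_filter.mp hc).2
          rw [mem_filter]
          refine ⟨mem_univ _, ?_⟩
          rw [← this]; field_simp
      _ = _ := by rw [mul_sum]
  rw [hSa]
  have hp2R : (2 : ℝ) ≤ p := by exact_mod_cast hp2
  have h5 : ((p : ℝ) - 1) * ‖S a‖ ^ 2 ≤ (p - 1) * (2 * k ^ 2 * p) := by
    refine hcount.trans ?_
    calc (k : ℝ) * ∑ b, ‖S b‖ ^ 2 ≤ k * (p * (k * p)) := by gcongr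
      _ = k ^ 2 * p * p := by ring
      _ ≤ k ^ 2 * p * (2 * (p - 1)) := by gcongr; linarith
      _ = _ := by ring
  exact le_of_mul_le_mul_left h5 (by linarith)

end

section

local notation "ψ" => (ZMod.stdAddChar : AddChar (ZMod _) ℂ)

theorem sum_range_mul_of_periodic {M : Type*} [AddCommMonoid M] {f : ℕ → M} {N : ℕ}
    (hf : ∀ x, f (x + N) = f x) (c : ℕ) : ∑ x ∈ range (c * N), f x = c • ∑ x ∈ range N, f x := by
  have hper : ∀ c x, f (c * N + x) = f x := by
    intro c
    induction c with
    | zero => simp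
    | succ c ih => intro x; rw [add_mul, one_mul, add_right_comm, hf, ih]
  induction c with
  | zero => simp
  | succ c ih => rw [add_mul, one_mul, sum_range_add, ih, succ_nsmul]; simp only [hper]

theorem sum_range_e_div (p : ℕ) [NeZero p] (c : ℤ) :
    ∑ t ∈ range p, e ((c * t : ℤ) / p) = if (p : ℤ) ∣ c then (p : ℂ) else 0 := by
  rw [← sum_val_eq_sum_range (fun t => e ((c * t : ℤ) / p))]
  have h := sum_stdAddChar_mul (c : ZMod p)
  simp only [ZMod.intCast_zmod_eq_zero_iff_dvd] at h
  rw [← h]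
  refine sum_congr rfl fun t _ => ?_
  rw [← stdAddChar_intCast_eq_e]
  congr 1
  simp [mul_comm]

/-- Modulo a high power of `p`, only the multiples of `p` contribute to the complete sum. -/
theorem powerGauss_prime_pow_eq {p : ℕ} (hp : p.Prime) {k v k' m : ℕ} (hk : 2 ≤ k)
    (hkv : k = p ^ v * k') (hk' : ¬ p ∣ k') (hm : 2 + 2 * v ≤ m) {a : ℤ} (ha : ¬ (p : ℤ) ∣ a) :
    powerGauss k (p ^ m) a = ∑ z ∈ range (p ^ (m - 1)), e ((a * (p * z) ^ k : ℤ) / (p ^ m : ℕ)) := by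
  have : NeZero (p ^ m) := ⟨by have := hp.pos; positivity⟩
  have : NeZero p := ⟨hp.ne_zero⟩
  have hp0 : (p : ℝ) ≠ 0 := by exact_mod_cast hp.ne_zero
  have hshift : ∀ t : ℕ, powerGauss k (p ^ m) a = ∑ x ∈ range (p ^ m),
      e ((a * x ^ k : ℤ) / (p ^ m : ℕ)) * e ((a * k' * x ^ (k - 1) * t : ℤ) / p) := by
    intro t
    set y : ZMod (p ^ m) := ((p ^ (m - 1 - v) * t : ℕ) : ZMod (p ^ m)) with hy
    have hy2 : y ^ 2 = 0 := by
      rw [hy, ← Nat.cast_pow, ZMod.natCast_eq_zero_iff, mul_pow, ← pow_mul]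
      exact Dvd.dvd.mul_right (pow_dvd_pow _ (by omega)) _
    have hshiftsum := Equiv.sum_comp (Equiv.addRight y)
      (fun x : ZMod (p ^ m) => (ψ ((a : ZMod (p ^ m)) * x ^ k) : ℂ))
    rw [powerGauss_eq_sum, ← hshiftsum, ← sum_val_eq_sum_range (fun x : ℕ =>
      e ((a * x ^ k : ℤ) / (p ^ m : ℕ)) * e ((a * k' * x ^ (k - 1) * t : ℤ) / p))]
    refine sum_congr rfl fun x _ => ?_
    rw [Equiv.coe_addRight, add_pow_of_sq_eq_zero _ hy2, mul_add, AddChar.map_add_eq_mul]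
    have e1 := stdAddChar_intCast_eq_e (P := p ^ m) (a * (x.val : ℤ) ^ k)
    have e2 := stdAddChar_intCast_eq_e (P := p ^ m)
      (a * k' * (x.val : ℤ) ^ (k - 1) * t * p ^ (m - 1))
    have hkp : (k : ZMod (p ^ m)) * y = k' * t * p ^ (m - 1) := by
      have : (p : ZMod (p ^ m)) ^ (m - 1) = p ^ v * p ^ (m - 1 - v) := by
        rw [← pow_add]; congr 1; omega
      rw [hy, this, hkv]; push_cast; ring
    congr 1
    · rw [← e1]; simp
    · have e3 : (a * k' * (x.val : ℤ) ^ (k - 1) * t * p ^ (m - 1) : ℤ) / ((p ^ m : ℕ) : ℝ)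
          = (a * k' * (x.val : ℤ) ^ (k - 1) * t : ℤ) / (p : ℝ) := by
        have : (p : ℝ) ^ m = p ^ (m - 1) * p := by rw [← pow_succ]; congr 1; omega
        push_cast
        rw [this]
        field_simp
      push_cast at e2 e3 ⊢
      rw [← e3, ← e2]
      congr 1
      simp only [ZMod.natCast_zmod_val]
      linear_combination (a : ZMod (p ^ m)) * x ^ (k - 1) * hkp
  have havg : (p : ℂ) * powerGauss k (p ^ m) a = ∑ x ∈ range (p ^ m),
      if p ∣ x then (p : ℂ) * e ((a * x ^ k : ℤ) / (p ^ m : ℕ)) else 0 := by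
    calc (p : ℂ) * powerGauss k (p ^ m) a = ∑ t ∈ range p, powerGauss k (p ^ m) a := by simp
      _ = _ := by
        rw [sum_congr rfl fun t _ => hshift t, sum_comm]
        refine sum_congr rfl fun x _ => ?_
        rw [← mul_sum, sum_range_e_div]
        have hiff : (p : ℤ) ∣ a * k' * x ^ (k - 1) ↔ p ∣ x := by
          have hpi := Nat.prime_iff_prime_int.mp hp
          rw [hpi.dvd_mul, hpi.dvd_mul, hpi.dvd_pow_iff_dvd (by omega), Int.natCast_dvd_natCast,
            Int.natCast_dvd_natCast]
          tauto
        simp only [hiff]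
        split_ifs <;> ring
  have hpC : (p : ℂ) ≠ 0 := by exact_mod_cast hp.ne_zero
  apply mul_left_cancel₀ hpC
  rw [havg, ← sum_filter, ← mul_sum]
  congr 1
  have hpm : p ^ m = p * p ^ (m - 1) := by rw [← pow_succ']; congr 1; omega
  symm
  refine sum_bij (fun z _ => p * z) ?_ ?_ ?_ ?_
  · intro z hz
    rw [mem_range] at hz
    rw [mem_filter, mem_range, hpm]
    exact ⟨Nat.mul_lt_mul_of_pos_left hz hp.pos, dvd_mul_right _ _⟩
  · intro z _ w _ h
    exact Nat.eq_of_mul_eq_mul_left hp.pos h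
  · intro x hx
    rw [mem_filter, mem_range, hpm] at hx
    obtain ⟨hx1, z, rfl⟩ := hx
    exact ⟨z, mem_range.mpr (lt_of_mul_lt_mul_left hx1 (by omega)), rfl⟩
  · intro z _
    push_cast
    rfl

theorem norm_powerGauss_prime_pow_le {p : ℕ} (hp : p.Prime) {k v k' : ℕ} (hk : 2 ≤ k)
    (hkv : k = p ^ v * k') (hk' : ¬ p ∣ k') {K : ℝ} (hK : 1 ≤ K)
    (hsmall : ∀ m, 0 < m → m < 2 + 2 * v → ∀ a : ℤ, ¬ (p : ℤ) ∣ a →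
      ‖powerGauss k (p ^ m) a‖ ≤ K * ((p ^ m : ℕ) : ℝ) ^ (1 - 1 / k : ℝ)) {m : ℕ} (hm : 0 < m)
    {a : ℤ} (ha : ¬ (p : ℤ) ∣ a) :
    ‖powerGauss k (p ^ m) a‖ ≤ K * ((p ^ m : ℕ) : ℝ) ^ (1 - 1 / k : ℝ) := by
  have hp1 : (1 : ℝ) ≤ p := by exact_mod_cast hp.one_lt.le
  have hp0 : (0 : ℝ) < p := by linarith
  have hk0 : (0 : ℝ) < k := by exact_mod_cast (by omega : 0 < k)
  induction m using Nat.strong_induction_on with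
  | _ m ih =>
    by_cases hml : m < 2 + 2 * v
    · exact hsmall m hm hml a ha
    rw [powerGauss_prime_pow_eq hp hk hkv hk' (not_lt.mp hml) ha]
    rcases le_or_gt m k with hmk | hmk
    · calc ‖∑ z ∈ range (p ^ (m - 1)), e ((a * (p * z) ^ k : ℤ) / (p ^ m : ℕ))‖
          ≤ ∑ z ∈ range (p ^ (m - 1)), ‖e ((a * (p * z) ^ k : ℤ) / (p ^ m : ℕ))‖ :=
            norm_sum_le _ _
        _ = (p : ℝ) ^ ((m : ℝ) - 1) := by
            simp only [norm_e, sum_const, card_range, nsmul_eq_mul, mul_one]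
            rw [← Nat.cast_pred hm, Real.rpow_natCast]
            push_cast; rfl
        _ ≤ (p : ℝ) ^ ((m : ℝ) * (1 - 1 / k)) := by
            refine Real.rpow_le_rpow_of_exponent_le hp1 ?_
            have : (m : ℝ) * (1 / k) ≤ 1 := by
              rw [mul_one_div, div_le_one hk0]; exact_mod_cast hmk
            linarith
        _ = ((p ^ m : ℕ) : ℝ) ^ (1 - 1 / k : ℝ) := by
            rw [Real.rpow_mul hp0.le, Real.rpow_natCast]; push_cast; rfl
        _ ≤ _ := le_mul_of_one_le_left (by positivity) hK
    · obtain ⟨i, rfl⟩ : ∃ i, m = k + i := ⟨m - k, by omega⟩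
      have hi : 0 < i := by omega
      have h1 : ∀ z : ℕ, e ((a * (p * z) ^ k : ℤ) / (p ^ (k + i) : ℕ))
          = e ((a * z ^ k : ℤ) / (p ^ i : ℕ)) := by
        intro z
        congr 1
        push_cast
        rw [mul_pow, pow_add]
        field_simp
      have h2 : p ^ (k + i - 1) = p ^ (k - 1) * p ^ i := by rw [← pow_add]; congr 1; omega
      have : NeZero (p ^ i) := ⟨by have := hp.pos; positivity⟩
      have h3 : ∑ z ∈ range (p ^ (k + i - 1)), e ((a * z ^ k : ℤ) / (p ^ i : ℕ))
          = (p ^ (k - 1)) • powerGauss k (p ^ i) a := by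
        rw [h2]
        refine sum_range_mul_of_periodic (fun x => ?_) _
        rw [← stdAddChar_intCast_eq_e, ← stdAddChar_intCast_eq_e]
        congr 1
        have : ((p : ZMod (p ^ i)) ^ i) = 0 := by
          rw [← Nat.cast_pow, ZMod.natCast_self]
        push_cast
        rw [this, add_zero]
      simp only [h1]
      rw [h3, nsmul_eq_mul, norm_mul]
      calc ‖((p ^ (k - 1) : ℕ) : ℂ)‖ * ‖powerGauss k (p ^ i) a‖
          ≤ (p : ℝ) ^ (k - 1) * (K * ((p ^ i : ℕ) : ℝ) ^ (1 - 1 / k : ℝ)) := by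
            rw [Complex.norm_natCast]
            push_cast
            have := ih i (by omega) hi
            push_cast at this
            gcongr
        _ = _ := by
            have h4 : (p : ℝ) ^ (k - 1) = ((p : ℝ) ^ k) ^ (1 - 1 / k : ℝ) := by
              rw [← Real.rpow_natCast (p : ℝ) k, ← Real.rpow_mul hp0.le, mul_sub, mul_one,
                mul_one_div_cancel hk0.ne', ← Nat.cast_pred (by omega), Real.rpow_natCast]
            rw [h4]
            push_cast
            rw [pow_add, Real.mul_rpow (by positivity) (by positivity)]
            ring

/-- Uniform bound for complete exponential sums of `k`-th powers. -/
theorem exists_norm_powerGauss_le {k : ℕ} (hk : 3 ≤ k) :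
    ∃ C : ℝ, 0 ≤ C ∧ ∀ q : ℕ, 1 ≤ q → ∀ a : ℤ, IsCoprime a q →
      ‖powerGauss k q a‖ ≤ C * (q : ℝ) ^ (1 - 1 / k : ℝ) := by
  have hk0 : (0 : ℝ) < k := by exact_mod_cast (by omega : 0 < k)
  have hk3 : (3 : ℝ) ≤ k := by exact_mod_cast hk
  set B : ℕ := 8 * k ^ 6 with hB
  have hk6 : 0 < k ^ 6 := pow_pos (by omega) 6
  have hB1 : 1 ≤ B := by omega
  set K : ℝ := (B : ℝ) ^ (2 + 2 * k) with hKdef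
  have hB1R : (1 : ℝ) ≤ B := by exact_mod_cast hB1
  have hK1 : 1 ≤ K := one_le_pow₀ hB1R
  set Q : ℕ → ℝ → Prop := fun q c => ∀ a : ℤ, IsCoprime a q →
    ‖powerGauss k q a‖ ≤ c * (q : ℝ) ^ (1 - 1 / k : ℝ) with hQ
  have hnd : ∀ {p m : ℕ}, p.Prime → 0 < m → ∀ a : ℤ, IsCoprime a (p ^ m : ℕ) → ¬ (p : ℤ) ∣ a := by
    intro p m hp hm a ha hd
    push_cast at ha
    rw [IsCoprime.pow_right_iff hm] at ha
    exact (Nat.prime_iff_prime_int.mp hp).not_isUnit (ha.isUnit_of_dvd' hd dvd_rfl)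
  have hone : (0 : ℝ) ≤ 1 - 1 / k := by
    rw [sub_nonneg, div_le_one hk0]; linarith
  have hmul : ∀ m n : ℕ, 1 < m → 1 < n → m.Coprime n → ∀ c d : ℝ, 0 ≤ c → 0 ≤ d → Q m c → Q n d →
      Q (m * n) (c * d) := by
    intro m n hm hn hmn c d hc hd hQm hQn a ha
    push_cast at ha
    rw [IsCoprime.mul_right_iff] at ha
    have hmn' : IsCoprime (m : ℤ) n := Nat.isCoprime_iff_coprime.mpr hmn
    rw [powerGauss_mul (by omega) (by omega) (by omega) hmn, norm_mul]
    refine (mul_le_mul (hQm _ (ha.1.mul_left hmn'.symm.pow_left))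
      (hQn _ (ha.2.mul_left hmn'.pow_left)) (norm_nonneg _) (by positivity)).trans (le_of_eq ?_)
    push_cast
    rw [Real.mul_rpow (by positivity) (by positivity)]
    ring
  have hKp : ∀ p m : ℕ, p.Prime → 0 < m → p < B → Q (p ^ m) K := by
    intro p m hp hm hpB a ha
    obtain ⟨v, k', hk', hkv⟩ := Nat.exists_eq_pow_mul_and_not_dvd (n := k) (by omega) p hp.ne_one
    have hv : v < k := by
      refine (Nat.lt_pow_self hp.one_lt).trans_le (Nat.le_of_dvd (by omega) ⟨k', hkv⟩)
    refine norm_powerGauss_prime_pow_le hp (by omega) hkv hk' hK1 ?_ hm (hnd hp hm a ha)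
    intro i hi hil b hb
    have hp1 : (1 : ℝ) ≤ p := by exact_mod_cast hp.one_lt.le
    have hpi : (1 : ℝ) ≤ ((p ^ i : ℕ) : ℝ) := by push_cast; exact one_le_pow₀ hp1
    calc ‖powerGauss k (p ^ i) b‖ ≤ ((p ^ i : ℕ) : ℝ) := norm_powerGauss_le _ _ _
      _ = (p : ℝ) ^ i := by push_cast; rfl
      _ ≤ (B : ℝ) ^ i := by gcongr
      _ ≤ K := pow_le_pow_right₀ hB1R (by omega)
      _ ≤ _ := le_mul_of_one_le_right (by positivity) (Real.one_le_rpow hpi hone)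
  have hBp : ∀ p m : ℕ, p.Prime → 0 < m → B ≤ p → Q (p ^ m) 1 := by
    intro p m hp hm hpB a ha
    have hkB : k < B := by
      calc k ≤ k ^ 6 := Nat.le_self_pow (by norm_num) k
        _ < B := by omega
    refine norm_powerGauss_prime_pow_le hp (by omega) (v := 0) (k' := k) (by simp)
      (Nat.not_dvd_of_pos_of_lt (by omega) (by omega)) le_rfl ?_ hm (hnd hp hm a ha)
    intro i hi hil b hb
    obtain rfl : i = 1 := by omega
    have : Fact p.Prime := ⟨hp⟩
    have hp1 : (1 : ℝ) ≤ p := by exact_mod_cast hp.one_lt.le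
    have hp0 : (0 : ℝ) < p := by linarith
    rw [pow_one, one_mul]
    have h := norm_powerGauss_prime_sq_le (k := k) (by omega) hb
    refine le_of_sq_le_sq (h.trans ?_) (by positivity)
    have h13 : (2 * k ^ 2 : ℝ) ≤ (p : ℝ) ^ (1 / 3 : ℝ) := by
      have hpB' : ((2 * k ^ 2 : ℝ)) ^ 3 ≤ p := by
        calc ((2 * k ^ 2 : ℝ)) ^ 3 = (B : ℝ) := by rw [hB]; push_cast; ring
          _ ≤ p := by exact_mod_cast hpB
      calc (2 * k ^ 2 : ℝ) = ((2 * k ^ 2 : ℝ) ^ 3) ^ (1 / 3 : ℝ) := by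
            rw [← Real.rpow_natCast (2 * k ^ 2 : ℝ) 3, ← Real.rpow_mul (by positivity)]; norm_num
        _ ≤ _ := Real.rpow_le_rpow (by positivity) hpB' (by norm_num)
    calc (2 * k ^ 2 * p : ℝ) ≤ (p : ℝ) ^ (1 / 3 : ℝ) * p := by gcongr
      _ = (p : ℝ) ^ (4 / 3 : ℝ) := by
          rw [← Real.rpow_add_one hp0.ne']; norm_num
      _ ≤ (p : ℝ) ^ ((1 - 1 / k : ℝ) * 2) := by
          refine Real.rpow_le_rpow_of_exponent_le hp1 ?_
          have : (1 : ℝ) / k ≤ 1 / 3 := one_div_le_one_div_of_le (by norm_num) hk3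
          linarith
      _ = _ := by rw [Real.rpow_mul hp0.le]; norm_cast
  have hKp' : ∀ p m : ℕ, p.Prime → 0 < m → Q (p ^ m) K := by
    intro p m hp hm
    by_cases h : p < B
    · exact hKp p m hp hm h
    · intro a ha
      refine (hBp p m hp hm (not_lt.mp h) a ha).trans ?_
      gcongr
  have h1 : Q 1 1 := by
    intro a _
    simpa using norm_powerGauss_le k 1 a
  refine ⟨K ^ B, by positivity, fun q hq a ha => ?_⟩
  obtain ⟨i, hi, h⟩ := exists_bound_of_coprime_mul hK1 B h1 hmul hKp' hBp
    (n := q) (by omega)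
  refine (h a ha).trans ?_
  gcongr

end

/-- The coefficients of `(1 - T) ^ (-a)`. -/
noncomputable def riesz (a : ℝ) : ℕ → ℝ
  | 0 => 1
  | m + 1 => riesz a m * ((a + m) / (m + 1))

theorem riesz_succ_mul (a : ℝ) (m : ℕ) : (m + 1) * riesz a (m + 1) = (a + m) * riesz a m := by
  rw [riesz]; field_simp

theorem riesz_nonneg {a : ℝ} (ha : 0 ≤ a) (m : ℕ) : 0 ≤ riesz a m := by
  induction m with
  | zero => simp [riesz]
  | succ m ih => rw [riesz]; positivity

theorem riesz_antitone {a : ℝ} (ha : 0 ≤ a) (ha1 : a ≤ 1) : Antitone (riesz a) := by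
  refine antitone_nat_of_succ_le fun m => ?_
  rw [riesz]
  refine mul_le_of_le_one_right (riesz_nonneg ha m) ?_
  rw [div_le_one (by positivity)]
  linarith

theorem riesz_one (m : ℕ) : riesz 1 m = 1 := by
  induction m with
  | zero => simp [riesz]
  | succ m ih => rw [riesz, ih, one_mul, add_comm, div_self (by positivity)]

theorem riesz_zero_succ (m : ℕ) : riesz 0 (m + 1) = 0 := by
  induction m with
  | zero => simp [riesz]
  | succ m ih => rw [riesz, ih, zero_mul]

/-- The Chu–Vandermonde identity. -/
theorem sum_antidiagonal_riesz (a c : ℝ) (m : ℕ) :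
    ∑ x ∈ antidiagonal m, riesz a x.1 * riesz c x.2 = riesz (a + c) m := by
  induction m with
  | zero => simp [riesz]
  | succ m ih =>
    have h : ((m : ℝ) + 1) * ∑ x ∈ antidiagonal (m + 1), riesz a x.1 * riesz c x.2
        = (a + c + m) * ∑ x ∈ antidiagonal m, riesz a x.1 * riesz c x.2 := by
      calc ((m : ℝ) + 1) * ∑ x ∈ antidiagonal (m + 1), riesz a x.1 * riesz c x.2
          = ∑ x ∈ antidiagonal (m + 1), (x.1 * riesz a x.1) * riesz c x.2
            + ∑ x ∈ antidiagonal (m + 1), riesz a x.1 * (x.2 * riesz c x.2) := by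
            rw [mul_sum, ← sum_add_distrib]
            refine sum_congr rfl fun x hx => ?_
            have : (x.1 : ℝ) + x.2 = m + 1 := by exact_mod_cast mem_antidiagonal.mp hx
            rw [← this]; ring
        _ = ∑ x ∈ antidiagonal m, ((a + x.1) * riesz a x.1) * riesz c x.2
            + ∑ x ∈ antidiagonal m, riesz a x.1 * ((c + x.2) * riesz c x.2) := by
            rw [Nat.sum_antidiagonal_succ, Nat.sum_antidiagonal_succ']
            congr 1
            · simp only [← riesz_succ_mul]; push_cast; simp
            · simp only [← riesz_succ_mul]; push_cast; simp
        _ = _ := by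
            rw [mul_sum, ← sum_add_distrib]
            refine sum_congr rfl fun x hx => ?_
            have : (x.1 : ℝ) + x.2 = m := by exact_mod_cast mem_antidiagonal.mp hx
            rw [← this]; ring
    rw [ih, ← riesz_succ_mul] at h
    exact mul_left_cancel₀ (by positivity) h

theorem sum_range_riesz (a : ℝ) (m : ℕ) : ∑ i ∈ range (m + 1), riesz a i = riesz (1 + a) m := by
  rw [add_comm 1 a, ← sum_antidiagonal_riesz, Nat.sum_antidiagonal_eq_sum_range_succ
    (fun i j => riesz a i * riesz 1 j)]
  simp [riesz_one]

theorem mk_riesz_pow (a : ℝ) (s : ℕ) :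
    (PowerSeries.mk (riesz a)) ^ s = PowerSeries.mk (riesz (s * a)) := by
  induction s with
  | zero =>
    ext m
    cases m with
    | zero => simp [riesz]
    | succ m => simp [riesz_zero_succ, PowerSeries.coeff_one]
  | succ s ih =>
    ext m
    rw [pow_succ, ih, PowerSeries.coeff_mul]
    simp only [PowerSeries.coeff_mk]
    rw [sum_antidiagonal_riesz]
    congr 1
    push_cast; ring

theorem Gamma_mul_riesz {a : ℝ} (ha : 0 < a) (m : ℕ) :
    Real.Gamma a * riesz a m = Real.Gamma (m + a) / m.factorial := by
  induction m with
  | zero => simp [riesz]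
  | succ m ih =>
    have h : Real.Gamma ((m + 1 : ℕ) + a) = (m + a) * Real.Gamma (m + a) := by
      rw [← Real.Gamma_add_one (by positivity)]; congr 1; push_cast; ring
    rw [riesz, ← mul_assoc, ih, h, Nat.factorial_succ]
    push_cast
    field_simp
    ring

theorem rpow_le_Gamma_add_div {a : ℝ} (ha : 0 < a) (ha1 : a < 1) (m : ℕ) :
    (m : ℝ) ^ a ≤ Real.Gamma (m + (1 + a)) / m.factorial ∧
      Real.Gamma (m + (1 + a)) / m.factorial ≤ ((m : ℝ) + 1) ^ a := by
  have hf : (0 : ℝ) < m.factorial := by positivity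
  have h0 : Real.Gamma (m + 1) = m.factorial := Real.Gamma_nat_eq_factorial m
  constructor
  · rw [le_div_iff₀ hf]
    have h1 := Real.Gamma_mul_add_mul_le_rpow_Gamma_mul_rpow_Gamma (s := m + a) (t := m + (1 + a))
      (a := a) (b := 1 - a) (by positivity) (by positivity) ha (by linarith) (by ring)
    rw [show a * (m + a) + (1 - a) * (m + (1 + a)) = m + 1 by ring, h0] at h1
    have h2 : Real.Gamma (m + (1 + a)) = (m + a) * Real.Gamma (m + a) := by
      rw [← Real.Gamma_add_one (by positivity)]; congr 1; ring
    have hG : 0 < Real.Gamma (m + (1 + a)) := Real.Gamma_pos_of_pos (by positivity)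
    have hG' : 0 < Real.Gamma (m + a) := Real.Gamma_pos_of_pos (by positivity)
    calc (m : ℝ) ^ a * m.factorial
        ≤ (m + a) ^ a * (Real.Gamma (m + a) ^ a * Real.Gamma (m + (1 + a)) ^ (1 - a)) := by
          gcongr; linarith
      _ = ((m + a) * Real.Gamma (m + a)) ^ a * Real.Gamma (m + (1 + a)) ^ (1 - a) := by
          rw [Real.mul_rpow (by positivity) hG'.le]; ring
      _ = Real.Gamma (m + (1 + a)) := by
          rw [← h2, ← Real.rpow_add hG, add_sub_cancel, Real.rpow_one]
  · rw [div_le_iff₀ hf]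
    have h1 := Real.Gamma_mul_add_mul_le_rpow_Gamma_mul_rpow_Gamma (s := m + 1) (t := m + 1 + 1)
      (a := 1 - a) (b := a) (by positivity) (by positivity) (by linarith) ha (by ring)
    rw [show (1 - a) * (m + 1) + a * (m + 1 + 1) = m + (1 + a) by ring,
      Real.Gamma_add_one (s := (m : ℝ) + 1) (by positivity), h0,
      Real.mul_rpow (by positivity) (by positivity)] at h1
    calc _ ≤ _ := h1
      _ = ((m : ℝ) + 1) ^ a * ((m.factorial : ℝ) ^ (1 - a) * (m.factorial : ℝ) ^ a) := by ring
      _ = _ := by rw [← Real.rpow_add hf]; simp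

/-- The density of `k`-th powers, as weights (`a = 1 / k`). -/
noncomputable def powWeight (a : ℝ) (m : ℕ) : ℝ := Real.Gamma (1 + a) * riesz a m

theorem sum_powWeight_bounds {a : ℝ} (ha : 0 < a) (ha1 : a < 1) (N : ℕ) :
    (N : ℝ) ^ a - 1 ≤ ∑ i ∈ range N, powWeight a i ∧
      ∑ i ∈ range N, powWeight a i ≤ (N : ℝ) ^ a := by
  cases N with
  | zero => simp [Real.zero_rpow ha.ne']
  | succ m =>
    simp only [powWeight]
    rw [← mul_sum, sum_range_riesz, Gamma_mul_riesz (by linarith)]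
    obtain ⟨h1, h2⟩ := rpow_le_Gamma_add_div ha ha1 m
    push_cast
    refine ⟨?_, h2⟩
    have := Real.rpow_add_le_add_rpow (Nat.cast_nonneg (α := ℝ) m) zero_le_one ha.le ha1.le
    rw [Real.one_rpow] at this
    linarith

theorem powWeight_nonneg {a : ℝ} (ha : 0 ≤ a) (m : ℕ) : 0 ≤ powWeight a m :=
  mul_nonneg (Real.Gamma_pos_of_pos (by linarith)).le (riesz_nonneg ha m)

theorem powWeight_antitone {a : ℝ} (ha : 0 ≤ a) (ha1 : a ≤ 1) : Antitone (powWeight a) :=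
  fun _ _ h => mul_le_mul_of_nonneg_left (riesz_antitone ha ha1 h)
    (Real.Gamma_pos_of_pos (by linarith)).le

theorem powWeight_le {a : ℝ} (ha : 0 < a) (ha1 : a < 1) (N : ℕ) :
    powWeight a N ≤ ((N : ℝ) + 1) ^ (a - 1) := by
  have h := (sum_powWeight_bounds ha ha1 (N + 1)).2
  have h2 : ((N : ℝ) + 1) * powWeight a N ≤ ∑ i ∈ range (N + 1), powWeight a i := by
    calc ((N : ℝ) + 1) * powWeight a N = ∑ i ∈ range (N + 1), powWeight a N := by simp
      _ ≤ _ := sum_le_sum fun i hi =>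
        powWeight_antitone ha.le ha1.le (Nat.lt_succ_iff.mp (mem_range.mp hi))
  push_cast at h
  rw [Real.rpow_sub_one (by positivity), le_div_iff₀ (by positivity)]
  linarith

theorem tendsto_riesz_div {a : ℝ} (ha : 0 < a) :
    Filter.Tendsto (fun n : ℕ => riesz a n / (n : ℝ) ^ (a - 1)) Filter.atTop
      (nhds (Real.Gamma a)⁻¹) := by
  have h1 := Real.GammaSeq_tendsto_Gamma a
  have h2 : Filter.Tendsto (fun n : ℕ => (n : ℝ) / (n + a)) Filter.atTop (nhds 1) :=
    tendsto_natCast_div_add_atTop a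
  have h3 := h2.mul (h1.inv₀ (Real.Gamma_pos_of_pos ha).ne')
  rw [one_mul] at h3
  refine h3.congr' ?_
  filter_upwards [Filter.eventually_gt_atTop 0] with n hn
  have hn0 : (0 : ℝ) < n := by exact_mod_cast hn
  have hprod : ∀ m : ℕ, riesz a m * m.factorial = ∏ j ∈ range m, (a + j) := by
    intro m
    induction m with
    | zero => simp [riesz]
    | succ m ih =>
      rw [prod_range_succ, ← ih, riesz, Nat.factorial_succ]; push_cast; field_simp
  have hr : riesz a n = (∏ j ∈ range n, (a + j)) / n.factorial := by
    rw [← hprod]; field_simp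
  have hpos : 0 < ∏ j ∈ range n, (a + (j : ℝ)) := prod_pos fun j _ => by positivity
  rw [Real.GammaSeq, prod_range_succ, Real.rpow_sub_one hn0.ne', hr]
  have : (n : ℝ) ^ a ≠ 0 := by positivity
  field_simp
  ring

section

theorem norm_one_sub_e_le (t : ℝ) : ‖1 - e t‖ ≤ 2 * Real.pi * distInt t := by
  have h : e t = e (t - round t) := by
    rw [sub_eq_add_neg, ← Int.cast_neg, e_add_intCast]
  rw [h, norm_sub_rev, distInt]
  have := Real.norm_exp_I_mul_ofReal_sub_one_le (x := 2 * Real.pi * (t - round t))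
  rw [Real.norm_eq_abs, abs_mul, abs_of_pos (by positivity)] at this
  refine le_of_eq_of_le ?_ this
  congr 2
  unfold e
  congr 1
  push_cast; ring

/-- Partial summation, with bounded partial sums. -/
theorem norm_sum_mul_pow_le {d : ℕ → ℂ} {N : ℕ} {M : ℝ}
    (hd : ∀ m ≤ N, ‖∑ i ∈ range m, d i‖ ≤ M) {z : ℂ} (hz : ‖z‖ = 1) :
    ‖∑ i ∈ range N, d i * z ^ i‖ ≤ M * (1 + N * ‖1 - z‖) := by
  have key : ∀ m, ∑ i ∈ range m, d i * z ^ i = (∑ i ∈ range m, d i) * z ^ m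
      + (1 - z) * ∑ l ∈ range m, (∑ i ∈ range (l + 1), d i) * z ^ l := by
    intro m
    induction m with
    | zero => simp
    | succ m ih =>
      rw [sum_range_succ, ih, sum_range_succ (fun l => (∑ i ∈ range (l + 1), d i) * z ^ l),
        sum_range_succ d]
      ring
  rw [key]
  refine (norm_add_le _ _).trans ?_
  rw [norm_mul, norm_mul, norm_pow, hz, one_pow, mul_one]
  have h1 : ‖∑ l ∈ range N, (∑ i ∈ range (l + 1), d i) * z ^ l‖ ≤ N * M := by
    calc _ ≤ ∑ l ∈ range N, ‖(∑ i ∈ range (l + 1), d i) * z ^ l‖ := norm_sum_le _ _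
      _ ≤ ∑ l ∈ range N, M := by
        refine sum_le_sum fun l hl => ?_
        rw [norm_mul, norm_pow, hz, one_pow, mul_one]
        exact hd _ (by rw [mem_range] at hl; omega)
      _ = _ := by simp
  calc _ ≤ M + ‖1 - z‖ * (N * M) := by gcongr; exact hd N le_rfl
    _ = _ := by ring

/-- Partial summation, with monotone weights. -/
theorem norm_sum_antitone_mul_pow_le {b : ℕ → ℝ} (hb : Antitone b) (hb0 : ∀ m, 0 ≤ b m) {z : ℂ}
    (hz : ‖z‖ = 1) {M N : ℕ} (h : M ≤ N) :
    ‖1 - z‖ * ‖∑ m ∈ Ico M N, (b m : ℂ) * z ^ m‖ ≤ 2 * b M := by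
  have key : ‖(1 - z) * ∑ m ∈ Ico M N, (b m : ℂ) * z ^ m + b N * z ^ N‖ ≤ 2 * b M - b N := by
    induction N, h using Nat.le_induction with
    | base => simp [hz, abs_of_nonneg (hb0 M)]; linarith
    | succ N hN ih =>
      rw [sum_Ico_succ_top hN]
      have h1 : (1 - z) * (∑ m ∈ Ico M N, (b m : ℂ) * z ^ m + b N * z ^ N) + b (N + 1) * z ^ (N + 1)
          = ((1 - z) * ∑ m ∈ Ico M N, (b m : ℂ) * z ^ m + b N * z ^ N)
            + -((b N - b (N + 1) : ℝ) : ℂ) * z ^ (N + 1) := by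
        push_cast; ring
      rw [h1]
      refine (norm_add_le _ _).trans ?_
      have h2 : ‖-((b N - b (N + 1) : ℝ) : ℂ) * z ^ (N + 1)‖ = b N - b (N + 1) := by
        rw [norm_mul, norm_pow, hz, one_pow, mul_one, norm_neg, Complex.norm_real,
          Real.norm_of_nonneg (sub_nonneg.mpr (hb N.le_succ))]
      rw [h2]; linarith
  rw [← norm_mul]
  have h3 : ‖(b N : ℂ) * z ^ N‖ = b N := by
    rw [norm_mul, norm_pow, hz, one_pow, mul_one, Complex.norm_real, Real.norm_of_nonneg (hb0 N)]
  have h4 := norm_sub_le ((1 - z) * ∑ m ∈ Ico M N, (b m : ℂ) * z ^ m + b N * z ^ N) (b N * z ^ N)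
  rw [add_sub_cancel_right, h3] at h4
  linarith

/-- The approximation to the exponential sum near `0`. -/
noncomputable def powKernel (a : ℝ) (N : ℕ) (t : ℝ) : ℂ :=
  ∑ m ∈ range N, (powWeight a m : ℂ) * e t ^ m

theorem norm_powKernel_le {a : ℝ} (ha : 0 < a) (ha1 : a < 1) (N : ℕ) (t : ℝ) :
    ‖powKernel a N t‖ ≤ (N : ℝ) ^ a := by
  refine (norm_sum_le _ _).trans ((le_of_eq ?_).trans (sum_powWeight_bounds ha ha1 N).2)
  refine sum_congr rfl fun m _ => ?_
  rw [norm_mul, norm_pow, norm_e, one_pow, mul_one, Complex.norm_real,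
    Real.norm_of_nonneg (powWeight_nonneg ha.le m)]

theorem norm_powKernel_le_distInt {a : ℝ} (ha : 0 < a) (ha1 : a < 1) (N : ℕ) {t D : ℝ}
    (hD : 0 < D) (hDt : D ≤ distInt t) :
    ‖powKernel a N t‖ ≤ 2 * D ^ (-a) := by
  have hD2 : D ≤ 1 / 2 := hDt.trans (distInt_le_half t)
  have hDa : (1 / D) ^ a = D ^ (-a) := by
    rw [one_div, Real.inv_rpow hD.le, Real.rpow_neg hD.le]
  have hDa0 : 0 < D ^ (-a) := by positivity
  obtain ⟨L, hL⟩ : ∃ L, L = ⌊1 / D⌋₊ := ⟨_, rfl⟩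
  have hL1 : (L : ℝ) ≤ 1 / D := by rw [hL]; exact Nat.floor_le (by positivity)
  have hL2 : 1 / D < (L : ℝ) + 1 := by rw [hL]; exact Nat.lt_floor_add_one _
  rcases le_or_gt N L with h | h
  · calc ‖powKernel a N t‖ ≤ (N : ℝ) ^ a := norm_powKernel_le ha ha1 N t
      _ ≤ (1 / D) ^ a := by
        refine Real.rpow_le_rpow (by positivity) (le_trans ?_ hL1) ha.le
        exact_mod_cast h
      _ ≤ _ := by rw [hDa]; linarith
  · have hsplit : powKernel a N t = powKernel a L t
        + ∑ m ∈ Ico L N, (powWeight a m : ℂ) * e t ^ m := by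
      rw [powKernel, powKernel, sum_range_add_sum_Ico _ h.le]
    have h1 : ‖powKernel a L t‖ ≤ D ^ (-a) := by
      rw [← hDa]
      exact (norm_powKernel_le ha ha1 L t).trans (Real.rpow_le_rpow (by positivity) hL1 ha.le)
    have h2 := norm_sum_antitone_mul_pow_le (powWeight_antitone ha.le ha1.le)
      (powWeight_nonneg ha.le) (norm_e t) h.le
    have h3 : 4 * D ≤ ‖1 - e t‖ := by
      have := four_mul_distInt_le t
      linarith
    have h4 : powWeight a L ≤ D ^ (1 - a) := by
      calc powWeight a L ≤ ((L : ℝ) + 1) ^ (a - 1) := powWeight_le ha ha1 L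
        _ ≤ (1 / D) ^ (a - 1) :=
          Real.rpow_le_rpow_of_nonpos (by positivity) hL2.le (by linarith)
        _ = _ := by rw [one_div, Real.inv_rpow hD.le, ← Real.rpow_neg hD.le]; congr 1; ring
    have h5 : 4 * D * ‖∑ m ∈ Ico L N, (powWeight a m : ℂ) * e t ^ m‖ ≤ 2 * D ^ (1 - a) := by
      calc _ ≤ ‖1 - e t‖ * ‖∑ m ∈ Ico L N, (powWeight a m : ℂ) * e t ^ m‖ := by gcongr
        _ ≤ _ := h2
        _ ≤ _ := by linarith
    have h6 : D ^ (1 - a) = D * D ^ (-a) := by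
      rw [sub_eq_add_neg, Real.rpow_add hD, Real.rpow_one]
    have h7 : ‖∑ m ∈ Ico L N, (powWeight a m : ℂ) * e t ^ m‖ ≤ D ^ (-a) := by
      rw [h6] at h5
      have : D * ‖∑ m ∈ Ico L N, (powWeight a m : ℂ) * e t ^ m‖ ≤ D * D ^ (-a) := by
        nlinarith [norm_nonneg (∑ m ∈ Ico L N, (powWeight a m : ℂ) * e t ^ m)]
      exact le_of_mul_le_mul_left this hD
    rw [hsplit]
    refine (norm_add_le _ _).trans ?_
    linarith

/-- The polynomial whose value at `e t` is `powKernel a N t`. -/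
noncomputable def powPoly (a : ℝ) (N : ℕ) : Polynomial ℝ :=
  PowerSeries.trunc N (PowerSeries.mk (powWeight a))

theorem mk_powWeight_pow (a : ℝ) (s : ℕ) : (PowerSeries.mk (powWeight a)) ^ s
    = PowerSeries.mk fun m => Real.Gamma (1 + a) ^ s * riesz (s * a) m := by
  have h : PowerSeries.mk (powWeight a)
      = PowerSeries.C (Real.Gamma (1 + a)) * PowerSeries.mk (riesz a) := by
    ext m; simp [powWeight]
  rw [h, mul_pow, mk_riesz_pow, ← map_pow]
  ext m
  rw [PowerSeries.coeff_C_mul, PowerSeries.coeff_mk, PowerSeries.coeff_mk]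

theorem powPoly_pow_coeff_of_lt (a : ℝ) (s : ℕ) {n N : ℕ} (h : n < N) :
    (powPoly a N ^ s).coeff n = Real.Gamma (1 + a) ^ s * riesz (s * a) n := by
  have h1 := PowerSeries.trunc_trunc_pow (PowerSeries.mk (powWeight a)) N s
  have h2 := congrArg (fun p => Polynomial.coeff p n) h1
  simp only [PowerSeries.coeff_trunc, if_pos h] at h2
  rw [mk_powWeight_pow, PowerSeries.coeff_mk] at h2
  rw [← h2, powPoly, ← Polynomial.coe_pow, Polynomial.coeff_coe]

theorem powPoly_pow_coeff_bounds {a : ℝ} (ha : 0 ≤ a) (s n N : ℕ) :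
    0 ≤ (powPoly a N ^ s).coeff n ∧
      (powPoly a N ^ s).coeff n ≤ Real.Gamma (1 + a) ^ s * riesz (s * a) n := by
  have h0 : ∀ i, 0 ≤ (powPoly a N).coeff i ∧ (powPoly a N).coeff i ≤ powWeight a i := by
    intro i
    rw [powPoly, PowerSeries.coeff_trunc, PowerSeries.coeff_mk]
    have := powWeight_nonneg ha i
    split_ifs
    · exact ⟨this, le_rfl⟩
    · exact ⟨le_rfl, this⟩
  have key : ∀ s n, 0 ≤ (powPoly a N ^ s).coeff n ∧
      (powPoly a N ^ s).coeff n ≤ PowerSeries.coeff n ((PowerSeries.mk (powWeight a)) ^ s) := by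
    intro s
    induction s with
    | zero =>
      intro n
      rw [pow_zero, pow_zero, Polynomial.coeff_one, PowerSeries.coeff_one]
      by_cases h : n = 0 <;> simp [h]
    | succ s ih =>
      intro n
      rw [pow_succ, pow_succ, Polynomial.coeff_mul, PowerSeries.coeff_mul]
      refine ⟨sum_nonneg fun x _ => mul_nonneg (ih _).1 (h0 _).1, sum_le_sum fun x _ => ?_⟩
      rw [PowerSeries.coeff_mk]
      exact mul_le_mul (ih _).2 (h0 _).2 (h0 _).1 ((ih _).1.trans (ih _).2)
  have := key s n
  rwa [mk_powWeight_pow, PowerSeries.coeff_mk] at this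

theorem powPoly_pow_natDegree_le (a : ℝ) (s N : ℕ) :
    (powPoly a (N + 1) ^ s).natDegree ≤ s * N := by
  refine Polynomial.natDegree_pow_le_of_le s ?_
  have := PowerSeries.natDegree_trunc_lt (PowerSeries.mk (powWeight a)) N
  rw [powPoly]; omega

theorem powKernel_pow (a : ℝ) (s N : ℕ) (t : ℝ) : powKernel a (N + 1) t ^ s
    = ∑ j ∈ range (s * N + 1), ((powPoly a (N + 1) ^ s).coeff j : ℂ) * e (j * t) := by
  have h1 : powKernel a (N + 1) t = (powPoly a (N + 1)).eval₂ Complex.ofRealHom (e t) := by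
    rw [powPoly, PowerSeries.eval₂_trunc_eq_sum_range]
    simp [powKernel]
  rw [h1, ← Polynomial.eval₂_pow,
    Polynomial.eval₂_eq_sum_range' _ (Nat.lt_succ_of_le (powPoly_pow_natDegree_le a s N))]
  refine sum_congr rfl fun j _ => ?_
  rw [e_nat_mul]; rfl

end

section

local notation "ψ" => (ZMod.stdAddChar : AddChar (ZMod _) ℂ)

theorem natCast_sub_eq_zero_iff {P i j : ℕ} (hi : i < P) (hj : j < P) :
    (i : ZMod P) - j = 0 ↔ i = j := by
  rw [sub_eq_zero, ZMod.natCast_eq_natCast_iff, Nat.ModEq, Nat.mod_eq_of_lt hi, Nat.mod_eq_of_lt hj]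

variable {P : ℕ} [NeZero P]

/-- Parseval's identity on `ZMod P`. -/
theorem sum_norm_sq_sum_range {J : ℕ} (hJ : J ≤ P) (d : ℕ → ℂ) :
    ∑ u : ZMod P, ‖∑ j ∈ range J, d j * (ψ (u * (j : ZMod P)) : ℂ)‖ ^ 2
      = P * ∑ j ∈ range J, ‖d j‖ ^ 2 := by
  have h : ((∑ u : ZMod P, ‖∑ j ∈ range J, d j * (ψ (u * (j : ZMod P)) : ℂ)‖ ^ 2 : ℝ) : ℂ)
      = ((P * ∑ j ∈ range J, ‖d j‖ ^ 2 : ℝ) : ℂ) := by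
    push_cast
    calc ∑ u : ZMod P, (‖∑ j ∈ range J, d j * (ψ (u * (j : ZMod P)) : ℂ)‖ : ℂ) ^ 2
        = ∑ u : ZMod P, ∑ i ∈ range J, ∑ j ∈ range J,
            d i * (starRingEnd ℂ) (d j) * (ψ (u * ((i : ZMod P) - (j : ZMod P))) : ℂ) := by
          refine sum_congr rfl fun u _ => ?_
          rw [← Complex.mul_conj', map_sum, sum_mul_sum]
          refine sum_congr rfl fun i _ => sum_congr rfl fun j _ => ?_
          rw [RingHom.map_mul, conj_stdAddChar, mul_sub, sub_eq_add_neg, AddChar.map_add_eq_mul]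
          ring
      _ = ∑ i ∈ range J, ∑ j ∈ range J, d i * (starRingEnd ℂ) (d j) *
            ∑ u : ZMod P, (ψ (u * ((i : ZMod P) - (j : ZMod P))) : ℂ) := by
          rw [sum_comm]
          refine sum_congr rfl fun i _ => ?_
          rw [sum_comm]
          refine sum_congr rfl fun j _ => ?_
          rw [mul_sum]
      _ = ∑ i ∈ range J, ∑ j ∈ range J, if i = j then (P : ℂ) * (‖d i‖ : ℂ) ^ 2 else 0 := by
          refine sum_congr rfl fun i hi => sum_congr rfl fun j hj => ?_
          rw [mem_range] at hi hj
          rw [sum_stdAddChar_mul]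
          by_cases hij : i = j
          · subst hij
            rw [if_pos (sub_self _), if_pos rfl, ← Complex.mul_conj']; ring
          · rw [if_neg (mt (natCast_sub_eq_zero_iff (by omega) (by omega)).mp hij), if_neg hij,
              mul_zero]
      _ = _ := by
          rw [mul_sum]
          refine sum_congr rfl fun i hi => ?_
          rw [sum_ite_eq, if_pos hi]
  exact_mod_cast h

theorem e_mul_val_div_sub (u : ZMod P) (j : ℕ) (β : ℝ) :
    e (j * ((u.val : ℝ) / P - β)) = e (-(j * β)) * (ψ (u * (j : ZMod P)) : ℂ) := by
  have h := stdAddChar_intCast_eq_e (P := P) (u.val * j)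
  push_cast at h
  rw [ZMod.natCast_zmod_val] at h
  rw [h, ← e_add]
  congr 1; ring

theorem powKernel_pow_grid (a : ℝ) (s N : ℕ) (u : ZMod P) (β : ℝ) :
    powKernel a (N + 1) ((u.val : ℝ) / P - β) ^ s = ∑ j ∈ range (s * N + 1),
      (((powPoly a (N + 1) ^ s).coeff j : ℂ) * e (-(j * β))) * (ψ (u * (j : ZMod P)) : ℂ) := by
  rw [powKernel_pow]
  refine sum_congr rfl fun j _ => ?_
  rw [e_mul_val_div_sub]; ring

/-- The `2k`-th moment of the kernel over a shifted grid. -/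
theorem sum_norm_powKernel_pow_le {k : ℕ} (hk : 1 ≤ k) {N : ℕ} (hP : k * N < P) (β : ℝ) :
    ∑ u : ZMod P, ‖powKernel (1 / k) (N + 1) ((u.val : ℝ) / P - β)‖ ^ (2 * k)
      ≤ P * ((k * N + 1) * (Real.Gamma (1 + 1 / k) ^ k) ^ 2) := by
  have hk0 : (k : ℝ) ≠ 0 := by positivity
  have ha : (0 : ℝ) ≤ 1 / k := by positivity
  calc ∑ u : ZMod P, ‖powKernel (1 / k) (N + 1) ((u.val : ℝ) / P - β)‖ ^ (2 * k)
      = P * ∑ j ∈ range (k * N + 1),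
          ‖((powPoly (1 / k) (N + 1) ^ k).coeff j : ℂ) * e (-(j * β))‖ ^ 2 := by
        rw [← sum_norm_sq_sum_range (by omega)]
        refine sum_congr rfl fun u _ => ?_
        rw [← powKernel_pow_grid, norm_pow, ← pow_mul, mul_comm k 2]
    _ ≤ P * ∑ j ∈ range (k * N + 1), (Real.Gamma (1 + 1 / k) ^ k) ^ 2 := by
        gcongr with j _
        rw [norm_mul, norm_e, mul_one, Complex.norm_real]
        obtain ⟨h1, h2⟩ := powPoly_pow_coeff_bounds ha k j (N + 1)
        rw [Real.norm_of_nonneg h1]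
        rwa [mul_one_div_cancel hk0, riesz_one, mul_one] at h2
    _ = _ := by simp

/-- The singular integral, as an exact identity. -/
theorem sum_powKernel_pow_mul {a : ℝ} {s N n : ℕ} (hsN : s * N < P) (hn : n ≤ N) (hs : 1 ≤ s)
    (β : ℝ) :
    ∑ u : ZMod P, powKernel a (N + 1) ((u.val : ℝ) / P - β) ^ s * (ψ (-(u * (n : ZMod P))) : ℂ)
      = P * (((Real.Gamma (1 + a) ^ s * riesz (s * a) n : ℝ) : ℂ) * e (-(n * β))) := by
  have hnP : n < P := by nlinarith
  simp only [powKernel_pow_grid, sum_mul]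
  rw [sum_comm]
  have h1 : ∀ j ∈ range (s * N + 1), ∑ u : ZMod P, (((powPoly a (N + 1) ^ s).coeff j : ℂ) *
      e (-(j * β))) * (ψ (u * (j : ZMod P)) : ℂ) * (ψ (-(u * (n : ZMod P))) : ℂ)
      = if j = n then P * (((powPoly a (N + 1) ^ s).coeff j : ℂ) * e (-(j * β))) else 0 := by
    intro j hj
    rw [mem_range] at hj
    simp only [mul_assoc, ← AddChar.map_add_eq_mul, ← mul_neg, ← mul_add]
    rw [← mul_sum, ← mul_sum, ← sub_eq_add_neg, sum_stdAddChar_mul]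
    by_cases hjn : j = n
    · subst hjn; rw [if_pos (sub_self _), if_pos rfl]; ring
    · rw [if_neg (mt (natCast_sub_eq_zero_iff (by omega) hnP).mp hjn), if_neg hjn]; ring
  rw [sum_congr rfl h1, sum_ite_eq', if_pos (mem_range.mpr (by nlinarith)),
    powPoly_pow_coeff_of_lt a s (by omega)]

theorem norm_sum_range_sub_le_of_periodic {g : ℕ → ℂ} {q : ℕ} (hq : 1 ≤ q)
    (hg : ∀ x, g (x + q) = g x) (h1 : ∀ x, ‖g x‖ ≤ 1) (Y : ℕ) :
    ‖∑ m ∈ range Y, g m - Y / q * ∑ m ∈ range q, g m‖ ≤ 2 * q := by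
  have hq0 : (q : ℂ) ≠ 0 := by exact_mod_cast (by omega : q ≠ 0)
  have hq0R : (0 : ℝ) < q := by exact_mod_cast hq
  have hY : Y / q * q + Y % q = Y := by rw [mul_comm]; exact Nat.div_add_mod Y q
  have hr : Y % q ≤ q := (Nat.mod_lt _ hq).le
  have hper : ∀ c x, g (c * q + x) = g x := by
    intro c
    induction c with
    | zero => simp
    | succ c ih => intro x; rw [add_mul, one_mul, add_right_comm, hg, ih]
  have hsum : ∀ N, ‖∑ m ∈ range N, g m‖ ≤ N := fun N =>
    (norm_sum_le _ _).trans ((sum_le_sum fun m _ => h1 m).trans (by simp))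
  have h2 : ∑ m ∈ range Y, g m - Y / q * ∑ m ∈ range q, g m
      = ∑ m ∈ range (Y % q), g m - (Y % q : ℕ) / q * ∑ m ∈ range q, g m := by
    have h3 : (Y : ℂ) = (Y / q : ℕ) * q + (Y % q : ℕ) := by exact_mod_cast hY.symm
    have h4 : ∑ m ∈ range Y, g m
        = (Y / q : ℕ) * ∑ m ∈ range q, g m + ∑ m ∈ range (Y % q), g m := by
      conv_lhs => rw [← hY, sum_range_add, sum_range_mul_of_periodic hg, nsmul_eq_mul]
      simp only [hper]
    rw [h4, h3]
    field_simp
    ring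
  rw [h2]
  refine (norm_sub_le _ _).trans ?_
  rw [norm_mul, norm_div, Complex.norm_natCast, Complex.norm_natCast]
  have hrR : ((Y % q : ℕ) : ℝ) ≤ q := by exact_mod_cast hr
  calc _ ≤ ((Y % q : ℕ) : ℝ) + (Y % q : ℕ) / q * q := by gcongr; exacts [hsum _, hsum _]
    _ = (Y % q : ℕ) + (Y % q : ℕ) := by field_simp
    _ ≤ _ := by linarith

theorem e_powerGauss_add (k q : ℕ) (hq : 1 ≤ q) (b : ℤ) (x : ℕ) :
    e ((b * (x + q : ℕ) ^ k : ℤ) / q) = e ((b * x ^ k : ℤ) / q) := by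
  have : NeZero q := ⟨by omega⟩
  rw [← stdAddChar_intCast_eq_e, ← stdAddChar_intCast_eq_e]
  congr 1
  push_cast
  rw [ZMod.natCast_self, add_zero]

theorem le_floor_rpow_iff {k : ℕ} (hk : 1 ≤ k) (m t : ℕ) :
    m ≤ ⌊(t : ℝ) ^ (1 / k : ℝ)⌋₊ ↔ m ^ k ≤ t := by
  rw [Nat.le_floor_iff (by positivity), one_div,
    Real.le_rpow_inv_iff_of_pos (by positivity) (by positivity) (by positivity)]
  norm_cast

/-- Approximation of the exponential sum near a rational point. -/
theorem norm_waringSum_sub_le {k : ℕ} (hk : 2 ≤ k) {X n : ℕ} (hX : X ^ k ≤ n)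
    (hn : n < (X + 1) ^ k) {q : ℕ} (hq : 1 ≤ q) (b : ℤ) (u : ZMod P) :
    ‖waringSum k X u - (q : ℂ)⁻¹ * powerGauss k q b *
        powKernel (1 / k) (n + 1) ((u.val : ℝ) / P - b / q)‖
      ≤ 6 * q * (1 + (n + 1) * (2 * Real.pi * distInt ((u.val : ℝ) / P - b / q))) := by
  have hq0 : (q : ℂ) ≠ 0 := by exact_mod_cast (by omega : q ≠ 0)
  have hq0R : (0 : ℝ) < q := by exact_mod_cast hq
  have hq1 : (1 : ℝ) ≤ q := by exact_mod_cast hq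
  have hk0 : (0 : ℝ) < k := by exact_mod_cast (by omega : 0 < k)
  have ha : (0 : ℝ) < 1 / k := by positivity
  have ha1 : (1 : ℝ) / k < 1 := by
    rw [div_lt_one hk0]; exact_mod_cast (by omega : 1 < k)
  obtain ⟨γ, hγ⟩ : ∃ γ, γ = (u.val : ℝ) / P - b / q := ⟨_, rfl⟩
  obtain ⟨S, hS⟩ : ∃ S, S = (q : ℂ)⁻¹ * powerGauss k q b := ⟨_, rfl⟩
  have hS1 : ‖S‖ ≤ 1 := by
    rw [hS, norm_mul, norm_inv, Complex.norm_natCast, inv_mul_le_iff₀ hq0R, mul_one]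
    exact norm_powerGauss_le _ _ _
  rw [← hγ, ← hS]
  set g : ℕ → ℂ := fun x => e ((b * x ^ k : ℤ) / q) with hg
  set c : ℕ → ℂ := fun l => ∑ m ∈ Icc 1 X, if m ^ k = l then g m else 0 with hc
  have hf : waringSum k X u = ∑ l ∈ range (n + 1), c l * e γ ^ l := by
    simp only [hc, sum_mul]
    rw [sum_comm, waringSum]
    refine sum_congr rfl fun m hm => ?_
    rw [mem_Icc] at hm
    have hmn : m ^ k < n + 1 := Nat.lt_succ_of_le ((Nat.pow_le_pow_left hm.2 k).trans hX)
    simp only [ite_mul, zero_mul]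
    rw [sum_ite_eq, if_pos (mem_range.mpr hmn), ← e_nat_mul, hγ, e_mul_val_div_sub]
    push_cast
    rw [← mul_assoc, hg, ← e_add]
    have : ((b * m ^ k : ℤ) : ℝ) / q + -((m : ℝ) ^ k * (b / q)) = 0 := by push_cast; ring
    rw [this, e_zero, one_mul]
  have hd : ∀ t ≤ n + 1, ‖∑ l ∈ range t, (c l - S * (powWeight (1 / k) l : ℂ))‖ ≤ 6 * q := by
    intro t ht
    cases t with
    | zero => simp
    | succ t =>
      obtain ⟨Y, hY⟩ : ∃ Y, Y = ⌊(t : ℝ) ^ (1 / k : ℝ)⌋₊ := ⟨_, rfl⟩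
      have hYX : Y ≤ X := by
        have h1 : Y ^ k ≤ t := (le_floor_rpow_iff (by omega) Y t).mp hY.le
        have h2 : Y < X + 1 :=
          lt_of_pow_lt_pow_left₀ k (by omega) (by omega : Y ^ k < (X + 1) ^ k)
        omega
      have hcs : ∑ l ∈ range (t + 1), c l = ∑ m ∈ range (Y + 1), g m - g 0 := by
        have h2 : ∑ l ∈ range (t + 1), c l = ∑ m ∈ Icc 1 Y, g m := by
          simp only [hc]
          rw [sum_comm]
          simp only [sum_ite_eq]
          rw [← sum_filter]
          congr 1
          ext m
          simp only [mem_filter, mem_Icc, mem_range, Nat.lt_succ_iff]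
          rw [← le_floor_rpow_iff (by omega), ← hY]
          omega
        rw [h2, range_eq_Ico, sum_eq_sum_Ico_succ_bot (by omega)]
        simp only [zero_add, add_sub_cancel_left]
        rfl
      have h3 := norm_sum_range_sub_le_of_periodic hq (g := g)
        (fun x => e_powerGauss_add k q hq b x) (fun x => (norm_e _).le) (Y + 1)
      have h4 : ∑ l ∈ range (t + 1), (c l - S * (powWeight (1 / k) l : ℂ))
          = (∑ m ∈ range (Y + 1), g m - ((Y + 1 : ℕ) : ℂ) / q * ∑ m ∈ range q, g m) - g 0
            + S * ((Y + 1 - ∑ l ∈ range (t + 1), powWeight (1 / k) l : ℝ) : ℂ) := by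
        have hSg : powerGauss k q b = ∑ x ∈ range q, g x := rfl
        rw [sum_sub_distrib, hcs, ← mul_sum, hS, hSg]
        push_cast
        field_simp
        ring
      have h5 : |(Y + 1 - ∑ l ∈ range (t + 1), powWeight (1 / k) l : ℝ)| ≤ 2 := by
        obtain ⟨h6, h7⟩ := sum_powWeight_bounds ha ha1 (t + 1)
        have h8 : (Y : ℝ) ≤ (t : ℝ) ^ (1 / k : ℝ) := by
          rw [hY]; exact Nat.floor_le (by positivity)
        have h9 : (t : ℝ) ^ (1 / k : ℝ) < Y + 1 := by rw [hY]; exact Nat.lt_floor_add_one _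
        have h10 := Real.rpow_add_le_add_rpow (Nat.cast_nonneg (α := ℝ) t) zero_le_one ha.le ha1.le
        have h11 : (t : ℝ) ^ (1 / k : ℝ) ≤ ((t : ℝ) + 1) ^ (1 / k : ℝ) :=
          Real.rpow_le_rpow (by positivity) (by linarith) ha.le
        rw [Real.one_rpow] at h10
        push_cast at h6 h7
        rw [abs_le]
        constructor <;> linarith
      rw [h4]
      refine (norm_add_le _ _).trans ?_
      have h12 := norm_sub_le
        (∑ m ∈ range (Y + 1), g m - ((Y + 1 : ℕ) : ℂ) / q * ∑ m ∈ range q, g m) (g 0)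
      have h13 : ‖g 0‖ = 1 := norm_e _
      have h14 : ‖S * ((Y + 1 - ∑ l ∈ range (t + 1), powWeight (1 / k) l : ℝ) : ℂ)‖ ≤ 1 * 2 := by
        rw [norm_mul, Complex.norm_real]
        exact mul_le_mul hS1 h5 (norm_nonneg _) zero_le_one
      linarith
  have h := norm_sum_mul_pow_le hd (norm_e γ)
  have h2 : ∑ l ∈ range (n + 1), (c l - S * (powWeight (1 / k) l : ℂ)) * e γ ^ l
      = waringSum k X u - S * powKernel (1 / k) (n + 1) γ := by
    rw [hf, powKernel, mul_sum, ← sum_sub_distrib]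
    refine sum_congr rfl fun l _ => by ring
  rw [h2] at h
  refine h.trans ?_
  push_cast
  gcongr
  exact norm_one_sub_e_le γ

end

/-- Reduced fractions `b / q` in `(0, 1]`. -/
def unitResidues (q : ℕ) : Finset ℕ := (Icc 1 q).filter fun b => Nat.gcd b q = 1

theorem mem_unitResidues {q b : ℕ} : b ∈ unitResidues q ↔ (1 ≤ b ∧ b ≤ q) ∧ Nat.gcd b q = 1 := by
  rw [unitResidues, mem_filter, mem_Icc]

theorem card_unitResidues_le (q : ℕ) : (unitResidues q).card ≤ q :=
  (card_filter_le _ _).trans (by simp)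

/-- The pairs `(q, b)` of denominators `q ≤ Q` and numerators of reduced fractions `b / q`. -/
def farey (Q : ℕ) : Finset (Σ _ : ℕ, ℕ) := (Icc 1 Q).sigma unitResidues

theorem mem_farey {Q : ℕ} {x : Σ _ : ℕ, ℕ} :
    x ∈ farey Q ↔ (1 ≤ x.1 ∧ x.1 ≤ Q) ∧ (1 ≤ x.2 ∧ x.2 ≤ x.1) ∧ Nat.gcd x.2 x.1 = 1 := by
  rw [farey, mem_sigma, mem_unitResidues, mem_Icc]

theorem card_farey_le (Q : ℕ) : (farey Q).card ≤ Q ^ 2 := by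
  rw [farey, card_sigma]
  calc ∑ q ∈ Icc 1 Q, (unitResidues q).card ≤ ∑ q ∈ Icc 1 Q, Q :=
        sum_le_sum fun q hq => (card_unitResidues_le q).trans (mem_Icc.mp hq).2
    _ = _ := by simp [sq]

section

variable {P : ℕ} [NeZero P]

/-- The major arc around `b / q`. -/
noncomputable def majorArc (P : ℕ) [NeZero P] (δ : ℝ) (x : Σ _ : ℕ, ℕ) : Finset (ZMod P) :=
  univ.filter fun u => x.1 * distInt ((u.val : ℝ) / P - x.2 / x.1) ≤ δ

theorem mem_majorArc {δ : ℝ} {x : Σ _ : ℕ, ℕ} {u : ZMod P} :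
    u ∈ majorArc P δ x ↔ x.1 * distInt ((u.val : ℝ) / P - x.2 / x.1) ≤ δ := by
  simp [majorArc]

theorem inv_le_distInt_div {N : ℕ} (hN : 0 < N) {z : ℤ} (hz : ¬ (N : ℤ) ∣ z) :
    1 / (N : ℝ) ≤ distInt ((z : ℝ) / N) := by
  have hN0 : (0 : ℝ) < N := by exact_mod_cast hN
  obtain ⟨m, hm⟩ : ∃ m, m = round ((z : ℝ) / N) := ⟨_, rfl⟩
  have h1 : z - N * m ≠ 0 := fun h => hz ⟨m, by omega⟩
  have h2 : (1 : ℝ) ≤ |((z - N * m : ℤ) : ℝ)| := by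
    rw [← Int.cast_abs]; exact_mod_cast Int.one_le_abs h1
  have h3 : (z : ℝ) / N - m = ((z - N * m : ℤ) : ℝ) / N := by
    push_cast; field_simp
  rw [distInt, ← hm, h3, abs_div, abs_of_pos hN0]
  gcongr

theorem distInt_sub_le (s t : ℝ) : distInt (s - t) ≤ distInt s + distInt t := by
  have h := distInt_le (s - t) (round s - round t)
  push_cast at h
  rw [show s - t - ((round s : ℝ) - round t) = (s - round s) - (t - round t) by ring] at h
  exact h.trans (abs_sub _ _)

/-- Distinct major arcs are disjoint. -/
theorem majorArc_disjoint {Q : ℕ} {δ : ℝ} (hδ : 2 * Q * δ < 1) {x y : Σ _ : ℕ, ℕ}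
    (hx : x ∈ farey Q) (hy : y ∈ farey Q) (hxy : x ≠ y) :
    Disjoint (majorArc P δ x) (majorArc P δ y) := by
  obtain ⟨q, b⟩ := x
  obtain ⟨r, c⟩ := y
  obtain ⟨⟨hq, hqQ⟩, ⟨hb, hbq⟩, hbg⟩ := mem_farey.mp hx
  obtain ⟨⟨hr, hrQ⟩, ⟨hc, hcr⟩, hcg⟩ := mem_farey.mp hy
  simp only at hq hqQ hb hbq hbg hr hrQ hc hcr hcg
  rw [disjoint_left]
  intro u hu hv
  rw [mem_majorArc] at hu hv
  simp only at hu hv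
  have hq0 : (0 : ℝ) < q := by exact_mod_cast hq
  have hr0 : (0 : ℝ) < r := by exact_mod_cast hr
  by_cases hdvd : ((q * r : ℕ) : ℤ) ∣ (c * q - b * r : ℤ)
  · have h1 : (q : ℤ) ∣ b * r := by
      have h2 : (q : ℤ) ∣ c * q - b * r := (Dvd.intro _ (by push_cast; rfl)).trans hdvd
      have := dvd_sub (Dvd.intro_left (c : ℤ) rfl : (q : ℤ) ∣ c * q) h2
      simpa using this
    have h3 : (r : ℤ) ∣ c * q := by
      have h2 : (r : ℤ) ∣ c * q - b * r :=
        (Dvd.intro_left (q : ℤ) (by push_cast; rfl)).trans hdvd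
      have := dvd_add h2 (Dvd.intro_left (b : ℤ) rfl : (r : ℤ) ∣ b * r)
      simpa using this
    have h4 : q ∣ r := by
      have : q ∣ b * r := by exact_mod_cast h1
      exact (Nat.Coprime.symm hbg).dvd_of_dvd_mul_left this
    have h5 : r ∣ q := by
      have : r ∣ c * q := by exact_mod_cast h3
      exact (Nat.Coprime.symm hcg).dvd_of_dvd_mul_left this
    have h6 : q = r := Nat.dvd_antisymm h4 h5
    subst h6
    have h7 : (q : ℤ) ∣ c - b := by
      rw [← sub_mul, Nat.cast_mul] at hdvd
      exact Int.dvd_of_mul_dvd_mul_right (by omega) hdvd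
    have h8 : (c : ℤ) - b = 0 := by
      apply Int.eq_zero_of_abs_lt_dvd h7
      rw [abs_lt]; constructor <;> omega
    exact hxy (by rw [show b = c by omega])
  · have h1 := inv_le_distInt_div (Nat.mul_pos hq hr) hdvd
    have h2 : ((c * q - b * r : ℤ) : ℝ) / ((q * r : ℕ) : ℝ)
        = ((u.val : ℝ) / P - b / q) - ((u.val : ℝ) / P - c / r) := by
      push_cast; field_simp; ring
    rw [h2] at h1
    have h3 := h1.trans (distInt_sub_le _ _)
    obtain ⟨d₁, hd₁⟩ : ∃ d, d = distInt ((u.val : ℝ) / P - b / q) := ⟨_, rfl⟩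
    obtain ⟨d₂, hd₂⟩ : ∃ d, d = distInt ((u.val : ℝ) / P - c / r) := ⟨_, rfl⟩
    rw [← hd₁] at hu h3
    rw [← hd₂] at hv h3
    have hd₁0 : 0 ≤ d₁ := hd₁ ▸ distInt_nonneg _
    have hqQ' : (q : ℝ) ≤ Q := by exact_mod_cast hqQ
    have hrQ' : (r : ℝ) ≤ Q := by exact_mod_cast hrQ
    have hδ0 : 0 ≤ δ := (mul_nonneg hq0.le hd₁0).trans hu
    rw [Nat.cast_mul, div_le_iff₀ (by positivity)] at h3
    have h4 : 1 ≤ r * δ + q * δ := by nlinarith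
    nlinarith

/-- Points outside of the major arcs lie on the minor arcs. -/
theorem isMinor_of_notMem {k X : ℕ} {τ : ℝ} {u : ZMod P}
    (hu : ∀ x ∈ farey ⌊(X : ℝ) ^ τ⌋₊, u ∉ majorArc P ((X : ℝ) ^ (τ - k)) x) :
    IsMinor k X τ u := by
  intro q hq hqX b
  by_contra! hcon
  obtain ⟨α, hα⟩ : ∃ α, α = (u.val : ℝ) / P := ⟨_, rfl⟩
  rw [← hα] at hcon
  obtain ⟨g, hg⟩ : ∃ g, g = Int.gcd b q := ⟨_, rfl⟩
  have hg0 : 0 < g := hg ▸ Int.gcd_pos_of_ne_zero_right _ (by omega)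
  obtain ⟨b', hb'⟩ : (g : ℤ) ∣ b := hg ▸ Int.gcd_dvd_left _ _
  obtain ⟨q', hq'⟩ : g ∣ q := by
    have := hg ▸ Int.gcd_dvd_right b q; exact_mod_cast this
  have hq'0 : 0 < q' := Nat.pos_of_ne_zero (by rintro rfl; omega)
  have hcop : Int.gcd b' q' = 1 := by
    have h1 := Int.gcd_mul_left g b' q'
    rw [← hb', show ((g : ℤ) * q') = (q : ℕ) by rw [hq']; push_cast; rfl, ← hg,
      Int.natAbs_natCast] at h1
    exact Nat.eq_of_mul_eq_mul_left hg0 (by omega)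
  -- reduce the numerator to a representative between 1 and the denominator
  obtain ⟨c, hc⟩ : ∃ c : ℤ, c = (b' - 1) % q' + 1 := ⟨_, rfl⟩
  have hc1 : 1 ≤ c ∧ c ≤ q' := by
    have h1 := Int.emod_nonneg (b' - 1) (by omega : (q' : ℤ) ≠ 0)
    have h2 := Int.emod_lt_of_pos (b' - 1) (by omega : (0 : ℤ) < q')
    omega
  obtain ⟨m, hm⟩ : ∃ m : ℤ, b' = c + q' * m :=
    ⟨(b' - 1) / q', by have := Int.emod_add_mul_ediv (b' - 1) q'; omega⟩
  lift c to ℕ using by omega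
  have hgR : (1 : ℝ) ≤ g := by exact_mod_cast hg0
  have hq'R : (0 : ℝ) < q' := by exact_mod_cast hq'0
  refine hu ⟨q', c⟩ (mem_farey.mpr ⟨⟨hq'0, ?_⟩, ⟨?_, ?_⟩, ?_⟩) ?_
  · refine Nat.le_floor (le_trans ?_ hqX)
    exact_mod_cast hq' ▸ Nat.le_mul_of_pos_left q' hg0
  · exact_mod_cast hc1.1
  · exact_mod_cast hc1.2
  · have h1 : Int.gcd (c + q' * m) q' = Int.gcd c q' := by simp
    rw [← hm, hcop] at h1
    exact h1.symm
  · rw [mem_majorArc]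
    simp only
    rw [← hα]
    have h1 := distInt_le (α - c / q') m
    have h2 : q' * |α - c / q' - m| = |q' * α - b'| := by
      rw [← abs_of_pos hq'R, ← abs_mul, abs_of_pos hq'R, hm]
      congr 1; push_cast; field_simp; ring
    have h3 : |(q : ℝ) * α - b| = g * |q' * α - b'| := by
      rw [show (q : ℝ) * α - b = g * (q' * α - b') by rw [hq', hb']; push_cast; ring, abs_mul,
        Nat.abs_cast]
    have h4 := abs_nonneg ((q' : ℝ) * α - b')
    calc q' * distInt (α - c / q') ≤ q' * |α - c / q' - m| := by gcongr
      _ ≤ g * |q' * α - b'| := by rw [h2]; nlinarith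
      _ ≤ _ := h3 ▸ hcon

theorem card_majorArc_le {δ : ℝ} (hδ : 0 ≤ δ) {x : Σ _ : ℕ, ℕ} (hx : 1 ≤ x.1) :
    ((majorArc P δ x).card : ℝ) ≤ 4 * δ * P + 1 := by
  have hP : (0 : ℝ) < P := by exact_mod_cast NeZero.pos P
  rcases (majorArc P δ x).eq_empty_or_nonempty with h | ⟨v, hv⟩
  · rw [h, card_empty, Nat.cast_zero]; positivity
  have hx1 : (1 : ℝ) ≤ x.1 := by exact_mod_cast hx
  have hle : ∀ u ∈ majorArc P δ x, distInt ((u.val : ℝ) / P - x.2 / x.1) ≤ δ := by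
    intro u hu
    rw [mem_majorArc] at hu
    nlinarith [distInt_nonneg ((u.val : ℝ) / P - x.2 / x.1)]
  have hsub : majorArc P δ x ⊆ (Icc (-(⌊2 * δ * P⌋₊ : ℤ)) ⌊2 * δ * P⌋₊).image
      fun j : ℤ => v + (j : ZMod P) := by
    intro u hu
    obtain ⟨m, hm⟩ : ∃ m, m = round ((u.val : ℝ) / P - v.val / P) := ⟨_, rfl⟩
    have h1 := distInt_sub_le ((u.val : ℝ) / P - x.2 / x.1) ((v.val : ℝ) / P - x.2 / x.1)
    rw [sub_sub_sub_cancel_right, distInt, ← hm] at h1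
    obtain ⟨j, hj⟩ : ∃ j : ℤ, j = u.val - v.val - P * m := ⟨_, rfl⟩
    have h2 : |(j : ℝ)| ≤ 2 * δ * P := by
      have h3 : (j : ℝ) = P * ((u.val : ℝ) / P - v.val / P - m) := by
        rw [hj]; push_cast; field_simp
      rw [h3, abs_mul, abs_of_pos hP, mul_comm]
      gcongr
      linarith [hle u hu, hle v hv]
    have h4 : j.natAbs ≤ ⌊2 * δ * P⌋₊ := by
      refine Nat.le_floor ?_
      rwa [Nat.cast_natAbs, Int.cast_abs]
    rw [mem_image]
    refine ⟨j, mem_Icc.mpr (by omega), ?_⟩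
    rw [hj]; push_cast
    rw [ZMod.natCast_zmod_val, ZMod.natCast_zmod_val, ZMod.natCast_self]
    ring
  have h5 := (card_le_card hsub).trans card_image_le
  rw [Int.card_Icc] at h5
  have h6 : (majorArc P δ x).card ≤ 2 * ⌊2 * δ * P⌋₊ + 1 := by omega
  have h7 : ((majorArc P δ x).card : ℝ) ≤ 2 * ⌊2 * δ * P⌋₊ + 1 := by exact_mod_cast h6
  have h8 := Nat.floor_le (by positivity : 0 ≤ 2 * δ * P)
  linarith

end

theorem norm_pow_succ_sub_pow_succ_le {f v : ℂ} {B : ℝ} (hf : ‖f‖ ≤ B) (hv : ‖v‖ ≤ B) (t : ℕ) :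
    ‖f ^ (t + 1) - v ^ (t + 1)‖ ≤ (t + 1) * B ^ t * ‖f - v‖ := by
  have hB : 0 ≤ B := (norm_nonneg _).trans hf
  induction t with
  | zero => simp
  | succ t ih =>
    have h1 : f ^ (t + 1 + 1) - v ^ (t + 1 + 1)
        = f ^ (t + 1) * (f - v) + (f ^ (t + 1) - v ^ (t + 1)) * v := by ring
    rw [h1]
    refine (norm_add_le _ _).trans ?_
    rw [norm_mul, norm_mul, norm_pow]
    calc ‖f‖ ^ (t + 1) * ‖f - v‖ + ‖f ^ (t + 1) - v ^ (t + 1)‖ * ‖v‖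
        ≤ B ^ (t + 1) * ‖f - v‖ + ((t + 1) * B ^ t * ‖f - v‖) * B := by gcongr
      _ = _ := by push_cast; ring

theorem norm_pow_succ_sub_pow_succ_le' {f v : ℂ} {D : ℝ} (h : ‖f - v‖ ≤ D) (t : ℕ) :
    ‖f ^ (t + 1) - v ^ (t + 1)‖ ≤ (t + 1) * 2 ^ t * D * (‖v‖ ^ t + D ^ t) := by
  have hD : 0 ≤ D := (norm_nonneg _).trans h
  have hf : ‖f‖ ≤ ‖v‖ + D := by
    have := norm_add_le v (f - v)
    rw [add_sub_cancel] at this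
    linarith
  have h1 : (‖v‖ + D) ^ t ≤ 2 ^ t * (‖v‖ ^ t + D ^ t) := by
    refine (add_pow_le (norm_nonneg v) hD t).trans ?_
    gcongr
    · norm_num
    · omega
  calc ‖f ^ (t + 1) - v ^ (t + 1)‖ ≤ (t + 1) * (‖v‖ + D) ^ t * ‖f - v‖ :=
        norm_pow_succ_sub_pow_succ_le hf (by linarith) t
    _ ≤ (t + 1) * (2 ^ t * (‖v‖ ^ t + D ^ t)) * D := by gcongr
    _ = _ := by ring

/-- Splitting a sum over disjoint pieces with an approximation on each piece. -/
theorem norm_sum_sub_sum_le {U ι : Type*} [Fintype U] [DecidableEq U] (F : U → ℂ)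
    (G : ι → U → ℂ) (I : Finset ι) (A : ι → Finset U)
    (hA : (I : Set ι).PairwiseDisjoint A) :
    ‖∑ u, F u - ∑ x ∈ I, ∑ u, G x u‖ ≤ ∑ u ∈ (I.biUnion A)ᶜ, ‖F u‖
      + (∑ x ∈ I, ∑ u ∈ A x, ‖F u - G x u‖ + ∑ x ∈ I, ∑ u ∈ (A x)ᶜ, ‖G x u‖) := by
  have h1 : ∑ u, F u - ∑ x ∈ I, ∑ u, G x u = ∑ u ∈ (I.biUnion A)ᶜ, F u
      + (∑ x ∈ I, ∑ u ∈ A x, (F u - G x u) - ∑ x ∈ I, ∑ u ∈ (A x)ᶜ, G x u) := by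
    rw [← sum_add_sum_compl (I.biUnion A) F, sum_biUnion hA]
    simp only [sum_sub_distrib]
    rw [sum_congr rfl fun x _ => (sum_add_sum_compl (A x) (G x)).symm, sum_add_distrib]
    ring
  rw [h1]
  refine (norm_add_le _ _).trans (add_le_add (norm_sum_le _ _)
    ((norm_sub_le _ _).trans (add_le_add ?_ ?_)))
  · exact (norm_sum_le _ _).trans (sum_le_sum fun x _ => norm_sum_le _ _)
  · exact (norm_sum_le _ _).trans (sum_le_sum fun x _ => norm_sum_le _ _)

/-- The normalised complete exponential sum attached to the fraction `b / q`. -/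
noncomputable def localGauss (k q b : ℕ) : ℂ := (q : ℂ)⁻¹ * powerGauss k q b

theorem norm_localGauss_le_one (k q b : ℕ) : ‖localGauss k q b‖ ≤ 1 := by
  rw [localGauss, norm_mul, norm_inv, Complex.norm_natCast]
  refine (mul_le_mul_of_nonneg_left (norm_powerGauss_le k q b) (by positivity)).trans ?_
  exact inv_mul_le_one

theorem exists_norm_localGauss_le {k : ℕ} (hk : 3 ≤ k) :
    ∃ C : ℝ, 0 ≤ C ∧ ∀ q b : ℕ, b ∈ unitResidues q →
      ‖localGauss k q b‖ ≤ C * (q : ℝ) ^ (-(1 / k) : ℝ) := by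
  obtain ⟨C, hC0, hC⟩ := exists_norm_powerGauss_le hk
  refine ⟨C, hC0, fun q b hb => ?_⟩
  obtain ⟨⟨hb1, hbq⟩, hg⟩ := mem_unitResidues.mp hb
  have hq : (0 : ℝ) < q := by exact_mod_cast (by omega : 0 < q)
  have h := hC q (by omega) b (Nat.isCoprime_iff_coprime.mpr hg)
  rw [localGauss, norm_mul, norm_inv, Complex.norm_natCast, inv_mul_le_iff₀ hq]
  refine h.trans (le_of_eq ?_)
  rw [sub_eq_add_neg, Real.rpow_add hq, Real.rpow_one]; ring

theorem exists_norm_localGauss_pow_le {k : ℕ} (hk : 3 ≤ k) :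
    ∃ C : ℝ, 0 ≤ C ∧ ∀ t : ℕ, 3 * k ≤ t → ∀ q b : ℕ, b ∈ unitResidues q →
      ‖localGauss k q b‖ ^ t ≤ C * (1 / (q : ℝ) ^ 3) := by
  obtain ⟨C, hC0, hC⟩ := exists_norm_localGauss_le hk
  refine ⟨C ^ (3 * k), by positivity, fun t ht q b hb => ?_⟩
  have hk0 : (k : ℝ) ≠ 0 := by positivity
  calc ‖localGauss k q b‖ ^ t ≤ ‖localGauss k q b‖ ^ (3 * k) :=
        pow_le_pow_of_le_one (norm_nonneg _) (norm_localGauss_le_one k q b) ht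
    _ ≤ (C * (q : ℝ) ^ (-(1 / k) : ℝ)) ^ (3 * k) := by gcongr; exact hC q b hb
    _ = _ := by
        rw [mul_pow, ← Real.rpow_mul_natCast (by positivity)]
        have h : (-(1 / k) : ℝ) * ((3 * k : ℕ) : ℝ) = -((3 : ℕ) : ℝ) := by
          push_cast; field_simp
        rw [h, Real.rpow_neg (by positivity), Real.rpow_natCast, one_div]

/-- Sums of a quantity decaying like `q⁻³` over reduced fractions. -/
theorem sum_farey_le {Q : ℕ} {g : (Σ _ : ℕ, ℕ) → ℝ} {C : ℝ} (hC : 0 ≤ C)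
    (hg : ∀ q b : ℕ, b ∈ unitResidues q → g ⟨q, b⟩ ≤ C * (1 / (q : ℝ) ^ 3)) :
    ∑ x ∈ farey Q, g x ≤ C * ∑' q : ℕ, 1 / (q : ℝ) ^ 2 := by
  rw [farey, sum_sigma]
  calc ∑ q ∈ Icc 1 Q, ∑ b ∈ unitResidues q, g ⟨q, b⟩
      ≤ ∑ q ∈ Icc 1 Q, C * (1 / (q : ℝ) ^ 2) := by
        refine sum_le_sum fun q hq => ?_
        have hq0 : (0 : ℝ) < q := by exact_mod_cast (mem_Icc.mp hq).1
        calc ∑ b ∈ unitResidues q, g ⟨q, b⟩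
            ≤ (unitResidues q).card • (C * (1 / (q : ℝ) ^ 3)) :=
              sum_le_card_nsmul _ _ _ fun b hb => hg q b hb
          _ ≤ q * (C * (1 / (q : ℝ) ^ 3)) := by
              rw [nsmul_eq_mul]
              gcongr
              exact_mod_cast card_unitResidues_le q
          _ = _ := by field_simp
    _ = C * ∑ q ∈ Icc 1 Q, 1 / (q : ℝ) ^ 2 := by rw [mul_sum]
    _ ≤ _ := by
        gcongr
        exact (Real.summable_one_div_nat_pow.mpr (by norm_num)).sum_le_tsum _
          fun q _ => by positivity

section

local notation "ψ" => (ZMod.stdAddChar : AddChar (ZMod _) ℂ)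

/-- The approximation to `waringSum` near `b / q`. -/
noncomputable def localApprox {P : ℕ} (k n : ℕ) (x : Σ _ : ℕ, ℕ) (u : ZMod P) : ℂ :=
  localGauss k x.1 x.2 * powKernel (1 / k) (n + 1) ((u.val : ℝ) / P - x.2 / x.1)

theorem norm_powKernel_le_of_lt {k : ℕ} (hk : 2 ≤ k) {X n : ℕ} (hX1 : 1 ≤ X)
    (hn : n < (X + 1) ^ k) (t : ℝ) : ‖powKernel (1 / k) (n + 1) t‖ ≤ 2 * X := by
  have hk0 : (0 : ℝ) < k := by exact_mod_cast (by omega : 0 < k)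
  have ha1 : (1 : ℝ) / k < 1 := by
    rw [div_lt_one hk0]; exact_mod_cast (by omega : 1 < k)
  have hX : (1 : ℝ) ≤ X := by exact_mod_cast hX1
  refine (norm_powKernel_le (by positivity) ha1 (n + 1) t).trans ?_
  calc ((n + 1 : ℕ) : ℝ) ^ (1 / k : ℝ) ≤ (((X + 1) ^ k : ℕ) : ℝ) ^ (1 / k : ℝ) := by
        gcongr; exact_mod_cast hn
    _ = X + 1 := by
        push_cast
        rw [← Real.rpow_natCast_mul (by positivity), mul_one_div_cancel hk0.ne', Real.rpow_one]
    _ ≤ _ := by linarith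

theorem succ_le_two_pow_mul {k X n : ℕ} (hX1 : 1 ≤ X) (hn : n < (X + 1) ^ k) :
    n + 1 ≤ 2 ^ k * X ^ k := by
  rw [← mul_pow]
  exact (Nat.succ_le_of_lt hn).trans (Nat.pow_le_pow_left (by omega) k)

/-- High moments of the local approximations. -/
theorem exists_sum_norm_localApprox_pow_le {k : ℕ} (hk : 3 ≤ k) {t : ℕ} (ht : 3 * k ≤ t) :
    ∃ C : ℝ, 0 ≤ C ∧ ∀ X n P Q : ℕ, [NeZero P] → 1 ≤ X → n < (X + 1) ^ k → k * n < P →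
      ∑ x ∈ farey Q, ∑ u : ZMod P, ‖localApprox k n x u‖ ^ t
        ≤ C * (P * (X : ℝ) ^ (t - k)) := by
  obtain ⟨C, hC0, hC⟩ := exists_norm_localGauss_pow_le hk
  obtain ⟨G, hG⟩ : ∃ G : ℝ, G = (Real.Gamma (1 + 1 / k) ^ k) ^ 2 := ⟨_, rfl⟩
  have hG0 : 0 ≤ G := hG ▸ sq_nonneg _
  obtain ⟨Z, hZ⟩ : ∃ Z : ℝ, Z = ∑' q : ℕ, 1 / (q : ℝ) ^ 2 := ⟨_, rfl⟩
  have hZ0 : 0 ≤ Z := hZ ▸ tsum_nonneg fun q => by positivity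
  refine ⟨C * (2 ^ (t - 2 * k) * (k * 2 ^ k * G)) * Z, by positivity, ?_⟩
  intro X n P Q _ hX1 hn hP
  have hkn : (k * n + 1 : ℝ) ≤ k * 2 ^ k * X ^ k := by
    have h1 := succ_le_two_pow_mul hX1 hn
    have h2 : k * n + 1 ≤ k * 2 ^ k * X ^ k := by
      calc k * n + 1 ≤ k * (n + 1) := by rw [mul_add]; omega
        _ ≤ k * (2 ^ k * X ^ k) := by gcongr
        _ = _ := by ring
    exact_mod_cast h2
  have hv : ∀ x : Σ _ : ℕ, ℕ, ∑ u : ZMod P,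
      ‖powKernel (1 / k) (n + 1) ((u.val : ℝ) / P - x.2 / x.1)‖ ^ t
        ≤ 2 ^ (t - 2 * k) * (k * 2 ^ k * G) * (P * (X : ℝ) ^ (t - k)) := by
    intro x
    have hte : t = (t - 2 * k) + 2 * k := by omega
    calc ∑ u : ZMod P, ‖powKernel (1 / k) (n + 1) ((u.val : ℝ) / P - x.2 / x.1)‖ ^ t
        ≤ ∑ u : ZMod P, (2 * X : ℝ) ^ (t - 2 * k) *
            ‖powKernel (1 / k) (n + 1) ((u.val : ℝ) / P - x.2 / x.1)‖ ^ (2 * k) := by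
          refine sum_le_sum fun u _ => ?_
          conv_lhs => rw [hte, pow_add]
          gcongr
          exact norm_powKernel_le_of_lt (by omega) hX1 hn _
      _ ≤ (2 * X : ℝ) ^ (t - 2 * k) * (P * ((k * n + 1) * G)) := by
          rw [← mul_sum, hG]
          gcongr
          exact sum_norm_powKernel_pow_le (by omega) hP _
      _ ≤ (2 * X : ℝ) ^ (t - 2 * k) * (P * ((k * 2 ^ k * X ^ k) * G)) := by gcongr
      _ = _ := by
          rw [show t - k = (t - 2 * k) + k by omega, pow_add, mul_pow]; ring
  refine (sum_farey_le (C := C * (2 ^ (t - 2 * k) * (k * 2 ^ k * G)) * (P * (X : ℝ) ^ (t - k)))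
    (by positivity) fun q b hb => ?_).trans (le_of_eq ?_)
  · simp only [localApprox, norm_mul, mul_pow]
    rw [← mul_sum]
    calc _ ≤ C * (1 / (q : ℝ) ^ 3) *
          (2 ^ (t - 2 * k) * (k * 2 ^ k * G) * (P * (X : ℝ) ^ (t - k))) := by
          refine mul_le_mul (hC t ht q b hb) (hv ⟨q, b⟩) ?_ (by positivity)
          exact sum_nonneg fun u _ => by positivity
      _ = _ := by ring
  · rw [hZ]; ring

/-- The local approximation is small away from its major arc. -/
theorem exists_norm_localApprox_le {k : ℕ} (hk : 3 ≤ k) :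
    ∃ C : ℝ, 0 ≤ C ∧ ∀ X n P Q : ℕ, [NeZero P] → 1 ≤ X → ∀ x ∈ farey Q, ∀ u : ZMod P,
      u ∉ majorArc P ((X : ℝ) ^ (1 - 1 / k - k : ℝ)) x →
        ‖localApprox k n x u‖ ≤ C * (X : ℝ) ^ (1 - 1 / (2 * k) : ℝ) := by
  obtain ⟨C, hC0, hC⟩ := exists_norm_localGauss_le hk
  refine ⟨C * 2, by positivity, ?_⟩
  rintro X n P Q _ hX1 ⟨q, b⟩ hx u hu
  have hxb : b ∈ unitResidues q := (mem_sigma.mp hx).2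
  have hq : (0 : ℝ) < q := by exact_mod_cast (mem_farey.mp hx).1.1
  have hX : (1 : ℝ) ≤ X := by exact_mod_cast hX1
  have hX0 : (0 : ℝ) < X := by linarith
  have hk0 : (0 : ℝ) < k := by exact_mod_cast (by omega : 0 < k)
  have hk3 : (3 : ℝ) ≤ k := by exact_mod_cast hk
  have ha1 : (1 : ℝ) / k < 1 := by
    rw [div_lt_one hk0]; exact_mod_cast (by omega : 1 < k)
  rw [mem_majorArc, not_le] at hu
  simp only at hu
  obtain ⟨δ, hδ⟩ : ∃ δ : ℝ, δ = (X : ℝ) ^ (1 - 1 / k - k : ℝ) := ⟨_, rfl⟩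
  have hδ0 : 0 < δ := hδ ▸ by positivity
  rw [← hδ, ← div_lt_iff₀' hq] at hu
  have h1 := norm_powKernel_le_distInt (a := 1 / k) (by positivity) ha1 (n + 1)
    (div_pos hδ0 hq) hu.le
  rw [localApprox, norm_mul]
  calc _ ≤ C * (q : ℝ) ^ (-(1 / k) : ℝ) * (2 * (δ / q) ^ (-(1 / k) : ℝ)) := by
        gcongr
        exact hC q b hxb
    _ = C * 2 * δ ^ (-(1 / k) : ℝ) := by
        rw [Real.div_rpow hδ0.le hq.le]
        have : (q : ℝ) ^ (-(1 / k) : ℝ) ≠ 0 := by positivity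
        field_simp
    _ ≤ _ := by
        gcongr C * 2 * ?_
        rw [hδ, ← Real.rpow_mul hX0.le]
        refine Real.rpow_le_rpow_of_exponent_le hX ?_
        rw [div_eq_mul_inv, div_eq_mul_inv, mul_inv]
        have h2 : (k : ℝ) * (k : ℝ)⁻¹ = 1 := mul_inv_cancel₀ hk0.ne'
        have h3 : (0 : ℝ) < (k : ℝ)⁻¹ := by positivity
        nlinarith

/-- The local approximation on its major arc. -/
theorem norm_waringSum_sub_localApprox_le {k : ℕ} (hk : 3 ≤ k) {X n P : ℕ} [NeZero P]
    (hX1 : 1 ≤ X) (hX : X ^ k ≤ n) (hn : n < (X + 1) ^ k) {x : Σ _ : ℕ, ℕ}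
    (hx : x ∈ farey ⌊(X : ℝ) ^ (1 - 1 / k : ℝ)⌋₊) {u : ZMod P}
    (hu : u ∈ majorArc P ((X : ℝ) ^ (1 - 1 / k - k : ℝ)) x) :
    ‖waringSum k X u - localApprox k n x u‖
      ≤ 6 * (1 + 2 ^ k * (2 * Real.pi)) * (X : ℝ) ^ (1 - 1 / k : ℝ) := by
  obtain ⟨q, b⟩ := x
  obtain ⟨⟨hq1, hqX⟩, -⟩ := mem_farey.mp hx
  simp only at hq1 hqX
  have hX0 : (0 : ℝ) < X := by exact_mod_cast hX1
  have hqX' : (q : ℝ) ≤ (X : ℝ) ^ (1 - 1 / k : ℝ) :=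
    (Nat.cast_le.mpr hqX).trans (Nat.floor_le (by positivity))
  rw [mem_majorArc] at hu
  simp only at hu
  have h := norm_waringSum_sub_le (by omega) hX hn hq1 b u
  rw [Int.cast_natCast] at h
  have hn1 : (n + 1 : ℝ) ≤ 2 ^ k * X ^ k := by exact_mod_cast succ_le_two_pow_mul hX1 hn
  obtain ⟨d, hd⟩ : ∃ d, d = distInt ((u.val : ℝ) / P - b / q) := ⟨_, rfl⟩
  rw [← hd] at h hu
  have hδ : (X : ℝ) ^ k * (X : ℝ) ^ (1 - 1 / k - k : ℝ) = (X : ℝ) ^ (1 - 1 / k : ℝ) := by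
    rw [← Real.rpow_natCast, ← Real.rpow_add hX0]; congr 1; ring
  refine h.trans ?_
  have hd0 : 0 ≤ d := hd ▸ distInt_nonneg _
  calc 6 * q * (1 + (n + 1) * (2 * Real.pi * d))
      = 6 * (q + (n + 1) * (2 * Real.pi * (q * d))) := by ring
    _ ≤ 6 * ((X : ℝ) ^ (1 - 1 / k : ℝ)
          + (2 ^ k * X ^ k) * (2 * Real.pi * (X : ℝ) ^ (1 - 1 / k - k : ℝ))) := by
        have := Real.pi_pos
        gcongr
    _ = 6 * ((X : ℝ) ^ (1 - 1 / k : ℝ) + 2 ^ k * (2 * Real.pi) *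
          (X ^ k * (X : ℝ) ^ (1 - 1 / k - k : ℝ))) := by ring
    _ = _ := by rw [hδ]; ring

end

section

local notation "ψ" => (ZMod.stdAddChar : AddChar (ZMod _) ℂ)

/-- The error terms of the circle method on the major arcs. -/
theorem exists_circle_method_error {k : ℕ} (hk : 3 ≤ k) {t : ℕ} (ht : 3 * k ≤ t) :
    ∃ C : ℝ, 0 ≤ C ∧ ∀ X n P : ℕ, [NeZero P] → 2 ≤ X → X ^ k ≤ n → n < (X + 1) ^ k →
      k * n < P → X ^ k ≤ P → ∃ A : Finset (ZMod P), (∀ u ∈ A, IsMinor k X (1 - 1 / k) u) ∧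
      ∀ χ : ZMod P → ℂ, (∀ u, ‖χ u‖ = 1) →
      ‖∑ u : ZMod P, waringSum k X u ^ (t + 1) * χ u
          - ∑ x ∈ farey ⌊(X : ℝ) ^ (1 - 1 / k : ℝ)⌋₊, ∑ u, localApprox k n x u ^ (t + 1) * χ u‖
        ≤ ∑ u ∈ A, ‖waringSum k X u‖ ^ (t + 1)
          + C * (P * (X : ℝ) ^ ((t + 1 : ℝ) - k - 1 / (2 * k))) := by
  obtain ⟨C₁, hC₁0, hC₁⟩ := exists_sum_norm_localApprox_pow_le hk ht
  obtain ⟨C₂, hC₂0, hC₂⟩ := exists_norm_localApprox_le hk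
  obtain ⟨c, hc⟩ : ∃ c : ℝ, c = 6 * (1 + 2 ^ k * (2 * Real.pi)) := ⟨_, rfl⟩
  have hc0 : 0 ≤ c := by rw [hc]; have := Real.pi_pos; positivity
  have hk0 : (0 : ℝ) < k := by exact_mod_cast (by omega : 0 < k)
  have hk3 : (3 : ℝ) ≤ k := by exact_mod_cast hk
  obtain ⟨κ, hκ⟩ : ∃ κ : ℝ, κ = 1 / k := ⟨_, rfl⟩
  have hκ0 : 0 < κ := hκ ▸ by positivity
  have hκk : κ * k = 1 := by rw [hκ]; field_simp
  have hκ3 : κ ≤ 1 / 3 := by rw [hκ]; gcongr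
  have hκ2 : (1 : ℝ) / (2 * k) = κ / 2 := by rw [hκ]; field_simp
  have htk : (3 : ℝ) ≤ κ * t := by
    have : (3 * k : ℝ) ≤ t := by exact_mod_cast ht
    nlinarith
  refine ⟨(t + 1) * 2 ^ t * c * (C₁ + c ^ t * 5) + C₂ * C₁, by positivity, ?_⟩
  intro X n P _ hX2 hXn hn hP hXP
  have hX1 : 1 ≤ X := by omega
  have hX : (1 : ℝ) ≤ X := by exact_mod_cast hX1
  have hX0 : (0 : ℝ) < X := by linarith
  have hP0 : (0 : ℝ) < P := by exact_mod_cast NeZero.pos P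
  obtain ⟨Q, hQ⟩ : ∃ Q, Q = ⌊(X : ℝ) ^ (1 - κ)⌋₊ := ⟨_, rfl⟩
  have hQX : (Q : ℝ) ≤ (X : ℝ) ^ (1 - κ) := hQ ▸ Nat.floor_le (by positivity)
  obtain ⟨δ, hδ⟩ : ∃ δ : ℝ, δ = (X : ℝ) ^ (1 - κ - k) := ⟨_, rfl⟩
  have hδ0 : 0 < δ := hδ ▸ by positivity
  have hQδ : 2 * Q * δ < 1 := by
    have h1 : (Q : ℝ) * δ < (X : ℝ) ^ (-1 : ℝ) := by
      calc (Q : ℝ) * δ ≤ (X : ℝ) ^ (1 - κ) * (X : ℝ) ^ (1 - κ - k) := by rw [hδ]; gcongr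
        _ = (X : ℝ) ^ ((1 - κ) + (1 - κ - k)) := by rw [Real.rpow_add hX0]
        _ < _ := Real.rpow_lt_rpow_of_exponent_lt (by exact_mod_cast hX2) (by linarith)
    have h2 : (X : ℝ) ^ (-1 : ℝ) ≤ 1 / 2 := by
      rw [Real.rpow_neg_one, inv_eq_one_div]; gcongr; exact_mod_cast hX2
    linarith
  refine ⟨((farey Q).biUnion (majorArc P δ))ᶜ, fun u hu => ?_, fun χ hχ => ?_⟩
  · refine isMinor_of_notMem fun x hx hux => ?_
    rw [mem_compl, mem_biUnion] at hu
    rw [← hκ] at hx hux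
    exact hu ⟨x, hQ ▸ hx, hδ ▸ hux⟩
  rw [← hκ, ← hQ, hκ2]
  have hmain := norm_sum_sub_sum_le (fun u : ZMod P => waringSum k X u ^ (t + 1) * χ u)
    (fun x u => localApprox k n x u ^ (t + 1) * χ u) (farey Q) (majorArc P δ)
    (fun x hx y hy hxy => majorArc_disjoint hQδ hx hy hxy)
  simp only [← sub_mul, norm_mul, hχ, mul_one] at hmain
  obtain ⟨D, hD⟩ : ∃ D : ℝ, D = c * (X : ℝ) ^ (1 - κ) := ⟨_, rfl⟩
  have hD0 : 0 ≤ D := hD ▸ by positivity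
  obtain ⟨M, hM⟩ : ∃ M : ℝ, M = ∑ x ∈ farey Q, ∑ u : ZMod P, ‖localApprox k n x u‖ ^ t :=
    ⟨_, rfl⟩
  have hMle : M ≤ C₁ * (P * (X : ℝ) ^ (t - k)) := hM ▸ hC₁ X n P Q hX1 hn hP
  have hon : ∑ x ∈ farey Q, ∑ u ∈ majorArc P δ x,
      ‖waringSum k X u ^ (t + 1) - localApprox k n x u ^ (t + 1)‖
      ≤ (t + 1) * 2 ^ t * D * (M + D ^ t * (Q ^ 2 * (4 * δ * P + 1))) := by
    calc _ ≤ ∑ x ∈ farey Q, ((t + 1) * 2 ^ t * D *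
          ((∑ u : ZMod P, ‖localApprox k n x u‖ ^ t) + D ^ t * (4 * δ * P + 1))) := by
          refine sum_le_sum fun x hx => ?_
          calc _ ≤ ∑ u ∈ majorArc P δ x,
                (t + 1) * 2 ^ t * D * (‖localApprox k n x u‖ ^ t + D ^ t) := by
                refine sum_le_sum fun u hu => norm_pow_succ_sub_pow_succ_le' ?_ t
                rw [hQ, hκ] at hx
                rw [hδ, hκ] at hu
                rw [hD, hc, hκ]
                exact norm_waringSum_sub_localApprox_le hk hX1 hXn hn hx hu
            _ = (t + 1) * 2 ^ t * D * (∑ u ∈ majorArc P δ x, ‖localApprox k n x u‖ ^ t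
                  + D ^ t * (majorArc P δ x).card) := by
                rw [← mul_sum, sum_add_distrib, sum_const, nsmul_eq_mul]; ring
            _ ≤ _ := by
                gcongr
                · exact subset_univ _
                · exact card_majorArc_le hδ0.le (mem_farey.mp hx).1.1
      _ = (t + 1) * 2 ^ t * D * (M + D ^ t * ((farey Q).card * (4 * δ * P + 1))) := by
          rw [← mul_sum, sum_add_distrib, ← hM, sum_const, nsmul_eq_mul]; ring
      _ ≤ _ := by gcongr; exact_mod_cast card_farey_le Q
  have hoff : ∑ x ∈ farey Q, ∑ u ∈ (majorArc P δ x)ᶜ, ‖localApprox k n x u ^ (t + 1)‖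
      ≤ C₂ * (X : ℝ) ^ (1 - κ / 2) * M := by
    rw [hM, mul_sum]
    refine sum_le_sum fun x hx => ?_
    calc _ ≤ ∑ u ∈ (majorArc P δ x)ᶜ,
          C₂ * (X : ℝ) ^ (1 - κ / 2) * ‖localApprox k n x u‖ ^ t := by
          refine sum_le_sum fun u hu => ?_
          rw [norm_pow, pow_succ']
          gcongr
          have h := hC₂ X n P Q hX1 x hx u (by rw [mem_compl, hδ, hκ] at hu; exact hu)
          rwa [hκ2] at h
      _ ≤ _ := by
          rw [← mul_sum]
          gcongr
          exact subset_univ _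
  have hXt : ((X : ℝ) ^ (t - k) : ℝ) = (X : ℝ) ^ ((t : ℝ) - k) := by
    rw [← Real.rpow_natCast, Nat.cast_sub (by omega)]
  have e1 : (X : ℝ) ^ (1 - κ) * (X : ℝ) ^ (t - k) ≤ (X : ℝ) ^ ((t + 1 : ℝ) - k - κ / 2) := by
    rw [hXt, ← Real.rpow_add hX0]
    exact Real.rpow_le_rpow_of_exponent_le hX (by linarith)
  have e2 : (X : ℝ) ^ (1 - κ / 2) * (X : ℝ) ^ (t - k) ≤ (X : ℝ) ^ ((t + 1 : ℝ) - k - κ / 2) := by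
    rw [hXt, ← Real.rpow_add hX0]
    exact Real.rpow_le_rpow_of_exponent_le hX (by linarith)
  have e3 : (X : ℝ) ^ (1 - κ) * (((X : ℝ) ^ (1 - κ)) ^ t * (Q ^ 2 * (4 * δ * P + 1)))
      ≤ 5 * (P * (X : ℝ) ^ ((t + 1 : ℝ) - k - κ / 2)) := by
    have h1 : 4 * δ * P + 1 ≤ 5 * (P * (X : ℝ) ^ (1 - κ - k)) := by
      have h2 : 1 ≤ (P : ℝ) * (X : ℝ) ^ (1 - κ - k) := by
        calc (1 : ℝ) ≤ (X : ℝ) ^ (1 - κ) := Real.one_le_rpow hX (by linarith)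
          _ = (X : ℝ) ^ k * (X : ℝ) ^ (1 - κ - k) := by
              rw [← Real.rpow_natCast, ← Real.rpow_add hX0]; congr 1; ring
          _ ≤ _ := by gcongr; exact_mod_cast hXP
      rw [hδ]; linarith
    calc _ ≤ (X : ℝ) ^ (1 - κ) * (((X : ℝ) ^ (1 - κ)) ^ t *
          (((X : ℝ) ^ (1 - κ)) ^ 2 * (5 * (P * (X : ℝ) ^ (1 - κ - k))))) := by gcongr
      _ = 5 * (P * (((X : ℝ) ^ (1 - κ)) ^ (t + 3) * (X : ℝ) ^ (1 - κ - k))) := by ring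
      _ ≤ _ := by
          rw [← Real.rpow_mul_natCast hX0.le, ← Real.rpow_add hX0]
          gcongr 5 * (P * ?_)
          refine Real.rpow_le_rpow_of_exponent_le hX ?_
          push_cast
          nlinarith
  obtain ⟨E, hE⟩ : ∃ E : ℝ, E = (X : ℝ) ^ ((t + 1 : ℝ) - k - κ / 2) := ⟨_, rfl⟩
  rw [← hE] at e1 e2 e3 ⊢
  refine hmain.trans ?_
  simp only [norm_pow] at hoff ⊢
  have f1 : (t + 1) * 2 ^ t * D * (M + D ^ t * (Q ^ 2 * (4 * δ * P + 1)))
      ≤ (t + 1) * 2 ^ t * c * (C₁ + c ^ t * 5) * (P * E) := by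
    calc _ ≤ (t + 1) * 2 ^ t * D *
          (C₁ * (P * (X : ℝ) ^ (t - k)) + D ^ t * (Q ^ 2 * (4 * δ * P + 1))) := by gcongr
      _ = (t + 1) * 2 ^ t * c * (C₁ * (P * ((X : ℝ) ^ (1 - κ) * (X : ℝ) ^ (t - k))) + c ^ t *
          ((X : ℝ) ^ (1 - κ) * (((X : ℝ) ^ (1 - κ)) ^ t * (Q ^ 2 * (4 * δ * P + 1))))) := by
          rw [hD, mul_pow]; ring
      _ ≤ (t + 1) * 2 ^ t * c * (C₁ * (P * E) + c ^ t * (5 * (P * E))) := by gcongr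
      _ = _ := by ring
  have f2 : C₂ * (X : ℝ) ^ (1 - κ / 2) * M ≤ C₂ * C₁ * (P * E) := by
    calc _ ≤ C₂ * (X : ℝ) ^ (1 - κ / 2) * (C₁ * (P * (X : ℝ) ^ (t - k))) := by gcongr
      _ = C₂ * C₁ * (P * ((X : ℝ) ^ (1 - κ / 2) * (X : ℝ) ^ (t - k))) := by ring
      _ ≤ _ := by gcongr
  rw [add_mul]
  linarith

/-- The main term of the circle method. -/
theorem sum_localApprox_pow {k s n P : ℕ} [NeZero P] (hs : 1 ≤ s) (hP : s * n < P)
    (F : Finset (Σ _ : ℕ, ℕ)) :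
    ∑ x ∈ F, ∑ u : ZMod P, localApprox k n x u ^ s * (ψ (-(u * (n : ZMod P))) : ℂ)
      = P * ((Real.Gamma (1 + 1 / k) ^ s * riesz (s * (1 / k)) n : ℝ) *
          ∑ x ∈ F, localGauss k x.1 x.2 ^ s * e (-(n * ((x.2 : ℝ) / x.1)))) := by
  rw [mul_sum, mul_sum]
  refine sum_congr rfl fun x _ => ?_
  simp only [localApprox, mul_pow, mul_assoc]
  rw [← mul_sum, sum_powKernel_pow_mul hP le_rfl hs]
  ring

/-- Orthogonality. -/
theorem sum_waringSum_pow {k s n X P : ℕ} [NeZero P] (hn : n < (X + 1) ^ k)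
    (hX : X ^ k ≤ n) (hP : s * n < P) (hnP : n < P) :
    ∑ u : ZMod P, waringSum k X u ^ s * (ψ (-(u * (n : ZMod P))) : ℂ) = P * R s k n := by
  have h1 : ∀ u : ZMod P, waringSum k X u ^ s * (ψ (-(u * (n : ZMod P))) : ℂ)
      = ∑ m ∈ Fintype.piFinset (fun _ : Fin s => Icc 1 X),
          (ψ (u * (((∑ i, m i ^ k : ℕ) : ZMod P) - (n : ZMod P))) : ℂ) := by
    intro u
    rw [waringSum, sum_pow_stdAddChar, sum_mul]
    refine sum_congr rfl fun m _ => ?_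
    rw [← AddChar.map_add_eq_mul]
    congr 1
    push_cast
    rw [← mul_sum]; ring
  simp only [h1]
  rw [sum_comm]
  simp only [sum_stdAddChar_mul]
  have h2 : ∀ m ∈ Fintype.piFinset (fun _ : Fin s => Icc 1 X),
      (if ((∑ i, m i ^ k : ℕ) : ZMod P) - (n : ZMod P) = 0 then (P : ℂ) else 0)
        = if ∑ i, m i ^ k = n then (P : ℂ) else 0 := by
    intro m hm
    have h3 : ∑ i, m i ^ k ≤ s * n := by
      calc ∑ i, m i ^ k ≤ ∑ i : Fin s, n := by
            refine sum_le_sum fun i _ => ?_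
            exact (Nat.pow_le_pow_left (mem_Icc.mp (Fintype.mem_piFinset.mp hm i)).2 k).trans hX
        _ = s * n := by simp
    simp only [natCast_sub_eq_zero_iff (h3.trans_lt hP) hnP]
  rw [sum_congr rfl h2, ← sum_filter, sum_const, nsmul_eq_mul, mul_comm]
  congr 2
  rw [R]
  refine (Nat.subtype_card _ fun m => ?_).symm
  rw [mem_filter, Fintype.mem_piFinset]
  refine and_congr_left fun hm => forall_congr' fun i => ?_
  rw [mem_Icc]
  refine ⟨fun h => h.1, fun h => ⟨h, ?_⟩⟩
  have h3 : m i ^ k ≤ n := hm ▸ single_le_sum (f := fun i => m i ^ k)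
    (fun i _ => Nat.zero_le _) (mem_univ i)
  have h4 : m i < X + 1 := lt_of_pow_lt_pow_left₀ k (by omega) (by omega)
  omega

end

section

local notation "ψ" => (ZMod.stdAddChar : AddChar (ZMod _) ℂ)

theorem three_mul_add_one_le {k s : ℕ} (hk : 3 ≤ k) (hs : k ^ 2 + 2 ≤ s + Nat.log 2 k) :
    3 * k + 1 ≤ s := by
  have h1 : Nat.log 2 k < k - 1 := by
    apply Nat.log_lt_of_lt_pow (by omega)
    have h2 : ∀ m, 2 ≤ m → m + 1 < 2 ^ m := by
      intro m hm
      induction m, hm using Nat.le_induction with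
      | base => norm_num
      | succ m hm ih => rw [pow_succ]; omega
    have := h2 (k - 1) (by omega)
    omega
  have h3 : Nat.log 2 k + 2 ≤ k := by omega
  obtain ⟨m, rfl⟩ : ∃ m, k = 3 + m := ⟨k - 3, by omega⟩
  nlinarith

/-- The partial sums of the singular series. -/
noncomputable def singularSum (s k n Q : ℕ) : ℂ :=
  ∑ x ∈ farey Q, localGauss k x.1 x.2 ^ s * e (-(n * ((x.2 : ℝ) / x.1)))

/-- The circle method with a truncated singular series. -/
theorem exists_waring_error {k s : ℕ} (hk : 3 ≤ k) (hs : k ^ 2 + 2 ≤ s + Nat.log 2 k) :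
    ∃ C η : ℝ, 0 < η ∧ ∀ n X : ℕ, 2 ≤ X → X ^ k ≤ n → n < (X + 1) ^ k →
      ‖(R s k n : ℂ) - (Real.Gamma (1 + 1 / k) ^ s * riesz (s * (1 / k)) n : ℝ) *
          singularSum s k n ⌊(X : ℝ) ^ (1 - 1 / k : ℝ)⌋₊‖
        ≤ C * (n : ℝ) ^ ((s : ℝ) / k - 1 - η) := by
  have hs3 := three_mul_add_one_le hk hs
  obtain ⟨t, rfl⟩ : ∃ t, s = t + 1 := ⟨s - 1, by omega⟩
  obtain ⟨p, hpk, hp⟩ := Nat.exists_infinite_primes (k + 1)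
  have : Fact p.Prime := ⟨hp⟩
  obtain ⟨K, hK⟩ : ∃ K, K = (p * 2) ^ k + 2 * k ^ 2 + 2 * 2 ^ k + (t + 1 + k) * 2 ^ k + 1 :=
    ⟨_, rfl⟩
  obtain ⟨C₁, η, hC₁, hη, hminor⟩ := minor_arc_bound (p := p) hk (by omega) hs (p * K)
  obtain ⟨C₂, hC₂, hmajor⟩ := exists_circle_method_error hk (t := t) (by omega)
  have hk0 : (0 : ℝ) < k := by exact_mod_cast (by omega : 0 < k)
  have hk3 : (3 : ℝ) ≤ k := by exact_mod_cast hk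
  obtain ⟨θ, hθ⟩ : ∃ θ : ℝ, θ = min η (1 / (2 * k)) := ⟨_, rfl⟩
  have hθ0 : 0 < θ := hθ ▸ lt_min hη (by positivity)
  have hθ1 : θ ≤ 1 := (hθ ▸ min_le_right _ _ : θ ≤ 1 / (2 * k)).trans (by
    rw [div_le_one (by positivity)]; linarith)
  refine ⟨C₁ + C₂, θ / k, by positivity, fun n X hX2 hX hn => ?_⟩
  have hX1 : 1 ≤ X := by omega
  have hXR : (1 : ℝ) ≤ X := by exact_mod_cast hX1
  have hX0 : (0 : ℝ) < X := by linarith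
  obtain ⟨H, hH⟩ : ∃ H, H = X ^ k := ⟨_, rfl⟩
  have hH1 : 1 ≤ H := hH ▸ Nat.one_le_pow _ _ hX1
  obtain ⟨M, hM1, hM2⟩ := exists_nat_pow_near (x := K * H) (y := p)
    (Nat.mul_pos (by omega) hH1) hp.one_lt
  obtain ⟨P, hP⟩ : ∃ P, P = p ^ (M + 1) := ⟨_, rfl⟩
  have : NeZero P := ⟨by rw [hP]; exact pow_ne_zero _ hp.ne_zero⟩
  rw [← hP] at hM2
  have hPle : P ≤ p * K * H := by
    rw [hP, pow_succ', mul_assoc]; exact Nat.mul_le_mul_left _ hM1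
  have hnH : n + 1 ≤ 2 ^ k * H := hH ▸ succ_le_two_pow_mul hX1 hn
  have hKH : K * H = (p * 2) ^ k * H + 2 * (k ^ 2 * H) + 2 * (2 ^ k * H)
      + (t + 1) * (2 ^ k * H) + k * (2 ^ k * H) + H := by rw [hK]; ring
  have hsn : (t + 1) * n ≤ (t + 1) * (2 ^ k * H) := Nat.mul_le_mul_left _ (by omega)
  have hkn : k * n ≤ k * (2 ^ k * H) := Nat.mul_le_mul_left _ (by omega)
  have h1 : (p * (2 * X)) ^ k ≤ P := by
    rw [← mul_assoc, mul_pow, ← hH]; omega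
  have h2 : 2 * (k ^ 2 * X ^ (k - 1)) < P := by
    have : X ^ (k - 1) ≤ H := hH ▸ Nat.pow_le_pow_right hX1 (by omega)
    have := Nat.mul_le_mul_left (k ^ 2) this
    omega
  have h3 : 2 * (2 ^ k * X ^ k) < P := by rw [← hH]; omega
  have h4 : (P : ℝ) ≤ p * K * (X : ℝ) ^ k := by
    rw [hH] at hPle; exact_mod_cast hPle
  obtain ⟨A, hA, hmaj⟩ := hmajor X n P hX2 hX hn (by omega) (by omega)
  have hmin := hminor X P (M + 1) hP hX1 h1 h2 h3 h4 A hA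
  have hmaj' := hmaj (fun u => ψ (-(u * (n : ZMod P)))) fun u => norm_stdAddChar _
  rw [sum_waringSum_pow hn hX (by omega) (by omega), sum_localApprox_pow (by omega) (by omega),
    ← mul_sub, norm_mul, Complex.norm_natCast] at hmaj'
  have hP0 : (0 : ℝ) < P := by exact_mod_cast NeZero.pos P
  obtain ⟨E, hE⟩ : ∃ E : ℝ, E = (X : ℝ) ^ (((t + 1 : ℕ) : ℝ) - k - θ) := ⟨_, rfl⟩
  have hE1 : (X : ℝ) ^ (((t + 1 : ℕ) : ℝ) - k - η) ≤ E := by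
    rw [hE]
    refine Real.rpow_le_rpow_of_exponent_le hXR ?_
    have := hθ ▸ min_le_left η (1 / (2 * k : ℝ))
    linarith
  have hE2 : (X : ℝ) ^ ((t + 1 : ℝ) - k - 1 / (2 * k)) ≤ E := by
    rw [hE]
    refine Real.rpow_le_rpow_of_exponent_le hXR ?_
    have := hθ ▸ min_le_right η (1 / (2 * k : ℝ))
    push_cast
    linarith
  have hE3 : E ≤ (n : ℝ) ^ (((t + 1 : ℕ) : ℝ) / k - 1 - θ / k) := by
    have hst : (k : ℝ) + 1 ≤ ((t + 1 : ℕ) : ℝ) := by exact_mod_cast (by omega : k + 1 ≤ t + 1)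
    have h5 : ((t + 1 : ℕ) : ℝ) / k - 1 - θ / k = (((t + 1 : ℕ) : ℝ) - k - θ) / k := by
      field_simp
    have h6 : (0 : ℝ) ≤ (((t + 1 : ℕ) : ℝ) - k - θ) / k := div_nonneg (by linarith) hk0.le
    calc E = ((X : ℝ) ^ k) ^ ((((t + 1 : ℕ) : ℝ) - k - θ) / k) := by
          rw [hE, ← Real.rpow_natCast_mul hX0.le]; congr 1; field_simp
      _ ≤ (n : ℝ) ^ ((((t + 1 : ℕ) : ℝ) - k - θ) / k) := by
          gcongr; exact_mod_cast hX
      _ = _ := by rw [h5]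
  refine le_trans (le_of_mul_le_mul_left ?_ hP0)
    (mul_le_mul_of_nonneg_left hE3 (by positivity : 0 ≤ C₁ + C₂))
  refine hmaj'.trans ?_
  calc _ ≤ C₁ * E * P + C₂ * (P * E) := by
        gcongr
        exact hmin.trans (by gcongr)
    _ = _ := by ring

end

/-- The `q`-th term of the singular series. -/
noncomputable def singularTerm (s k n q : ℕ) : ℂ :=
  ∑ b ∈ unitResidues q, localGauss k q b ^ s * e (-(n * ((b : ℝ) / q)))

theorem singularSeries_eq (s k n : ℕ) : singularSeries s k n = ∑' q, singularTerm s k n q := by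
  rw [singularSeries]
  refine tsum_congr fun q => sum_congr rfl fun b hb => ?_
  have hq : 1 ≤ q := by have := (mem_unitResidues.mp hb).1; omega
  have h1 : ∑ r ∈ Icc 1 q, e ((b * r ^ k : ℕ) / (q : ℝ)) = powerGauss k q b := by
    have h2 : ∀ r : ℕ, e ((b * r ^ k : ℕ) / (q : ℝ)) = e (((b : ℤ) * (r : ℤ) ^ k : ℤ) / q) := by
      intro r; push_cast; rfl
    simp only [h2]
    have h3 := e_powerGauss_add k q hq b 0
    rw [zero_add] at h3
    rw [powerGauss, ← Finset.Ico_succ_right_eq_Icc, Finset.sum_Ico_eq_sum_range]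
    have h4 := (sum_range_succ (fun r : ℕ => e (((b : ℤ) * (r : ℤ) ^ k : ℤ) / q)) q).symm.trans
      (sum_range_succ' _ q)
    rw [h3] at h4
    refine Eq.trans ?_ (add_right_cancel h4).symm
    simp [add_comm]
  rw [h1, localGauss]
  congr 2
  push_cast; ring

theorem exists_norm_singularTerm_le {k s : ℕ} (hk : 3 ≤ k) (hs : 3 * k ≤ s) :
    ∃ C : ℝ, 0 ≤ C ∧ ∀ n q : ℕ, ‖singularTerm s k n q‖ ≤ C * (1 / (q : ℝ) ^ 2) := by
  obtain ⟨C, hC0, hC⟩ := exists_norm_localGauss_pow_le hk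
  refine ⟨C, hC0, fun n q => ?_⟩
  rcases Nat.eq_zero_or_pos q with rfl | hq
  · simp [singularTerm, unitResidues]
  have hq0 : (0 : ℝ) < q := by exact_mod_cast hq
  calc ‖singularTerm s k n q‖ ≤ ∑ b ∈ unitResidues q, C * (1 / (q : ℝ) ^ 3) := by
        refine (norm_sum_le _ _).trans (sum_le_sum fun b hb => ?_)
        rw [norm_mul, norm_e, mul_one, norm_pow]
        exact hC s hs q b hb
    _ ≤ q * (C * (1 / (q : ℝ) ^ 3)) := by
        rw [sum_const, nsmul_eq_mul]
        gcongr
        exact_mod_cast card_unitResidues_le q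
    _ = _ := by field_simp

theorem singularSum_eq (s k n Q : ℕ) :
    singularSum s k n Q = ∑ q ∈ Icc 1 Q, singularTerm s k n q := by
  rw [singularSum, farey, sum_sigma]
  rfl

theorem summable_const_mul_inv_sq (C : ℝ) : Summable fun q : ℕ => C * (1 / (q : ℝ) ^ 2) :=
  (Real.summable_one_div_nat_pow.mpr (by norm_num)).mul_left C

theorem exists_norm_singularSeries_le {k s : ℕ} (hk : 3 ≤ k) (hs : 3 * k ≤ s) :
    ∃ C : ℝ, ∀ n : ℕ, ‖singularSeries s k n‖ ≤ C := by
  obtain ⟨C, hC0, hC⟩ := exists_norm_singularTerm_le hk hs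
  refine ⟨∑' q : ℕ, C * (1 / (q : ℝ) ^ 2), fun n => ?_⟩
  rw [singularSeries_eq]
  exact tsum_of_norm_bounded (summable_const_mul_inv_sq C).hasSum (hC n)

/-- The singular series converges uniformly. -/
theorem tendsto_singularSeries_sub {k s : ℕ} (hk : 3 ≤ k) (hs : 3 * k ≤ s) {Q : ℕ → ℕ}
    (hQ : Filter.Tendsto Q Filter.atTop Filter.atTop) :
    Filter.Tendsto (fun n => singularSum s k n (Q n) - singularSeries s k n) Filter.atTop
      (nhds 0) := by
  obtain ⟨C, hC0, hC⟩ := exists_norm_singularTerm_le hk hs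
  have hsum : ∀ n, Summable (singularTerm s k n) := fun n =>
    .of_norm_bounded (summable_const_mul_inv_sq C) (hC n)
  have h0 : ∀ n, singularTerm s k n 0 = 0 := fun n => by simp [singularTerm, unitResidues]
  have h1 : ∀ n, singularSum s k n (Q n) - singularSeries s k n
      = ∑' q, ((if q ∈ Icc 1 (Q n) then singularTerm s k n q else 0) - singularTerm s k n q) := by
    intro n
    have h2 : HasSum (fun q => if q ∈ Icc 1 (Q n) then singularTerm s k n q else 0)
        (∑ q ∈ Icc 1 (Q n), if q ∈ Icc 1 (Q n) then singularTerm s k n q else 0) :=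
      hasSum_sum_of_ne_finset_zero fun q hq => if_neg hq
    rw [sum_congr rfl fun q hq => if_pos hq] at h2
    rw [singularSum_eq, singularSeries_eq]
    exact (h2.sub (hsum n).hasSum).tsum_eq.symm
  suffices h3 : Filter.Tendsto (fun n => ∑' q, ((if q ∈ Icc 1 (Q n) then singularTerm s k n q else 0)
      - singularTerm s k n q)) Filter.atTop (nhds (∑' _ : ℕ, (0 : ℂ))) by
    simpa only [h1, tsum_zero] using h3
  refine tendsto_tsum_of_dominated_convergence (summable_const_mul_inv_sq C) (fun q => ?_)
    (Filter.Eventually.of_forall fun n q => ?_)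
  · refine tendsto_const_nhds.congr' ?_
    filter_upwards [hQ.eventually_ge_atTop q] with n hn
    rcases Nat.eq_zero_or_pos q with rfl | hq
    · simp [h0]
    · rw [if_pos (mem_Icc.mpr ⟨hq, hn⟩), sub_self]
  · split_ifs
    · rw [sub_self, norm_zero]; positivity
    · rw [zero_sub, norm_neg]; exact hC n q

theorem floor_log_div_log_two {k : ℕ} (hk : k ≠ 0) :
    ⌊Real.log k / Real.log 2⌋ = (Nat.log 2 k : ℤ) := by
  have h := Real.floor_logb_natCast (b := 2) (r := (k : ℝ)) (by positivity)
  rw [Nat.cast_ofNat, Int.log_natCast] at h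
  exact h

end

/-- The asymptotic formula in Waring's problem holds for
`s ≥ k² + 2 - ⌊log k / log 2⌋` (`k ≥ 3`). -/
theorem waring_asymptotic_log (k s : ℕ) (hk : 3 ≤ k)
    (hs : (k : ℤ) ^ 2 + 2 - ⌊Real.log k / Real.log 2⌋ ≤ (s : ℤ)) :
    Asymptotics.IsLittleO Filter.atTop
      (fun n : ℕ => (R s k n : ℂ) -
        ((Real.Gamma (1 + 1 / k) ^ s / Real.Gamma ((s : ℝ) / k) : ℝ) : ℂ) *
          singularSeries s k n * ((n : ℝ) ^ ((s : ℝ) / k - 1) : ℝ))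
      (fun n : ℕ => (n : ℝ) ^ ((s : ℝ) / k - 1)) := by
  have hs' : k ^ 2 + 2 ≤ s + Nat.log 2 k := by
    rw [floor_log_div_log_two (by omega)] at hs
    zify; linarith
  have hs3 := three_mul_add_one_le hk hs'
  have hk0 : (0 : ℝ) < k := by exact_mod_cast (by omega : 0 < k)
  have hk3 : (3 : ℝ) ≤ k := by exact_mod_cast hk
  have hs0 : (0 : ℝ) < s := by exact_mod_cast (by omega : 0 < s)
  obtain ⟨C, η, hη, hC⟩ := exists_waring_error hk hs'
  obtain ⟨B, hB⟩ := exists_norm_singularSeries_le hk (by omega : 3 * k ≤ s)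
  obtain ⟨X, hX⟩ : ∃ X : ℕ → ℕ, X = fun n : ℕ => ⌊(n : ℝ) ^ (1 / k : ℝ)⌋₊ := ⟨_, rfl⟩
  have hXt : Filter.Tendsto X Filter.atTop Filter.atTop := by
    rw [hX]
    exact tendsto_nat_floor_atTop.comp
      ((tendsto_rpow_atTop (by positivity)).comp tendsto_natCast_atTop_atTop)
  obtain ⟨Q, hQ⟩ : ∃ Q : ℕ → ℕ, Q = fun n => ⌊(X n : ℝ) ^ (1 - 1 / k : ℝ)⌋₊ := ⟨_, rfl⟩
  have hQt : Filter.Tendsto Q Filter.atTop Filter.atTop := by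
    rw [hQ]
    refine tendsto_nat_floor_atTop.comp
      ((tendsto_rpow_atTop ?_).comp (tendsto_natCast_atTop_atTop.comp hXt))
    rw [sub_pos, div_lt_one hk0]; linarith
  obtain ⟨G, hG⟩ : ∃ G, G = Real.Gamma (1 + 1 / k) ^ s := ⟨_, rfl⟩
  obtain ⟨σ, hσ⟩ : ∃ σ, σ = (s : ℝ) / k := ⟨_, rfl⟩
  have hσ0 : 0 < σ := hσ ▸ by positivity
  have hσ' : (s : ℝ) * (1 / k) = σ := by rw [hσ]; ring
  rw [← hG, ← hσ]
  -- the three sources of error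
  have h1 : Filter.Tendsto (fun n : ℕ => ((R s k n : ℂ) -
      (G * riesz σ n : ℝ) * singularSum s k n (Q n)) / ((n : ℝ) ^ (σ - 1) : ℝ))
      Filter.atTop (nhds 0) := by
    have h2 : Filter.Tendsto (fun n : ℕ => C * (n : ℝ) ^ (-η)) Filter.atTop (nhds 0) := by
      have := ((tendsto_rpow_neg_atTop hη).comp tendsto_natCast_atTop_atTop).const_mul C
      rwa [mul_zero] at this
    refine squeeze_zero_norm' ?_ h2
    filter_upwards [hXt.eventually_ge_atTop 2, Filter.eventually_ge_atTop 1] with n hn hn1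
    have hn0 : (0 : ℝ) < n := by exact_mod_cast hn1
    have h3 : X n ^ k ≤ n := (le_floor_rpow_iff (by omega) _ _).mp (by rw [hX])
    have h4 : n < (X n + 1) ^ k := by
      by_contra! h
      have := (le_floor_rpow_iff (by omega) _ _).mpr h
      simp only [hX] at this
      omega
    have h5 := hC n (X n) hn h3 h4
    rw [hσ', ← hG, ← hσ] at h5
    rw [norm_div, Complex.norm_real, Real.norm_of_nonneg (by positivity),
      div_le_iff₀ (by positivity), mul_assoc, ← Real.rpow_add hn0, hQ]
    rwa [show -η + (σ - 1) = σ - 1 - η by ring]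
  have h6 : Filter.Tendsto (fun n : ℕ => ((G * (riesz σ n / (n : ℝ) ^ (σ - 1)) : ℝ) : ℂ) *
      (singularSum s k n (Q n) - singularSeries s k n)) Filter.atTop (nhds 0) := by
    have := ((Complex.continuous_ofReal.tendsto _).comp
      ((tendsto_riesz_div hσ0).const_mul G)).mul
      (tendsto_singularSeries_sub hk (by omega : 3 * k ≤ s) hQt)
    rwa [mul_zero] at this
  have h7 : Filter.Tendsto (fun n : ℕ =>
      ((G * (riesz σ n / (n : ℝ) ^ (σ - 1) - (Real.Gamma σ)⁻¹) : ℝ) : ℂ) *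
        singularSeries s k n) Filter.atTop (nhds 0) := by
    have h8 : Filter.Tendsto (fun n : ℕ =>
        |G * (riesz σ n / (n : ℝ) ^ (σ - 1) - (Real.Gamma σ)⁻¹)| * B)
        Filter.atTop (nhds 0) := by
      have := ((((tendsto_riesz_div hσ0).sub_const (Real.Gamma σ)⁻¹).const_mul G).abs).mul_const B
      rwa [sub_self, mul_zero, abs_zero, zero_mul] at this
    refine squeeze_zero_norm (fun n => ?_) h8
    rw [norm_mul, Complex.norm_real, Real.norm_eq_abs]
    gcongr
    exact hB n
  rw [← Complex.isLittleO_ofReal_right]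
  rw [Asymptotics.isLittleO_iff_tendsto']
  · have h9 := (h1.add h6).add h7
    rw [add_zero, add_zero] at h9
    refine h9.congr' ?_
    filter_upwards [Filter.eventually_ge_atTop 1] with n hn
    have hn0 : (0 : ℝ) < n := by exact_mod_cast hn
    have hne : (((n : ℝ) ^ (σ - 1) : ℝ) : ℂ) ≠ 0 := by
      exact_mod_cast (by positivity : (n : ℝ) ^ (σ - 1) ≠ 0)
    push_cast
    field_simp
    ring
  · filter_upwards [Filter.eventually_ge_atTop 1] with n hn h
    have hn0 : (0 : ℝ) < n := by exact_mod_cast hn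
    exact absurd h (by exact_mod_cast (by positivity : (n : ℝ) ^ (σ - 1) ≠ 0))
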